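/- Let n ≥ 1 and 0 < α ≤ n, and suppose s satisfies: s > (n−α)/2 + n/(2(n+1)) when 0 < α ≤ n − 1 + 2/(n+1), and s > (n − α + 1)(1/2 − 1/(4n)) when n − 1 + 2/(n+1) ≤ α ≤ n. Then there is a constant C (depending on n, α, s) such that for every Schwartz function f on ℝⁿ and every α-dimensional measure μ on ℝⁿ, ( ∫ sup_{0<t<1} |e^{itΔ} f(x)|² dμ(x) )^{1/2} ≤ C √(c_α(μ)) ‖f‖_{H^s(ℝⁿ)}. -/

import Mathlib

open MeasureTheory Metric Filter Set
open scoped ENNReal InnerProductSpace Topology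

noncomputable def cAlpha (n : ℕ) (α : ℝ) (μ : Measure (EuclideanSpace ℝ (Fin n))) : ℝ≥0∞ :=
  ⨆ (x : EuclideanSpace ℝ (Fin n)) (r : ℝ) (_ : 0 < r), μ (ball x r) / ENNReal.ofReal (r ^ α)

def IsAlphaDimensional (n : ℕ) (α : ℝ) (μ : Measure (EuclideanSpace ℝ (Fin n))) : Prop :=
  μ (closedBall 0 1)ᶜ = 0 ∧ cAlpha n α μ ≠ ⊤

/-- The Fourier transform `f̂(ξ) = (2π)^{-n/2} ∫ e^{-i x·ξ} f(x) dx`. -/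
noncomputable def hatFn (n : ℕ) (f : EuclideanSpace ℝ (Fin n) → ℂ)
    (ξ : EuclideanSpace ℝ (Fin n)) : ℂ :=
  (((2 * Real.pi) ^ (-(n : ℝ) / 2) : ℝ) : ℂ) *
    ∫ x, Complex.exp (-Complex.I * ((⟪x, ξ⟫_ℝ : ℝ) : ℂ)) * f x

/-- For Schwartz data, `e^{itΔ}f(x) = (2π)^{-n/2} ∫ f̂(ξ) e^{i(x·ξ - t|ξ|²)} dξ`. -/
noncomputable def schroEvol (n : ℕ) (f : SchwartzMap (EuclideanSpace ℝ (Fin n)) ℂ)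
    (t : ℝ) (x : EuclideanSpace ℝ (Fin n)) : ℂ :=
  (((2 * Real.pi) ^ (-(n : ℝ) / 2) : ℝ) : ℂ) *
    ∫ ξ, hatFn n (⇑f) ξ *
      Complex.exp (Complex.I * (((⟪x, ξ⟫_ℝ : ℝ) : ℂ) - (t : ℂ) * ((‖ξ‖ ^ 2 : ℝ) : ℂ)))

/-- The `H^s` norm, computed on the Fourier side. -/
noncomputable def hsNorm (n : ℕ) (s : ℝ)
    (f : SchwartzMap (EuclideanSpace ℝ (Fin n)) ℂ) : ℝ :=
  (∫ ξ, (1 + ‖ξ‖ ^ 2) ^ s * ‖hatFn n (⇑f) ξ‖ ^ 2) ^ ((1 : ℝ) / 2)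

open ENNReal (ofReal)

/-- The Euclidean space `ℝⁿ`. -/
abbrev Euc (n : ℕ) := EuclideanSpace ℝ (Fin n)

/-- Orthonormal bases of `ℝⁿ`. -/
abbrev ONB (n : ℕ) := OrthonormalBasis (Fin n) ℝ (Euc n)

instance isAddHaarMeasure_volume (n : ℕ) : (volume : Measure (Euc n × ℝ)).IsAddHaarMeasure := by
  rw [Measure.volume_eq_prod]; infer_instance

/-- The unimodular number `e^{iθ}`. -/
noncomputable def osc (θ : ℝ) : ℂ := Complex.exp ((θ : ℂ) * Complex.I)

@[simp] lemma norm_osc (θ : ℝ) : ‖osc θ‖ = 1 := Complex.norm_exp_ofReal_mul_I θ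

@[simp] lemma enorm_osc (θ : ℝ) : ‖osc θ‖ₑ = 1 := by
  rw [← ofReal_norm, norm_osc, ENNReal.ofReal_one]

lemma osc_add (a b : ℝ) : osc (a + b) = osc a * osc b := by
  simp [osc, ← Complex.exp_add, add_mul]

@[simp] lemma osc_zero : osc 0 = 1 := by simp [osc]

lemma contDiff_osc : ContDiff ℝ (⊤ : ℕ∞) osc := by
  unfold osc
  exact (Complex.ofRealCLM.contDiff.mul contDiff_const).cexp

@[fun_prop] lemma continuous_osc : Continuous osc := contDiff_osc.continuous

@[fun_prop] lemma measurable_osc : Measurable osc := continuous_osc.measurable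

lemma hasDerivAt_osc (θ : ℝ) : HasDerivAt osc (osc θ * Complex.I) θ := by
  unfold osc
  have h : HasDerivAt (fun x : ℝ => (x : ℂ) * Complex.I) (1 * Complex.I) θ :=
    (Complex.ofRealCLM.hasDerivAt).mul_const _
  simpa using h.cexp

/-- The Fourier integral with kernel `e^{ix·ξ}`. -/
noncomputable def fourierInt {n : ℕ} (f : Euc n → ℂ) (x : Euc n) : ℂ :=
  ∫ ξ, f ξ * osc ⟪x, ξ⟫_ℝ

/-- The Schrödinger evolution with frequency data `h`. -/
noncomputable def evol {n : ℕ} (h : Euc n → ℂ) (x : Euc n) (t : ℝ) : ℂ :=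
  ∫ ξ, h ξ * osc (⟪x, ξ⟫_ℝ - t * ‖ξ‖ ^ 2)

/-- Bounded measurable functions with bounded support. -/
structure Nice {n : ℕ} (h : Euc n → ℂ) : Prop where
  meas : Measurable h
  bdd : ∃ B : ℝ, ∀ ξ, ‖h ξ‖ ≤ B
  supp : ∃ r : ℝ, ∀ ξ, h ξ ≠ 0 → ‖ξ‖ ≤ r

lemma Nice.memLp {n : ℕ} {h : Euc n → ℂ} (hh : Nice h) (p : ℝ≥0∞) : MemLp h p := by
  obtain ⟨B, hB⟩ := hh.bdd
  obtain ⟨r, hr⟩ := hh.supp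
  have h1 : h = (closedBall (0 : Euc n) r).indicator h := by
    symm
    rw [Set.indicator_eq_self]
    intro ξ hξ
    simpa using hr ξ hξ
  rw [h1, memLp_indicator_iff_restrict measurableSet_closedBall]
  have : IsFiniteMeasure (volume.restrict (closedBall (0 : Euc n) r)) :=
    ⟨by simpa using measure_closedBall_lt_top⟩
  exact MemLp.of_bound hh.meas.aestronglyMeasurable B (Eventually.of_forall hB)

lemma Nice.integrable {n : ℕ} {h : Euc n → ℂ} (hh : Nice h) : Integrable h :=
  memLp_one_iff_integrable.1 (hh.memLp 1)

lemma Nice.mul {n : ℕ} {h m : Euc n → ℂ} (hh : Nice h) (hm : Measurable m)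
    (hb : ∃ B : ℝ, ∀ ξ, ‖m ξ‖ ≤ B) : Nice (fun ξ => h ξ * m ξ) := by
  obtain ⟨B, hB⟩ := hh.bdd
  obtain ⟨r, hr⟩ := hh.supp
  obtain ⟨B', hB'⟩ := hb
  refine ⟨hh.meas.mul hm, ⟨B * B', fun ξ => ?_⟩, ⟨r, fun ξ hξ => hr ξ (left_ne_zero_of_mul hξ)⟩⟩
  rw [norm_mul]
  exact mul_le_mul (hB ξ) (hB' ξ) (norm_nonneg _) ((norm_nonneg _).trans (hB ξ))

lemma Nice.mul_osc {n : ℕ} {h : Euc n → ℂ} (hh : Nice h) {g : Euc n → ℝ} (hg : Measurable g) :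
    Nice (fun ξ => h ξ * osc (g ξ)) :=
  hh.mul (measurable_osc.comp hg) ⟨1, fun ξ => by simp⟩

lemma Nice.indicator {n : ℕ} {h : Euc n → ℂ} (hh : Nice h) {s : Set (Euc n)}
    (hs : MeasurableSet s) : Nice (s.indicator h) := by
  obtain ⟨B, hB⟩ := hh.bdd
  obtain ⟨r, hr⟩ := hh.supp
  refine ⟨hh.meas.indicator hs, ⟨B, fun ξ => (norm_indicator_le_norm_self _ _).trans (hB ξ)⟩,
    ⟨r, fun ξ hξ => hr ξ ?_⟩⟩
  intro h0
  apply hξ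
  simp [Set.indicator, h0]

lemma Nice.sum {n : ℕ} {ι : Type*} (s : Finset ι) {h : ι → Euc n → ℂ}
    (hh : ∀ i ∈ s, Nice (h i)) : Nice (fun ξ => ∑ i ∈ s, h i ξ) := by
  classical
  induction s using Finset.induction_on with
  | empty => exact ⟨by simp, ⟨0, by simp⟩, ⟨0, by simp⟩⟩
  | insert a s ha ih =>
    obtain ⟨m1, ⟨B, hB⟩, ⟨r, hr⟩⟩ := hh a (Finset.mem_insert_self a s)
    obtain ⟨m2, ⟨B', hB'⟩, ⟨r', hr'⟩⟩ := ih fun i hi => hh i (Finset.mem_insert_of_mem hi)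
    simp only [Finset.sum_insert ha]
    refine ⟨m1.add m2, ⟨B + B', fun ξ => (norm_add_le _ _).trans (add_le_add (hB ξ) (hB' ξ))⟩,
      ⟨max r r', fun ξ hξ => ?_⟩⟩
    by_cases h0 : h a ξ = 0
    · rw [h0, zero_add] at hξ
      exact (hr' ξ hξ).trans (le_max_right _ _)
    · exact (hr ξ h0).trans (le_max_left _ _)

section Plancherel

open FourierTransform SchwartzMap

lemma fourier_toLp_ae_eq {n : ℕ} {f : Euc n → ℂ} (h1 : Integrable f) (h2 : MemLp f 2) :
    (𝓕 (h2.toLp f) : Lp ℂ 2 (volume : Measure (Euc n))) =ᵐ[volume] 𝓕 f := by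
  apply ae_eq_of_integral_contDiff_smul_eq
  · exact (Lp.memLp _).locallyIntegrable (by norm_num)
  · exact (VectorFourier.fourierIntegral_continuous Real.continuous_fourierChar
      continuous_inner h1).locallyIntegrable
  · intro g hg1 hg2
    have hc1 : HasCompactSupport (Complex.ofRealCLM ∘ g) := hg2.comp_left rfl
    have hc2 : ContDiff ℝ (⊤ : ℕ∞) (Complex.ofRealCLM ∘ g) := by fun_prop
    set G : 𝓢(Euc n, ℂ) := hc1.toSchwartzMap hc2 with hG
    have hGg : ∀ x, G x = (g x : ℂ) := fun x => by simp [hG]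
    have e1 : ∫ x, g x • (𝓕 (h2.toLp f) : Lp ℂ 2 (volume : Measure (Euc n))) x
        = ∫ x, G x • (𝓕 (h2.toLp f) : Lp ℂ 2 (volume : Measure (Euc n))) x := by
      congr with x
    have e2 : ∫ x, g x • 𝓕 f x = ∫ x, G x • 𝓕 f x := by
      congr with x
    rw [e1, e2, ← Lp.toTemperedDistribution_apply, ← Lp.fourier_toTemperedDistribution_eq,
      TemperedDistribution.fourier_apply, Lp.toTemperedDistribution_apply]
    have e3 : ∫ x, (𝓕 G) x • (h2.toLp f) x = ∫ x, (𝓕 G) x • f x := by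
      apply integral_congr_ae
      filter_upwards [h2.coeFn_toLp] with x hx
      rw [hx]
    rw [e3]
    have := VectorFourier.integral_fourierIntegral_smul_eq_flip (μ := (volume : Measure (Euc n)))
      (ν := (volume : Measure (Euc n))) (L := innerₗ (Euc n)) (f := G) (g := f)
      Real.continuous_fourierChar continuous_inner G.integrable h1
    rw [flip_innerₗ] at this
    rw [SchwartzMap.fourier_coe]
    exact this

lemma lintegral_comp_smul_euc {n : ℕ} (f : Euc n → ℝ≥0∞) {R : ℝ} (hR : R ≠ 0) :
    ∫⁻ x, f (R • x) = ofReal (|R ^ n|⁻¹) * ∫⁻ x, f x := by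
  have h := Measure.map_addHaar_smul (volume : Measure (Euc n)) hR
  have e : ∫⁻ x, f (R • x) = ∫⁻ x, f x ∂(Measure.map (fun x => R • x) volume) :=
    (((Homeomorph.smulOfNeZero R hR).toMeasurableEquiv).measurableEmbedding.lintegral_map f).symm
  rw [e]
  have h' : Measure.map (fun x : Euc n => R • x) volume = Measure.map (R • ·) volume := rfl
  rw [h', h, lintegral_smul_measure, finrank_euclideanSpace_fin, abs_inv]
  rfl

lemma lintegral_enorm_sq_eq_norm_toLp {n : ℕ} {f : Euc n → ℂ} (h2 : MemLp f 2) :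
    ∫⁻ x, ‖f x‖ₑ ^ 2 = ofReal (‖h2.toLp f‖ ^ 2) := by
  rw [Lp.norm_toLp, ENNReal.ofReal_pow ENNReal.toReal_nonneg, ENNReal.ofReal_toReal h2.2.ne,
    eLpNorm_eq_lintegral_rpow_enorm_toReal (by norm_num) (by norm_num)]
  simp only [ENNReal.toReal_ofNat, ENNReal.rpow_ofNat, one_div]
  rw [← ENNReal.rpow_natCast, ← ENNReal.rpow_mul]
  norm_num

/-- **Plancherel** for integrable square-integrable functions. -/
theorem lintegral_fourierInt_sq {n : ℕ} {f : Euc n → ℂ} (h1 : Integrable f) (h2 : MemLp f 2) :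
    ∫⁻ x, ‖fourierInt f x‖ₑ ^ 2 = ofReal ((2 * Real.pi) ^ n) * ∫⁻ ξ, ‖f ξ‖ₑ ^ 2 := by
  have key : ∀ x, fourierInt f x = 𝓕 f ((-(2 * Real.pi)⁻¹) • x) := by
    intro x
    rw [Real.fourier_eq', fourierInt]
    congr with ξ
    rw [smul_eq_mul, mul_comm, osc]
    congr 2
    rw [inner_smul_right, real_inner_comm]
    push_cast
    field_simp
  simp_rw [key]
  rw [lintegral_comp_smul_euc (fun x => ‖𝓕 f x‖ₑ ^ 2) (by
    rw [neg_ne_zero]; exact inv_ne_zero (by positivity))]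
  congr 1
  · congr 1
    rw [abs_pow, abs_neg, abs_inv, abs_of_pos (by positivity : (0:ℝ) < 2 * Real.pi), inv_pow,
      inv_inv]
  · rw [lintegral_enorm_sq_eq_norm_toLp h2, ← Lp.norm_fourier_eq,
      ← Lp.toLp_coeFn (𝓕 (h2.toLp f)) (Lp.memLp _), ← lintegral_enorm_sq_eq_norm_toLp]
    apply lintegral_congr_ae
    filter_upwards [fourier_toLp_ae_eq h1 h2] with x hx
    rw [hx]

end Plancherel

lemma integrable_evol {n : ℕ} {h : Euc n → ℂ} (hh : Integrable h) {g : Euc n → ℝ}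
    (hg : Measurable g) : Integrable fun ξ => h ξ * osc (g ξ) := by
  refine hh.mul_bdd (c := 1) (measurable_osc.comp hg).aestronglyMeasurable ?_
  exact Eventually.of_forall fun ξ => by simp

lemma continuous_evol {n : ℕ} {h : Euc n → ℂ} (hh : Nice h) :
    Continuous fun z : Euc n × ℝ => evol h z.1 z.2 := by
  unfold evol
  apply continuous_of_dominated (bound := fun ξ => ‖h ξ‖)
  · intro z
    exact (integrable_evol hh.integrable (by fun_prop)).aestronglyMeasurable
  · intro z
    exact Eventually.of_forall fun ξ => by simp
  · exact hh.integrable.norm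
  · exact Eventually.of_forall fun ξ => by fun_prop

lemma norm_evol_le {n : ℕ} {h : Euc n → ℂ} (x : Euc n) (t : ℝ) :
    ‖evol h x t‖ ≤ ∫ ξ, ‖h ξ‖ := by
  unfold evol
  refine (norm_integral_le_integral_norm _).trans (le_of_eq ?_)
  congr with ξ
  simp

lemma evol_sum {n : ℕ} {ι : Type*} (s : Finset ι) {h : ι → Euc n → ℂ}
    (hh : ∀ i ∈ s, Nice (h i)) (x : Euc n) (t : ℝ) :
    evol (fun ξ => ∑ i ∈ s, h i ξ) x t = ∑ i ∈ s, evol (h i) x t := by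
  unfold evol
  simp_rw [Finset.sum_mul]
  rw [integral_finsetSum]
  intro i hi
  exact integrable_evol (hh i hi).integrable (by fun_prop)

lemma evol_add {n : ℕ} {h h' : Euc n → ℂ} (hh : Nice h) (hh' : Nice h') (x : Euc n) (t : ℝ) :
    evol (fun ξ => h ξ + h' ξ) x t = evol h x t + evol h' x t := by
  unfold evol
  simp_rw [add_mul]
  exact integral_add (integrable_evol hh.integrable (by fun_prop))
    (integrable_evol hh'.integrable (by fun_prop))

/-- Translation in space is a modulation of the data. -/
lemma evol_translate {n : ℕ} (h : Euc n → ℂ) (x y : Euc n) (t : ℝ) :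
    evol (fun ξ => h ξ * osc ⟪y, ξ⟫_ℝ) x t = evol h (x + y) t := by
  unfold evol
  congr with ξ
  rw [mul_assoc, ← osc_add, inner_add_left]
  ring_nf

lemma sq_enorm_add_le (a b : ℂ) : ‖a + b‖ₑ ^ 2 ≤ 2 * (‖a‖ₑ ^ 2 + ‖b‖ₑ ^ 2) := by
  have h : ‖a + b‖ ^ 2 ≤ 2 * (‖a‖ ^ 2 + ‖b‖ ^ 2) := by
    have := norm_add_le a b
    nlinarith [sq_nonneg (‖a‖ - ‖b‖), norm_nonneg (a + b), norm_nonneg a, norm_nonneg b]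
  have h2 := ENNReal.ofReal_le_ofReal h
  rw [ENNReal.ofReal_mul (by norm_num), ENNReal.ofReal_add (by positivity) (by positivity),
    ENNReal.ofReal_pow (norm_nonneg _), ENNReal.ofReal_pow (norm_nonneg _),
    ENNReal.ofReal_pow (norm_nonneg _), ofReal_norm, ofReal_norm, ofReal_norm] at h2
  simpa using h2

lemma sq_enorm_sum_le {ι : Type*} (s : Finset ι) (f : ι → ℂ) :
    ‖∑ i ∈ s, f i‖ₑ ^ 2 ≤ s.card * ∑ i ∈ s, ‖f i‖ₑ ^ 2 := by
  have h : ‖∑ i ∈ s, f i‖ ^ 2 ≤ s.card * ∑ i ∈ s, ‖f i‖ ^ 2 := by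
    have h1 := norm_sum_le s f
    have h2 := sq_sum_le_card_mul_sum_sq (s := s) (f := fun i => ‖f i‖)
    exact (pow_le_pow_left₀ (norm_nonneg _) h1 2).trans h2
  have h2 := ENNReal.ofReal_le_ofReal h
  rw [ENNReal.ofReal_mul (by positivity), ENNReal.ofReal_sum_of_nonneg (fun _ _ => by positivity),
    ENNReal.ofReal_pow (norm_nonneg _), ofReal_norm] at h2
  simpa [ENNReal.ofReal_pow] using h2

/-- The product weight `∏ (1 + y_i²)`. -/
noncomputable def wt {n : ℕ} (y : Euc n) : ℝ := ∏ i, (1 + y i ^ 2)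

/-- The rapidly decreasing weight `∏ (1 + y_i²)^{-N}`. -/
noncomputable def phi {n : ℕ} (N : ℕ) (y : Euc n) : ℝ≥0∞ := ofReal ((wt y)⁻¹ ^ N)

lemma one_le_wt {n : ℕ} (y : Euc n) : 1 ≤ wt y := by
  unfold wt
  calc (1 : ℝ) = ∏ _i : Fin n, (1 : ℝ) := by simp
    _ ≤ _ := Finset.prod_le_prod (fun i _ => by positivity) fun i _ => by nlinarith [sq_nonneg (y i)]

lemma wt_pos {n : ℕ} (y : Euc n) : 0 < wt y := one_pos.trans_le (one_le_wt y)

lemma wt_neg {n : ℕ} (y : Euc n) : wt (-y) = wt y := by simp [wt]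

lemma wt_add_le {n : ℕ} (y v : Euc n) : wt (y + v) ≤ 2 ^ n * (wt y * wt v) := by
  unfold wt
  have : (2 : ℝ) ^ n = ∏ _i : Fin n, (2 : ℝ) := by simp
  rw [this, ← Finset.prod_mul_distrib, ← Finset.prod_mul_distrib]
  refine Finset.prod_le_prod (fun i _ => by positivity) fun i _ => ?_
  simp only [PiLp.add_apply]
  nlinarith [sq_nonneg (y i - v i), mul_nonneg (sq_nonneg (y i)) (sq_nonneg (v i))]

lemma one_add_sum_le_prod {ι : Type*} (s : Finset ι) {f : ι → ℝ} (hf : ∀ i, 0 ≤ f i) :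
    1 + ∑ i ∈ s, f i ≤ ∏ i ∈ s, (1 + f i) := by
  classical
  induction s using Finset.induction_on with
  | empty => simp
  | insert a s ha ih =>
    rw [Finset.sum_insert ha, Finset.prod_insert ha]
    have := hf a
    have : 0 ≤ ∑ i ∈ s, f i := Finset.sum_nonneg fun i _ => hf i
    nlinarith [mul_nonneg (hf a) this, mul_le_mul_of_nonneg_left ih (hf a)]

lemma one_add_norm_sq_le_wt {n : ℕ} (y : Euc n) : 1 + ‖y‖ ^ 2 ≤ wt y := by
  rw [EuclideanSpace.norm_sq_eq]
  simp only [Real.norm_eq_abs, sq_abs]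
  unfold wt
  exact one_add_sum_le_prod _ fun i => sq_nonneg _

lemma wt_le {n : ℕ} (y : Euc n) : wt y ≤ (1 + ‖y‖ ^ 2) ^ n := by
  unfold wt
  calc ∏ i, (1 + y i ^ 2) ≤ ∏ _i : Fin n, (1 + ‖y‖ ^ 2) := by
        refine Finset.prod_le_prod (fun i _ => by positivity) fun i _ => ?_
        have := PiLp.norm_apply_le y i
        rw [Real.norm_eq_abs] at this
        have := sq_le_sq' (by linarith [neg_abs_le (y i), abs_nonneg (y i)]) ((le_abs_self _).trans this)
        linarith
    _ = _ := by simp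

@[fun_prop] lemma continuous_wt {n : ℕ} : Continuous (wt : Euc n → ℝ) := by
  unfold wt; fun_prop

@[fun_prop] lemma measurable_wt {n : ℕ} : Measurable (wt : Euc n → ℝ) := continuous_wt.measurable

@[fun_prop] lemma measurable_phi {n : ℕ} (N : ℕ) : Measurable (phi N : Euc n → ℝ≥0∞) := by
  unfold phi; fun_prop

lemma phi_neg {n : ℕ} (N : ℕ) (y : Euc n) : phi N (-y) = phi N y := by simp [phi, wt_neg]

lemma phi_add {n : ℕ} (N M : ℕ) (y : Euc n) : phi (N + M) y = phi N y * phi M y := by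
  unfold phi
  rw [pow_add, ENNReal.ofReal_mul]
  have := wt_pos y
  positivity

lemma phi_le_one {n : ℕ} (N : ℕ) (y : Euc n) : phi N y ≤ 1 := by
  unfold phi
  rw [ENNReal.ofReal_le_one]
  exact pow_le_one₀ (inv_nonneg.2 (wt_pos y).le) (inv_le_one_of_one_le₀ (one_le_wt y))

lemma phi_ne_top {n : ℕ} (N : ℕ) (y : Euc n) : phi N y ≠ ⊤ := ENNReal.ofReal_ne_top

lemma phi_pos {n : ℕ} (N : ℕ) (y : Euc n) : 0 < phi N y := by
  unfold phi
  rw [ENNReal.ofReal_pos]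
  have := wt_pos y
  positivity

lemma phi_anti {n : ℕ} {N M : ℕ} (h : N ≤ M) (y : Euc n) : phi M y ≤ phi N y := by
  obtain ⟨k, rfl⟩ := Nat.exists_eq_add_of_le h
  rw [phi_add]
  exact mul_le_of_le_one_right' (phi_le_one _ _)

lemma phi_mul_le {n : ℕ} (N : ℕ) (y v : Euc n) :
    phi N y * phi N v ≤ 2 ^ (n * N) * phi N (y + v) := by
  unfold phi
  have h1 := wt_pos y
  have h2 := wt_pos v
  have h3 := wt_pos (y + v)
  have e : (2 : ℝ≥0∞) ^ (n * N) = ofReal (2 ^ (n * N)) := by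
    rw [ENNReal.ofReal_pow (by norm_num)]; simp
  rw [e, ← ENNReal.ofReal_mul (by positivity), ← ENNReal.ofReal_mul (by positivity)]
  apply ENNReal.ofReal_le_ofReal
  rw [pow_mul, ← mul_pow, ← mul_pow]
  apply pow_le_pow_left₀ (by positivity)
  rw [← mul_inv, inv_le_comm₀ (by positivity) (by positivity), mul_inv, inv_inv, inv_mul_le_iff₀ (by positivity)]
  exact wt_add_le y v

lemma phi_ge {n : ℕ} (N : ℕ) (y : Euc n) :
    ofReal ((1 + ‖y‖ ^ 2)⁻¹ ^ (n * N)) ≤ phi N y := by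
  unfold phi
  apply ENNReal.ofReal_le_ofReal
  rw [pow_mul]
  refine pow_le_pow_left₀ (by positivity) ?_ _
  rw [inv_pow]
  exact inv_anti₀ (wt_pos y) (wt_le y)

lemma phi_le {n : ℕ} (N : ℕ) (y : Euc n) :
    phi N y ≤ ofReal ((1 + ‖y‖ ^ 2)⁻¹ ^ N) := by
  unfold phi
  apply ENNReal.ofReal_le_ofReal
  have := wt_pos y
  refine pow_le_pow_left₀ (by positivity) ?_ _
  exact inv_anti₀ (by positivity) (one_add_norm_sq_le_wt y)

lemma integrable_one_add_norm_sq {n : ℕ} {N : ℕ} (hN : n < N) :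
    Integrable fun y : Euc n => (1 + ‖y‖ ^ 2)⁻¹ ^ N := by
  have h := integrable_rpow_neg_one_add_norm_sq (E := Euc n) (μ := volume) (r := 2 * N) (by
    rw [finrank_euclideanSpace_fin]
    have : (n : ℝ) < N := by exact_mod_cast hN
    have : (0 : ℝ) ≤ n := by positivity
    linarith)
  refine h.congr (Eventually.of_forall fun y => ?_)
  simp only
  rw [inv_pow, neg_div, mul_div_cancel_left₀ _ (by norm_num), Real.rpow_neg (by positivity),
    Real.rpow_natCast]

lemma lintegral_phi_lt_top {n : ℕ} {N : ℕ} (hN : n < N) : ∫⁻ y : Euc n, phi N y < ⊤ := by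
  refine (lintegral_mono (phi_le N)).trans_lt ?_
  exact (integrable_one_add_norm_sq hN).lintegral_lt_top

/-- Convolution of weights. -/
lemma lintegral_phi_conv_le {n : ℕ} (N : ℕ) (m : Euc n) :
    ∫⁻ l, phi N l * phi (N + (n + 1)) (m - l)
      ≤ 2 ^ (n * N) * (∫⁻ y : Euc n, phi (n + 1) y) * phi N m := by
  calc ∫⁻ l, phi N l * phi (N + (n + 1)) (m - l)
      ≤ ∫⁻ l, (2 ^ (n * N) * phi N m) * phi (n + 1) (m - l) := by
        refine lintegral_mono fun l => ?_
        rw [phi_add, ← mul_assoc]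
        refine mul_le_mul_left ?_ _
        simpa using phi_mul_le N l (m - l)
    _ = _ := by
        rw [lintegral_const_mul _ (by fun_prop), lintegral_sub_left_eq_self (fun y => phi (n + 1) y)]
        ring

/-- Anisotropic dilation along an orthonormal basis. -/
noncomputable def sc {n : ℕ} (b : ONB n) (ρ : Fin n → ℝ)
    (y : Euc n) : Euc n := ∑ i, (ρ i * y i) • b i

/-- The adjoint of `sc`. -/
noncomputable def fr {n : ℕ} (b : ONB n) (ρ : Fin n → ℝ)
    (ξ : Euc n) : Euc n := WithLp.toLp 2 fun i => ρ i * ⟪b i, ξ⟫_ℝ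

section sc
variable {n : ℕ} (b : ONB n) (ρ : Fin n → ℝ)

@[simp] lemma fr_apply (ξ : Euc n) (i : Fin n) : fr b ρ ξ i = ρ i * ⟪b i, ξ⟫_ℝ := rfl

lemma sc_add (y v : Euc n) : sc b ρ (y + v) = sc b ρ y + sc b ρ v := by
  simp [sc, mul_add, add_smul, Finset.sum_add_distrib]

lemma sc_neg (y : Euc n) : sc b ρ (-y) = -sc b ρ y := by
  simp [sc]

lemma sc_sub (y v : Euc n) : sc b ρ (y - v) = sc b ρ y - sc b ρ v := by
  rw [sub_eq_add_neg, sc_add, sc_neg, sub_eq_add_neg]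

@[fun_prop] lemma continuous_sc : Continuous (sc b ρ) := by unfold sc; fun_prop

@[fun_prop] lemma measurable_sc : Measurable (sc b ρ) := (continuous_sc b ρ).measurable

@[fun_prop] lemma continuous_fr : Continuous (fr b ρ) := by unfold fr; fun_prop

@[fun_prop] lemma measurable_fr : Measurable (fr b ρ) := (continuous_fr b ρ).measurable

lemma inner_sc (y ξ : Euc n) : ⟪sc b ρ y, ξ⟫_ℝ = ⟪y, fr b ρ ξ⟫_ℝ := by
  simp only [sc, sum_inner, inner_smul_left, PiLp.inner_apply, fr_apply]
  refine Finset.sum_congr rfl fun i _ => ?_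
  simp
  ring

lemma inner_basis_sc (y : Euc n) (i : Fin n) : ⟪b i, sc b ρ y⟫_ℝ = ρ i * y i := by
  simp [sc, inner_sum, inner_smul_right, b.inner_eq_ite]

lemma fr_sub (y v : Euc n) : fr b ρ (y - v) = fr b ρ y - fr b ρ v := by
  ext i; simp [inner_sub_right, mul_sub]

lemma sc_surj {ρ : Fin n → ℝ} (hρ : ∀ i, ρ i ≠ 0) (x : Euc n) :
    sc b ρ (WithLp.toLp 2 fun i => ⟪b i, x⟫_ℝ / ρ i) = x := by
  conv_rhs => rw [← b.sum_repr' x]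
  unfold sc
  refine Finset.sum_congr rfl fun i _ => ?_
  congr 1
  simp only
  field_simp [hρ i]

lemma norm_sq_basis (ξ : Euc n) : ‖ξ‖ ^ 2 = ∑ i, ⟪b i, ξ⟫_ℝ ^ 2 := by
  rw [← b.sum_sq_norm_inner_right ξ]; simp

end sc

/-- The energy of `evol h` near `(x, t)` at the spatial scales `ρ`. -/
noncomputable def en {n : ℕ} (b : ONB n) (ρ : Fin n → ℝ) (N : ℕ)
    (h : Euc n → ℂ) (x : Euc n) (t : ℝ) : ℝ≥0∞ :=
  ∫⁻ y, ‖evol h (x - sc b ρ y) t‖ₑ ^ 2 * phi N y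

/-- Smooth functions with compact support. -/
structure Cutoff {n : ℕ} (χ : Euc n → ℂ) : Prop where
  smooth : ContDiff ℝ (⊤ : ℕ∞) χ
  cpt : HasCompactSupport χ

lemma Cutoff.continuous {n : ℕ} {χ : Euc n → ℂ} (h : Cutoff χ) : Continuous χ := h.smooth.continuous

lemma Cutoff.integrable {n : ℕ} {χ : Euc n → ℂ} (h : Cutoff χ) : Integrable χ :=
  h.continuous.integrable_of_hasCompactSupport h.cpt

lemma Cutoff.mul_right {n : ℕ} {χ g : Euc n → ℂ} (h : Cutoff χ) (hg : ContDiff ℝ (⊤ : ℕ∞) g) :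
    Cutoff (fun η => χ η * g η) := ⟨h.smooth.mul hg, h.cpt.mul_right⟩

lemma Cutoff.deriv {n : ℕ} {χ : Euc n → ℂ} (h : Cutoff χ) (v : Euc n) :
    Cutoff (fun η => fderiv ℝ χ η v) :=
  ⟨(h.smooth.fderiv_right (m := (⊤ : ℕ∞)) (by norm_cast)).clm_apply contDiff_const,
    h.cpt.fderiv_apply ℝ v⟩

/-- The kernel of a frequency cutoff with a quadratic phase. -/
noncomputable def qker {n : ℕ} (a : Fin n → ℝ) (χ : Euc n → ℂ) (y : Euc n) : ℂ :=
  fourierInt (fun η => χ η * osc (-∑ i, a i * η i ^ 2)) y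

lemma contDiff_quadPhase {n : ℕ} (a : Fin n → ℝ) :
    ContDiff ℝ (⊤ : ℕ∞) (fun η : Euc n => osc (-∑ i, a i * η i ^ 2)) := by
  refine contDiff_osc.comp ?_
  fun_prop

lemma coord_mul_qker {n : ℕ} (a : Fin n → ℝ) {χ : Euc n → ℂ} (hχ : Cutoff χ) (y : Euc n)
    (i : Fin n) : |y i| * ‖qker a χ y‖ ≤
      ‖qker a (fun η => fderiv ℝ χ η (EuclideanSpace.single i 1)) y‖
        + 2 * |a i| * ‖qker a (fun η => χ η * (η i : ℂ)) y‖ := by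
  set v : Euc n := EuclideanSpace.single i 1 with hv
  set f : Euc n → ℂ := fun η => χ η * osc (-∑ i, a i * η i ^ 2) with hf
  have hfc : Cutoff f := hχ.mul_right (contDiff_quadPhase a)
  set g : Euc n → ℂ := fun η => osc ⟪y, η⟫_ℝ with hg
  have hgs : ContDiff ℝ (⊤ : ℕ∞) g := contDiff_osc.comp (innerSL ℝ y).contDiff
  have hgd : ∀ η, fderiv ℝ g η v = (y i : ℂ) * (Complex.I * g η) := by
    intro η
    have h1 : HasFDerivAt (fun η : Euc n => ⟪y, η⟫_ℝ) (innerSL ℝ y) η := (innerSL ℝ y).hasFDerivAt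
    have h2 := (hasDerivAt_osc ⟪y, η⟫_ℝ).hasFDerivAt.comp η h1
    rw [show g = osc ∘ fun η : Euc n => ⟪y, η⟫_ℝ from rfl, h2.fderiv]
    have h3 : ⟪y, (EuclideanSpace.single i 1 : Euc n)⟫_ℝ = y i := by
      rw [EuclideanSpace.inner_single_right]; simp
    simp only [hv, Function.comp_apply, ContinuousLinearMap.comp_apply, innerSL_apply_apply, h3,
      ContinuousLinearMap.toSpanSingleton_apply, Complex.real_smul]
    ring
  have hfd : ∀ η, fderiv ℝ f η v = fderiv ℝ χ η v * osc (-∑ i, a i * η i ^ 2)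
      + (-2 * a i * Complex.I) * (χ η * (η i : ℂ) * osc (-∑ i, a i * η i ^ 2)) := by
    intro η
    have h0 : HasFDerivAt (fun η : Euc n => -∑ i, a i * η i ^ 2)
        (-∑ j, (2 * a j * η j) • (EuclideanSpace.proj j : Euc n →L[ℝ] ℝ)) η := by
      refine HasFDerivAt.neg (HasFDerivAt.fun_sum fun j _ => ?_)
      have h3 : HasFDerivAt (fun η : Euc n => η j) (EuclideanSpace.proj j : Euc n →L[ℝ] ℝ) η :=
        (EuclideanSpace.proj j : Euc n →L[ℝ] ℝ).hasFDerivAt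
      have h4 := (h3.pow 2).const_mul (a j)
      refine h4.congr_fderiv ?_
      rw [← smul_assoc]
      congr 1
      simp; ring
    have h2 := (hasDerivAt_osc (-∑ i, a i * η i ^ 2)).hasFDerivAt.comp η h0
    have h1 : HasFDerivAt χ (fderiv ℝ χ η) η :=
      (hχ.smooth.differentiable (by simp)).differentiableAt.hasFDerivAt
    have h5 := (h1.mul h2).fderiv
    rw [hf]
    rw [show (fun η : Euc n => χ η * osc (-∑ i, a i * η i ^ 2)) = χ * (osc ∘ fun η : Euc n => -∑ i, a i * η i ^ 2) from rfl, h5]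
    simp [hv]
    ring
  have hcg : ∀ {k : Euc n → ℂ}, Cutoff k → Integrable fun η => k η * g η := fun hk =>
    (hk.mul_right hgs).integrable
  have key := integral_mul_fderiv_eq_neg_fderiv_mul_of_integrable (𝕜 := ℂ) (μ := volume) (f := f)
    (g := g) (v := v) (hcg (hfc.deriv v)) (by
      refine ((hfc.mul_right (hgs.mul contDiff_const)).integrable).congr
        (g := fun x => f x * fderiv ℝ g x v) (f := fun x => f x * (g x * ((y i : ℂ) * Complex.I))) (Eventually.of_forall fun x => ?_)
      simp only [hgd]
      ring) (hcg hfc) (fun x _ => (hfc.smooth.differentiable (by simp)).differentiableAt)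
      (fun x _ => (hgs.differentiable (by simp)).differentiableAt)
  have e1 : ∫ η, f η * fderiv ℝ g η v = (y i : ℂ) * Complex.I * qker a χ y := by
    unfold qker fourierInt
    rw [← integral_const_mul]
    congr with η
    rw [hgd]
    simp only [hf, hg]
    ring
  have e2 : ∫ η, fderiv ℝ f η v * g η = qker a (fun η => fderiv ℝ χ η v) y
      + (-2 * a i * Complex.I) * qker a (fun η => χ η * (η i : ℂ)) y := by
    unfold qker fourierInt
    rw [← integral_const_mul, ← integral_add]
    · congr with η
      rw [hfd]
      simp only [hg]
      ring
    · exact hcg ((hχ.deriv v).mul_right (contDiff_quadPhase a))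
    · refine (hcg (Cutoff.mul_right (hχ.mul_right (g := fun η => (η i : ℂ)) ?_) (contDiff_quadPhase a))).const_mul _
      exact Complex.ofRealCLM.contDiff.comp (EuclideanSpace.proj i : Euc n →L[ℝ] ℝ).contDiff
  rw [e1, e2] at key
  have := congrArg norm key
  rw [norm_mul, norm_mul, norm_neg] at this
  simp only [Complex.norm_real, Real.norm_eq_abs, Complex.norm_I, mul_one] at this
  rw [this]
  refine (norm_add_le _ _).trans (le_of_eq ?_)
  simp

lemma qker_decay {n : ℕ} (A : ℝ) (Q : ℕ) : ∀ χ : Euc n → ℂ, Cutoff χ → ∃ C : ℝ, 0 ≤ C ∧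
    ∀ a : Fin n → ℝ, (∀ i, |a i| ≤ A) → ∀ y, ‖y‖ ^ Q * ‖qker a χ y‖ ≤ C := by
  induction Q with
  | zero =>
    intro χ hχ
    refine ⟨∫ η, ‖χ η‖, integral_nonneg fun _ => norm_nonneg _, fun a _ y => ?_⟩
    rw [pow_zero, one_mul]
    unfold qker fourierInt
    refine (norm_integral_le_integral_norm _).trans (le_of_eq ?_)
    congr with ξ
    simp
  | succ Q ih =>
    intro χ hχ
    have hc : ∀ i : Fin n, Cutoff (fun η => χ η * (η i : ℂ)) := fun i => hχ.mul_right
      (Complex.ofRealCLM.contDiff.comp (EuclideanSpace.proj i : Euc n →L[ℝ] ℝ).contDiff)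
    choose C1 hC1 hC1' using fun i : Fin n => ih _ (hχ.deriv (EuclideanSpace.single i 1))
    choose C2 hC2 hC2' using fun i : Fin n => ih _ (hc i)
    refine ⟨∑ i, (C1 i + 2 * |A| * C2 i), Finset.sum_nonneg fun i _ => ?_, fun a ha y => ?_⟩
    · have := hC1 i; have := hC2 i; positivity
    have h1 : ‖y‖ ≤ ∑ i, |y i| := by
      have : y = ∑ i, EuclideanSpace.single i (y i) := by
        ext j; simp
      conv_lhs => rw [this]
      refine (norm_sum_le _ _).trans (le_of_eq ?_)
      simp
    calc ‖y‖ ^ (Q + 1) * ‖qker a χ y‖ = ‖y‖ ^ Q * (‖y‖ * ‖qker a χ y‖) := by ring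
      _ ≤ ‖y‖ ^ Q * ((∑ i, |y i|) * ‖qker a χ y‖) := by gcongr
      _ = ∑ i, ‖y‖ ^ Q * (|y i| * ‖qker a χ y‖) := by rw [Finset.sum_mul, Finset.mul_sum]
      _ ≤ _ := by
        refine Finset.sum_le_sum fun i _ => ?_
        refine (mul_le_mul_of_nonneg_left (coord_mul_qker a hχ y i) (by positivity)).trans ?_
        have h2 := hC1' i a ha y
        have h3 := hC2' i a ha y
        have h4 : |a i| ≤ |A| := (ha i).trans (le_abs_self _)
        calc _ = ‖y‖ ^ Q * ‖qker a (fun η => fderiv ℝ χ η (EuclideanSpace.single i 1)) y‖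
              + 2 * |a i| * (‖y‖ ^ Q * ‖qker a (fun η => χ η * (η i : ℂ)) y‖) := by ring
          _ ≤ _ := by gcongr

lemma qker_le_phi {n : ℕ} (A : ℝ) (N : ℕ) {χ : Euc n → ℂ} (hχ : Cutoff χ) : ∃ C : ℝ, 0 ≤ C ∧
    ∀ a : Fin n → ℝ, (∀ i, |a i| ≤ A) → ∀ y, ‖qker a χ y‖ₑ ≤ ofReal C * phi N y := by
  obtain ⟨C1, h1, h1'⟩ := qker_decay A 0 χ hχ
  obtain ⟨C2, h2, h2'⟩ := qker_decay A (2 * (n * N)) χ hχ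
  refine ⟨2 ^ (n * N) * (C1 + C2), by positivity, fun a ha y => ?_⟩
  refine le_trans ?_ (mul_le_mul_right (phi_ge N y) _)
  rw [← ENNReal.ofReal_mul (by positivity), ← ofReal_norm]
  apply ENNReal.ofReal_le_ofReal
  rw [inv_pow, ← div_eq_mul_inv, le_div_iff₀ (by positivity)]
  have h3 : (1 + ‖y‖ ^ 2) ^ (n * N) ≤ 2 ^ (n * N) * (1 + ‖y‖ ^ (2 * (n * N))) := by
    have h5 : (1 + ‖y‖ ^ 2) ≤ 2 * max 1 (‖y‖ ^ 2) := by
      have := le_max_left 1 (‖y‖ ^ 2); have := le_max_right 1 (‖y‖ ^ 2); linarith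
    refine (pow_le_pow_left₀ (by positivity) h5 _).trans ?_
    rw [mul_pow]
    gcongr
    rcases max_cases 1 (‖y‖ ^ 2) with ⟨h, _⟩ | ⟨h, _⟩
    · rw [h, one_pow]; have : 0 ≤ ‖y‖ ^ (2 * (n * N)) := by positivity
      linarith
    · rw [h, ← pow_mul]; linarith
  have h4 := h1' a ha y
  have h5 := h2' a ha y
  rw [pow_zero, one_mul] at h4
  calc ‖qker a χ y‖ * (1 + ‖y‖ ^ 2) ^ (n * N)
      ≤ ‖qker a χ y‖ * (2 ^ (n * N) * (1 + ‖y‖ ^ (2 * (n * N)))) := by gcongr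
    _ = 2 ^ (n * N) * (‖qker a χ y‖ + ‖y‖ ^ (2 * (n * N)) * ‖qker a χ y‖) := by ring
    _ ≤ _ := by gcongr

lemma continuous_fourierInt {n : ℕ} {f : Euc n → ℂ} (hf : Integrable f) :
    Continuous (fourierInt f) := by
  unfold fourierInt
  apply continuous_of_dominated (bound := fun ξ => ‖f ξ‖)
  · intro z
    exact (integrable_evol hf (by fun_prop)).aestronglyMeasurable
  · intro z
    exact Eventually.of_forall fun ξ => by simp
  · exact hf.norm
  · exact Eventually.of_forall fun ξ => by fun_prop

lemma qker_continuous {n : ℕ} (a : Fin n → ℝ) {χ : Euc n → ℂ} (hχ : Cutoff χ) :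
    Continuous (qker a χ) :=
  continuous_fourierInt (hχ.mul_right (contDiff_quadPhase a)).integrable

lemma qker_integrable {n : ℕ} (a : Fin n → ℝ) {χ : Euc n → ℂ} (hχ : Cutoff χ) :
    Integrable (qker a χ) := by
  obtain ⟨C, hC, h⟩ := qker_le_phi (∑ i, |a i|) (n + 1) hχ
  refine ⟨(qker_continuous a hχ).aestronglyMeasurable, ?_⟩
  refine (lintegral_mono fun y => h a (fun i => ?_) y).trans_lt ?_
  · exact Finset.single_le_sum (f := fun i => |a i|) (fun _ _ => abs_nonneg _) (Finset.mem_univ i)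
  · rw [lintegral_const_mul _ (by fun_prop)]
    exact ENNReal.mul_lt_top ENNReal.ofReal_lt_top (lintegral_phi_lt_top (by omega))

open FourierTransform in
lemma fourierInt_inv {n : ℕ} {f : Euc n → ℂ} (hc : Continuous f) (hf : Integrable f)
    (hF : Integrable (fourierInt f)) (η : Euc n) :
    f η = (((2 * Real.pi) ^ n)⁻¹ : ℝ) * ∫ y, fourierInt f y * osc (-⟪y, η⟫_ℝ) := by
  have hpi : (2 * Real.pi) ≠ 0 := by positivity
  have key : ∀ w, 𝓕⁻ f w = fourierInt f ((2 * Real.pi) • w) := by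
    intro w
    rw [Real.fourierInv_eq', fourierInt]
    congr with ξ
    rw [smul_eq_mul, mul_comm, osc, inner_smul_left, real_inner_comm]
    simp
  have key2 : 𝓕 f = fun w => 𝓕⁻ f (-w) := by
    ext w; rw [Real.fourierInv_eq_fourier_neg, neg_neg]
  have hi : Integrable (𝓕 f) := by
    rw [key2]
    simp_rw [key]
    exact (hF.comp_smul hpi).comp_neg
  have h := congrFun (hc.fourier_fourierInv_eq hf hi) η
  rw [← h, Real.fourier_eq']
  simp_rw [key]
  have := Measure.integral_comp_smul (volume : Measure (Euc n))
    (fun y => fourierInt f y * osc (-⟪y, η⟫_ℝ)) (2 * Real.pi)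
  rw [finrank_euclideanSpace_fin, abs_of_pos (by positivity)] at this
  rw [← Complex.real_smul, ← this]
  congr with w
  rw [smul_eq_mul, mul_comm, osc, inner_smul_left]
  congr 2
  simp

lemma lintegral_mul_sq_le {α : Type*} [MeasurableSpace α] {μ : Measure α} {f g : α → ℝ≥0∞}
    (hf : AEMeasurable f μ) (hg : AEMeasurable g μ) :
    (∫⁻ a, f a * g a ∂μ) ^ 2 ≤ (∫⁻ a, f a ∂μ) * ∫⁻ a, g a ^ 2 * f a ∂μ := by
  have h := ENNReal.lintegral_mul_norm_pow_le (μ := μ) (f := f) (g := fun a => g a ^ 2 * f a)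
    hf ((hg.pow_const 2).mul hf) (p := 1 / 2) (q := 1 / 2) (by norm_num) (by norm_num) (by norm_num)
  have e : ∀ a, f a ^ (1 / 2 : ℝ) * (g a ^ 2 * f a) ^ (1 / 2 : ℝ) = f a * g a := by
    intro a
    rw [← ENNReal.mul_rpow_of_nonneg _ _ (by norm_num)]
    have : f a * (g a ^ 2 * f a) = (f a * g a) ^ (2 : ℝ) := by
      rw [ENNReal.rpow_ofNat]; ring
    rw [this, ← ENNReal.rpow_mul]; norm_num
  simp_rw [e] at h
  refine (pow_le_pow_left' h 2).trans (le_of_eq ?_)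
  rw [mul_pow, ← ENNReal.rpow_natCast, ← ENNReal.rpow_mul, ← ENNReal.rpow_natCast,
    ← ENNReal.rpow_mul]
  norm_num

lemma exists_cutoff {n : ℕ} (A : ℝ) : ∃ χ : Euc n → ℂ, Cutoff χ ∧
    (∀ η, (∀ i, |η i| ≤ A) → χ η = 1) ∧ ∀ η, χ η ≠ 0 → ∀ i, |η i| ≤ n * |A| + 2 := by
  let f : ContDiffBump (0 : Euc n) := ⟨n * |A| + 1, n * |A| + 2, by positivity, by linarith⟩
  refine ⟨fun η => (f η : ℂ), ⟨Complex.ofRealCLM.contDiff.comp f.contDiff,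
    f.hasCompactSupport.comp_left (g := fun r : ℝ => (r : ℂ)) (by simp)⟩, fun η hη => ?_, fun η hη i => ?_⟩
  swap
  · have h2 : η ∈ Function.support f := fun h => hη (by simp [h])
    rw [f.support_eq] at h2
    have h3 := PiLp.norm_apply_le η i
    rw [Real.norm_eq_abs] at h3
    refine h3.trans (le_of_lt ?_)
    simpa using h2
  have h1 : ‖η‖ ≤ n * |A| + 1 := by
    have : η = ∑ i, EuclideanSpace.single i (η i) := by
      ext j; simp
    rw [this]
    refine (norm_sum_le _ _).trans ?_
    simp only [PiLp.norm_single, Real.norm_eq_abs]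
    have : ∑ i, |η i| ≤ ∑ _i : Fin n, |A| :=
      Finset.sum_le_sum fun i _ => (hη i).trans (le_abs_self A)
    simp at this
    linarith
  have h2 : f η = 1 := f.one_of_mem_closedBall (by simpa using h1)
  simp [h2]

section
variable {n : ℕ} (b : ONB n) (ρ : Fin n → ℝ)

lemma nice_mul_comp_fr {h f : Euc n → ℂ} (hh : Nice h) (hf : Cutoff f) (σ : Euc n) :
    Nice (fun ξ => h ξ * f (fr b ρ ξ - σ)) := by
  refine hh.mul (hf.continuous.measurable.comp (by fun_prop)) ?_
  obtain ⟨B, hB⟩ := hf.continuous.bounded_above_of_compact_support hf.cpt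
  exact ⟨B, fun ξ => hB _⟩

/-- A smooth frequency cutoff is a superposition of translations. -/
lemma evol_mul_comp_fr {h f : Euc n → ℂ} (hh : Nice h) (hc : Continuous f) (hf : Integrable f)
    (hF : Integrable (fourierInt f)) (σ x : Euc n) (s : ℝ) :
    evol (fun ξ => h ξ * f (fr b ρ ξ - σ)) x s = (((2 * Real.pi) ^ n)⁻¹ : ℝ) *
      fourierInt (fun y => fourierInt f y * evol h (x - sc b ρ y) s) σ := by
  have h1 : ∀ ξ, h ξ * f (fr b ρ ξ - σ) * osc (⟪x, ξ⟫_ℝ - s * ‖ξ‖ ^ 2) =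
      (((2 * Real.pi) ^ n)⁻¹ : ℝ) * ∫ y, (h ξ * fourierInt f y) *
        osc (⟪x, ξ⟫_ℝ - s * ‖ξ‖ ^ 2 - ⟪y, fr b ρ ξ - σ⟫_ℝ) := by
    intro ξ
    rw [fourierInt_inv hc hf hF, mul_left_comm, mul_assoc, mul_assoc, ← integral_mul_const,
      ← integral_const_mul]
    congr 1
    congr with y
    rw [sub_eq_add_neg (_ - _) (inner ℝ y _), osc_add]
    ring
  have h2 : ∀ y, fourierInt f y * evol h (x - sc b ρ y) s * osc ⟪σ, y⟫_ℝ =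
      ∫ ξ, (h ξ * fourierInt f y) * osc (⟪x, ξ⟫_ℝ - s * ‖ξ‖ ^ 2 - ⟪y, fr b ρ ξ - σ⟫_ℝ) := by
    intro y
    rw [evol, mul_right_comm, ← integral_const_mul]
    congr with ξ
    rw [inner_sub_left, inner_sub_right, inner_sc, real_inner_comm σ,
      show ⟪x, ξ⟫_ℝ - s * ‖ξ‖ ^ 2 - (⟪y, fr b ρ ξ⟫_ℝ - ⟪σ, y⟫_ℝ) =
        ⟪σ, y⟫_ℝ + (⟪x, ξ⟫_ℝ - ⟪y, fr b ρ ξ⟫_ℝ - s * ‖ξ‖ ^ 2) by ring, osc_add]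
    ring
  rw [evol, fourierInt]
  simp_rw [h1, h2]
  rw [integral_const_mul, integral_integral_swap]
  have h3 : Integrable (fun p : Euc n × Euc n => h p.1 * fourierInt f p.2)
      ((volume : Measure (Euc n)).prod volume) := hh.integrable.mul_prod hF
  refine h3.mul_bdd (c := 1) (Measurable.aestronglyMeasurable ?_) (Eventually.of_forall fun p => by simp)
  have := continuous_fr b ρ
  fun_prop

end

lemma measurable_enorm_evol {n : ℕ} {h : Euc n → ℂ} (hh : Nice h) :
    Measurable fun z : Euc n × ℝ => ‖evol h z.1 z.2‖ₑ :=
  (continuous_evol hh).measurable.enorm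

lemma measurable_enorm_evol_comp {n : ℕ} {h : Euc n → ℂ} (hh : Nice h) {α : Type*}
    [MeasurableSpace α] {f : α → Euc n} {g : α → ℝ} (hf : Measurable f) (hg : Measurable g) :
    Measurable fun a => ‖evol h (f a) (g a)‖ₑ := by
  have h1 : Measurable fun a => (f a, g a) := hf.prodMk hg
  have h2 := (continuous_evol hh).measurable.comp h1
  exact h2.enorm

/-- Local constancy at a single point. -/
theorem enorm_evol_sq_le (n : ℕ) (A : ℝ) (N : ℕ) : ∃ C : ℝ≥0∞, C ≠ ⊤ ∧
    ∀ (b : ONB n) (ρ : Fin n → ℝ) (c : Euc n) (h : Euc n → ℂ),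
      (∀ i, 0 < ρ i) → Nice h → (∀ ξ, h ξ ≠ 0 → ∀ i, ρ i * |⟪b i, ξ - c⟫_ℝ| ≤ A) →
      ∀ (x : Euc n) (t s : ℝ), (∀ i, |t - s| ≤ A * ρ i ^ 2) →
        ‖evol h x t‖ₑ ^ 2 ≤ C * en b ρ N h (x - (2 * (t - s)) • c) s := by
  obtain ⟨χ, hχ, hχ1, -⟩ := exists_cutoff (n := n) A
  obtain ⟨C, hC, hk⟩ := qker_le_phi A (N + (n + 1)) hχ
  refine ⟨(ofReal (((2 * Real.pi) ^ n)⁻¹) * ofReal C) ^ 2 *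
    ∫⁻ y : Euc n, phi (n + 1) y, ?_, ?_⟩
  · exact ENNReal.mul_ne_top (by finiteness) (lintegral_phi_lt_top (by omega)).ne
  intro b ρ c h hρ hh hsupp x t s hts
  set r := t - s with hr
  set a : Fin n → ℝ := fun i => r / ρ i ^ 2 with ha
  have haA : ∀ i, |a i| ≤ A := fun i => by
    have := hρ i
    rw [ha, abs_div, abs_of_pos (by positivity : 0 < ρ i ^ 2), div_le_iff₀ (by positivity)]
    exact hts i
  set f : Euc n → ℂ := fun η => χ η * osc (-∑ i, a i * η i ^ 2) with hf
  have hfc : Cutoff f := hχ.mul_right (contDiff_quadPhase a)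
  have hker : fourierInt f = qker a χ := rfl
  have hF : Integrable (fourierInt f) := qker_integrable a hχ
  set x' := x - (2 * r) • c with hx'
  have e1 : evol h x t = osc (r * ‖c‖ ^ 2) *
      evol (fun ξ => h ξ * f (fr b ρ ξ - fr b ρ c)) x' s := by
    unfold evol
    rw [← integral_const_mul]
    congr with ξ
    by_cases h0 : h ξ = 0
    · simp [h0]
    have h1 : χ (fr b ρ ξ - fr b ρ c) = 1 := by
      apply hχ1
      intro i
      rw [← fr_sub, fr_apply, abs_mul, abs_of_pos (hρ i)]
      exact hsupp ξ h0 i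
    have h2 : ∑ i, a i * (fr b ρ ξ - fr b ρ c) i ^ 2 = r * ‖ξ - c‖ ^ 2 := by
      rw [norm_sq_basis b, Finset.mul_sum, ← fr_sub]
      refine Finset.sum_congr rfl fun i _ => ?_
      have := hρ i
      simp only [ha, fr_apply]
      field_simp
    have h3 : ‖ξ - c‖ ^ 2 = ‖ξ‖ ^ 2 - 2 * ⟪c, ξ⟫_ℝ + ‖c‖ ^ 2 := by
      rw [norm_sub_sq_real, real_inner_comm]
    simp only [hf]
    rw [h1, h2, one_mul, mul_left_comm, mul_assoc, ← osc_add, ← osc_add, h3, hx', inner_sub_left,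
      inner_smul_left]
    congr 2
    simp only [hr, conj_trivial]
    ring
  have hnorm : ‖evol h x t‖ₑ ≤ (ofReal (((2 * Real.pi) ^ n)⁻¹) * ofReal C) *
      ∫⁻ y, phi (N + (n + 1)) y * ‖evol h (x' - sc b ρ y) s‖ₑ := by
    rw [e1, evol_mul_comp_fr b ρ hh hfc.continuous hfc.integrable hF, enorm_mul, enorm_mul,
      enorm_osc, one_mul, mul_assoc]
    have e2 : ‖(((((2 * Real.pi) ^ n)⁻¹ : ℝ)) : ℂ)‖ₑ = ofReal (((2 * Real.pi) ^ n)⁻¹) := by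
      rw [← ofReal_norm, Complex.norm_real, Real.norm_of_nonneg (by positivity)]
    rw [e2]
    refine mul_le_mul_right ?_ _
    rw [fourierInt]
    refine (enorm_integral_le_lintegral_enorm _).trans ?_
    have hm : Measurable fun y => ‖evol h (x' - sc b ρ y) s‖ₑ :=
      measurable_enorm_evol_comp hh (by fun_prop) measurable_const
    rw [← lintegral_const_mul _ (by fun_prop)]
    refine lintegral_mono fun y => ?_
    rw [enorm_mul, enorm_mul, enorm_osc, mul_one, ← mul_assoc]
    exact mul_le_mul_left (hk a haA y) _
  refine (pow_le_pow_left' hnorm 2).trans ?_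
  rw [mul_pow, mul_assoc]
  refine mul_le_mul_right ?_ _
  have hm : Measurable fun y => ‖evol h (x' - sc b ρ y) s‖ₑ :=
    measurable_enorm_evol_comp hh (by fun_prop) measurable_const
  refine (lintegral_mul_sq_le (by fun_prop) hm.aemeasurable).trans ?_
  refine mul_le_mul' (lintegral_mono fun y => phi_anti (by omega) y) ?_
  exact lintegral_mono fun y => mul_le_mul_right (phi_anti (by omega) y) _

/-- The data `h` is supported in the box around `c` dual to the scales `ρ`. -/
def InBox {n : ℕ} (b : ONB n) (ρ : Fin n → ℝ) (c : Euc n) (A : ℝ)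
    (h : Euc n → ℂ) : Prop := ∀ ξ, h ξ ≠ 0 → ∀ i, ρ i * |⟪b i, ξ - c⟫_ℝ| ≤ A

/-- Changing the base point of the energy. -/
lemma en_shift_le {n : ℕ} (b : ONB n) (ρ : Fin n → ℝ) (N : ℕ)
    {h : Euc n → ℂ} (hh : Nice h) (x v : Euc n) (t : ℝ) :
    en b ρ N h (x + sc b ρ v) t * phi N v ≤ 2 ^ (n * N) * en b ρ N h x t := by
  have e1 : en b ρ N h (x + sc b ρ v) t = ∫⁻ m, ‖evol h (x - sc b ρ m) t‖ₑ ^ 2 * phi N (m + v) := by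
    unfold en
    rw [← lintegral_add_right_eq_self _ v]
    congr with m
    rw [sc_add]
    congr 4
    abel
  have hm : Measurable fun m => ‖evol h (x - sc b ρ m) t‖ₑ :=
    measurable_enorm_evol_comp hh (by fun_prop) measurable_const
  rw [e1, en, ← lintegral_mul_const _ (by fun_prop), ← lintegral_const_mul _ (by fun_prop)]
  refine lintegral_mono fun m => ?_
  have h1 : phi N (m + v) * phi N v ≤ 2 ^ (n * N) * phi N m := by
    rw [← phi_neg N v]
    simpa using phi_mul_le N (m + v) (-v)
  calc _ = ‖evol h (x - sc b ρ m) t‖ₑ ^ 2 * (phi N (m + v) * phi N v) := mul_assoc _ _ _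
    _ ≤ _ := mul_le_mul_right h1 _
    _ = _ := mul_left_comm _ _ _

lemma phi_ge_of_coord {n : ℕ} (N : ℕ) {A : ℝ} {v : Euc n} (hv : ∀ i, |v i| ≤ A) :
    ofReal (((1 + A ^ 2) ^ n)⁻¹ ^ N) ≤ phi N v := by
  unfold phi
  apply ENNReal.ofReal_le_ofReal
  refine pow_le_pow_left₀ (by positivity) (inv_anti₀ (wt_pos v) ?_) _
  unfold wt
  calc ∏ i, (1 + v i ^ 2) ≤ ∏ _i : Fin n, (1 + A ^ 2) := by
        refine Finset.prod_le_prod (fun i _ => by positivity) fun i _ => ?_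
        have := abs_le.1 (hv i)
        nlinarith [sq_le_sq' this.1 this.2]
    _ = _ := by simp

/-- A bounded change of the base point changes the energy by a bounded factor. -/
lemma en_shift_bdd (n : ℕ) (A : ℝ) (N : ℕ) : ∃ C : ℝ≥0∞, C ≠ ⊤ ∧
    ∀ (b : ONB n) (ρ : Fin n → ℝ) (h : Euc n → ℂ), Nice h →
      ∀ (x v : Euc n) (t : ℝ), (∀ i, |v i| ≤ A) →
        en b ρ N h (x + sc b ρ v) t ≤ C * en b ρ N h x t := by
  refine ⟨(ofReal (((1 + A ^ 2) ^ n)⁻¹ ^ N))⁻¹ * 2 ^ (n * N), ?_, ?_⟩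
  · refine ENNReal.mul_ne_top (ENNReal.inv_ne_top.2 ?_) (by finiteness)
    rw [← pos_iff_ne_zero, ENNReal.ofReal_pos]
    positivity
  intro b ρ h hh x v t hv
  rw [mul_assoc, ← ENNReal.div_eq_inv_mul, ENNReal.le_div_iff_mul_le]
  · exact (mul_le_mul_right (phi_ge_of_coord N hv) _).trans (en_shift_le b ρ N hh x v t)
  · left
    rw [← pos_iff_ne_zero, ENNReal.ofReal_pos]
    positivity
  · left; exact ENNReal.ofReal_ne_top

/-- Local constancy: pointwise form. -/
theorem enorm_evol_sq_mul_phi_le (n : ℕ) (A : ℝ) (N : ℕ) : ∃ C : ℝ≥0∞, C ≠ ⊤ ∧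
    ∀ (b : ONB n) (ρ : Fin n → ℝ) (c : Euc n) (h : Euc n → ℂ),
      (∀ i, 0 < ρ i) → Nice h → InBox b ρ c A h →
      ∀ (x v : Euc n) (t s : ℝ), (∀ i, |t - s| ≤ A * ρ i ^ 2) →
        ‖evol h (x + (2 * (t - s)) • c + sc b ρ v) t‖ₑ ^ 2 * phi N v ≤ C * en b ρ N h x s := by
  obtain ⟨C, hC, H⟩ := enorm_evol_sq_le n A N
  refine ⟨C * 2 ^ (n * N), by finiteness, ?_⟩
  intro b ρ c h hρ hh hb x v t s hts
  have h1 := H b ρ c h hρ hh hb (x + (2 * (t - s)) • c + sc b ρ v) t s hts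
  have e : x + (2 * (t - s)) • c + sc b ρ v - (2 * (t - s)) • c = x + sc b ρ v := by abel
  rw [e] at h1
  refine (mul_le_mul_left h1 _).trans ?_
  rw [mul_assoc, mul_assoc]
  exact mul_le_mul_right (en_shift_le b ρ N hh x v s) _

/-- Transport of the energy of a localized piece. -/
lemma en_transport_box (n : ℕ) (A : ℝ) (N : ℕ) : ∃ C : ℝ≥0∞, C ≠ ⊤ ∧
    ∀ (b : ONB n) (ρ : Fin n → ℝ) (c : Euc n) (h : Euc n → ℂ),
      (∀ i, 0 < ρ i) → Nice h → InBox b ρ c A h →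
      ∀ (x : Euc n) (t s : ℝ), (∀ i, |t - s| ≤ A * ρ i ^ 2) →
        en b ρ N h (x + (2 * (t - s)) • c) t ≤ C * en b ρ N h x s := by
  obtain ⟨C, hC, H⟩ := enorm_evol_sq_le n A (N + (n + 1))
  have hI := lintegral_phi_lt_top (n := n) (N := n + 1) (by omega)
  refine ⟨C * (2 ^ (n * N) * ∫⁻ y : Euc n, phi (n + 1) y), by finiteness, ?_⟩
  intro b ρ c h hρ hh hb x t s hts
  have hm2 : Measurable fun p : Euc n × Euc n => ‖evol h (x - sc b ρ p.2) s‖ₑ ^ 2 *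
      phi (N + (n + 1)) (p.2 - p.1) * phi N p.1 := by
    have : Measurable fun p : Euc n × Euc n => ‖evol h (x - sc b ρ p.2) s‖ₑ :=
      measurable_enorm_evol_comp hh (by fun_prop) measurable_const
    fun_prop
  have hm1 : Measurable fun m : Euc n => ‖evol h (x - sc b ρ m) s‖ₑ :=
      measurable_enorm_evol_comp hh (by fun_prop) measurable_const
  calc en b ρ N h (x + (2 * (t - s)) • c) t
      ≤ ∫⁻ l, C * ((∫⁻ m, ‖evol h (x - sc b ρ m) s‖ₑ ^ 2 * phi (N + (n + 1)) (m - l)) * phi N l) := by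
        refine lintegral_mono fun l => ?_
        rw [← mul_assoc]
        refine mul_le_mul_left ((H b ρ c h hρ hh hb _ t s hts).trans ?_) _
        refine mul_le_mul_right (le_of_eq ?_) _
        unfold en
        rw [← lintegral_sub_right_eq_self _ l]
        congr with m
        rw [sc_sub]
        congr 4
        abel
    _ = C * ∫⁻ l, ∫⁻ m, ‖evol h (x - sc b ρ m) s‖ₑ ^ 2 * phi (N + (n + 1)) (m - l) * phi N l := by
        rw [lintegral_const_mul']
        · congr 1
          refine lintegral_congr fun l => ?_
          rw [lintegral_mul_const]
          fun_prop
        · exact hC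
    _ = C * ∫⁻ m, ∫⁻ l, ‖evol h (x - sc b ρ m) s‖ₑ ^ 2 * phi (N + (n + 1)) (m - l) * phi N l := by
        rw [lintegral_lintegral_swap hm2.aemeasurable]
    _ ≤ C * ∫⁻ m, ‖evol h (x - sc b ρ m) s‖ₑ ^ 2 *
          ((2 ^ (n * N) * ∫⁻ y : Euc n, phi (n + 1) y) * phi N m) := by
        refine mul_le_mul_right (lintegral_mono fun m => ?_) _
        calc _ = ‖evol h (x - sc b ρ m) s‖ₑ ^ 2 * ∫⁻ l, phi N l * phi (N + (n + 1)) (m - l) := by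
              rw [← lintegral_const_mul _ (by fun_prop)]
              refine lintegral_congr fun l => by ring
          _ ≤ _ := mul_le_mul_right (lintegral_phi_conv_le N m) _
    _ = _ := by
        rw [mul_assoc C]
        congr 1
        exact (lintegral_congr fun m => mul_left_comm _ _ _).trans
          (lintegral_const_mul _ (by fun_prop))

lemma norm_sc_le {n : ℕ} (b : ONB n) {ρ : Fin n → ℝ} {K : ℝ}
    (h0 : ∀ i, 0 ≤ ρ i) (h1 : ∀ i, ρ i ≤ K) (y : Euc n) (hK : 0 ≤ K) : ‖sc b ρ y‖ ≤ K * ‖y‖ := by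
  refine (pow_le_pow_iff_left₀ (norm_nonneg _) (by positivity) two_ne_zero).1 ?_
  rw [norm_sq_basis b, mul_pow, EuclideanSpace.norm_sq_eq, Finset.mul_sum]
  refine Finset.sum_le_sum fun i _ => ?_
  rw [inner_basis_sc, mul_pow, Real.norm_eq_abs, sq_abs]
  have := pow_le_pow_left₀ (h0 i) (h1 i) 2
  nlinarith [sq_nonneg (y i)]

/-- Local constancy: comparison of energies at smaller scales. -/
theorem en_le_en_of_scale_le (n : ℕ) (A : ℝ) (N N' : ℕ) (hN : n * N + n + 1 ≤ N') :
    ∃ C : ℝ≥0∞, C ≠ ⊤ ∧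
    ∀ (b b' : ONB n) (ρ ρ' : Fin n → ℝ) (c : Euc n)
      (h : Euc n → ℂ),
      (∀ i, 0 < ρ i) → (∀ i, 0 < ρ' i) → (∀ i j, ρ' i ≤ ρ j) → Nice h → InBox b ρ c A h →
      ∀ (x v : Euc n) (t s : ℝ), (∀ i, |t - s| ≤ A * ρ i ^ 2) → (∀ i, |v i| ≤ A) →
        en b' ρ' N' h (x + (2 * (t - s)) • c + sc b ρ v) t ≤ C * en b ρ N h x s := by
  obtain ⟨C, hC, H⟩ := enorm_evol_sq_mul_phi_le n A N
  obtain ⟨C2, hC2, H2⟩ := en_shift_bdd n A N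
  have hI := (integrable_one_add_norm_sq (n := n) (N := n + 1) (by omega)).lintegral_lt_top
  refine ⟨C * C2 * ∫⁻ y : Euc n, ofReal ((1 + ‖y‖ ^ 2)⁻¹ ^ (n + 1)), by finiteness, ?_⟩
  intro b b' ρ ρ' c h hρ hρ' hρρ hh hb x v t s hts hv
  rw [mul_right_comm, ← lintegral_const_mul _ (by fun_prop)]
  refine lintegral_mono fun y => ?_
  set w : Euc n := WithLp.toLp 2 fun i => ⟪b i, -sc b' ρ' y⟫_ℝ / ρ i with hw
  have hsw : sc b ρ w = - sc b' ρ' y := sc_surj b (fun i => (hρ i).ne') _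
  have hwy : ‖w‖ ≤ ‖y‖ := by
    rcases Nat.eq_zero_or_pos n with h0 | h0
    · subst h0
      rw [Subsingleton.elim w y]
    have hne : (Finset.univ : Finset (Fin n)).Nonempty := ⟨⟨0, h0⟩, Finset.mem_univ _⟩
    obtain ⟨j, -, hj⟩ := Finset.exists_min_image Finset.univ ρ hne
    have h1 : ‖sc b' ρ' y‖ ≤ ρ j * ‖y‖ :=
      norm_sc_le b' (fun i => (hρ' i).le) (fun i => hρρ i j) y (hρ j).le
    have h2 : ρ j ^ 2 * ‖w‖ ^ 2 ≤ ‖sc b' ρ' y‖ ^ 2 := by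
      rw [← norm_neg (sc b' ρ' y), ← hsw, norm_sq_basis b (sc b ρ w), EuclideanSpace.norm_sq_eq, Finset.mul_sum]
      refine Finset.sum_le_sum fun i _ => ?_
      rw [inner_basis_sc, mul_pow, Real.norm_eq_abs, sq_abs]
      have := pow_le_pow_left₀ (hρ j).le (hj i (Finset.mem_univ i)) 2
      nlinarith [sq_nonneg (w i)]
    rw [← mul_pow] at h2
    have h3 := ((pow_le_pow_iff_left₀ (by have := (hρ j).le; positivity) (norm_nonneg _) two_ne_zero).1 h2).trans h1
    exact le_of_mul_le_mul_left h3 (hρ j)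
  have h1 := H b ρ c h hρ hh hb (x + sc b ρ v) w t s hts
  have e1 : x + (2 * (t - s)) • c + sc b ρ v - sc b' ρ' y
      = x + sc b ρ v + (2 * (t - s)) • c + sc b ρ w := by rw [hsw]; abel
  rw [e1]
  have h2 : phi N' y ≤ phi N w * ofReal ((1 + ‖y‖ ^ 2)⁻¹ ^ (n + 1)) := by
    calc phi N' y ≤ phi (n * N + n + 1) y := phi_anti hN y
      _ ≤ ofReal ((1 + ‖y‖ ^ 2)⁻¹ ^ (n * N + n + 1)) := phi_le _ y
      _ = ofReal ((1 + ‖y‖ ^ 2)⁻¹ ^ (n * N)) * ofReal ((1 + ‖y‖ ^ 2)⁻¹ ^ (n + 1)) := by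
          rw [← ENNReal.ofReal_mul (by positivity), ← pow_add, add_assoc]
      _ ≤ _ := by
          refine mul_le_mul_left (le_trans ?_ (phi_ge N w)) _
          apply ENNReal.ofReal_le_ofReal
          refine pow_le_pow_left₀ (by positivity) (inv_anti₀ (by positivity) ?_) _
          gcongr
  refine (mul_le_mul_right h2 _).trans ?_
  rw [← mul_assoc]
  calc _ ≤ C * en b ρ N h (x + sc b ρ v) s * ofReal ((1 + ‖y‖ ^ 2)⁻¹ ^ (n + 1)) :=
        mul_le_mul_left h1 _
    _ ≤ C * (C2 * en b ρ N h x s) * ofReal ((1 + ‖y‖ ^ 2)⁻¹ ^ (n + 1)) :=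
        mul_le_mul_left (mul_le_mul_right (H2 b ρ h hh x v s hv) _) _
    _ = _ := by ring

/-- The piece of `h` at frequency `σ` at the scale dual to `ρ`. -/
noncomputable def loc {n : ℕ} (b : ONB n) (ρ : Fin n → ℝ)
    (G : Euc n → ℂ) (σ : Euc n) (h : Euc n → ℂ) (ξ : Euc n) : ℂ := h ξ * G (fr b ρ ξ - σ)

lemma fourierInt_eq_qker {n : ℕ} (f : Euc n → ℂ) : fourierInt f = qker 0 f := by
  ext y
  simp [qker]

lemma Cutoff.integrable_fourierInt {n : ℕ} {f : Euc n → ℂ} (hf : Cutoff f) :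
    Integrable (fourierInt f) := by
  rw [fourierInt_eq_qker]
  exact qker_integrable 0 hf

lemma Cutoff.fourierInt_le_phi {n : ℕ} {f : Euc n → ℂ} (hf : Cutoff f) (N : ℕ) :
    ∃ C : ℝ≥0∞, C ≠ ⊤ ∧ ∀ y, ‖fourierInt f y‖ₑ ^ 2 ≤ C * phi N y := by
  obtain ⟨C, hC, h⟩ := qker_le_phi 0 N hf
  refine ⟨ofReal C ^ 2, by finiteness, fun y => ?_⟩
  rw [fourierInt_eq_qker]
  refine (pow_le_pow_left' (h 0 (by simp) y) 2).trans ?_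
  rw [mul_pow]
  refine mul_le_mul_right ?_ _
  rw [sq]
  exact mul_le_of_le_one_right' (phi_le_one _ _)

section
variable {n : ℕ} (b : ONB n) (ρ : Fin n → ℝ)

lemma nice_loc {h G : Euc n → ℂ} (hh : Nice h) (hG : Cutoff G) (σ : Euc n) :
    Nice (loc b ρ G σ h) := nice_mul_comp_fr b ρ hh hG σ

lemma lintegral_evol_loc_sq {h f : Euc n → ℂ} (hh : Nice h) (hf : Cutoff f) (x : Euc n) (s : ℝ) :
    ∫⁻ σ, ‖evol (loc b ρ f σ h) x s‖ₑ ^ 2 = ofReal (((2 * Real.pi) ^ n)⁻¹) *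
      ∫⁻ y, ‖fourierInt f y‖ₑ ^ 2 * ‖evol h (x - sc b ρ y) s‖ₑ ^ 2 := by
  have hF := hf.integrable_fourierInt
  have hcev : Continuous fun y => evol h (x - sc b ρ y) s :=
    (continuous_evol hh).comp (f := fun y => (x - sc b ρ y, s)) (by
      have := continuous_sc b ρ
      fun_prop)
  have hcF := continuous_fourierInt hf.integrable
  set g : Euc n → ℂ := fun y => fourierInt f y * evol h (x - sc b ρ y) s with hg
  have hg1 : Integrable g :=
    hF.mul_bdd (c := ∫ ξ, ‖h ξ‖) hcev.aestronglyMeasurable (Eventually.of_forall fun y => norm_evol_le _ _)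
  have hgb : ∀ y, ‖g y‖ ≤ (∫ ξ, ‖f ξ‖) * ∫ ξ, ‖h ξ‖ := by
    intro y
    rw [hg, norm_mul]
    refine mul_le_mul ?_ (norm_evol_le _ _) (norm_nonneg _) (integral_nonneg fun _ => norm_nonneg _)
    refine (norm_integral_le_integral_norm _).trans (le_of_eq ?_)
    simp
  have hg2 : MemLp g 2 := by
    rw [memLp_two_iff_integrable_sq_norm hg1.aestronglyMeasurable]
    simp_rw [sq]
    refine hg1.norm.mul_bdd (c := (∫ ξ, ‖f ξ‖) * ∫ ξ, ‖h ξ‖) (hcF.mul hcev).norm.aestronglyMeasurable ?_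
    exact Eventually.of_forall fun y => by simpa using hgb y
  have key : ∀ σ, ‖evol (loc b ρ f σ h) x s‖ₑ ^ 2 =
      ofReal (((2 * Real.pi) ^ n)⁻¹) ^ 2 * ‖fourierInt g σ‖ₑ ^ 2 := by
    intro σ
    have := evol_mul_comp_fr b ρ hh hf.continuous hf.integrable hF σ x s
    unfold loc
    rw [this, enorm_mul, mul_pow]
    congr 2
    rw [← ofReal_norm, Complex.norm_real, Real.norm_of_nonneg (by positivity)]
  simp_rw [key]
  rw [lintegral_const_mul' _ _ (by finiteness), lintegral_fourierInt_sq hg1 hg2, ← mul_assoc]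
  congr 1
  · rw [sq, mul_assoc, ← ENNReal.ofReal_mul (by positivity), inv_mul_cancel₀ (by positivity)]
    simp
  · simp [hg, enorm_mul, mul_pow]

lemma measurable_evol_loc {h G : Euc n → ℂ} (hh : Nice h) (hG : Cutoff G) :
    Measurable fun p : Euc n × Euc n × ℝ => ‖evol (loc b ρ G p.1 h) p.2.1 p.2.2‖ₑ := by
  unfold evol loc
  have hm : Measurable (Function.uncurry fun (p : Euc n × Euc n × ℝ) (ξ : Euc n) =>
      h ξ * G (fr b ρ ξ - p.1) * osc (⟪p.2.1, ξ⟫_ℝ - p.2.2 * ‖ξ‖ ^ 2)) := by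
    have h1 := hh.meas
    have h2 := hG.continuous.measurable
    have h3 := measurable_fr b ρ
    unfold Function.uncurry
    fun_prop
  exact hm.stronglyMeasurable.integral_prod_right.measurable.enorm

end

/-- The energy is comparable to the sum of the energies of the localized pieces. -/
theorem en_stft (n N : ℕ) {G : Euc n → ℂ} (hG : Cutoff G) (hG0 : ∃ η, G η ≠ 0) :
    ∃ C : ℝ≥0∞, C ≠ ⊤ ∧ ∀ (b : ONB n) (ρ : Fin n → ℝ)
      (h : Euc n → ℂ), Nice h → ∀ x t,
      en b ρ N h x t ≤ C * ∫⁻ σ, en b ρ N (loc b ρ G σ h) x t ∧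
      ∫⁻ σ, en b ρ N (loc b ρ G σ h) x t ≤ C * en b ρ N h x t := by
  obtain ⟨C1, hC1, hF⟩ := hG.fourierInt_le_phi (N + (n + 1))
  have hcF := continuous_fourierInt hG.integrable
  have hI := lintegral_phi_lt_top (n := n) (N := n + 1) (by omega)
  set D := ofReal (((2 * Real.pi) ^ n)⁻¹) with hD
  have hD0 : D ≠ 0 := by
    rw [← pos_iff_ne_zero, hD, ENNReal.ofReal_pos]; positivity
  set κ := ∫⁻ m, ‖fourierInt G m‖ₑ ^ 2 * phi N m with hκ
  have hκ0 : κ ≠ 0 := by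
    intro h0
    rw [hκ, lintegral_eq_zero_iff (by fun_prop)] at h0
    obtain ⟨η, hη⟩ := hG0
    apply hη
    rw [fourierInt_inv hG.continuous hG.integrable hG.integrable_fourierInt]
    rw [integral_eq_zero_of_ae, mul_zero]
    filter_upwards [h0] with y hy
    have : fourierInt G y = 0 := by
      simpa [(phi_pos N y).ne'] using hy
    simp [this]
  set W : Euc n → ℝ≥0∞ := fun l => ∫⁻ m, ‖fourierInt G m‖ₑ ^ 2 * phi N (l - m) with hW
  have hW1 : ∀ l, κ * phi N l ≤ 2 ^ (n * N) * W l := by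
    intro l
    rw [hκ, hW, ← lintegral_mul_const _ (by fun_prop), ← lintegral_const_mul _ (by fun_prop)]
    refine lintegral_mono fun m => ?_
    rw [mul_assoc, mul_left_comm (2 ^ _)]
    refine mul_le_mul_right ?_ _
    have := phi_mul_le N l (-m)
    rwa [phi_neg, ← sub_eq_add_neg, mul_comm] at this
  have hW2 : ∀ l, W l ≤ C1 * (2 ^ (n * N) * (∫⁻ y : Euc n, phi (n + 1) y) * phi N l) := by
    intro l
    refine le_trans ?_ (mul_le_mul_right (lintegral_phi_conv_le N l) _)
    rw [hW, ← lintegral_const_mul _ (by fun_prop)]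
    rw [← lintegral_sub_left_eq_self _ l]
    refine lintegral_mono fun m => ?_
    simp only [sub_sub_cancel]
    rw [mul_comm (phi N (l - m)), ← mul_assoc]
    exact mul_le_mul_left (hF _) _
  have key : ∀ (b : ONB n) (ρ : Fin n → ℝ)
      (h : Euc n → ℂ), Nice h → ∀ x t, ∫⁻ σ, en b ρ N (loc b ρ G σ h) x t =
        D * ∫⁻ l, ‖evol h (x - sc b ρ l) t‖ₑ ^ 2 * W l := by
    intro b ρ h hh x t
    have hm0 := measurable_evol_loc b ρ hh hG
    have hsc := measurable_sc b ρ
    have hm1 : Measurable fun p : Euc n × Euc n => ‖evol (loc b ρ G p.1 h) (x - sc b ρ p.2) t‖ₑ :=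
      hm0.comp (f := fun p : Euc n × Euc n => (p.1, x - sc b ρ p.2, t)) (by fun_prop)
    have hm2 : Measurable fun p : Euc n × Euc n => ‖evol h (x - sc b ρ p.2) t‖ₑ :=
      measurable_enorm_evol_comp hh (by fun_prop) measurable_const
    have hm3 : Measurable fun m : Euc n => ‖evol h (x - sc b ρ m) t‖ₑ :=
      measurable_enorm_evol_comp hh (by fun_prop) measurable_const
    have hm4 : ∀ y, Measurable fun m : Euc n => ‖evol h (x - sc b ρ y - sc b ρ m) t‖ₑ := fun y =>
      measurable_enorm_evol_comp hh (by fun_prop) measurable_const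
    calc ∫⁻ σ, en b ρ N (loc b ρ G σ h) x t
        = ∫⁻ y, ∫⁻ σ, ‖evol (loc b ρ G σ h) (x - sc b ρ y) t‖ₑ ^ 2 * phi N y := by
          unfold en
          rw [lintegral_lintegral_swap]
          exact Measurable.aemeasurable (by unfold Function.uncurry; fun_prop)
      _ = ∫⁻ y, D * ∫⁻ m, ‖fourierInt G m‖ₑ ^ 2 * ‖evol h (x - sc b ρ y - sc b ρ m) t‖ₑ ^ 2 * phi N y := by
          refine lintegral_congr fun y => ?_
          have h2 := hm4 y
          rw [lintegral_mul_const' _ _ (phi_ne_top _ _), lintegral_evol_loc_sq b ρ hh hG,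
            lintegral_mul_const' _ _ (phi_ne_top _ _), mul_assoc]
      _ = D * ∫⁻ y, ∫⁻ l, ‖fourierInt G (l - y)‖ₑ ^ 2 * ‖evol h (x - sc b ρ l) t‖ₑ ^ 2 * phi N y := by
          rw [lintegral_const_mul' _ _ (by finiteness)]
          congr 1
          refine lintegral_congr fun y => ?_
          conv_lhs => rw [← lintegral_sub_right_eq_self _ y]
          refine lintegral_congr fun l => ?_
          rw [sc_sub]
          congr 5
          abel
      _ = D * ∫⁻ l, ∫⁻ y, ‖fourierInt G (l - y)‖ₑ ^ 2 * ‖evol h (x - sc b ρ l) t‖ₑ ^ 2 * phi N y := by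
          rw [lintegral_lintegral_swap]
          have h5 : Measurable fun p : Euc n × Euc n => ‖fourierInt G (p.2 - p.1)‖ₑ :=
            (hcF.measurable.comp (by fun_prop)).enorm
          exact Measurable.aemeasurable (by unfold Function.uncurry; fun_prop)
      _ = _ := by
          congr 1
          refine lintegral_congr fun l => ?_
          rw [hW, ← lintegral_const_mul _ (by fun_prop), ← lintegral_sub_left_eq_self _ l]
          refine lintegral_congr fun m => ?_
          simp only [sub_sub_cancel]
          ring
  refine ⟨(D⁻¹ * κ⁻¹ * 2 ^ (n * N)) + D * (C1 * (2 ^ (n * N) * ∫⁻ y : Euc n, phi (n + 1) y)),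
    ?_, fun b ρ h hh x t => ?_⟩
  · have : D⁻¹ ≠ ⊤ := ENNReal.inv_ne_top.2 hD0
    have : κ⁻¹ ≠ ⊤ := ENNReal.inv_ne_top.2 hκ0
    finiteness
  have hm3 : Measurable fun m : Euc n => ‖evol h (x - sc b ρ m) t‖ₑ :=
      measurable_enorm_evol_comp hh (by fun_prop) measurable_const
  have hWm : Measurable W := by
    have : Measurable fun p : Euc n × Euc n => ‖fourierInt G p.2‖ₑ ^ 2 * phi N (p.1 - p.2) := by
      exact ((hcF.measurable.comp measurable_snd).enorm.pow_const 2).mul (by fun_prop)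
    exact this.lintegral_prod_right'
  rw [key b ρ h hh]
  constructor
  · refine le_trans ?_ (mul_le_mul_left (le_self_add) _)
    have hκt : κ ≠ ⊤ := by
      refine ((lintegral_mono (g := fun m => C1 * phi (n + 1) m) fun m => ?_).trans_lt ?_).ne
      · refine (mul_le_of_le_one_right' (phi_le_one _ _)).trans ((hF m).trans ?_)
        exact mul_le_mul_right (phi_anti (by omega) _) _
      · rw [lintegral_const_mul _ (by fun_prop)]
        finiteness
    have h1 : κ * en b ρ N h x t ≤ 2 ^ (n * N) * ∫⁻ l, ‖evol h (x - sc b ρ l) t‖ₑ ^ 2 * W l := by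
      rw [en, ← lintegral_const_mul _ (by fun_prop), ← lintegral_const_mul _ (by fun_prop)]
      refine lintegral_mono fun l => ?_
      rw [mul_left_comm, mul_left_comm (2 ^ _)]
      exact mul_le_mul_right (hW1 l) _
    calc en b ρ N h x t = κ⁻¹ * (κ * en b ρ N h x t) := by
          rw [← mul_assoc, ENNReal.inv_mul_cancel hκ0 hκt, one_mul]
      _ ≤ κ⁻¹ * (2 ^ (n * N) * ∫⁻ l, ‖evol h (x - sc b ρ l) t‖ₑ ^ 2 * W l) := mul_le_mul_right h1 _
      _ = (D⁻¹ * D) * (κ⁻¹ * (2 ^ (n * N) * ∫⁻ l, ‖evol h (x - sc b ρ l) t‖ₑ ^ 2 * W l)) := by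
          rw [ENNReal.inv_mul_cancel hD0 (by finiteness), one_mul]
      _ = _ := by ring
  · refine le_trans ?_ (mul_le_mul_left (le_add_self) _)
    rw [mul_assoc D]
    refine mul_le_mul_right ?_ _
    rw [en, ← lintegral_const_mul _ (by fun_prop)]
    refine lintegral_mono fun l => ?_
    rw [mul_left_comm]
    refine mul_le_mul_right ((hW2 l).trans (le_of_eq (by ring))) _

lemma evol_zero {n : ℕ} (x : Euc n) (t : ℝ) : evol (fun _ => 0) x t = 0 := by simp [evol]

lemma en_zero {n : ℕ} (b : ONB n) (ρ : Fin n → ℝ) (N : ℕ)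
    (x : Euc n) (t : ℝ) : en b ρ N (fun _ => 0) x t = 0 := by simp [en, evol_zero]

lemma en_sum_le {n : ℕ} (b : ONB n) (ρ : Fin n → ℝ) (N : ℕ)
    {ι : Type*} (T : Finset ι) {h : ι → Euc n → ℂ} (hh : ∀ τ ∈ T, Nice (h τ)) (x : Euc n) (t : ℝ) :
    en b ρ N (fun ξ => ∑ τ ∈ T, h τ ξ) x t ≤ T.card * ∑ τ ∈ T, en b ρ N (h τ) x t := by
  unfold en
  rw [← lintegral_finsetSum' _ fun τ hτ => ?_, ← lintegral_const_mul' _ _ (by finiteness)]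
  · refine lintegral_mono fun y => ?_
    rw [evol_sum T hh, ← Finset.sum_mul, ← mul_assoc]
    exact mul_le_mul_left (sq_enorm_sum_le T _) _
  · have : Measurable fun y => ‖evol (h τ) (x - sc b ρ y) t‖ₑ :=
      measurable_enorm_evol_comp (hh τ hτ) (by fun_prop) measurable_const
    fun_prop

lemma measurable_en_loc {n : ℕ} (b : ONB n) (ρ : Fin n → ℝ) (N : ℕ)
    {h G : Euc n → ℂ} (hh : Nice h) (hG : Cutoff G) (x : Euc n) (t : ℝ) :
    Measurable fun σ => en b ρ N (loc b ρ G σ h) x t := by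
  unfold en
  have hm1 : Measurable fun p : Euc n × Euc n => ‖evol (loc b ρ G p.1 h) (x - sc b ρ p.2) t‖ₑ :=
    (measurable_evol_loc b ρ hh hG).comp
      (f := fun p : Euc n × Euc n => (p.1, x - sc b ρ p.2, t)) (by fun_prop)
  have : Measurable fun p : Euc n × Euc n =>
      ‖evol (loc b ρ G p.1 h) (x - sc b ρ p.2) t‖ₑ ^ 2 * phi N p.2 := by fun_prop
  exact this.lintegral_prod_right'

lemma loc_inBox {n : ℕ} (b : ONB n) {ρ : Fin n → ℝ}
    (hρ : ∀ i, 0 < ρ i) {h G : Euc n → ℂ} {B : ℝ}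
    (hG : ∀ η, G η ≠ 0 → ∀ i, |η i| ≤ B) {σ ξ₀ : Euc n} (h0 : loc b ρ G σ h ξ₀ ≠ 0) :
    InBox b ρ ξ₀ (2 * B) (loc b ρ G σ h) := by
  intro ξ hξ i
  have h1 := hG _ (right_ne_zero_of_mul h0) i
  have h2 := hG _ (right_ne_zero_of_mul hξ) i
  rw [← abs_of_pos (hρ i), ← abs_mul]
  have : ρ i * ⟪b i, ξ - ξ₀⟫_ℝ = (fr b ρ ξ - σ) i - (fr b ρ ξ₀ - σ) i := by
    simp [inner_sub_right]; ring
  rw [this]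
  exact (abs_sub _ _).trans (by linarith)

/-- Propagation of energies along the group velocity. -/
theorem en_transport (n : ℕ) (A : ℝ) (N : ℕ) : ∃ C : ℝ≥0∞, C ≠ ⊤ ∧
    ∀ (b : ONB n) (ρ δ : Fin n → ℝ) (c : Euc n) (h : Euc n → ℂ),
      (∀ i, 0 < ρ i) → Nice h → (∀ ξ, h ξ ≠ 0 → ∀ i, |⟪b i, ξ - c⟫_ℝ| ≤ δ i) →
      ∀ (x : Euc n) (t s : ℝ), (∀ i, |t - s| ≤ A * ρ i ^ 2) → (∀ i, |t - s| * δ i ≤ A * ρ i) →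
        en b ρ N h (x + (2 * (t - s)) • c) t ≤ C * en b ρ N h x s := by
  obtain ⟨G, hG, hG1, hGs⟩ := exists_cutoff (n := n) 1
  have hG0 : ∃ η, G η ≠ 0 := ⟨0, by rw [hG1 0 (by simp)]; exact one_ne_zero⟩
  obtain ⟨C1, hC1, H1⟩ := en_stft n N hG hG0
  set B := n * |(1:ℝ)| + 2 with hB
  obtain ⟨C2, hC2, H2⟩ := en_transport_box n (max A (2 * B)) N
  obtain ⟨C3, hC3, H3⟩ := en_shift_bdd n (2 * A) N
  refine ⟨C1 * (C2 * C3 * C1), by finiteness, ?_⟩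
  intro b ρ δ c h hρ hh hb x t s hts htd
  refine ((H1 b ρ h hh _ t).1).trans ?_
  rw [mul_assoc, mul_assoc (C2 * C3)]
  refine mul_le_mul_right ?_ _
  refine le_trans ?_ (mul_le_mul_right ((H1 b ρ h hh x s).2) _)
  rw [← lintegral_const_mul' _ _ (by finiteness)]
  refine lintegral_mono fun σ => ?_
  have hl := nice_loc b ρ hh hG σ
  by_cases h0 : ∃ ξ₀, loc b ρ G σ h ξ₀ ≠ 0
  · obtain ⟨ξ₀, h0⟩ := h0
    have hbox := loc_inBox b hρ hGs h0
    set v : Euc n := WithLp.toLp 2 fun i => ⟪b i, (2 * (t - s)) • (c - ξ₀)⟫_ℝ / ρ i with hv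
    have hsv : sc b ρ v = (2 * (t - s)) • (c - ξ₀) := sc_surj b (fun i => (hρ i).ne') _
    have hvA : ∀ i, |v i| ≤ 2 * A := by
      intro i
      have h1 := hb ξ₀ (left_ne_zero_of_mul h0) i
      have h2 := htd i
      have h3 := hρ i
      simp only [hv, inner_smul_right, abs_div, abs_mul, abs_two, abs_of_pos h3]
      rw [div_le_iff₀ h3]
      have h4 : |⟪b i, c - ξ₀⟫_ℝ| = |⟪b i, ξ₀ - c⟫_ℝ| := by rw [← neg_sub, inner_neg_right, abs_neg]
      rw [h4]
      nlinarith [mul_le_mul_of_nonneg_left h1 (abs_nonneg (t - s))]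
    have e : x + (2 * (t - s)) • c = (x + sc b ρ v) + (2 * (t - s)) • ξ₀ := by
      rw [hsv, smul_sub]; abel
    rw [e, mul_assoc]
    refine (H2 b ρ ξ₀ _ hρ hl (fun ξ hξ i => (hbox ξ hξ i).trans (le_max_right _ _)) _ t s
      fun i => (hts i).trans ?_).trans ?_
    · exact mul_le_mul_of_nonneg_right (le_max_left _ _) (by positivity)
    · exact mul_le_mul_right (H3 b ρ _ hl x v s hvA) _
  · push Not at h0
    have : loc b ρ G σ h = fun _ => 0 := funext h0
    rw [this, en_zero]
    exact zero_le

/-- Local orthogonality of pieces with boundedly overlapping frequency supports. -/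
theorem en_orthogonality (n N : ℕ) : ∃ C : ℝ≥0∞, C ≠ ⊤ ∧
    ∀ (b : ONB n) (ρ : Fin n → ℝ), (∀ i, 0 < ρ i) →
      ∀ {ι : Type} (T : Finset ι) (h : ι → Euc n → ℂ), (∀ τ ∈ T, Nice (h τ)) → ∀ M : ℕ,
      (∀ ξ₀ : Euc n, ∀ T' ⊆ T, (∀ τ ∈ T', ∃ ξ, h τ ξ ≠ 0 ∧
        ∀ i, ρ i * |⟪b i, ξ - ξ₀⟫_ℝ| ≤ 2 * (n + 2)) → T'.card ≤ M) → ∀ x t,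
      en b ρ N (fun ξ => ∑ τ ∈ T, h τ ξ) x t ≤ C * M * ∑ τ ∈ T, en b ρ N (h τ) x t := by
  classical
  obtain ⟨G, hG, hG1, hGs⟩ := exists_cutoff (n := n) 1
  have hG0 : ∃ η, G η ≠ 0 := ⟨0, by rw [hG1 0 (by simp)]; exact one_ne_zero⟩
  obtain ⟨C1, hC1, H1⟩ := en_stft n N hG hG0
  refine ⟨C1 * C1, by finiteness, ?_⟩
  intro b ρ hρ ι T h hh M hM x t
  refine ((H1 b ρ _ (Nice.sum T hh) _ t).1).trans ?_
  rw [mul_assoc, mul_assoc]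
  refine mul_le_mul_right ?_ _
  have h1 : ∀ σ, en b ρ N (loc b ρ G σ fun ξ => ∑ τ ∈ T, h τ ξ) x t ≤
      M * ∑ τ ∈ T, en b ρ N (loc b ρ G σ (h τ)) x t := by
    intro σ
    set T' := T.filter fun τ => ∃ ξ, loc b ρ G σ (h τ) ξ ≠ 0 with hT'
    have e : (loc b ρ G σ fun ξ => ∑ τ ∈ T, h τ ξ) = fun ξ => ∑ τ ∈ T', loc b ρ G σ (h τ) ξ := by
      ext ξ
      rw [hT', Finset.sum_filter_of_ne]
      · simp [loc, Finset.sum_mul]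
      · exact fun τ _ hτ => ⟨ξ, hτ⟩
    rw [e]
    have hsub : T' ⊆ T := Finset.filter_subset _ _
    refine (en_sum_le b ρ N T' (fun τ hτ => nice_loc b ρ (hh τ (hsub hτ)) hG σ) x t).trans ?_
    refine mul_le_mul' ?_ (Finset.sum_le_sum_of_subset hsub)
    rcases T'.eq_empty_or_nonempty with h0 | ⟨τ₀, h0⟩
    · simp [h0]
    obtain ⟨-, ξ₀, hξ₀⟩ := Finset.mem_filter.1 h0
    refine Nat.cast_le.2 (hM ξ₀ T' hsub fun τ hτ => ?_)
    obtain ⟨-, ξ, hξ⟩ := Finset.mem_filter.1 hτ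
    refine ⟨ξ, left_ne_zero_of_mul hξ, fun i => ?_⟩
    have h1 := hGs _ (right_ne_zero_of_mul hξ₀) i
    have h2 := hGs _ (right_ne_zero_of_mul hξ) i
    have h3 : ρ i * ⟪b i, ξ - ξ₀⟫_ℝ = (fr b ρ ξ - σ) i - (fr b ρ ξ₀ - σ) i := by
      simp [inner_sub_right]; ring
    rw [← abs_of_pos (hρ i), ← abs_mul, h3]
    simp only [abs_one, mul_one] at h1 h2
    exact (abs_sub _ _).trans (by linarith)
  refine (lintegral_mono h1).trans ?_
  rw [lintegral_const_mul' _ _ (by finiteness), lintegral_finsetSum' _ fun τ hτ =>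
    (measurable_en_loc b ρ N (hh τ hτ) hG x t).aemeasurable, mul_left_comm]
  refine mul_le_mul_right ?_ _
  rw [Finset.mul_sum]
  exact Finset.sum_le_sum fun τ hτ => (H1 b ρ _ (hh τ hτ) x t).2

lemma lintegral_snoc {d : ℕ} {f : (Fin (d + 1) → ℝ) → ℝ≥0∞} (hf : Measurable f) :
    ∫⁻ z, f z = ∫⁻ s : ℝ, ∫⁻ y : Fin d → ℝ, f (Fin.snoc y s) := by
  have h := (volume_preserving_piFinSuccAbove (fun _ : Fin (d + 1) => ℝ) (Fin.last d)).symm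
  rw [← h.lintegral_comp hf, Measure.volume_eq_prod, lintegral_prod]
  · congr with s
    congr with y
    congr 1
    simp [MeasurableEquiv.piFinSuccAbove]
    rfl
  · exact (hf.comp (MeasurableEquiv.measurable _)).aemeasurable

/-- The position at time zero of a point moving with velocity `v`. -/
def pull {d : ℕ} (v : Fin d → ℝ) (z : Fin (d + 1) → ℝ) : Fin d → ℝ :=
  fun i => z i.castSucc - z (Fin.last d) * v i

/-- The matrix whose columns are the space-time directions `(v_j, 1)`. -/
def vmat {d : ℕ} (v : Fin (d + 1) → Fin d → ℝ) : Matrix (Fin (d + 1)) (Fin (d + 1)) ℝ :=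
  Matrix.of fun i j => Fin.lastCases (motive := fun _ => ℝ) 1 (fun i => v j i) i

lemma measurable_pull {d : ℕ} (v : Fin d → ℝ) : Measurable (pull v) := by
  unfold pull; fun_prop

lemma lintegral_comp_mulVec {m : ℕ} {A : Matrix (Fin m) (Fin m) ℝ} (hA : A.det ≠ 0)
    {f : (Fin m → ℝ) → ℝ≥0∞} (hf : Measurable f) :
    ∫⁻ x, f (A.mulVec x) = ofReal |A.det⁻¹| * ∫⁻ x, f x := by
  have h := Real.map_matrix_volume_pi_eq_smul_volume_pi hA
  rw [← smul_eq_mul, ← lintegral_smul_measure, ← h, lintegral_map hf]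
  · rfl
  · exact (LinearMap.continuous_of_finiteDimensional _).measurable

/-- The Loomis–Whitney inequality for transversal velocities. -/
theorem lintegral_prod_pull_le {d : ℕ} (hd : 1 ≤ d) (v : Fin (d + 1) → Fin d → ℝ)
    (hA : (vmat v).det ≠ 0) {G : Fin (d + 1) → (Fin d → ℝ) → ℝ≥0∞} (hG : ∀ j, Measurable (G j))
    (hfin : ∀ j, ∫⁻ y, G j y ≠ ⊤) :
    ∫⁻ z, ∏ j, G j (pull (v j) z) ^ (1 / d : ℝ) ≤
      (d + 1) ^ ((d + 1) / d : ℝ) * ofReal |(vmat v).det⁻¹| ^ (1 / d : ℝ)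
        * ∏ j, (∫⁻ y, G j y) ^ (1 / d : ℝ) := by
  have hd0 : (0 : ℝ) < d := by exact_mod_cast hd
  set A := vmat v with hAdef
  set D := ofReal |A.det⁻¹| with hD
  have hD0 : D ≠ 0 := by
    rw [← pos_iff_ne_zero, hD, ENNReal.ofReal_pos]
    positivity
  have hDt : D ≠ ⊤ := by finiteness
  have hmp := fun j => measurable_pull (v j)
  have hmA : Measurable fun x => A.mulVec x :=
    (LinearMap.continuous_of_finiteDimensional (Matrix.toLin' A)).measurable
  have hInt : ∀ j, ∀ g : ℝ → ℝ≥0∞, Measurable g → ∫⁻ z, G j (pull (v j) z) * g (z (Fin.last d)) =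
      (∫⁻ y, G j y) * ∫⁻ s, g s := by
    intro j g hg
    have := hG j
    rw [lintegral_snoc (by fun_prop), ← lintegral_const_mul _ hg]
    refine lintegral_congr fun s => ?_
    simp only [Fin.snoc_last]
    rw [lintegral_mul_const _ (by
      refine (hG j).comp ?_
      unfold pull
      simp only [Fin.snoc_last, Fin.snoc_castSucc]
      fun_prop)]
    congr 1
    have e : ∀ y, pull (v j) (Fin.snoc y s) = y - s • v j := by
      intro y; ext i; simp [pull]
    simp_rw [e]
    exact lintegral_sub_right_eq_self (fun y => G j y) _
  by_cases h0 : ∃ j, ∫⁻ y, G j y = 0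
  · obtain ⟨j, hj⟩ := h0
    have h1 := hInt j (fun _ => 1) measurable_const
    rw [hj, zero_mul] at h1
    simp only [mul_one] at h1
    have := hG j
    rw [lintegral_eq_zero_iff (by fun_prop)] at h1
    rw [lintegral_congr_ae (g := fun _ => 0), lintegral_zero]
    · exact zero_le
    filter_upwards [h1] with z hz
    refine Finset.prod_eq_zero (Finset.mem_univ j) ?_
    rw [show G j (pull (v j) z) = 0 from hz]
    exact ENNReal.zero_rpow_of_pos (by positivity)
  push Not at h0
  set lam : Fin (d + 1) → ℝ≥0∞ := fun j => (∫⁻ y, G j y)⁻¹ with hlam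
  set I : ℝ → ℝ≥0∞ := (Icc (0 : ℝ) 1).indicator 1 with hI
  have hIm : Measurable I := measurable_one.indicator measurableSet_Icc
  have hI1 : ∫⁻ s, I s = 1 := by
    rw [hI, lintegral_indicator_one measurableSet_Icc]; simp
  set F : (Fin (d + 1) → ℝ) → ℝ≥0∞ := fun z => ∑ j, lam j * (G j (pull (v j) z) * I (z (Fin.last d)))
    with hF
  have hFm : Measurable F := by
    have := hG
    fun_prop
  have hFint : ∫⁻ z, F z = d + 1 := by
    rw [hF, lintegral_finsetSum _ fun j _ => by have := hG j; fun_prop]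
    calc _ = ∑ j : Fin (d + 1), (1 : ℝ≥0∞) := by
          refine Finset.sum_congr rfl fun j _ => ?_
          have := hG j
          rw [lintegral_const_mul _ (by fun_prop), hInt j I hIm, hI1, mul_one, hlam]
          exact ENNReal.inv_mul_cancel (h0 j) (hfin j)
      _ = _ := by simp
  have hcol : ∀ x i t, A.mulVec (Function.update x i t) = A.mulVec x + (t - x i) • A.col i := by
    intro x i t
    have : Function.update x i t = x + Pi.single i (t - x i) := by
      ext k
      rcases eq_or_ne k i with rfl | hk
      · simp
      · simp [hk]
    rw [this, Matrix.mulVec_add, Matrix.mulVec_single, op_smul_eq_smul]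
  have hlast : ∀ i, A.col i (Fin.last d) = 1 := by intro i; simp [hAdef, vmat, Matrix.col]
  have hcs : ∀ i k, A.col i (Fin.castSucc k) = v i k := by intro i k; simp [hAdef, vmat, Matrix.col]
  have hlow : ∀ x i, lam i * G i (pull (v i) (A.mulVec x)) ≤
      ∫⁻ t, F (A.mulVec (Function.update x i t)) := by
    intro x i
    calc _ = ∫⁻ t, lam i * (G i (pull (v i) (A.mulVec x)) * I (t + (A.mulVec x (Fin.last d) - x i))) := by
          rw [lintegral_const_mul _ (by fun_prop), lintegral_const_mul _ (by fun_prop),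
            lintegral_add_right_eq_self I, hI1, mul_one]
      _ ≤ _ := by
          refine lintegral_mono fun t => ?_
          rw [hF]
          refine le_trans (le_of_eq ?_) (Finset.single_le_sum (fun _ _ => zero_le) (Finset.mem_univ i))
          rw [hcol]
          congr 3
          · ext k
            simp only [pull, Pi.add_apply, Pi.smul_apply, hlast, hcs, smul_eq_mul]
            ring
          · simp only [Pi.add_apply, Pi.smul_apply, hlast, smul_eq_mul]
            ring
  have hconj : (↑(Fintype.card (Fin (d + 1))) : ℝ).HolderConjugate ((d + 1) / d : ℝ) := by
    rw [Real.holderConjugate_iff]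
    refine ⟨by simp; omega, ?_⟩
    simp
    field_simp
    ring
  have hLW := lintegral_prod_lintegral_pow_le (fun _ : Fin (d + 1) => (volume : Measure ℝ)) hconj
    (f := fun x => F (A.mulVec x)) (hFm.comp hmA)
  rw [← volume_pi] at hLW
  have hcard : 1 / ((Fintype.card (Fin (d + 1)) : ℝ) - 1) = 1 / d := by simp
  rw [hcard, lintegral_comp_mulVec hA hFm, hFint] at hLW
  have hL2 : (∏ j, lam j ^ (1 / d : ℝ)) * (D * ∫⁻ z, ∏ j, G j (pull (v j) z) ^ (1 / d : ℝ)) ≤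
      (D * (d + 1)) ^ ((d + 1) / d : ℝ) := by
    refine le_trans ?_ hLW
    have hGm := hG
    rw [← lintegral_comp_mulVec hA (by fun_prop), ← lintegral_const_mul _ (by fun_prop)]
    refine lintegral_mono fun x => ?_
    rw [← Finset.prod_mul_distrib]
    refine Finset.prod_le_prod' fun j _ => ?_
    rw [← ENNReal.mul_rpow_of_nonneg _ _ (by positivity)]
    exact ENNReal.rpow_le_rpow (hlow x j) (by positivity)
  have hprod : (∏ j, (∫⁻ y, G j y) ^ (1 / d : ℝ)) * ∏ j, lam j ^ (1 / d : ℝ) = 1 := by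
    rw [← Finset.prod_mul_distrib]
    refine Finset.prod_eq_one fun j _ => ?_
    rw [← ENNReal.mul_rpow_of_nonneg _ _ (by positivity), hlam, ENNReal.mul_inv_cancel (h0 j) (hfin j),
      ENNReal.one_rpow]
  set Y := ∏ j, (∫⁻ y, G j y) ^ (1 / d : ℝ)
  calc _ = Y * (∏ j, lam j ^ (1 / d : ℝ)) * (D⁻¹ * D) *
        ∫⁻ z, ∏ j, G j (pull (v j) z) ^ (1 / d : ℝ) := by
        rw [hprod, ENNReal.inv_mul_cancel hD0 hDt, one_mul, one_mul]
    _ = Y * D⁻¹ * ((∏ j, lam j ^ (1 / d : ℝ)) * (D * ∫⁻ z, ∏ j, G j (pull (v j) z) ^ (1 / d : ℝ))) := by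
        ring
    _ ≤ Y * D⁻¹ * (D * (d + 1)) ^ ((d + 1) / d : ℝ) := mul_le_mul_right hL2 _
    _ = _ := by
        rw [ENNReal.mul_rpow_of_nonneg _ _ (by positivity)]
        have : D ^ ((d + 1) / d : ℝ) = D * D ^ (1 / d : ℝ) := by
          rw [show ((d + 1) / d : ℝ) = 1 + 1 / d by field_simp, ENNReal.rpow_add _ _ hD0 hDt,
            ENNReal.rpow_one]
        rw [this]
        calc _ = (D⁻¹ * D) * ((d + 1) ^ ((d + 1) / d : ℝ) * D ^ (1 / d : ℝ) * Y) := by ring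
          _ = _ := by rw [ENNReal.inv_mul_cancel hD0 hDt, one_mul]

section avg
variable {E : Type*} [NormedAddCommGroup E] [MeasurableSpace E] [BorelSpace E]
  {μ : Measure E} [μ.IsAddRightInvariant]
  {Y : Type*} [MeasurableSpace Y] {ν : Measure Y} [SFinite ν]

lemma setLIntegral_add_right (f : E → ℝ≥0∞) (a z₀ : E) (R : ℝ) :
    ∫⁻ z in closedBall z₀ R, f (z + a) ∂μ = ∫⁻ z in closedBall (z₀ + a) R, f z ∂μ := by
  rw [← lintegral_indicator measurableSet_closedBall, ← lintegral_indicator measurableSet_closedBall]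
  conv_rhs => rw [← lintegral_add_right_eq_self _ a]
  congr with z
  by_cases h : z ∈ closedBall z₀ R
  · rw [indicator_of_mem h, indicator_of_mem]
    simpa using h
  · rw [indicator_of_notMem h, indicator_of_notMem]
    simpa using h

variable [SecondCountableTopology E] [SFinite μ]

lemma setLIntegral_le_avg {f : E → ℝ≥0∞} (hf : Measurable f) {ι : Y → E} (hι : Measurable ι)
    {K : Set Y} (hK : MeasurableSet K) {r : ℝ} (hr : ∀ y ∈ K, ‖ι y‖ ≤ r) (z₀ : E) (R : ℝ) :
    ν K * ∫⁻ z in closedBall z₀ R, f z ∂μ ≤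
      ∫⁻ z in closedBall z₀ (R + r), ∫⁻ y in K, f (z + ι y) ∂ν ∂μ := by
  rw [lintegral_lintegral_swap (Measurable.aemeasurable (by unfold Function.uncurry; fun_prop)),
    mul_comm, ← setLIntegral_const]
  refine setLIntegral_mono' hK fun y hy => ?_
  rw [setLIntegral_add_right f]
  refine lintegral_mono_set (closedBall_subset_closedBall' ?_)
  have := hr y hy
  rw [dist_eq_norm]
  simpa using this

lemma setLIntegral_avg_le {f : E → ℝ≥0∞} (hf : Measurable f) {ι : Y → E} (hι : Measurable ι)
    {K : Set Y} (hK : MeasurableSet K) {r : ℝ} (hr : ∀ y ∈ K, ‖ι y‖ ≤ r) (z₀ : E) (R : ℝ) :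
    ∫⁻ z in closedBall z₀ R, ∫⁻ y in K, f (z + ι y) ∂ν ∂μ ≤
      ν K * ∫⁻ z in closedBall z₀ (R + r), f z ∂μ := by
  rw [lintegral_lintegral_swap (Measurable.aemeasurable (by unfold Function.uncurry; fun_prop)),
    mul_comm, ← setLIntegral_const]
  refine setLIntegral_mono' hK fun y hy => ?_
  rw [setLIntegral_add_right f]
  refine lintegral_mono_set (closedBall_subset_closedBall' ?_)
  have := hr y hy
  rw [dist_eq_norm]
  simpa using this

end avg

lemma prod_mul_rpow {ι : Type*} [Fintype ι] (C : ℝ≥0∞) (f : ι → ℝ≥0∞) {p : ℝ} (hp : 0 ≤ p) :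
    ∏ j, (C * f j) ^ p = (C ^ p) ^ Fintype.card ι * ∏ j, f j ^ p := by
  simp_rw [ENNReal.mul_rpow_of_nonneg _ _ hp]
  rw [Finset.prod_mul_distrib]
  simp

/-- Multiscale iteration of the Loomis–Whitney inequality. -/
theorem multiscale_transversal {d : ℕ} (hd : 1 ≤ d) (C : ℝ≥0∞) (hC : C ≠ ⊤) {V ν : ℝ}
    (hV : 0 ≤ V) (hν : 0 < ν) : ∃ C1 : ℝ≥0∞, C1 ≠ ⊤ ∧ ∀ (M : ℝ), 1 ≤ M →
    ∀ v : Fin (d + 1) → Fin d → ℝ, (∀ j i, |v j i| ≤ V) → ν ≤ |(vmat v).det| →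
    ∀ (L : ℕ) (F : ℕ → Fin (d + 1) → (Fin (d + 1) → ℝ) → ℝ≥0∞),
      (∀ l j, Measurable (F l j)) → (∀ l j ζ, F l j ζ ≠ ⊤) →
      (∀ l, 1 ≤ l → l < L → ∀ j ζ, ∀ s : ℝ, |s| ≤ 2 * M ^ (l + 1) →
        F l j (ζ + s • (Fin.snoc (v j) 1 : Fin (d + 1) → ℝ)) ≤ C * F l j ζ) →
      (∀ l, 1 ≤ l → l < L → ∀ j ζ, ∫⁻ y in closedBall (0 : Fin d → ℝ) (2 * (1 + V) * M ^ (l + 1)),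
        F l j (ζ + (Fin.snoc y 0 : Fin (d + 1) → ℝ)) ≤
          C * ofReal (M ^ ((l + 1) * d)) * F (l + 1) j ζ) →
      (∀ j ζ ζ', dist ζ ζ' ≤ M → F 1 j ζ ≤ C * F 1 j ζ') →
      ∀ l, 1 ≤ l → l ≤ L → ∀ ζ₀, ∫⁻ ζ in closedBall ζ₀ (M ^ l), ∏ j, F 1 j ζ ^ (1 / d : ℝ) ≤
        C1 ^ l * ofReal (M ^ (l * (d + 1))) * ∏ j, F l j ζ₀ ^ (1 / d : ℝ) := by
  have hd0 : (0 : ℝ) < d := by exact_mod_cast hd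
  have hp : (0 : ℝ) ≤ 1 / d := by positivity
  set a : ℝ≥0∞ := (C ^ (1 / d : ℝ)) ^ (d + 1) with ha
  have hat : a ≠ ⊤ := by
    have : C ^ (1 / d : ℝ) ≠ ⊤ := ENNReal.rpow_ne_top_of_nonneg hp hC
    finiteness
  set B : ℝ≥0∞ := (d + 1) ^ ((d + 1) / d : ℝ) * ofReal (ν⁻¹) ^ (1 / d : ℝ) with hB
  have hBt : B ≠ ⊤ := by
    refine ENNReal.mul_ne_top (ENNReal.rpow_ne_top_of_nonneg (by positivity) (by finiteness))
      (ENNReal.rpow_ne_top_of_nonneg hp (by finiteness))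
  refine ⟨2 ^ (d + 1) * a + a * B * a, by finiteness, ?_⟩
  set C1 := 2 ^ (d + 1) * a + a * B * a with hC1
  intro M hM v hv hdet L F hFm hFt h1 h2 h3 l hl
  have hM0 : 0 < M := by linarith
  have hcard : Fintype.card (Fin (d + 1)) = d + 1 := by simp
  induction l, hl using Nat.le_induction with
  | base =>
    intro _ ζ₀
    calc _ ≤ ∫⁻ ζ in closedBall ζ₀ (M ^ 1), a * ∏ j, F 1 j ζ₀ ^ (1 / d : ℝ) := by
          refine setLIntegral_mono' measurableSet_closedBall fun ζ hζ => ?_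
          have hpr := prod_mul_rpow C (fun j => F 1 j ζ₀) hp
          rw [hcard] at hpr
          rw [ha, ← hpr]
          refine Finset.prod_le_prod' fun j _ => ENNReal.rpow_le_rpow (h3 j ζ ζ₀ ?_) hp
          simpa using hζ
      _ = 2 ^ (d + 1) * a * ofReal (M ^ (1 * (d + 1))) * ∏ j, F 1 j ζ₀ ^ (1 / d : ℝ) := by
          rw [setLIntegral_const, Real.volume_pi_closedBall _ (by positivity)]
          simp only [Fintype.card_fin, pow_one, one_mul]
          rw [mul_pow, ENNReal.ofReal_mul (by positivity), ENNReal.ofReal_pow (by norm_num)]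
          simp only [ENNReal.ofReal_ofNat]
          ring
      _ ≤ _ := by
          rw [pow_one]
          gcongr
          exact le_self_add
  | succ l hl ih =>
    intro hlL ζ₀
    have hlL' : l < L := by omega
    have ih' := ih (by omega)
    have hMl : M ^ l ≤ M ^ (l + 1) := pow_le_pow_right₀ hM (by omega)
    have hMl0 : 0 < M ^ l := by positivity
    set g : (Fin (d + 1) → ℝ) → ℝ≥0∞ := fun ζ => ∏ j, F 1 j ζ ^ (1 / d : ℝ) with hg
    have hgm : Measurable g := by fun_prop
    have havg := setLIntegral_le_avg (μ := (volume : Measure (Fin (d + 1) → ℝ)))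
      (ν := (volume : Measure (Fin (d + 1) → ℝ))) hgm (ι := id) measurable_id
      (K := closedBall 0 (M ^ l)) measurableSet_closedBall (r := M ^ l) (by simp) ζ₀ (M ^ (l + 1))
    have hstep : ∫⁻ ζ in closedBall ζ₀ (M ^ (l + 1)), g ζ ≤
        C1 ^ l * ∫⁻ ζ in closedBall ζ₀ (2 * M ^ (l + 1)), ∏ j, F l j ζ ^ (1 / d : ℝ) := by
      set Mv := ofReal (M ^ (l * (d + 1))) with hMv
      have hMv0 : Mv ≠ 0 := by
        rw [← pos_iff_ne_zero, hMv, ENNReal.ofReal_pos]; positivity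
      have hvol : Mv ≤ volume (closedBall (0 : Fin (d + 1) → ℝ) (M ^ l)) := by
        rw [Real.volume_pi_closedBall _ (by positivity)]
        apply ENNReal.ofReal_le_ofReal
        rw [hcard, pow_mul]
        exact pow_le_pow_left₀ (by positivity) (by linarith) _
      rw [← ENNReal.mul_le_mul_iff_right hMv0 (by finiteness)]
      calc Mv * ∫⁻ ζ in closedBall ζ₀ (M ^ (l + 1)), g ζ
          ≤ volume (closedBall (0 : Fin (d + 1) → ℝ) (M ^ l)) *
            ∫⁻ ζ in closedBall ζ₀ (M ^ (l + 1)), g ζ := mul_le_mul_left hvol _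
        _ ≤ _ := havg
        _ = ∫⁻ ζ in closedBall ζ₀ (M ^ (l + 1) + M ^ l), ∫⁻ y in closedBall ζ (M ^ l), g y := by
            refine lintegral_congr fun ζ => ?_
            have := setLIntegral_add_right (μ := (volume : Measure (Fin (d + 1) → ℝ))) g ζ 0 (M ^ l)
            rw [zero_add] at this
            rw [← this]
            refine lintegral_congr fun y => by rw [id, add_comm]
        _ ≤ ∫⁻ ζ in closedBall ζ₀ (M ^ (l + 1) + M ^ l), C1 ^ l * Mv * ∏ j, F l j ζ ^ (1 / d : ℝ) :=
            lintegral_mono fun ζ => ih' ζ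
        _ ≤ ∫⁻ ζ in closedBall ζ₀ (2 * M ^ (l + 1)), C1 ^ l * Mv * ∏ j, F l j ζ ^ (1 / d : ℝ) :=
            lintegral_mono_set (closedBall_subset_closedBall (by linarith))
        _ = _ := by
            rw [lintegral_const_mul' _ _ (by finiteness)]
            ring
    set G : Fin (d + 1) → (Fin d → ℝ) → ℝ≥0∞ := fun j =>
      (closedBall (0 : Fin d → ℝ) (2 * (1 + V) * M ^ (l + 1))).indicator
        fun y => F l j (ζ₀ + (Fin.snoc y 0 : Fin (d + 1) → ℝ)) with hG
    have hsnoc : Measurable fun y : Fin d → ℝ => (Fin.snoc y 0 : Fin (d + 1) → ℝ) := by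
      rw [measurable_pi_iff]
      intro i
      refine Fin.lastCases ?_ (fun k => ?_) i
      · simp
      · simp only [Fin.snoc_castSucc]; fun_prop
    have hGm : ∀ j, Measurable (G j) := fun j =>
      ((hFm l j).comp (hsnoc.const_add ζ₀)).indicator measurableSet_closedBall
    have hGint : ∀ j, ∫⁻ y, G j y ≤ C * ofReal (M ^ ((l + 1) * d)) * F (l + 1) j ζ₀ := by
      intro j
      rw [hG, lintegral_indicator measurableSet_closedBall]
      exact h2 l hl hlL' j ζ₀
    have hGt : ∀ j, ∫⁻ y, G j y ≠ ⊤ := fun j =>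
      ne_top_of_le_ne_top (ENNReal.mul_ne_top (by finiteness) (hFt _ _ _)) (hGint j)
    have hdet0 : (vmat v).det ≠ 0 := by
      intro h0; rw [h0, abs_zero] at hdet; linarith
    have hLW := lintegral_prod_pull_le hd v hdet0 hGm hGt
    have hle : ∫⁻ ζ in closedBall ζ₀ (2 * M ^ (l + 1)), ∏ j, F l j ζ ^ (1 / d : ℝ) ≤
        a * ∫⁻ z, ∏ j, G j (pull (v j) z) ^ (1 / d : ℝ) := by
      rw [← lintegral_const_mul' _ _ hat, ← lintegral_indicator measurableSet_closedBall,
        ← lintegral_add_right_eq_self _ ζ₀]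
      refine lintegral_mono fun z => ?_
      by_cases hz : z + ζ₀ ∈ closedBall ζ₀ (2 * M ^ (l + 1))
      swap
      · rw [indicator_of_notMem hz]; exact zero_le
      rw [indicator_of_mem hz]
      have hz' : ‖z‖ ≤ 2 * M ^ (l + 1) := by simpa using hz
      have hzi : ∀ i, |z i| ≤ 2 * M ^ (l + 1) := fun i => (norm_le_pi_norm z i).trans hz'
      have hpr := prod_mul_rpow C (fun j => G j (pull (v j) z)) hp
      rw [hcard] at hpr
      rw [ha, ← hpr]
      refine Finset.prod_le_prod' fun j _ => ENNReal.rpow_le_rpow ?_ hp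
      have hmem : pull (v j) z ∈ closedBall (0 : Fin d → ℝ) (2 * (1 + V) * M ^ (l + 1)) := by
        rw [mem_closedBall_zero_iff, pi_norm_le_iff_of_nonneg (by positivity)]
        intro i
        simp only [pull, Real.norm_eq_abs]
        refine (abs_sub _ _).trans ?_
        rw [abs_mul]
        have h5 := mul_le_mul (hzi (Fin.last d)) (hv j i) (abs_nonneg _) (by positivity)
        have h6 := hzi i.castSucc
        nlinarith
      have hGv : G j (pull (v j) z) = F l j (ζ₀ + (Fin.snoc (pull (v j) z) 0 : Fin (d + 1) → ℝ)) := by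
        rw [hG]; exact indicator_of_mem hmem _
      rw [hGv]
      have hz1 : z + ζ₀ = ζ₀ + (Fin.snoc (pull (v j) z) 0 : Fin (d + 1) → ℝ) +
          z (Fin.last d) • (Fin.snoc (v j) 1 : Fin (d + 1) → ℝ) := by
        ext i
        refine Fin.lastCases ?_ (fun k => ?_) i
        · simp [add_comm]
        · simp [pull]; ring
      rw [hz1]
      exact h1 l hl hlL' j _ _ (hzi _)
    set P := ∏ j, F (l + 1) j ζ₀ ^ (1 / d : ℝ) with hP
    have hprod : ∏ j, (∫⁻ y, G j y) ^ (1 / d : ℝ) ≤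
        a * ofReal (M ^ ((l + 1) * (d + 1))) * P := by
      have hpr := prod_mul_rpow (C * ofReal (M ^ ((l + 1) * d)))
        (fun j => F (l + 1) j ζ₀) hp
      rw [hcard, ENNReal.mul_rpow_of_nonneg _ _ hp, mul_pow, ← ha] at hpr
      have hMp : ofReal (M ^ ((l + 1) * d)) ^ (1 / d : ℝ) = ofReal (M ^ (l + 1)) := by
        rw [ENNReal.ofReal_rpow_of_nonneg (by positivity) hp, pow_mul, one_div,
          Real.pow_rpow_inv_natCast (by positivity) (by omega)]
      rw [hMp, ← ENNReal.ofReal_pow (by positivity), ← pow_mul] at hpr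
      rw [hP, ← hpr]
      exact Finset.prod_le_prod' fun j _ => ENNReal.rpow_le_rpow (hGint j) hp
    have hdi : |((vmat v).det)⁻¹| ≤ ν⁻¹ := by
      rw [abs_inv]; exact inv_anti₀ hν hdet
    calc ∫⁻ ζ in closedBall ζ₀ (M ^ (l + 1)), g ζ
        ≤ C1 ^ l * (a * (B * (a * ofReal (M ^ ((l + 1) * (d + 1))) * P))) := by
          refine hstep.trans ?_
          gcongr
          refine hle.trans ?_
          gcongr
          refine hLW.trans ?_
          rw [hB]
          gcongr
      _ = C1 ^ l * (a * B * a) * ofReal (M ^ ((l + 1) * (d + 1))) * P := by ring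
      _ ≤ C1 ^ (l + 1) * ofReal (M ^ ((l + 1) * (d + 1))) * P := by
          rw [pow_succ]
          gcongr
          exact le_add_self

lemma lintegral_pi_prod_le {d : ℕ} {f : Fin d → ℝ → ℝ≥0∞} (hf : ∀ i, Measurable (f i)) :
    ∫⁻ y : Fin d → ℝ, ∏ i, f i (y i) ≤ ∏ i, ∫⁻ s, f i s := by
  induction d with
  | zero => simp [volume_pi]
  | succ d ih =>
    rw [lintegral_snoc (by fun_prop), Fin.prod_univ_castSucc]
    simp_rw [Fin.prod_univ_castSucc, Fin.snoc_castSucc, Fin.snoc_last]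
    calc _ = ∫⁻ s, (∫⁻ y : Fin d → ℝ, ∏ i : Fin d, f i.castSucc (y i)) * f (Fin.last d) s :=
          lintegral_congr fun s => lintegral_mul_const _ (by fun_prop)
      _ = (∫⁻ y : Fin d → ℝ, ∏ i : Fin d, f i.castSucc (y i)) * ∫⁻ s, f (Fin.last d) s :=
          lintegral_const_mul _ (hf _)
      _ ≤ _ := by gcongr; exact ih fun i => hf _

lemma lintegral_inv_one_add_sq_le {r : ℝ} (hr : 0 < r) (a : ℝ) :
    ∫⁻ y : ℝ, ofReal ((1 + (a + y / r) ^ 2)⁻¹) ≤ ofReal (Real.pi * r) := by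
  have e : (fun y : ℝ => (1 + (a + y / r) ^ 2)⁻¹) =
      fun y => (fun x => (1 + x ^ 2)⁻¹) (r⁻¹ * (y + r * a)) := by
    ext y; congr 3; field_simp; ring
  have hi : Integrable fun y : ℝ => (1 + (a + y / r) ^ 2)⁻¹ := by
    rw [e]
    exact (integrable_inv_one_add_sq.comp_mul_left' (inv_ne_zero hr.ne')).comp_add_right (r * a)
  rw [← ofReal_integral_eq_lintegral_ofReal hi (ae_of_all _ fun y => by positivity)]
  apply ENNReal.ofReal_le_ofReal
  rw [e, integral_add_right_eq_self (fun y => (fun x : ℝ => (1 + x ^ 2)⁻¹) (r⁻¹ * y)) (r * a),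
    Measure.integral_comp_mul_left (fun x : ℝ => (1 + x ^ 2)⁻¹), integral_univ_inv_one_add_sq]
  rw [inv_inv, abs_of_pos hr, smul_eq_mul, mul_comm]

lemma kernel_one_dim (D : ℝ) (hD : 0 ≤ D) (N : ℕ) (hN : 1 ≤ N) : ∃ C : ℝ≥0∞, C ≠ ⊤ ∧
    ∀ (M r u : ℝ), 1 ≤ M → 0 < r →
      ∫⁻ y in closedBall (0 : ℝ) (D * (r * M)), ofReal ((1 + (M * u + y / r) ^ 2)⁻¹ ^ N) ≤
        C * ofReal r * ofReal ((1 + u ^ 2)⁻¹ ^ N) := by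
  set E : ℝ := 2 * (1 + D ^ 2) with hE
  have hE0 : 2 ≤ E := by rw [hE]; nlinarith [sq_nonneg D]
  refine ⟨ofReal (E ^ N * (Real.pi + 2 * D)), by finiteness, fun M r u hM hr => ?_⟩
  have hM0 : 0 < M := by linarith
  have key : ∀ y ∈ closedBall (0 : ℝ) (D * (r * M)), ofReal ((1 + (M * u + y / r) ^ 2)⁻¹ ^ N) ≤
      ofReal (E ^ N * (1 + u ^ 2)⁻¹ ^ N) *
        (ofReal ((1 + (M * u + y / r) ^ 2)⁻¹) + ofReal (M ^ 2)⁻¹) := by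
    intro y hy
    rw [← ENNReal.ofReal_add (by positivity) (by positivity), ← ENNReal.ofReal_mul (by positivity)]
    apply ENNReal.ofReal_le_ofReal
    set v := M * u + y / r with hv
    have hs : |y / r| ≤ D * M := by
      have : |y| ≤ D * (r * M) := by simpa using hy
      rw [abs_div, abs_of_pos hr, div_le_iff₀ hr]; linarith
    set s := y / r
    have hs2 : s ^ 2 ≤ D ^ 2 * M ^ 2 := by
      rw [← mul_pow, ← sq_abs]; exact pow_le_pow_left₀ (abs_nonneg _) hs 2
    have hu : u ^ 2 * M ^ 2 ≤ 2 * v ^ 2 + 2 * s ^ 2 := by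
      have : u * M = v - s := by rw [hv]; ring
      rw [← mul_pow, this]; nlinarith [sq_nonneg (v + s)]
    have h1 : 1 + u ^ 2 ≤ E * (1 + v ^ 2) * ((1 + v ^ 2)⁻¹ + (M ^ 2)⁻¹) := by
      have : E * (1 + v ^ 2) * ((1 + v ^ 2)⁻¹ + (M ^ 2)⁻¹) = E + E * (1 + v ^ 2) / M ^ 2 := by
        field_simp
      rw [this, ← sub_le_iff_le_add', le_div_iff₀ (by positivity)]
      have : 0 ≤ D ^ 2 * v ^ 2 := by positivity
      have : 0 ≤ D ^ 2 * M ^ 2 := by positivity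
      have : 0 < M ^ 2 := by positivity
      rw [hE]
      nlinarith
    have h2 : 1 + u ^ 2 ≤ E * (1 + v ^ 2) := by
      have hM2 : 1 ≤ M ^ 2 := one_le_pow₀ hM
      have : u ^ 2 ≤ 2 * v ^ 2 + 2 * D ^ 2 := by
        have h5 : u ^ 2 * M ^ 2 ≤ (2 * v ^ 2 + 2 * D ^ 2) * M ^ 2 := by nlinarith [sq_nonneg v]
        exact le_of_mul_le_mul_right h5 (by positivity)
      rw [hE]; nlinarith [sq_nonneg (D * v)]
    obtain ⟨k, rfl⟩ := Nat.exists_eq_add_of_le' hN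
    have h3 : (1 + u ^ 2) ^ (k + 1) ≤
        E ^ (k + 1) * (1 + v ^ 2) ^ (k + 1) * ((1 + v ^ 2)⁻¹ + (M ^ 2)⁻¹) := by
      calc (1 + u ^ 2) ^ (k + 1) = (1 + u ^ 2) ^ k * (1 + u ^ 2) := pow_succ _ _
        _ ≤ (E * (1 + v ^ 2)) ^ k * (E * (1 + v ^ 2) * ((1 + v ^ 2)⁻¹ + (M ^ 2)⁻¹)) := by
            gcongr
        _ = _ := by rw [mul_pow, pow_succ, pow_succ]; ring
    rw [inv_pow, inv_pow, inv_le_iff_one_le_mul₀ (by positivity)]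
    calc (1 : ℝ) = (1 + u ^ 2) ^ (k + 1) * ((1 + u ^ 2) ^ (k + 1))⁻¹ := by
          rw [mul_inv_cancel₀ (by positivity)]
      _ ≤ (E ^ (k + 1) * (1 + v ^ 2) ^ (k + 1) * ((1 + v ^ 2)⁻¹ + (M ^ 2)⁻¹)) *
          ((1 + u ^ 2) ^ (k + 1))⁻¹ := by gcongr
      _ = _ := by ring
  calc _ ≤ ∫⁻ y in closedBall (0 : ℝ) (D * (r * M)), ofReal (E ^ N * (1 + u ^ 2)⁻¹ ^ N) *
        (ofReal ((1 + (M * u + y / r) ^ 2)⁻¹) + ofReal (M ^ 2)⁻¹) :=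
        setLIntegral_mono' measurableSet_closedBall key
    _ = ofReal (E ^ N * (1 + u ^ 2)⁻¹ ^ N) *
        ((∫⁻ y in closedBall (0 : ℝ) (D * (r * M)), ofReal ((1 + (M * u + y / r) ^ 2)⁻¹)) +
          ofReal (M ^ 2)⁻¹ * volume (closedBall (0 : ℝ) (D * (r * M)))) := by
        rw [lintegral_const_mul' _ _ (by finiteness), lintegral_add_right _ (by fun_prop),
          setLIntegral_const]
    _ ≤ ofReal (E ^ N * (1 + u ^ 2)⁻¹ ^ N) *
        (ofReal (Real.pi * r) + ofReal (2 * D * r)) := by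
        gcongr
        · exact (setLIntegral_le_lintegral _ _).trans (lintegral_inv_one_add_sq_le hr _)
        · rw [Real.volume_closedBall, ← ENNReal.ofReal_mul (by positivity)]
          apply ENNReal.ofReal_le_ofReal
          rw [inv_mul_le_iff₀ (by positivity)]
          have : 0 ≤ 2 * D * r * M := by positivity
          nlinarith
    _ = _ := by
        rw [← ENNReal.ofReal_add (by positivity) (by positivity), ← ENNReal.ofReal_mul (by positivity),
          ← ENNReal.ofReal_mul (by positivity), ← ENNReal.ofReal_mul (by positivity)]
        congr 1; ring

/-- The vector with first `d` coordinates `y` in the basis `b`. -/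
noncomputable def pad (n : ℕ) {d : ℕ} (y : Fin d → ℝ) : Euc n :=
  WithLp.toLp 2 fun i => if h : i.val < d then y ⟨i, h⟩ else 0

/-- Scales equal to `r` in the first `d` directions, and `R` in the others. -/
def scl (n d : ℕ) (r R : ℝ) (i : Fin n) : ℝ := if i.val < d then r else R

lemma measurable_pad (n : ℕ) {d : ℕ} : Measurable (pad n (d := d)) := by
  unfold pad
  refine (by fun_prop : Measurable (WithLp.toLp 2 : (Fin n → ℝ) → Euc n)).comp ?_
  rw [measurable_pi_iff]
  intro i
  by_cases h : i.val < d <;> (simp only [h, dite_true, dite_false]; fun_prop)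

lemma kernel_pad {n d : ℕ} (hd : d ≤ n) (D : ℝ) (hD : 0 ≤ D) (N : ℕ) (hN : 1 ≤ N) :
    ∃ C : ℝ≥0∞, C ≠ ⊤ ∧ ∀ (M r : ℝ) (u : Euc n), 1 ≤ M → 0 < r →
      ∫⁻ y in closedBall (0 : Fin d → ℝ) (D * (r * M)),
        phi N (WithLp.toLp 2 (fun i => scl n d M 1 i * u i) + r⁻¹ • pad n y) ≤
          C * ofReal (r ^ d) * phi N u := by
  obtain ⟨e, rfl⟩ := Nat.exists_eq_add_of_le hd
  obtain ⟨C, hC, H⟩ := kernel_one_dim D hD N hN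
  refine ⟨C ^ d, by finiteness, fun M r u hM hr => ?_⟩
  have hB : 0 ≤ D * (r * M) := by positivity
  have e1 : ∀ y : Fin d → ℝ, phi N (WithLp.toLp 2 (fun i => scl (d + e) d M 1 i * u i) +
      r⁻¹ • pad (d + e) y) =
      (∏ i : Fin d, ofReal ((1 + (M * u (Fin.castAdd e i) + y i / r) ^ 2)⁻¹ ^ N)) *
      ∏ i : Fin e, ofReal ((1 + u (Fin.natAdd d i) ^ 2)⁻¹ ^ N) := by
    intro y
    rw [phi, wt, Fin.prod_univ_add, ← ENNReal.ofReal_prod_of_nonneg (fun i _ => by positivity),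
      ← ENNReal.ofReal_prod_of_nonneg (fun i _ => by positivity), ← ENNReal.ofReal_mul (by positivity)]
    congr 1
    simp only [inv_pow, Finset.prod_inv_distrib, Finset.prod_pow, mul_pow, mul_inv]
    congr 3
    · refine Finset.prod_congr rfl fun i _ => ?_
      simp [pad, scl, div_eq_inv_mul]
    · simp [pad, scl]
  have e2 : phi N u = (∏ i : Fin d, ofReal ((1 + u (Fin.castAdd e i) ^ 2)⁻¹ ^ N)) *
      ∏ i : Fin e, ofReal ((1 + u (Fin.natAdd d i) ^ 2)⁻¹ ^ N) := by
    rw [phi, wt, Fin.prod_univ_add, ← ENNReal.ofReal_prod_of_nonneg (fun i _ => by positivity),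
      ← ENNReal.ofReal_prod_of_nonneg (fun i _ => by positivity), ← ENNReal.ofReal_mul (by positivity)]
    congr 1
    simp only [inv_pow, Finset.prod_inv_distrib, Finset.prod_pow, mul_pow, mul_inv]
  simp_rw [e1]
  rw [lintegral_mul_const _ (by fun_prop), e2, ← mul_assoc (C ^ d * _)]
  refine mul_le_mul' ?_ le_rfl
  calc ∫⁻ y in closedBall (0 : Fin d → ℝ) (D * (r * M)),
        ∏ i : Fin d, ofReal ((1 + (M * u (Fin.castAdd e i) + y i / r) ^ 2)⁻¹ ^ N)
      ≤ ∫⁻ y : Fin d → ℝ, ∏ i : Fin d, (closedBall (0 : ℝ) (D * (r * M))).indicator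
          (fun s => ofReal ((1 + (M * u (Fin.castAdd e i) + s / r) ^ 2)⁻¹ ^ N)) (y i) := by
        rw [← lintegral_indicator measurableSet_closedBall]
        refine lintegral_mono fun y => ?_
        by_cases hy : y ∈ closedBall (0 : Fin d → ℝ) (D * (r * M))
        swap
        · rw [indicator_of_notMem hy]; exact zero_le
        rw [indicator_of_mem hy]
        refine Finset.prod_le_prod' fun i _ => ?_
        rw [indicator_of_mem]
        rw [closedBall_pi _ hB] at hy
        exact hy i (mem_univ i)
    _ ≤ ∏ i : Fin d, ∫⁻ s, (closedBall (0 : ℝ) (D * (r * M))).indicator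
          (fun s => ofReal ((1 + (M * u (Fin.castAdd e i) + s / r) ^ 2)⁻¹ ^ N)) s :=
        lintegral_pi_prod_le fun i => Measurable.indicator (by fun_prop) measurableSet_closedBall
    _ ≤ ∏ i : Fin d, (C * ofReal r * ofReal ((1 + u (Fin.castAdd e i) ^ 2)⁻¹ ^ N)) := by
        refine Finset.prod_le_prod' fun i _ => ?_
        rw [lintegral_indicator measurableSet_closedBall]
        exact H M r _ hM hr
    _ = _ := by
        rw [Finset.prod_mul_distrib, Finset.prod_const, Finset.card_univ, Fintype.card_fin, mul_pow,
          ENNReal.ofReal_pow hr.le]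

lemma lintegral_scl {n d : ℕ} (hd : d ≤ n) {M : ℝ} (hM : 0 < M) {f : Euc n → ℝ≥0∞}
    (hf : Measurable f) :
    ∫⁻ u, f u = ofReal (M ^ d) * ∫⁻ u : Euc n, f (WithLp.toLp 2 fun i => scl n d M 1 i * u i) := by
  have hD : (Matrix.diagonal (scl n d M 1)).det = M ^ d := by
    obtain ⟨e, rfl⟩ := Nat.exists_eq_add_of_le hd
    rw [Matrix.det_diagonal, Fin.prod_univ_add]
    simp [scl]
  have h0 : (Matrix.diagonal (scl n d M 1)).det ≠ 0 := by rw [hD]; positivity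
  have hv := EuclideanSpace.volume_preserving_symm_measurableEquiv_toLp (Fin n)
  have h1 : ∀ g : Euc n → ℝ≥0∞, ∫⁻ u, g u = ∫⁻ v : Fin n → ℝ, g (WithLp.toLp 2 v) := fun g =>
    (hv.symm.lintegral_comp_emb (MeasurableEquiv.measurableEmbedding _) g).symm
  have h2 := lintegral_comp_mulVec h0
    (hf.comp (by fun_prop : Measurable (WithLp.toLp 2 : (Fin n → ℝ) → Euc n)))
  rw [h1, h1, hD] at *
  simp only [Function.comp_def] at h2
  have h3 : ∀ v : Fin n → ℝ, (Matrix.diagonal (scl n d M 1)).mulVec v = fun i => scl n d M 1 i * v i := by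
    intro v; ext i; rw [Matrix.mulVec_diagonal]
  simp_rw [h3] at h2
  rw [h2, ← mul_assoc, ← ENNReal.ofReal_mul (by positivity), abs_of_pos (by positivity),
    mul_inv_cancel₀ (by positivity), ENNReal.ofReal_one, one_mul]

lemma sc_scl {n d : ℕ} (b : ONB n) (M r R : ℝ) (u : Euc n) :
    sc b (scl n d r R) (WithLp.toLp 2 fun i => scl n d M 1 i * u i) = sc b (scl n d (r * M) R) u := by
  unfold sc
  refine Finset.sum_congr rfl fun i _ => ?_
  by_cases h : i.val < d <;> simp [scl, h, mul_assoc]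

lemma sc_pad {n d : ℕ} (b : ONB n) {r : ℝ} (hr : r ≠ 0) (R : ℝ)
    (y : Fin d → ℝ) : sc b (scl n d r R) (r⁻¹ • pad n y) = sc b (fun _ => 1) (pad n y) := by
  unfold sc
  refine Finset.sum_congr rfl fun i _ => ?_
  by_cases h : i.val < d <;> simp [scl, pad, h, hr]

lemma en_average {n d : ℕ} (hd : d ≤ n) (D : ℝ) (hD : 0 ≤ D) (N : ℕ) (hN : 1 ≤ N) :
    ∃ C : ℝ≥0∞, C ≠ ⊤ ∧ ∀ (b : ONB n) (M r R : ℝ) (h : Euc n → ℂ)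
      (x : Euc n) (t : ℝ), 1 ≤ M → 0 < r → Nice h →
      ∫⁻ y in closedBall (0 : Fin d → ℝ) (D * (r * M)),
        en b (scl n d r R) N h (x + sc b (fun _ => 1) (pad n y)) t ≤
          C * ofReal ((r * M) ^ d) * en b (scl n d (r * M) R) N h x t := by
  obtain ⟨C, hC, H⟩ := kernel_pad hd D hD N hN
  refine ⟨C, hC, fun b M r R h x t hM hr hh => ?_⟩
  have hm : Measurable fun u : Euc n => ‖evol h (x - sc b (scl n d r R) u) t‖ₑ ^ 2 :=
    (measurable_enorm_evol_comp hh (by fun_prop) measurable_const).pow_const 2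
  have hφ := measurable_phi (n := n) N
  have hp := measurable_pad n (d := d)
  have e1 : ∀ y : Fin d → ℝ, en b (scl n d r R) N h (x + sc b (fun _ => 1) (pad n y)) t =
      ∫⁻ u, ‖evol h (x - sc b (scl n d r R) u) t‖ₑ ^ 2 * phi N (u + r⁻¹ • pad n y) := by
    intro y
    rw [en, ← lintegral_add_right_eq_self _ (r⁻¹ • pad n y)]
    refine lintegral_congr fun u => ?_
    rw [sc_add, sc_pad b hr.ne']
    congr 4
    abel
  simp_rw [e1]
  have hm2 : Measurable fun p : (Fin d → ℝ) × Euc n =>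
      ‖evol h (x - sc b (scl n d r R) p.2) t‖ₑ ^ 2 * phi N (p.2 + r⁻¹ • pad n p.1) := by
    refine (hm.comp measurable_snd).mul (hφ.comp ?_)
    exact measurable_snd.add ((hp.comp measurable_fst).const_smul r⁻¹)
  rw [lintegral_lintegral_swap hm2.aemeasurable]
  have hm3 : Measurable fun u : Euc n => ∫⁻ y in closedBall (0 : Fin d → ℝ) (D * (r * M)),
      phi N (u + r⁻¹ • pad n y) := by
    refine Measurable.lintegral_prod_right' (f := fun q : Euc n × (Fin d → ℝ) =>
      phi N (q.1 + r⁻¹ • pad n q.2)) (hφ.comp ?_)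
    exact measurable_fst.add ((hp.comp measurable_snd).const_smul r⁻¹)
  calc _ = ∫⁻ u, ‖evol h (x - sc b (scl n d r R) u) t‖ₑ ^ 2 *
        ∫⁻ y in closedBall (0 : Fin d → ℝ) (D * (r * M)), phi N (u + r⁻¹ • pad n y) := by
        refine lintegral_congr fun u => ?_
        rw [lintegral_const_mul' _ _ (by finiteness)]
    _ = ofReal (M ^ d) * ∫⁻ u, ‖evol h (x - sc b (scl n d (r * M) R) u) t‖ₑ ^ 2 *
        ∫⁻ y in closedBall (0 : Fin d → ℝ) (D * (r * M)),
          phi N (WithLp.toLp 2 (fun i => scl n d M 1 i * u i) + r⁻¹ • pad n y) := by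
        have h5 := lintegral_scl hd (by linarith : 0 < M) (hm.mul hm3)
        simp only [Pi.mul_apply, sc_scl] at h5
        exact h5
    _ ≤ ofReal (M ^ d) * ∫⁻ u, (C * ofReal (r ^ d)) *
        (‖evol h (x - sc b (scl n d (r * M) R) u) t‖ₑ ^ 2 * phi N u) := by
        refine mul_le_mul' le_rfl (lintegral_mono fun u => ?_)
        refine (mul_le_mul' le_rfl (H M r u hM hr)).trans (le_of_eq ?_)
        ring
    _ = _ := by
        rw [lintegral_const_mul' _ _ (by finiteness), en, mul_pow, ENNReal.ofReal_mul (by positivity)]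
        ring

lemma measurable_en {n : ℕ} (b : ONB n) (ρ : Fin n → ℝ) (N : ℕ)
    {h : Euc n → ℂ} (hh : Nice h) : Measurable fun z : Euc n × ℝ => en b ρ N h z.1 z.2 := by
  unfold en
  refine Measurable.lintegral_prod_right' (f := fun q : (Euc n × ℝ) × Euc n =>
    ‖evol h (q.1.1 - sc b ρ q.2) q.1.2‖ₑ ^ 2 * phi N q.2) ?_
  exact ((measurable_enorm_evol_comp hh (by fun_prop) (by fun_prop)).pow_const 2).mul
    ((measurable_phi N).comp measurable_snd)

lemma en_ne_top {n : ℕ} (b : ONB n) (ρ : Fin n → ℝ) {N : ℕ}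
    (hN : n < N) (h : Euc n → ℂ) (x : Euc n) (t : ℝ) : en b ρ N h x t ≠ ⊤ := by
  set B := ofReal (∫ ξ, ‖h ξ‖) with hB
  have h1 : en b ρ N h x t ≤ ∫⁻ y : Euc n, B ^ 2 * phi N y := by
    refine lintegral_mono fun y => ?_
    gcongr
    rw [← ofReal_norm]
    exact ENNReal.ofReal_le_ofReal (norm_evol_le _ _)
  refine ne_top_of_le_ne_top ?_ h1
  rw [lintegral_const_mul' _ _ (by finiteness)]
  exact ENNReal.mul_ne_top (by finiteness) (lintegral_phi_lt_top hN).ne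

lemma pad_add (n : ℕ) {d : ℕ} (y z : Fin d → ℝ) : pad n (y + z) = pad n y + pad n z := by
  ext i
  by_cases h : i.val < d <;> simp [pad, h]

lemma pad_smul (n : ℕ) {d : ℕ} (a : ℝ) (y : Fin d → ℝ) : pad n (a • y) = a • pad n y := by
  ext i
  by_cases h : i.val < d <;> simp [pad, h]

lemma sc_smul {n : ℕ} (b : ONB n) (ρ : Fin n → ℝ) (a : ℝ) (y : Euc n) :
    sc b ρ (a • y) = a • sc b ρ y := by
  unfold sc
  rw [Finset.smul_sum]
  refine Finset.sum_congr rfl fun i _ => ?_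
  rw [smul_smul]; congr 1; simp; ring

lemma norm_sc_pad_le {n d : ℕ} (b : ONB n) (y : Fin d → ℝ) :
    ‖sc b (fun _ => 1) (pad n y)‖ ≤ n * ‖y‖ := by
  unfold sc
  refine (norm_sum_le _ _).trans ?_
  calc _ ≤ ∑ i : Fin n, ‖y‖ := by
        refine Finset.sum_le_sum fun i _ => ?_
        rw [norm_smul, b.norm_eq_one, mul_one, one_mul]
        by_cases h : i.val < d
        · simpa [pad, h] using norm_le_pi_norm y ⟨i, h⟩
        · simp [pad, h]
    _ = n * ‖y‖ := by simp

/-- The moving frame spanned by the first `d` basis vectors and time, with normal velocity `2q`. -/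
noncomputable def frm {n : ℕ} (d : ℕ) (b : ONB n) (q : Euc n)
    (ζ : Fin (d + 1) → ℝ) : Euc n × ℝ :=
  (sc b (fun _ => 1) (pad n (fun i : Fin d => ζ i.castSucc)) + (2 * ζ (Fin.last d)) • q, ζ (Fin.last d))

lemma measurable_frm {n : ℕ} (d : ℕ) (b : ONB n) (q : Euc n) :
    Measurable (frm d b q) := by
  unfold frm
  have hp := measurable_pad n (d := d)
  refine Measurable.prodMk (Measurable.add ?_ (by fun_prop)) (by fun_prop)
  exact (measurable_sc b _).comp (hp.comp (by fun_prop))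

lemma frm_add {n : ℕ} (d : ℕ) (b : ONB n) (q : Euc n)
    (ζ ζ' : Fin (d + 1) → ℝ) : frm d b q (ζ + ζ') = frm d b q ζ + frm d b q ζ' := by
  have h : (fun i : Fin d => (ζ + ζ') i.castSucc) =
    (fun i : Fin d => ζ i.castSucc) + fun i : Fin d => ζ' i.castSucc := rfl
  unfold frm
  rw [h, pad_add, sc_add]
  ext1
  · simp only [Prod.fst_add, Pi.add_apply]
    rw [mul_add, add_smul]; abel
  · simp

lemma norm_frm_le {n : ℕ} (d : ℕ) (b : ONB n) (q : Euc n)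
    (ζ : Fin (d + 1) → ℝ) : ‖frm d b q ζ‖ ≤ (n + 2 * ‖q‖ + 1) * ‖ζ‖ := by
  have h1 : |ζ (Fin.last d)| ≤ ‖ζ‖ := norm_le_pi_norm ζ _
  have h2 : ‖fun i : Fin d => ζ i.castSucc‖ ≤ ‖ζ‖ :=
    (pi_norm_le_iff_of_nonneg (norm_nonneg _)).2 fun i => norm_le_pi_norm ζ _
  have h3 := norm_nonneg ζ
  have h4 := norm_nonneg q
  rw [Prod.norm_def]
  refine max_le ((norm_add_le _ _).trans ?_) ?_
  · refine (add_le_add (norm_sc_pad_le b _) (norm_smul_le _ _)).trans ?_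
    rw [Real.norm_eq_abs, abs_mul, abs_two]
    have : (n : ℝ) * ‖fun i : Fin d => ζ i.castSucc‖ ≤ n * ‖ζ‖ := by gcongr
    have : 2 * |ζ (Fin.last d)| * ‖q‖ ≤ 2 * ‖ζ‖ * ‖q‖ := by gcongr
    nlinarith
  · refine h1.trans ?_
    have : 0 ≤ (n + 2 * ‖q‖) * ‖ζ‖ := by positivity
    linarith

/-- The tangential and normal parts of a vector. -/
lemma sc_pad_add {n d : ℕ} (hd : d ≤ n) (b : ONB n) {c q : Euc n}
    (hq : ∀ i : Fin n, i.val < d → ⟪b i, q⟫_ℝ = 0)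
    (hc : ∀ i : Fin n, d ≤ i.val → ⟪b i, c⟫_ℝ = ⟪b i, q⟫_ℝ) :
    sc b (fun _ => 1) (pad n (fun i : Fin d => 2 * ⟪b (Fin.castLE hd i), c⟫_ℝ)) + (2 : ℝ) • q =
      (2 : ℝ) • c := by
  refine b.repr.injective ?_
  ext i
  rw [b.repr_apply_apply, b.repr_apply_apply, inner_add_right, inner_basis_sc, inner_smul_right,
    inner_smul_right]
  by_cases h : i.val < d
  · have : Fin.castLE hd ⟨i, h⟩ = i := rfl
    simp [pad, h, hq i h]
  · simp [pad, h, hc i (by omega)]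

/-- Multilinear estimate for transversal wave packets, with factors concentrated near a plane. -/
theorem multilinear_energy {n d : ℕ} (hd : 1 ≤ d) (hdn : d ≤ n) {N : ℕ} (hN : n < N) {A ν : ℝ}
    (hA : 0 ≤ A) (hν : 0 < ν) : ∃ C1 : ℝ≥0∞, C1 ≠ ⊤ ∧ ∀ (M : ℝ) (L : ℕ), 1 ≤ M → 1 ≤ L →
    ∀ (b : ONB n) (q : Euc n) (c : Fin (d + 1) → Euc n)
      (h : Fin (d + 1) → Euc n → ℂ),
      (∀ j i, |⟪b i, c j⟫_ℝ| ≤ A) →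
      (∀ i : Fin n, i.val < d → ⟪b i, q⟫_ℝ = 0) →
      (∀ i : Fin n, d ≤ i.val → ∀ j, ⟪b i, c j⟫_ℝ = ⟪b i, q⟫_ℝ) →
      ν ≤ |(vmat fun j i => 2 * ⟪b (Fin.castLE hdn i), c j⟫_ℝ).det| →
      (∀ j, Nice (h j)) →
      (∀ j ξ, h j ξ ≠ 0 → ∀ i, |⟪b i, ξ - c j⟫_ℝ| ≤ scl n d (A / M) (A / M ^ L) i) →
      ∀ z : Euc n × ℝ,
      ∫⁻ ζ in closedBall (0 : Fin (d + 1) → ℝ) (M ^ L),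
        ∏ j, en b (scl n d M (M ^ L)) N (h j) (z + frm d b q ζ).1 (z + frm d b q ζ).2 ^ (1 / d : ℝ) ≤
        C1 ^ L * ofReal (M ^ (L * (d + 1))) *
          ∏ j, en b (fun _ => M ^ L) N (h j) z.1 z.2 ^ (1 / d : ℝ) := by
  obtain ⟨Ct, hCt, Ht⟩ := en_transport n (2 * (A + 1)) N
  obtain ⟨Cs, hCs, Hs⟩ := en_shift_bdd n (1 + 2 * A) N
  obtain ⟨Ca, hCa, Ha⟩ := en_average hdn (2 * (1 + 2 * A)) (by positivity) N (by omega)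
  set C := Ct + Ca + Cs * Ct with hC
  obtain ⟨C1, hC1, H⟩ := multiscale_transversal hd C (by finiteness) (V := 2 * A) (by positivity) hν
  refine ⟨C1, hC1, fun M L hM hL b q c h hcA hq hcq hdet hh hsupp z => ?_⟩
  have hM0 : 0 < M := by linarith
  set v : Fin (d + 1) → Fin d → ℝ := fun j i => 2 * ⟪b (Fin.castLE hdn i), c j⟫_ℝ with hv
  have hvA : ∀ j i, |v j i| ≤ 2 * A := by
    intro j i
    rw [hv]; simp only [abs_mul, abs_two]
    linarith [hcA j (Fin.castLE hdn i)]
  have hvel : ∀ j (s : ℝ), frm d b q (s • (Fin.snoc (v j) 1 : Fin (d + 1) → ℝ)) = ((2 * s) • c j, s) := by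
    intro j s
    have h5 := sc_pad_add hdn b hq (fun i hi => hcq i hi j)
    unfold frm
    ext1
    · have : (fun i : Fin d => (s • (Fin.snoc (v j) 1 : Fin (d + 1) → ℝ)) i.castSucc) = s • v j := by
        ext i; simp
      have hl : (s • (Fin.snoc (v j) 1 : Fin (d + 1) → ℝ)) (Fin.last d) = s := by simp
      simp only [this, pad_smul, sc_smul, hl]
      rw [mul_comm 2 s, ← smul_smul, ← smul_smul, ← h5, smul_add]
    · simp
  set F : ℕ → Fin (d + 1) → (Fin (d + 1) → ℝ) → ℝ≥0∞ := fun l j ζ =>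
    en b (scl n d (M ^ l) (M ^ L)) N (h j) (z + frm d b q ζ).1 (z + frm d b q ζ).2 with hF
  have hscl0 : ∀ l i, 0 < scl n d (M ^ l) (M ^ L) i := by
    intro l i; unfold scl; split_ifs <;> positivity
  have htr : ∀ l, ∀ j ζ, ∀ s : ℝ, (1 ≤ l) → l ≤ L → |s| ≤ 2 * M ^ (2 * l) → |s| ≤ 2 * M ^ (l + 1) →
      |s| ≤ 2 * M ^ (L + L) →
      |s| ≤ 2 * M ^ L → F l j (ζ + s • (Fin.snoc (v j) 1 : Fin (d + 1) → ℝ)) ≤ Ct * F l j ζ := by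
    intro l j ζ s hl hlL h1 h2 h3 h4
    rw [hF]
    simp only
    rw [frm_add, hvel, ← add_assoc]
    set w := z + frm d b q ζ
    have e1 : (w + ((2 * s) • c j, s)).1 = w.1 + (2 * ((w.2 + s) - w.2)) • c j := by simp
    have e2 : (w + ((2 * s) • c j, s)).2 = w.2 + s := rfl
    rw [e1, e2]
    refine Ht b _ _ (c j) (h j) (hscl0 l) (hh j) (hsupp j) w.1 (w.2 + s) w.2 ?_ ?_
    · intro i
      rw [add_sub_cancel_left]
      unfold scl
      split_ifs
      · rw [← pow_mul, mul_comm l]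
        have : 0 < M ^ (2 * l) := by positivity
        nlinarith
      · rw [← pow_mul, mul_two]
        have : 0 < M ^ (L + L) := by positivity
        nlinarith
    · intro i
      rw [add_sub_cancel_left]
      unfold scl
      split_ifs
      · have : 0 < M ^ l := by positivity
        calc |s| * (A / M) ≤ 2 * M ^ (l + 1) * (A / M) := by gcongr
          _ = 2 * A * M ^ l := by rw [pow_succ]; field_simp
          _ ≤ _ := by nlinarith
      · have : 1 ≤ M ^ L := one_le_pow₀ hM
        calc |s| * (A / M ^ L) ≤ 2 * M ^ L * (A / M ^ L) := by gcongr
          _ = 2 * A := by field_simp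
          _ ≤ _ := by nlinarith
  have hmono : ∀ {p q : ℕ}, p ≤ q → M ^ p ≤ M ^ q := fun hpq => pow_le_pow_right₀ hM hpq
  have hres := H M hM v hvA hdet L F ?_ ?_ ?_ ?_ ?_ L hL le_rfl 0
  · have e1 : ∀ j ζ, F 1 j ζ = en b (scl n d M (M ^ L)) N (h j) (z + frm d b q ζ).1 (z + frm d b q ζ).2 := by
      intro j ζ; rw [hF]; simp only [pow_one]
    have e2 : ∀ j, F L j 0 = en b (fun _ => M ^ L) N (h j) z.1 z.2 := by
      intro j
      rw [hF]
      have h0 : frm d b q 0 = 0 := by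
        have := frm_add d b q 0 0
        simpa using this
      simp only [h0, add_zero]
      congr
      ext i; unfold scl; split_ifs <;> rfl
    simp_rw [e1, e2] at hres
    exact hres
  · intro l j
    exact (measurable_en b _ N (hh j)).comp ((measurable_frm d b q).const_add z)
  · intro l j ζ
    exact en_ne_top _ _ hN _ _ _
  · intro l hl hlL j ζ s hs
    refine (htr l j ζ s hl hlL.le (hs.trans ?_) hs (hs.trans ?_) (hs.trans ?_)).trans ?_
    · have := hmono (show l + 1 ≤ 2 * l by omega); linarith
    · have := hmono (show l + 1 ≤ L + L by omega); linarith
    · have := hmono (show l + 1 ≤ L by omega); linarith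
    · gcongr; rw [hC, add_assoc]; exact le_self_add
  · intro l hl hlL j ζ
    have h5 := Ha b M (M ^ l) (M ^ L) (h j) (z + frm d b q ζ).1 (z + frm d b q ζ).2 hM (by positivity) (hh j)
    rw [← pow_succ] at h5
    have h6 : ∀ y : Fin d → ℝ, F l j (ζ + (Fin.snoc y 0 : Fin (d + 1) → ℝ)) =
        en b (scl n d (M ^ l) (M ^ L)) N (h j)
          ((z + frm d b q ζ).1 + sc b (fun _ => 1) (pad n y)) (z + frm d b q ζ).2 := by
      intro y
      rw [hF]
      simp only
      rw [frm_add, ← add_assoc]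
      have : frm d b q (Fin.snoc y 0 : Fin (d + 1) → ℝ) = (sc b (fun _ => 1) (pad n y), 0) := by
        unfold frm; simp
      rw [this]
      simp
    simp_rw [h6]
    refine (le_of_eq ?_).trans (h5.trans ?_)
    · rfl
    · rw [← pow_mul]
      gcongr
      rw [hC, add_right_comm]; exact le_add_self
  · intro j ζ ζ' hd1
    set s := ζ (Fin.last d) - ζ' (Fin.last d) with hs
    have hcoord : ∀ i, |ζ i - ζ' i| ≤ M := fun i => (dist_le_pi_dist ζ ζ' i).trans hd1
    set y : Fin d → ℝ := fun i => (ζ i.castSucc - ζ' i.castSucc) - s * v j i with hy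
    have hyb : ∀ i, |y i| ≤ M * (1 + 2 * A) := by
      intro i
      rw [hy]
      refine (abs_sub _ _).trans ?_
      rw [abs_mul]
      have h7 := mul_le_mul (hcoord (Fin.last d)) (hvA j i) (abs_nonneg _) hM0.le
      have h8 := hcoord i.castSucc
      linarith
    have hζ : ζ = (ζ' + s • (Fin.snoc (v j) 1 : Fin (d + 1) → ℝ)) + (Fin.snoc y 0 : Fin (d + 1) → ℝ) := by
      ext i
      refine Fin.lastCases ?_ (fun k => ?_) i
      · simp [hs]
      · simp [hy]
    have hs1 : |s| ≤ M := hcoord _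
    have hMM : ∀ p, 1 ≤ p → |s| ≤ 2 * M ^ p := by
      intro p hp
      have := hmono hp
      rw [pow_one] at this
      linarith
    have h9 := htr 1 j ζ' s le_rfl hL (hMM _ (by omega)) (hMM _ (by omega)) (hMM _ (by omega)) (hMM _ hL)
    have h10 : F 1 j ζ ≤ Cs * F 1 j (ζ' + s • (Fin.snoc (v j) 1 : Fin (d + 1) → ℝ)) := by
      rw [hζ, hF]
      simp only
      rw [frm_add, ← add_assoc]
      set w := z + frm d b q (ζ' + s • (Fin.snoc (v j) 1 : Fin (d + 1) → ℝ))
      have : frm d b q (Fin.snoc y 0 : Fin (d + 1) → ℝ) = (sc b (fun _ => 1) (pad n y), 0) := by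
        unfold frm; simp
      rw [this, ← sc_pad b (pow_pos hM0 1).ne' (M ^ L)]
      have e1 : ∀ u : Euc n, (w + (u, 0)).1 = w.1 + u := fun u => rfl
      have e2 : ∀ u : Euc n, (w + (u, 0)).2 = w.2 := fun u => add_zero _
      rw [e1, e2]
      refine Hs b _ (h j) (hh j) _ _ _ fun i => ?_
      by_cases hi : i.val < d
      · simp only [pad, hi, PiLp.smul_apply, smul_eq_mul, dite_true, abs_mul, pow_one]
        rw [abs_of_pos (by positivity), inv_mul_le_iff₀ hM0]
        exact hyb _
      · simp only [pad, hi, PiLp.smul_apply, smul_eq_mul, dite_false, mul_zero, abs_zero]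
        positivity
    calc F 1 j ζ ≤ Cs * (Ct * F 1 j ζ') := h10.trans (by gcongr)
      _ = Cs * Ct * F 1 j ζ' := by ring
      _ ≤ C * F 1 j ζ' := by gcongr; rw [hC]; exact le_add_self

lemma exists_sup_one_orthogonal {k j : ℕ} (hj : j < k) (u : Fin j → Fin k → ℝ) :
    ∃ e : Fin k → ℝ, ‖e‖ = 1 ∧ ∀ l, ∑ i, e i * u l i = 0 := by
  set T : (Fin k → ℝ) →ₗ[ℝ] (Fin j → ℝ) := Matrix.mulVecLin (Matrix.of u) with hT
  have hker : LinearMap.ker T ≠ ⊥ := LinearMap.ker_ne_bot_of_finrank_lt (by simpa using hj)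
  obtain ⟨x, hx, hx0⟩ := (Submodule.ne_bot_iff _).1 hker
  have hn : ‖x‖ ≠ 0 := norm_ne_zero_iff.2 hx0
  refine ⟨‖x‖⁻¹ • x, by rw [norm_smul, norm_inv, norm_norm, inv_mul_cancel₀ hn], fun l => ?_⟩
  have h1 : ∑ i, u l i * x i = 0 := by
    have := congrFun (LinearMap.mem_ker.1 hx) l
    simpa [hT, Matrix.mulVec, dotProduct] using this
  calc _ = ‖x‖⁻¹ * ∑ i, u l i * x i := by
        rw [Finset.mul_sum]; refine Finset.sum_congr rfl fun i _ => ?_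
        simp; ring
    _ = 0 := by rw [h1, mul_zero]

lemma abs_det_ge_of_triangular {k : ℕ} {f u : Fin k → Fin k → ℝ} {κ : ℝ} (hκ : 0 ≤ κ)
    (hf : ∀ i, ‖f i‖ = 1) (h0 : ∀ i l, l < i → ∑ a, f i a * u l a = 0)
    (h1 : ∀ i, κ ≤ |∑ a, f i a * u i a|) :
    κ ^ k / k.factorial ≤ |(Matrix.of u).det| := by
  have h2 : (Matrix.of f * (Matrix.of u).transpose).det = ∏ i, ∑ a, f i a * u i a := by
    rw [Matrix.det_of_isUpperTriangular]
    · simp [Matrix.mul_apply]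
    · intro i l hl
      simpa [Matrix.mul_apply] using h0 i l hl
  have h3 : |(Matrix.of f).det| ≤ k.factorial := by
    have := Matrix.det_le (A := Matrix.of f) (abv := AbsoluteValue.abs) (x := (1 : ℝ))
      (fun i a => by simpa [hf i] using norm_le_pi_norm (f i) a)
    simpa using this
  have h4 : κ ^ k ≤ |(Matrix.of f).det| * |(Matrix.of u).det| := by
    rw [← abs_mul, ← Matrix.det_transpose (Matrix.of u), ← Matrix.det_mul, h2, Finset.abs_prod]
    calc κ ^ k = ∏ _i : Fin k, κ := by simp
      _ ≤ _ := Finset.prod_le_prod (fun _ _ => hκ) fun i _ => h1 i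
  rw [div_le_iff₀ (by positivity)]
  refine h4.trans ?_
  rw [mul_comm]
  gcongr

/-- A set of vectors is either contained in a thin slab or contains a quantitative basis. -/
lemma narrow_or_basis {k : ℕ} (S : Set (Fin k → ℝ)) {κ : ℝ} (hκ : 0 < κ) :
    (∃ e : Fin k → ℝ, ‖e‖ = 1 ∧ ∀ u ∈ S, |∑ i, e i * u i| ≤ κ) ∨
    ∃ u : Fin k → Fin k → ℝ, (∀ j, u j ∈ S) ∧ κ ^ k / k.factorial ≤ |(Matrix.of u).det| := by
  by_contra! hcon
  obtain ⟨hA, hB⟩ := hcon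
  have key : ∀ j, j ≤ k → ∃ f u : Fin j → Fin k → ℝ, (∀ i, u i ∈ S) ∧ (∀ i, ‖f i‖ = 1) ∧
      (∀ i l, l < i → ∑ a, f i a * u l a = 0) ∧ ∀ i, κ ≤ |∑ a, f i a * u i a| := by
    intro j
    induction j with
    | zero => exact fun _ => ⟨Fin.elim0, Fin.elim0, fun i => i.elim0, fun i => i.elim0,
        fun i => i.elim0, fun i => i.elim0⟩
    | succ j ih =>
      intro hj
      obtain ⟨f, u, hu, hf, h0, h1⟩ := ih (by omega)
      obtain ⟨e, he, heu⟩ := exists_sup_one_orthogonal (show j < k by omega) u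
      obtain ⟨w, hw, hew⟩ := hA e he
      refine ⟨Fin.snoc f e, Fin.snoc u w, ?_, ?_, ?_, ?_⟩
      · intro i; refine Fin.lastCases ?_ (fun i => ?_) i <;> simp [hw, hu]
      · intro i; refine Fin.lastCases ?_ (fun i => ?_) i <;> simp [he, hf]
      · intro i
        refine Fin.lastCases ?_ (fun i => ?_) i
        · intro l
          refine Fin.lastCases ?_ (fun l => ?_) l
          · intro h; exact absurd h (lt_irrefl _)
          · intro _; simpa using heu l
        · intro l
          refine Fin.lastCases ?_ (fun l => ?_) l
          · intro h
            exact absurd h (by simpa using (Fin.castSucc_lt_last i).le)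
          · intro h; simpa using h0 i l (by simpa using h)
      · intro i; refine Fin.lastCases ?_ (fun i => ?_) i
        · simpa using hew.le
        · simpa using h1 i
  obtain ⟨f, u, hu, hf, h0, h1⟩ := key k le_rfl
  exact absurd (abs_det_ge_of_triangular hκ.le hf h0 h1) (not_le.2 (hB u hu))

lemma exists_basis_replacing {n d : ℕ} (hd : 1 ≤ d) (hdn : d ≤ n)
    (b : ONB n) {ω : Euc n} (hω : ‖ω‖ = 1)
    (hωb : ∀ i : Fin n, d ≤ i.val → ⟪b i, ω⟫_ℝ = 0) :
    ∃ b' : ONB n, (∀ i : Fin n, d ≤ i.val → b' i = b i) ∧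
      b' ⟨d - 1, by omega⟩ = ω := by
  set v : Fin n → Euc n := fun i => if i.val = d - 1 then ω else b i with hv
  have hon : Orthonormal ℝ (({i : Fin n | d - 1 ≤ i.val} : Set (Fin n)).domRestrict v) := by
    constructor
    · rintro ⟨i, hi⟩
      simp only [domRestrict_apply, hv]
      split_ifs
      · exact hω
      · exact b.norm_eq_one i
    · rintro ⟨i, hi⟩ ⟨j, hj⟩ hij
      have hij' : i ≠ j := fun h => hij (Subtype.ext h)
      have hi' : d - 1 ≤ i.val := hi
      have hj' : d - 1 ≤ j.val := hj
      simp only [domRestrict_apply, hv]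
      split_ifs with h1 h2 h2
      · exact absurd (Fin.ext (h1.trans h2.symm)) hij'
      · rw [real_inner_comm]; exact hωb j (by omega)
      · exact hωb i (by omega)
      · exact b.orthonormal.2 hij'
  obtain ⟨b', hb'⟩ := hon.exists_orthonormalBasis_extension_of_card_eq (by simp)
  refine ⟨b', fun i hi => ?_, ?_⟩
  · rw [hb' i (show d - 1 ≤ i.val by omega)]
    simp only [hv]
    rw [if_neg (by omega)]
  · rw [hb' _ (le_refl (d - 1))]
    simp [hv]

lemma narrow_or_broad {n d : ℕ} (hd : 1 ≤ d) (hdn : d ≤ n) {A κ : ℝ} (hA : 0 ≤ A) (hκ : 0 < κ)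
    (hκ1 : κ ≤ 1 / 2) (b : ONB n) (S : Set (Euc n))
    (hS : ∀ c ∈ S, ∀ i, |⟪b i, c⟫_ℝ| ≤ A) :
    (∃ (b' : ONB n) (β : ℝ),
      (∀ i : Fin n, d ≤ i.val → b' i = b i) ∧
      ∀ c ∈ S, |⟪b' ⟨d - 1, by omega⟩, c⟫_ℝ - β| ≤ (2 * n * A + 2) * κ) ∨
    ∃ c : Fin (d + 1) → Euc n, (∀ j, c j ∈ S) ∧ κ ^ (d + 1) / (d + 1).factorial ≤
      |(vmat fun j i => 2 * ⟪b (Fin.castLE hdn i), c j⟫_ℝ).det| := by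
  classical
  rcases S.eq_empty_or_nonempty with rfl | ⟨c0, hc0⟩
  · exact Or.inl ⟨b, 0, fun _ _ => rfl, fun c hc => absurd hc (notMem_empty c)⟩
  set g : Euc n → Fin (d + 1) → ℝ := fun c =>
    Fin.snoc (fun i : Fin d => 2 * ⟪b (Fin.castLE hdn i), c⟫_ℝ) 1 with hg
  rcases narrow_or_basis (g '' S) hκ with ⟨e, he, heS⟩ | ⟨u, hu, hdet⟩
  · left
    have hsum : ∀ c, ∑ i, e i * g c i =
        2 * ⟪∑ i : Fin d, e i.castSucc • b (Fin.castLE hdn i), c⟫_ℝ + e (Fin.last d) := by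
      intro c
      rw [Fin.sum_univ_castSucc, sum_inner, Finset.mul_sum]
      congr 1
      · refine Finset.sum_congr rfl fun i _ => ?_
        rw [real_inner_smul_left]; simp [hg]; ring
      · simp [hg]
    set η : ℝ := 1 / (4 * n * A + 4) with hη
    have hη0 : 0 < η := by positivity
    have hη1 : η < 1 := by
      rw [hη, div_lt_one (by positivity)]
      have : 0 ≤ 4 * n * A := by positivity
      linarith
    have hηA : 2 * (n * (η * A)) < 1 / 2 := by
      rw [hη]
      have h5 : (0 : ℝ) < 4 * n * A + 4 := by positivity
      rw [show 2 * (n * (1 / (4 * n * A + 4) * A)) = (2 * n * A) / (4 * n * A + 4) by ring,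
        div_lt_iff₀ h5]
      linarith
    set p := ∑ i : Fin d, e i.castSucc • b (Fin.castLE hdn i) with hp
    have hbp : ∀ i : Fin d, ⟪b (Fin.castLE hdn i), p⟫_ℝ = e i.castSucc := by
      intro i
      rw [hp, inner_sum]
      simp_rw [inner_smul_right, b.inner_eq_ite]
      rw [Finset.sum_eq_single i]
      · simp
      · intro j _ hj
        rw [if_neg (fun h => hj (Fin.castLE_injective hdn h.symm)), mul_zero]
      · simp
    have hbp0 : ∀ i : Fin n, d ≤ i.val → ⟪b i, p⟫_ℝ = 0 := by
      intro i hi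
      rw [hp, inner_sum]
      refine Finset.sum_eq_zero fun j _ => ?_
      rw [inner_smul_right, b.inner_eq_ite, if_neg, mul_zero]
      intro h
      have := congrArg Fin.val h
      simp at this
      omega
    have hpη : η ≤ ‖p‖ := by
      by_contra! hlt
      have h1 : ∀ i : Fin d, |e i.castSucc| ≤ η := by
        intro i
        rw [← hbp i]
        refine (abs_real_inner_le_norm _ _).trans ?_
        rw [b.norm_eq_one, one_mul]; exact hlt.le
      have h2 : |e (Fin.last d)| = 1 := by
        refine le_antisymm (he ▸ norm_le_pi_norm e _) ?_
        by_contra! h3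
        have : ‖e‖ < 1 := by
          refine (pi_norm_lt_iff one_pos).2 fun i => ?_
          refine Fin.lastCases ?_ (fun i => ?_) i
          · exact h3
          · exact (h1 i).trans_lt hη1
        exact absurd he this.ne
      have h4 := heS _ (mem_image_of_mem g hc0)
      rw [hsum] at h4
      have h5 : |⟪p, c0⟫_ℝ| ≤ n * (η * A) := by
        rw [hp, sum_inner]
        refine (Finset.abs_sum_le_sum_abs _ _).trans ?_
        calc _ ≤ ∑ _i : Fin d, η * A := by
              refine Finset.sum_le_sum fun i _ => ?_
              rw [real_inner_smul_left, abs_mul]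
              exact mul_le_mul (h1 i) (hS c0 hc0 _) (abs_nonneg _) hη0.le
          _ = d * (η * A) := by simp
          _ ≤ _ := by
              have : (d : ℝ) ≤ n := by exact_mod_cast hdn
              gcongr
      have h6 := abs_add_le (2 * ⟪p, c0⟫_ℝ + e (Fin.last d)) (-(2 * ⟪p, c0⟫_ℝ))
      rw [add_neg_cancel_comm, h2, abs_neg, abs_mul, abs_two] at h6
      linarith
    have hp0 : 0 < ‖p‖ := hη0.trans_le hpη
    obtain ⟨b', hb1, hb2⟩ := exists_basis_replacing hd hdn b (ω := ‖p‖⁻¹ • p)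
      (by rw [norm_smul, norm_inv, norm_norm, inv_mul_cancel₀ hp0.ne'])
      (fun i hi => by rw [inner_smul_right, hbp0 i hi, mul_zero])
    refine ⟨b', -(‖p‖⁻¹ * e (Fin.last d) / 2), hb1, fun c hc => ?_⟩
    rw [hb2, real_inner_smul_left]
    have h4 := heS _ (mem_image_of_mem g hc)
    rw [hsum] at h4
    rw [show ‖p‖⁻¹ * ⟪p, c⟫_ℝ - -(‖p‖⁻¹ * e (Fin.last d) / 2) =
      ‖p‖⁻¹ / 2 * (2 * ⟪p, c⟫_ℝ + e (Fin.last d)) by ring, abs_mul, abs_of_pos (by positivity)]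
    refine mul_le_mul ?_ h4 (abs_nonneg _) (by positivity)
    have : ‖p‖⁻¹ ≤ η⁻¹ := inv_anti₀ hη0 hpη
    rw [hη, one_div, inv_inv] at this
    linarith
  · right
    choose c hcS hc using hu
    refine ⟨c, hcS, hdet.trans_eq ?_⟩
    rw [← Matrix.det_transpose]
    congr 2
    ext i j
    simp only [Matrix.transpose_apply, Matrix.of_apply, ← hc, hg, vmat]
    refine Fin.lastCases ?_ (fun i => ?_) i <;> simp

/-- The part of `h` living on the grid cube of side `1/K` with index `τ`. -/
noncomputable def cap {n : ℕ} (K : ℕ) (τ : Fin n → ℤ) (h : Euc n → ℂ) : Euc n → ℂ :=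
  Set.indicator {ξ | ∀ i, ⌊(K : ℝ) * ξ i⌋ = τ i} h

/-- The grid cubes of side `1/K` meeting the unit cube. -/
noncomputable def caps (n K : ℕ) : Finset (Fin n → ℤ) := Fintype.piFinset fun _ => Finset.Icc (-K : ℤ) K

/-- The corner of a grid cube. -/
noncomputable def cpt {n : ℕ} (K : ℕ) (τ : Fin n → ℤ) : Euc n := WithLp.toLp 2 fun i => τ i / K

/-- Functions supported in the unit cube. -/
def InCube {n : ℕ} (h : Euc n → ℂ) : Prop := ∀ ξ, h ξ ≠ 0 → ∀ i, |ξ i| ≤ 1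

lemma measurableSet_cube {n : ℕ} (K : ℕ) (τ : Fin n → ℤ) :
    MeasurableSet {ξ : Euc n | ∀ i, ⌊(K : ℝ) * ξ i⌋ = τ i} := by
  have : {ξ : Euc n | ∀ i, ⌊(K : ℝ) * ξ i⌋ = τ i} = ⋂ i, {ξ : Euc n | ⌊(K : ℝ) * ξ i⌋ = τ i} := by
    ext; simp
  rw [this]
  refine MeasurableSet.iInter fun i => ?_
  have hm : Measurable fun ξ : Euc n => ⌊(K : ℝ) * ξ i⌋ := Int.measurable_floor.comp (by fun_prop)
  exact hm (measurableSet_singleton _)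

lemma Nice.cap {n : ℕ} {h : Euc n → ℂ} (hh : Nice h) (K : ℕ) (τ : Fin n → ℤ) : Nice (cap K τ h) :=
  hh.indicator (measurableSet_cube K τ)

lemma cap_ne_zero {n K : ℕ} {τ : Fin n → ℤ} {h : Euc n → ℂ} {ξ : Euc n} (hξ : cap K τ h ξ ≠ 0) :
    h ξ ≠ 0 ∧ ∀ i, ⌊(K : ℝ) * ξ i⌋ = τ i := by
  by_cases hm : ξ ∈ {ξ : Euc n | ∀ i, ⌊(K : ℝ) * ξ i⌋ = τ i}
  · unfold cap at hξ
    rw [indicator_of_mem hm] at hξ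
    exact ⟨hξ, hm⟩
  · exact absurd (indicator_of_notMem hm _) hξ

lemma InCube.cap {n : ℕ} {h : Euc n → ℂ} (hh : InCube h) (K : ℕ) (τ : Fin n → ℤ) :
    InCube (cap K τ h) := fun ξ hξ => hh ξ (cap_ne_zero hξ).1

lemma cap_ne_zero_coord {n K : ℕ} (hK : 1 ≤ K) {τ : Fin n → ℤ} {h : Euc n → ℂ} {ξ : Euc n}
    (hξ : cap K τ h ξ ≠ 0) (i : Fin n) : |ξ i - cpt K τ i| ≤ 1 / K := by
  have h1 := (cap_ne_zero hξ).2 i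
  have hK0 : (0 : ℝ) < K := by exact_mod_cast hK
  rw [Int.floor_eq_iff] at h1
  rw [show ξ i - cpt K τ i = (K * ξ i - τ i) / K by simp [cpt]; field_simp, abs_div,
    abs_of_pos hK0]
  gcongr
  rw [abs_le]
  constructor <;> linarith

lemma norm_le_sum_coord {n : ℕ} {v : Euc n} {a : ℝ} (hv : ∀ i, |v i| ≤ a) : ‖v‖ ≤ n * a := by
  have h1 : v = ∑ i, v i • (EuclideanSpace.basisFun (Fin n) ℝ) i := by
    conv_lhs => rw [← (EuclideanSpace.basisFun (Fin n) ℝ).sum_repr v]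
    simp
  rw [h1]
  refine (norm_sum_le _ _).trans ?_
  calc _ ≤ ∑ _i : Fin n, a := by
        refine Finset.sum_le_sum fun i _ => ?_
        rw [norm_smul, OrthonormalBasis.norm_eq_one, mul_one]; exact hv i
    _ = n * a := by simp

lemma norm_sub_cpt_le {n K : ℕ} (hK : 1 ≤ K) {τ : Fin n → ℤ} {h : Euc n → ℂ} {ξ : Euc n}
    (hξ : cap K τ h ξ ≠ 0) : ‖ξ - cpt K τ‖ ≤ n / K := by
  refine (norm_le_sum_coord (a := 1 / K) fun i => ?_).trans (by rw [mul_one_div])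
  exact cap_ne_zero_coord hK hξ i

lemma norm_cpt_le {n K : ℕ} (hK : 1 ≤ K) {τ : Fin n → ℤ} (hτ : τ ∈ caps n K) : ‖cpt K τ‖ ≤ n := by
  refine (norm_le_sum_coord (a := 1) fun i => ?_).trans (by rw [mul_one])
  have h1 := Fintype.mem_piFinset.1 hτ i
  rw [Finset.mem_Icc] at h1
  have hK0 : (0 : ℝ) < K := by exact_mod_cast hK
  simp only [cpt]
  rw [abs_div, abs_of_pos hK0, div_le_one hK0, abs_le]
  exact ⟨by exact_mod_cast h1.1, by exact_mod_cast h1.2⟩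

lemma abs_inner_basis_le {n : ℕ} (b : ONB n) (i : Fin n) (v : Euc n) :
    |⟪b i, v⟫_ℝ| ≤ ‖v‖ := by
  refine (abs_real_inner_le_norm _ _).trans ?_
  rw [b.norm_eq_one, one_mul]

lemma inBox_cap {n K : ℕ} (hK : 1 ≤ K) (τ : Fin n → ℤ) (h : Euc n → ℂ)
    (b : ONB n) :
    InBox b (fun _ => (K : ℝ)) (cpt K τ) n (cap K τ h) := by
  intro ξ hξ i
  have hK0 : (0 : ℝ) < K := by exact_mod_cast hK
  calc (K : ℝ) * |⟪b i, ξ - cpt K τ⟫_ℝ| ≤ K * (n / K) := by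
        gcongr; exact (abs_inner_basis_le b i _).trans (norm_sub_cpt_le hK hξ)
    _ = n := by field_simp

lemma sum_cap {n K : ℕ} {h : Euc n → ℂ} (hh : InCube h) :
    (fun ξ => ∑ τ ∈ caps n K, cap K τ h ξ) = h := by
  ext ξ
  by_cases h0 : h ξ = 0
  · rw [h0]
    refine Finset.sum_eq_zero fun τ _ => ?_
    by_contra hc
    exact (cap_ne_zero hc).1 h0
  · rw [Finset.sum_eq_single (fun i => ⌊(K : ℝ) * ξ i⌋)]
    · unfold cap
      rw [indicator_of_mem]
      exact fun i => rfl
    · intro τ _ hτ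
      by_contra hc
      exact hτ (funext fun i => ((cap_ne_zero hc).2 i).symm)
    · intro hn
      refine absurd (Fintype.mem_piFinset.2 fun i => ?_) hn
      have h1 := abs_le.1 (hh ξ h0 i)
      rw [Finset.mem_Icc]
      have hK0 : (0 : ℝ) ≤ K := by positivity
      constructor
      · rw [Int.le_floor]; push_cast; nlinarith
      · have := Int.floor_le ((K : ℝ) * ξ i)
        have : ((⌊(K : ℝ) * ξ i⌋ : ℤ) : ℝ) ≤ ((K : ℤ) : ℝ) := by push_cast; nlinarith
        exact_mod_cast this

lemma cap_comm {n : ℕ} (K K' : ℕ) (σ τ : Fin n → ℤ) (h : Euc n → ℂ) :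
    cap K σ (cap K' τ h) = cap K' τ (cap K σ h) := by
  unfold cap
  rw [indicator_indicator, indicator_indicator, inter_comm]

/-- Grids are nested. -/
lemma cap_cap {n K K' : ℕ} (hK : 1 ≤ K) (hK' : 1 ≤ K') (hd : K ∣ K') (σ τ : Fin n → ℤ) (h : Euc n → ℂ) :
    cap K σ (cap K' τ h) = cap K' τ h ∨ cap K σ (cap K' τ h) = fun _ => 0 := by
  obtain ⟨k, rfl⟩ := hd
  have hk : 1 ≤ k := Nat.one_le_iff_ne_zero.2 (by rintro rfl; simp at hK')
  have hfl : ∀ x : ℝ, ⌊(K : ℝ) * x⌋ = ⌊((K * k : ℕ) : ℝ) * x⌋ / (k : ℤ) := by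
    intro x
    rw [← Int.floor_div_natCast]
    congr 1
    have : (k : ℝ) ≠ 0 := by exact_mod_cast (by omega : k ≠ 0)
    push_cast; field_simp
  by_cases hc : ∀ i, τ i / (k : ℤ) = σ i
  · left
    ext ξ
    by_cases h0 : cap (K * k) τ h ξ = 0
    · rw [h0]
      by_contra hc'
      exact (cap_ne_zero hc').1 h0
    · have h1 := (cap_ne_zero h0).2
      conv_lhs => unfold cap
      rw [indicator_of_mem]
      · rfl
      · intro i
        rw [hfl, h1, hc]
  · right
    ext ξ
    by_contra h0
    have h1 := cap_ne_zero h0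
    have h2 := (cap_ne_zero h1.1).2
    refine hc fun i => ?_
    rw [← h1.2 i, hfl, h2]

lemma card_caps_near {n K : ℕ} (hK : 1 ≤ K) {T : Finset (Fin n → ℤ)} {h : (Fin n → ℤ) → Euc n → ℂ}
    (ξ₀ : Euc n) (D : ℕ) (hT : ∀ τ ∈ T, ∃ ξ, cap K τ (h τ) ξ ≠ 0 ∧ (K : ℝ) * ‖ξ - ξ₀‖ ≤ D) :
    T.card ≤ (2 * D + 3) ^ n := by
  have hsub : T ⊆ Fintype.piFinset fun i =>
      Finset.Icc (⌊(K : ℝ) * ξ₀ i⌋ - D - 1) (⌊(K : ℝ) * ξ₀ i⌋ + D + 1) := by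
    intro τ hτ
    obtain ⟨ξ, h1, h2⟩ := hT τ hτ
    rw [Fintype.mem_piFinset]
    intro i
    have h3 : |(K : ℝ) * ξ i - K * ξ₀ i| ≤ D := by
      rw [← mul_sub, abs_mul, Nat.abs_cast]
      refine le_trans ?_ h2
      gcongr
      exact PiLp.norm_apply_le (ξ - ξ₀) i
    rw [← (cap_ne_zero h1).2 i, Finset.mem_Icc]
    rw [abs_le] at h3
    have e1 := Int.floor_le ((K : ℝ) * ξ i)
    have e2 := Int.lt_floor_add_one ((K : ℝ) * ξ i)
    have e3 := Int.floor_le ((K : ℝ) * ξ₀ i)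
    have e4 := Int.lt_floor_add_one ((K : ℝ) * ξ₀ i)
    constructor
    · have : (⌊(K : ℝ) * ξ₀ i⌋ : ℝ) - D - 1 < ⌊(K : ℝ) * ξ i⌋ + 1 := by linarith
      have : ⌊(K : ℝ) * ξ₀ i⌋ - (D : ℤ) - 1 < ⌊(K : ℝ) * ξ i⌋ + 1 := by exact_mod_cast this
      omega
    · have : (⌊(K : ℝ) * ξ i⌋ : ℝ) < ⌊(K : ℝ) * ξ₀ i⌋ + D + 1 := by linarith
      have : ⌊(K : ℝ) * ξ i⌋ < ⌊(K : ℝ) * ξ₀ i⌋ + (D : ℤ) + 1 := by exact_mod_cast this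
      omega
  refine (Finset.card_le_card hsub).trans ?_
  rw [Fintype.card_piFinset]
  simp only [Int.card_Icc]
  rw [Finset.prod_congr rfl (fun i _ => show (⌊(K : ℝ) * ξ₀ i⌋ + D + 1 + 1 - (⌊(K : ℝ) * ξ₀ i⌋ - D - 1)).toNat
    = 2 * D + 3 by omega)]
  simp

/-- The isotropic energy at scale `K`. -/
noncomputable def eI {n : ℕ} (N : ℕ) (K : ℝ) (h : Euc n → ℂ) (z : Euc n × ℝ) : ℝ≥0∞ :=
  en (EuclideanSpace.basisFun (Fin n) ℝ) (fun _ => K) N h z.1 z.2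

lemma measurable_eI {n : ℕ} (N : ℕ) (K : ℝ) {h : Euc n → ℂ} (hh : Nice h) :
    Measurable (eI N K h) := measurable_en _ _ N hh

lemma eI_zero {n : ℕ} (N : ℕ) (K : ℝ) (z : Euc n × ℝ) : eI N K (fun _ => 0) z = 0 := en_zero _ _ _ _ _

lemma en_anti {n : ℕ} (b : ONB n) (ρ : Fin n → ℝ) {N N' : ℕ}
    (hN : N ≤ N') (h : Euc n → ℂ) (x : Euc n) (t : ℝ) : en b ρ N' h x t ≤ en b ρ N h x t := by
  unfold en
  exact lintegral_mono fun y => mul_le_mul' le_rfl (phi_anti hN y)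

lemma eI_anti {n : ℕ} {N N' : ℕ} (hN : N ≤ N') (K : ℝ) (h : Euc n → ℂ) (z : Euc n × ℝ) :
    eI N' K h z ≤ eI N K h z := en_anti _ _ hN _ _ _

/-- Almost orthogonality of the grid pieces. -/
lemma eI_le_sum_cap (n N : ℕ) : ∃ C : ℝ≥0∞, C ≠ ⊤ ∧ ∀ (K : ℕ), 1 ≤ K → ∀ h : Euc n → ℂ, Nice h →
    InCube h → ∀ z, eI N K h z ≤ C * ∑ τ ∈ caps n K, eI N K (cap K τ h) z := by
  obtain ⟨C, hC, H⟩ := en_orthogonality n N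
  set D : ℕ := n * (2 * (n + 2)) with hD
  refine ⟨C * ((2 * D + 3) ^ n : ℕ), by finiteness, fun K hK h hh hc z => ?_⟩
  have hK0 : (0 : ℝ) < K := by exact_mod_cast hK
  have := H (EuclideanSpace.basisFun (Fin n) ℝ) (fun _ => (K : ℝ)) (fun _ => hK0) (caps n K)
    (fun τ => cap K τ h) (fun τ _ => hh.cap K τ) ((2 * D + 3) ^ n) ?_ z.1 z.2
  · rw [sum_cap hc] at this
    exact this
  · intro ξ₀ T' _ hT'
    refine card_caps_near (h := fun _ => h) hK ξ₀ D fun τ hτ => ?_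
    obtain ⟨ξ, h1, h2⟩ := hT' τ hτ
    refine ⟨ξ, h1, ?_⟩
    have h3 : ‖ξ - ξ₀‖ ≤ n * (2 * (n + 2) / K) := by
      refine norm_le_sum_coord fun i => ?_
      have := h2 i
      rw [le_div_iff₀ hK0, mul_comm]
      rw [EuclideanSpace.basisFun_inner] at this
      exact this
    calc (K : ℝ) * ‖ξ - ξ₀‖ ≤ K * (n * (2 * (n + 2) / K)) := by gcongr
      _ = D := by rw [hD]; push_cast; field_simp

lemma exists_sc_eq {n : ℕ} (b : ONB n) {ρ : Fin n → ℝ}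
    (hρ : ∀ i, 0 < ρ i) {a : ℝ} {u : Euc n} (hu : ∀ i, ‖u‖ ≤ a * ρ i) :
    ∃ v : Euc n, sc b ρ v = u ∧ ∀ i, |v i| ≤ a := by
  refine ⟨WithLp.toLp 2 fun i => ⟪b i, u⟫_ℝ / ρ i, ?_, fun i => ?_⟩
  · refine b.repr.injective ?_
    ext i
    rw [b.repr_apply_apply, b.repr_apply_apply, inner_basis_sc]
    have := (hρ i).ne'
    simp; field_simp
  · simp only
    rw [abs_div, abs_of_pos (hρ i), div_le_iff₀ (hρ i)]
    exact (abs_inner_basis_le b i u).trans (hu i)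

lemma norm_sub_transport_le {n : ℕ} {A r : ℝ} {c : Euc n} (hc : ‖c‖ ≤ A)
    {z z' : Euc n × ℝ} (hz : ‖z' - z‖ ≤ A * r) :
    ‖z'.1 - z.1 - (2 * (z'.2 - z.2)) • c‖ ≤ (A + 2 * A ^ 2) * r ∧ |z'.2 - z.2| ≤ A * r := by
  have h1 : ‖z'.1 - z.1‖ ≤ A * r := (norm_fst_le (z' - z)).trans hz
  have h2 : |z'.2 - z.2| ≤ A * r := (norm_snd_le (z' - z)).trans hz
  refine ⟨(norm_sub_le _ _).trans ?_, h2⟩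
  rw [norm_smul, Real.norm_eq_abs, abs_mul, abs_two]
  have h3 : |z'.2 - z.2| * ‖c‖ ≤ A * r * A :=
    mul_le_mul h2 hc (norm_nonneg _) ((abs_nonneg _).trans h2)
  nlinarith

lemma en_near (n : ℕ) {A : ℝ} (hA : 0 ≤ A) (N N' : ℕ) (hN : n * N + n + 1 ≤ N') :
    ∃ C : ℝ≥0∞, C ≠ ⊤ ∧
    ∀ (b b' : ONB n) (ρ ρ' : Fin n → ℝ) (c : Euc n)
      (h : Euc n → ℂ),
      (∀ i, 1 ≤ ρ i) → (∀ i, 0 < ρ' i) → (∀ i j, ρ' i ≤ ρ j) → Nice h → InBox b ρ c A h →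
      ‖c‖ ≤ A → ∀ z z' : Euc n × ℝ, (∀ i, ‖z' - z‖ ≤ A * ρ i) →
        en b' ρ' N' h z'.1 z'.2 ≤ C * en b ρ N h z.1 z.2 := by
  obtain ⟨C, hC, H⟩ := en_le_en_of_scale_le n (A + 2 * A ^ 2) N N' hN
  refine ⟨C, hC, fun b b' ρ ρ' c h hρ hρ' hρρ hh hb hc z z' hz => ?_⟩
  have hρ0 : ∀ i, 0 < ρ i := fun i => one_pos.trans_le (hρ i)
  obtain ⟨v, hv, hvA⟩ := exists_sc_eq b hρ0
    (fun i => (norm_sub_transport_le hc (hz i)).1)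
  have := H b b' ρ ρ' c h hρ0 hρ' hρρ hh (fun ξ hξ i => (hb ξ hξ i).trans (by nlinarith)) z.1 v
    z'.2 z.2 (fun i => ?_) hvA
  · rw [hv] at this
    convert this using 2
    abel
  · refine (norm_sub_transport_le hc (hz i)).2.trans ?_
    have := hρ i
    have : ρ i ≤ ρ i ^ 2 := by nlinarith
    nlinarith [sq_nonneg A, sq_nonneg (ρ i)]

lemma evol_near (n : ℕ) {A : ℝ} (hA : 0 ≤ A) (N : ℕ) :
    ∃ C : ℝ≥0∞, C ≠ ⊤ ∧
    ∀ (b : ONB n) (ρ : Fin n → ℝ) (c : Euc n)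
      (h : Euc n → ℂ), (∀ i, 1 ≤ ρ i) → Nice h → InBox b ρ c A h →
      ‖c‖ ≤ A → ∀ z z' : Euc n × ℝ, (∀ i, ‖z' - z‖ ≤ A * ρ i) →
        ‖evol h z'.1 z'.2‖ₑ ^ 2 ≤ C * en b ρ N h z.1 z.2 := by
  obtain ⟨C, hC, H⟩ := enorm_evol_sq_mul_phi_le n (A + 2 * A ^ 2) N
  set q := ofReal (((1 + (A + 2 * A ^ 2) ^ 2) ^ n)⁻¹ ^ N) with hq
  have hq0 : q ≠ 0 := by rw [hq]; simp only [ne_eq, ENNReal.ofReal_eq_zero, not_le]; positivity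
  have hqt : q ≠ ⊤ := ENNReal.ofReal_ne_top
  refine ⟨C * q⁻¹, ENNReal.mul_ne_top hC (ENNReal.inv_ne_top.2 hq0),
    fun b ρ c h hρ hh hb hc z z' hz => ?_⟩
  have hρ0 : ∀ i, 0 < ρ i := fun i => one_pos.trans_le (hρ i)
  obtain ⟨v, hv, hvA⟩ := exists_sc_eq b hρ0
    (fun i => (norm_sub_transport_le hc (hz i)).1)
  have := H b ρ c h hρ0 hh (fun ξ hξ i => (hb ξ hξ i).trans (by nlinarith)) z.1 v
    z'.2 z.2 (fun i => ?_)
  · rw [hv, show z.1 + (2 * (z'.2 - z.2)) • c + (z'.1 - z.1 - (2 * (z'.2 - z.2)) • c) = z'.1 by abel]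
      at this
    rw [mul_right_comm, ← div_eq_mul_inv, ENNReal.le_div_iff_mul_le (Or.inl hq0) (Or.inl hqt)]
    exact (mul_le_mul' le_rfl (phi_ge_of_coord N hvA)).trans this
  · refine (norm_sub_transport_le hc (hz i)).2.trans ?_
    have := hρ i
    have : ρ i ≤ ρ i ^ 2 := by nlinarith
    nlinarith [sq_nonneg A, sq_nonneg (ρ i)]

lemma norm_le_of_inCube {n : ℕ} {h : Euc n → ℂ} (hh : InCube h) {ξ : Euc n} (hξ : h ξ ≠ 0) :
    ‖ξ‖ ≤ n := by
  simpa using norm_le_sum_coord (hh ξ hξ)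

lemma en_recenter (n : ℕ) {A : ℝ} (hA : 0 ≤ A) (N : ℕ) :
    ∃ C : ℝ≥0∞, C ≠ ⊤ ∧
    ∀ (b : ONB n) (R : ℝ) (h : Euc n → ℂ), 1 ≤ R → Nice h → InCube h →
      ∀ z z' : Euc n × ℝ, ‖z' - z‖ ≤ A * R →
        en b (fun _ => R) N h z'.1 z'.2 ≤ C * en b (fun _ => R) N h z.1 z.2 := by
  obtain ⟨C, hC, H⟩ := en_transport n (A + A * n) N
  obtain ⟨C', hC', H'⟩ := en_shift_bdd n A N
  refine ⟨C' * C, by finiteness, fun b R h hR hh hc z z' hz => ?_⟩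
  have hR0 : 0 < R := by linarith
  have ht : |z'.2 - z.2| ≤ A * R := (norm_snd_le (z' - z)).trans hz
  obtain ⟨v, hv, hvA⟩ := exists_sc_eq b (ρ := fun _ => R) (fun _ => hR0) (u := z'.1 - z.1)
    (fun i => (norm_fst_le (z' - z)).trans hz)
  have h1 := H b (fun _ => R) (fun _ => n) 0 h (fun _ => hR0) hh
    (fun ξ hξ i => by
      rw [sub_zero]; exact (abs_inner_basis_le b i ξ).trans (norm_le_of_inCube hc hξ)) z.1 z'.2 z.2
    (fun i => ht.trans (by
      have : R ≤ R ^ 2 := by nlinarith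
      have : 0 ≤ A * n * R ^ 2 := by positivity
      nlinarith)) (fun i => by
      have : |z'.2 - z.2| * n ≤ A * R * n := by gcongr
      nlinarith [mul_nonneg hA hR0.le])
  have h2 := H' b (fun _ => R) h hh z.1 v z'.2 hvA
  rw [hv, show z.1 + (z'.1 - z.1) = z'.1 by abel] at h2
  rw [smul_zero, add_zero] at h1
  rw [mul_assoc]
  exact h2.trans (mul_le_mul' le_rfl h1)

lemma sc_const {n : ℕ} (b : ONB n) (R : ℝ) (y : Euc n) :
    sc b (fun _ => R) y = R • b.repr.symm y := by
  rw [← b.sum_repr_symm, Finset.smul_sum]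
  unfold sc
  simp_rw [smul_smul]

lemma en_change_basis {n : ℕ} (b b' : ONB n) (R : ℝ) {N N' : ℕ}
    (hN : n * N ≤ N') (h : Euc n → ℂ) (x : Euc n) (t : ℝ) :
    en b (fun _ => R) N' h x t ≤ en b' (fun _ => R) N h x t := by
  unfold en
  have hmp := (b'.repr.symm.trans b.repr).measurePreserving
  have hemb := (b'.repr.symm.trans b.repr).toHomeomorph.measurableEmbedding
  rw [← hmp.lintegral_comp_emb hemb]
  refine lintegral_mono fun u => ?_
  simp only
  have e1 : sc b (fun _ => R) ((b'.repr.symm.trans b.repr) u) = sc b' (fun _ => R) u := by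
    rw [sc_const, sc_const]; simp
  rw [e1]
  refine mul_le_mul' le_rfl ?_
  refine (phi_le N' _).trans (le_trans ?_ (phi_ge N u))
  rw [LinearIsometryEquiv.norm_map]
  apply ENNReal.ofReal_le_ofReal
  apply pow_le_pow_of_le_one (by positivity) _ hN
  exact inv_le_one_of_one_le₀ (by nlinarith [sq_nonneg ‖u‖])

lemma prod_rpow_le_of_le {d : ℕ} {C : ℝ≥0∞} {f g : Fin (d + 1) → ℝ≥0∞} (h : ∀ j, f j ≤ C * g j)
    {p : ℝ} (hp : 0 ≤ p) : ∏ j, f j ^ p ≤ (C ^ p) ^ (d + 1) * ∏ j, g j ^ p := by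
  calc ∏ j, f j ^ p ≤ ∏ j, (C ^ p * g j ^ p) := by
        refine Finset.prod_le_prod' fun j _ => ?_
        rw [← ENNReal.mul_rpow_of_nonneg _ _ hp]
        exact ENNReal.rpow_le_rpow (h j) hp
    _ = _ := by rw [Finset.prod_mul_distrib]; simp

lemma evol_zero_of_forall {n : ℕ} {h : Euc n → ℂ} (h0 : ∀ ξ, h ξ = 0) (x : Euc n) (t : ℝ) :
    evol h x t = 0 := by
  rw [show h = fun _ => 0 from funext h0, evol_zero]

lemma eI_zero_of_forall {n : ℕ} {h : Euc n → ℂ} (h0 : ∀ ξ, h ξ = 0) (N : ℕ) (K : ℝ)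
    (z : Euc n × ℝ) : eI N K h z = 0 := by
  rw [show h = fun _ => 0 from funext h0, eI_zero]

/-- The part of `c` along the first `d` basis vectors. -/
noncomputable def tang {n : ℕ} (d : ℕ) (b : ONB n) (c : Euc n) : Euc n :=
  ∑ i : Fin n, (if i.val < d then ⟪b i, c⟫_ℝ else 0) • b i

/-- The combination of the last basis vectors with coefficients `β`. -/
noncomputable def norml {n : ℕ} (d : ℕ) (b : ONB n) (β : Fin n → ℝ) :
    Euc n := ∑ i : Fin n, (if i.val < d then 0 else β i) • b i

lemma inner_sum_smul_basis {n : ℕ} (b : ONB n) (a : Fin n → ℝ)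
    (i : Fin n) : ⟪b i, ∑ k, a k • b k⟫_ℝ = a i := by
  simp [inner_sum, inner_smul_right, b.inner_eq_ite]

lemma norm_sum_smul_basis_le {n : ℕ} (b : ONB n) {a : Fin n → ℝ} {A : ℝ}
    (ha : ∀ i, |a i| ≤ A) : ‖∑ k, a k • b k‖ ≤ n * A := by
  refine (norm_sum_le _ _).trans ?_
  calc _ ≤ ∑ _i : Fin n, A := by
        refine Finset.sum_le_sum fun i _ => ?_
        rw [norm_smul, b.norm_eq_one, mul_one]; exact ha i
    _ = n * A := by simp

lemma broad_window {n d : ℕ} (hd : 1 ≤ d) (hdn : d ≤ n) {N Nb Ne : ℕ} (hN : n < N)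
    (hNb : n * N ≤ Nb) (hNe : n * Nb + n + 1 ≤ Ne) {ν : ℝ} (hν : 0 < ν) :
    ∃ C : ℝ≥0∞, C ≠ ⊤ ∧ ∀ K L : ℕ, 1 ≤ K → 1 ≤ L →
    ∀ (b : ONB n) (β : Fin n → ℝ) (c : Fin (d + 1) → Euc n)
      (h : Fin (d + 1) → Euc n → ℂ),
      (∀ j, Nice (h j)) → (∀ j, InCube (h j)) → (∀ j, ‖c j‖ ≤ n) →
      (∀ j ξ, h j ξ ≠ 0 → ‖ξ - c j‖ ≤ n / K) →
      (∀ j ξ, h j ξ ≠ 0 → ∀ i : Fin n, d ≤ i.val → |⟪b i, ξ⟫_ℝ - β i| ≤ 1 / (K : ℝ) ^ L) →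
      ν ≤ |(vmat fun j i => 2 * ⟪b (Fin.castLE hdn i), c j⟫_ℝ).det| →
      ∀ z₀ : Euc n × ℝ,
      ∫⁻ z in closedBall z₀ (2 * (K : ℝ) ^ L), ∏ j, eI Ne K (h j) z ^ (1 / d : ℝ) ≤
        C ^ L * ofReal (((K : ℝ) ^ L) ^ (n + 1)) *
          ∏ j, eI N ((K : ℝ) ^ L) (h j) z₀ ^ (1 / d : ℝ) := by
  have hn1 : (1 : ℝ) ≤ n := by exact_mod_cast hd.trans hdn
  have hnN : n ≤ n * N := Nat.le_mul_of_pos_right n (by omega)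
  have hNb1 : n < Nb := by
    rcases Nat.lt_or_ge 1 N with h1 | h1
    · have : n * 2 ≤ n * N := Nat.mul_le_mul_left n h1
      omega
    · omega
  set A : ℝ := n * (2 * n + 2) with hA
  have hA0 : 0 ≤ A := by positivity
  have hA1 : (2 * n + 2 : ℝ) ≤ A := by rw [hA]; nlinarith
  set D : ℝ := n + 2 * A + 1 with hD
  obtain ⟨Cm, hCm, Hm⟩ := multilinear_energy hd hdn hNb1 hA0 hν
  obtain ⟨Cn, hCn, Hn⟩ := en_near n hA0 Nb Ne hNe
  obtain ⟨Cr, hCr, Hr⟩ := en_recenter n (show 0 ≤ 2 + D by positivity) Nb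
  have hp : (0 : ℝ) ≤ 1 / d := by positivity
  set Q : ℝ≥0∞ := volume (closedBall (0 : Euc n × ℝ) (2 + D)) with hQ
  have hQt : Q ≠ ⊤ := measure_closedBall_lt_top.ne
  set C0 := (Cn ^ (1 / d : ℝ)) ^ (d + 1) * Q * (Cr ^ (1 / d : ℝ)) ^ (d + 1) with hC0
  have hC0t : C0 ≠ ⊤ := by rw [hC0]; finiteness
  refine ⟨(1 + C0) * Cm, by finiteness, fun K L hK hL b β c h hh hcube hc hsupp hβ hdet z₀ => ?_⟩
  by_cases htriv : ∃ j, ∀ ξ, h j ξ = 0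
  · obtain ⟨j, hj⟩ := htriv
    have : ∀ z, ∏ j, eI Ne K (h j) z ^ (1 / d : ℝ) = 0 := by
      intro z
      refine Finset.prod_eq_zero (Finset.mem_univ j) ?_
      rw [eI_zero_of_forall hj, ENNReal.zero_rpow_of_pos (by positivity)]
    rw [lintegral_congr this, lintegral_zero]
    exact bot_le
  push Not at htriv
  have hK1 : (1 : ℝ) ≤ K := by exact_mod_cast hK
  have hK0 : (0 : ℝ) < K := by linarith
  set R : ℝ := (K : ℝ) ^ L with hR
  have hR1 : 1 ≤ R := one_le_pow₀ hK1
  have hR0 : 0 < R := by linarith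
  have hKR : (K : ℝ) ≤ R := by
    rw [hR]; exact le_self_pow₀ hK1 (by omega)
  have hβA : ∀ i : Fin n, d ≤ i.val → |β i| ≤ 2 * n + 2 := by
    intro i hi
    obtain ⟨ξ, hξ⟩ := htriv 0
    have h1 := hβ 0 ξ hξ i hi
    have h2 := (abs_inner_basis_le b i ξ).trans (norm_le_of_inCube (hcube 0) hξ)
    have h3 : 1 / R ≤ 1 := by rw [div_le_one hR0]; exact hR1
    rw [abs_le] at h1 h2 ⊢
    constructor <;> linarith
  set q := norml d b β with hq
  set c' : Fin (d + 1) → Euc n := fun j => tang d b (c j) + q with hc'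
  have hqi : ∀ i : Fin n, ⟪b i, q⟫_ℝ = if i.val < d then 0 else β i := fun i =>
    inner_sum_smul_basis b _ i
  have hci : ∀ j (i : Fin n), ⟪b i, c' j⟫_ℝ = if i.val < d then ⟪b i, c j⟫_ℝ else β i := by
    intro j i
    rw [hc', inner_add_right, hqi, tang, inner_sum_smul_basis]
    split_ifs <;> simp
  have hciA : ∀ j i, |⟪b i, c' j⟫_ℝ| ≤ 2 * n + 2 := by
    intro j i
    rw [hci]
    split_ifs with hi
    · have := (abs_inner_basis_le b i (c j)).trans (hc j); linarith
    · exact hβA i (by omega)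
  have hc'A : ∀ j, ‖c' j‖ ≤ A := by
    intro j
    have := norm_sum_smul_basis_le b (hciA j)
    rwa [b.sum_repr'] at this
  have hqA : ‖q‖ ≤ A := by
    refine norm_sum_smul_basis_le b (A := 2 * n + 2) fun i => ?_
    split_ifs with hi
    · rw [abs_zero]; positivity
    · exact hβA i (by omega)
  have hnA : (n : ℝ) ≤ A := by linarith
  have hsc : ∀ j ξ, h j ξ ≠ 0 → ∀ i, |⟪b i, ξ - c' j⟫_ℝ| ≤ scl n d (A / K) (A / K ^ L) i := by
    intro j ξ hξ i
    rw [inner_sub_right, hci]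
    unfold scl
    split_ifs with hi
    · rw [← inner_sub_right]
      refine (abs_inner_basis_le b i _).trans ((hsupp j ξ hξ).trans ?_)
      gcongr
    · refine (hβ j ξ hξ i (by omega)).trans ?_
      rw [← hR]
      gcongr; linarith
  have hscl1 : ∀ i, 1 ≤ scl n d (K : ℝ) R i := by
    intro i; unfold scl; split_ifs <;> assumption
  have hbox : ∀ j, InBox b (scl n d (K : ℝ) R) (c' j) A (h j) := by
    intro j ξ hξ i
    have := hsc j ξ hξ i
    unfold scl at this ⊢
    split_ifs at this ⊢ with hi
    · calc (K : ℝ) * _ ≤ K * (A / K) := by gcongr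
        _ = A := by field_simp
    · calc R * _ ≤ R * (A / R) := by gcongr
        _ = A := by field_simp
  have hball : volume (closedBall (0 : Fin (d + 1) → ℝ) R) = ofReal ((2 * R) ^ (d + 1)) := by
    rw [Real.volume_pi_closedBall _ hR0.le]; simp
  have hmeasF : Measurable fun z => ∏ j, eI Ne K (h j) z ^ (1 / d : ℝ) :=
    Finset.measurable_prod _ fun j _ => (measurable_eI Ne K (hh j)).pow_const _
  have hfrm : ∀ ζ ∈ closedBall (0 : Fin (d + 1) → ℝ) R, ‖frm d b q ζ‖ ≤ D * R := by
    intro ζ hζ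
    refine (norm_frm_le d b q ζ).trans ?_
    rw [mem_closedBall_zero_iff] at hζ
    gcongr
    rw [hD]; linarith
  have h1 := setLIntegral_le_avg (μ := (volume : Measure (Euc n × ℝ)))
    (ν := (volume : Measure (Fin (d + 1) → ℝ))) hmeasF (measurable_frm d b q)
    (K := closedBall (0 : Fin (d + 1) → ℝ) R) measurableSet_closedBall hfrm z₀ (2 * R)
  set E := ∏ j, eI N R (h j) z₀ ^ (1 / d : ℝ) with hE
  have h2 : ∀ z ∈ closedBall z₀ (2 * R + D * R), ∫⁻ ζ in closedBall (0 : Fin (d + 1) → ℝ) R,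
      ∏ j, eI Ne K (h j) (z + frm d b q ζ) ^ (1 / d : ℝ) ≤
      (Cn ^ (1 / d : ℝ)) ^ (d + 1) * (Cm ^ L * ofReal (R ^ (d + 1)) *
        ((Cr ^ (1 / d : ℝ)) ^ (d + 1) * E)) := by
    intro z hz
    have h3 : ∀ ζ, ∏ j, eI Ne K (h j) (z + frm d b q ζ) ^ (1 / d : ℝ) ≤
        (Cn ^ (1 / d : ℝ)) ^ (d + 1) * ∏ j, en b (scl n d K R) Nb (h j) (z + frm d b q ζ).1
          (z + frm d b q ζ).2 ^ (1 / d : ℝ) := by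
      intro ζ
      refine prod_rpow_le_of_le (fun j => ?_) hp
      refine Hn b _ (scl n d K R) (fun _ => K) (c' j) (h j) hscl1 (fun _ => hK0) (fun i j => ?_)
        (hh j) (hbox j) (hc'A j) _ _ fun i => ?_
      · unfold scl; split_ifs
        · exact le_rfl
        · exact hKR
      · rw [sub_self, norm_zero]
        exact mul_nonneg hA0 (zero_le_one.trans (hscl1 i))
    refine (lintegral_mono h3).trans ?_
    rw [lintegral_const_mul' _ _ (by finiteness)]
    refine mul_le_mul' le_rfl ((Hm K L hK1 hL b q c' h (fun j i => (hciA j i).trans hA1)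
      (fun i hi => by rw [hqi, if_pos hi])
      (fun i hi j => by rw [hci, hqi, if_neg (by omega), if_neg (by omega)]) ?_ hh hsc z).trans ?_)
    · refine hdet.trans_eq ?_
      congr 4
      ext j i
      rw [hci, if_pos (by simp)]
    · rw [show (K : ℝ) ^ (L * (d + 1)) = R ^ (d + 1) by rw [hR, pow_mul]]
      refine mul_le_mul' le_rfl (prod_rpow_le_of_le (fun j => ?_) hp)
      have h5 : ‖z - z₀‖ ≤ (2 + D) * R := by
        rw [← dist_eq_norm]; rw [mem_closedBall] at hz; linarith
      refine (Hr b R (h j) hR1 (hh j) (hcube j) z₀ z h5).trans (mul_le_mul' le_rfl ?_)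
      exact en_change_basis b _ R hNb (h j) _ _
  have h6 := h1.trans ((setLIntegral_mono' measurableSet_closedBall h2).trans_eq (setLIntegral_const _ _))
  have hvol : volume (closedBall z₀ (2 * R + D * R)) = ofReal (R ^ (n + 1)) * Q := by
    rw [show 2 * R + D * R = R * (2 + D) by ring, Measure.addHaar_closedBall_mul_of_pos _ _ hR0]
    congr 2
    simp
  rw [hvol, hball] at h6
  have hr1 : ofReal (R ^ (d + 1)) ≠ 0 := by
    simp only [ne_eq, ENNReal.ofReal_eq_zero, not_le]; positivity
  rw [← ENNReal.mul_le_mul_iff_right hr1 ENNReal.ofReal_ne_top]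
  calc _ ≤ ofReal ((2 * R) ^ (d + 1)) * ∫⁻ z in closedBall z₀ (2 * R), ∏ j, eI Ne K (h j) z ^ (1 / d : ℝ) := by
        gcongr; linarith
    _ ≤ _ := h6
    _ = ofReal (R ^ (d + 1)) * (C0 * Cm ^ L * ofReal (R ^ (n + 1)) * E) := by
        rw [hC0]; ring
    _ ≤ _ := by
        gcongr
        rw [mul_pow]
        gcongr
        exact le_add_self.trans (le_self_pow₀ le_self_add (by omega))

/-- The `1/n`-th power of the normalised mass of a weight near a point, at scale `K`. -/
noncomputable def avgW {n : ℕ} (K : ℕ) (w : Euc n × ℝ → ℝ≥0∞) (z : Euc n × ℝ) : ℝ≥0∞ :=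
  (((K : ℝ≥0∞) ^ (n + 1))⁻¹ * ∫⁻ z' in closedBall z (5 * K), w z') ^ (1 / n : ℝ)

/-- The sum of the energies of the pieces of `h` at scale `K`. -/
noncomputable def eS {n : ℕ} (N K : ℕ) (h : Euc n → ℂ) (z : Euc n × ℝ) : ℝ≥0∞ :=
  ∑ τ ∈ caps n K, eI N K (cap K τ h) z

/-- The weighted energy of the pieces of `h` at scale `K`. -/
noncomputable def Psi {n : ℕ} (N K : ℕ) (h : Euc n → ℂ) (w : Euc n × ℝ → ℝ≥0∞) (z : Euc n × ℝ) :
    ℝ≥0∞ := avgW K w z * eS N K h z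

/-- The part of `h` carried by a family of grid cubes. -/
noncomputable def part {n : ℕ} (K : ℕ) (S : Finset (Fin n → ℤ)) (h : Euc n → ℂ) (ξ : Euc n) : ℂ :=
  ∑ τ ∈ S, cap K τ h ξ

/-- Multiscale decoupling for functions concentrated near an `m`-plane. -/
def Decoupling (n m : ℕ) : Prop :=
  ∀ N : ℕ, n < N → ∀ ε : ℝ, 0 < ε → ∀ L : ℕ, ∃ (𝒦 : Finset ℕ) (K₁ : ℕ), 1 ≤ K₁ ∧ L ≤ K₁ ∧
    (∀ K ∈ 𝒦, 1 ≤ K ∧ L ≤ K ∧ K ∣ K₁) ∧ 𝒦.card ≤ 2 * m ∧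
    ∀ (b : ONB n) (β : Fin n → ℝ) (h : Euc n → ℂ),
      Nice h → InCube h →
      (∀ ξ, h ξ ≠ 0 → ∀ i : Fin n, m ≤ i.val → |⟪b i, ξ⟫_ℝ - β i| ≤ 1 / K₁) →
      ∀ w : Euc n × ℝ → ℝ≥0∞, Measurable w → ∀ z₀ : Euc n × ℝ,
        ∫⁻ z in closedBall z₀ K₁, ‖evol h z.1 z.2‖ₑ ^ 2 * w z ^ (1 / n : ℝ) ≤
          (∑ K ∈ 𝒦, (K : ℝ≥0∞) ^ ε * ∫⁻ z in closedBall z₀ (3 * K₁), Psi N K h w z) +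
            (K₁ : ℝ≥0∞) ^ ε * (K₁ : ℝ≥0∞) ^ (n + 1) * Psi N K₁ h w z₀

lemma volume_closedBall_eq {n : ℕ} (z : Euc n × ℝ) {r : ℝ} (hr : 0 < r) (c : ℝ) :
    volume (closedBall z (r * c)) =
      ofReal r ^ (n + 1) * volume (closedBall (0 : Euc n × ℝ) c) := by
  rw [Measure.addHaar_closedBall_mul_of_pos _ _ hr, ENNReal.ofReal_pow hr.le]
  congr 2
  simp

lemma eS_anti {n N N' : ℕ} (hN : N ≤ N') (K : ℕ) (h : Euc n → ℂ) (z : Euc n × ℝ) :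
    eS N' K h z ≤ eS N K h z := Finset.sum_le_sum fun _ _ => eI_anti hN _ _ _

lemma Psi_anti {n N N' : ℕ} (hN : N ≤ N') (K : ℕ) (h : Euc n → ℂ) (w : Euc n × ℝ → ℝ≥0∞)
    (z : Euc n × ℝ) : Psi N' K h w z ≤ Psi N K h w z := mul_le_mul' le_rfl (eS_anti hN K h z)

lemma measurable_eS {n : ℕ} (N K : ℕ) {h : Euc n → ℂ} (hh : Nice h) : Measurable (eS N K h) :=
  Finset.measurable_sum _ fun _ _ => measurable_eI N K (hh.cap K _)

lemma measurable_setLIntegral_closedBall {n : ℕ} {w : Euc n × ℝ → ℝ≥0∞} (hw : Measurable w) (r : ℝ) :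
    Measurable fun z => ∫⁻ z' in closedBall z r, w z' := by
  have : (fun z : Euc n × ℝ => ∫⁻ z' in closedBall z r, w z') =
      fun z => ∫⁻ z', {q : (Euc n × ℝ) × (Euc n × ℝ) | dist q.2 q.1 ≤ r}.indicator
        (fun q => w q.2) (z, z') := by
    ext z
    rw [← lintegral_indicator measurableSet_closedBall]
    rfl
  rw [this]
  refine Measurable.lintegral_prod_right' (f := {q : (Euc n × ℝ) × (Euc n × ℝ) |
    dist q.2 q.1 ≤ r}.indicator (fun q => w q.2)) ?_
  exact (hw.comp measurable_snd).indicator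
    (measurableSet_le (by fun_prop) measurable_const)

lemma measurable_avgW {n : ℕ} (K : ℕ) {w : Euc n × ℝ → ℝ≥0∞} (hw : Measurable w) :
    Measurable (avgW K w) :=
  ((measurable_setLIntegral_closedBall hw _).const_mul _).pow_const _

lemma measurable_Psi {n : ℕ} (N K : ℕ) {h : Euc n → ℂ} (hh : Nice h) {w : Euc n × ℝ → ℝ≥0∞}
    (hw : Measurable w) : Measurable (Psi N K h w) := (measurable_avgW K hw).mul (measurable_eS N K hh)

lemma Nice.part {n : ℕ} {h : Euc n → ℂ} (hh : Nice h) (K : ℕ) (S : Finset (Fin n → ℤ)) :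
    Nice (part K S h) := Nice.sum S fun τ _ => hh.cap K τ

lemma part_ne_zero {n K : ℕ} {S : Finset (Fin n → ℤ)} {h : Euc n → ℂ} {ξ : Euc n}
    (hξ : part K S h ξ ≠ 0) : ∃ τ ∈ S, cap K τ h ξ ≠ 0 := Finset.exists_ne_zero_of_sum_ne_zero hξ

lemma InCube.part {n : ℕ} {h : Euc n → ℂ} (hh : InCube h) (K : ℕ) (S : Finset (Fin n → ℤ)) :
    InCube (part K S h) := by
  intro ξ hξ
  obtain ⟨τ, -, hτ⟩ := part_ne_zero hξ
  exact hh ξ (cap_ne_zero hτ).1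

lemma cap_add {n : ℕ} (K : ℕ) (τ : Fin n → ℤ) (h h' : Euc n → ℂ) (ξ : Euc n) :
    cap K τ (fun ξ => h ξ + h' ξ) ξ = cap K τ h ξ + cap K τ h' ξ := by
  unfold cap
  simp only [indicator_apply]
  split_ifs <;> simp

lemma cap_part {n : ℕ} (K K' : ℕ) (σ : Fin n → ℤ) (S : Finset (Fin n → ℤ)) (h : Euc n → ℂ) :
    cap K' σ (part K S h) = fun ξ => ∑ τ ∈ S, cap K' σ (cap K τ h) ξ := by
  ext ξ
  unfold cap part
  simp only [indicator_apply]
  split_ifs <;> simp [cap, indicator_apply]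

lemma part_add_part {n K : ℕ} {h : Euc n → ℂ} (hh : InCube h) {S : Finset (Fin n → ℤ)}
    (hS : S ⊆ caps n K) : (fun ξ => part K S h ξ + part K (caps n K \ S) h ξ) = h := by
  conv_rhs => rw [← sum_cap (K := K) hh]
  ext ξ
  rw [add_comm]
  exact Finset.sum_sdiff hS

/-- Jensen's inequality for the weight. -/
lemma setLIntegral_rpow_le_avgW {n : ℕ} (hn : 1 ≤ n) : ∃ C : ℝ≥0∞, C ≠ ⊤ ∧ ∀ K : ℕ, 1 ≤ K →
    ∀ w : Euc n × ℝ → ℝ≥0∞, Measurable w → ∀ z : Euc n × ℝ,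
      ∫⁻ z' in closedBall z (5 * K), w z' ^ (1 / n : ℝ) ≤ C * (K : ℝ≥0∞) ^ (n + 1) * avgW K w z := by
  have hn0 : (0 : ℝ) < n := by exact_mod_cast hn
  have hn1 : (1 : ℝ) ≤ n := by exact_mod_cast hn
  have hp : (0 : ℝ) ≤ 1 / n := by positivity
  have hq : (0 : ℝ) ≤ 1 - 1 / n := by
    rw [sub_nonneg, div_le_one hn0]; exact hn1
  refine ⟨volume (closedBall (0 : Euc n × ℝ) 5) ^ (1 - 1 / n : ℝ),
    ENNReal.rpow_ne_top_of_nonneg hq measure_closedBall_lt_top.ne, fun K hK w hw z => ?_⟩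
  have hK0 : (0 : ℝ) < K := by exact_mod_cast hK
  have h1 := ENNReal.lintegral_mul_norm_pow_le (μ := volume.restrict (closedBall z (5 * K)))
    (f := w) (g := fun _ => 1) hw.aemeasurable aemeasurable_const hp hq (by ring)
  simp only [ENNReal.one_rpow, mul_one, lintegral_const, one_mul,
    Measure.restrict_apply MeasurableSet.univ, univ_inter] at h1
  refine h1.trans_eq ?_
  rw [show (5 : ℝ) * K = K * 5 by ring, volume_closedBall_eq _ hK0, ENNReal.ofReal_natCast,
    ENNReal.mul_rpow_of_nonneg _ _ hq, avgW, ENNReal.mul_rpow_of_nonneg _ _ hp, ENNReal.inv_rpow,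
    show (5 : ℝ) * K = K * 5 by ring]
  have hX0 : (K : ℝ≥0∞) ^ (n + 1) ≠ 0 := by
    have : (K : ℝ≥0∞) ≠ 0 := by exact_mod_cast (by omega : K ≠ 0)
    positivity
  have hXt : (K : ℝ≥0∞) ^ (n + 1) ≠ ⊤ := by finiteness
  rw [ENNReal.rpow_sub _ _ hX0 hXt, ENNReal.rpow_one, ENNReal.div_eq_inv_mul]
  ring

theorem decoupling_zero {n : ℕ} (hn : 1 ≤ n) : Decoupling n 0 := by
  intro N hN ε hε L
  obtain ⟨C1, hC1, H1⟩ := evol_near n (show (0 : ℝ) ≤ 2 * n by positivity) N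
  obtain ⟨C2, hC2, H2⟩ := eI_le_sum_cap n N
  obtain ⟨C3, hC3, H3⟩ := setLIntegral_rpow_le_avgW hn
  have hlim : Tendsto (fun K : ℕ => (K : ℝ≥0∞) ^ ε) atTop (𝓝 ⊤) := by
    have := (ENNReal.continuous_rpow_const (y := ε)).tendsto ⊤
    rw [ENNReal.top_rpow_of_pos hε] at this
    exact this.comp ENNReal.tendsto_nat_nhds_top
  have hCt : C1 * C2 * C3 < ⊤ := by finiteness
  obtain ⟨K, hK, hKL, hK1⟩ := ((hlim.eventually (lt_mem_nhds hCt)).and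
    ((eventually_ge_atTop L).and (eventually_ge_atTop 1))).exists
  refine ⟨∅, K, hK1, hKL, by simp, by simp, fun b β h hh hc hb w hw z₀ => ?_⟩
  have hK0 : (0 : ℝ) < K := by exact_mod_cast hK1
  have hK1' : (1 : ℝ) ≤ K := by exact_mod_cast hK1
  have hn1 : (1 : ℝ) ≤ n := by exact_mod_cast hn
  rw [Finset.sum_empty, zero_add]
  by_cases htriv : ∀ ξ, h ξ = 0
  · simp_rw [evol_zero_of_forall htriv]
    simp
  push Not at htriv
  obtain ⟨ξ₀, hξ₀⟩ := htriv
  have hdist : ∀ ξ, h ξ ≠ 0 → ‖ξ - ξ₀‖ ≤ n * (2 / K) := by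
    intro ξ hξ
    rw [← b.sum_repr' (ξ - ξ₀)]
    refine norm_sum_smul_basis_le b fun i => ?_
    have h1 := hb ξ hξ i (Nat.zero_le _)
    have h2 := hb ξ₀ hξ₀ i (Nat.zero_le _)
    rw [inner_sub_right, show (2 : ℝ) / K = 1 / K + 1 / K by ring]
    rw [abs_le] at *
    constructor <;> linarith
  have hbox : InBox (EuclideanSpace.basisFun (Fin n) ℝ) (fun _ => (K : ℝ)) ξ₀ (2 * n) h := by
    intro ξ hξ i
    calc (K : ℝ) * _ ≤ K * (n * (2 / K)) := by
          gcongr; exact (abs_inner_basis_le _ i _).trans (hdist ξ hξ)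
      _ = 2 * n := by field_simp
  have hξ₀n : ‖ξ₀‖ ≤ 2 * n := (norm_le_of_inCube hc hξ₀).trans (by linarith)
  have hpt : ∀ z ∈ closedBall z₀ (K : ℝ), ‖evol h z.1 z.2‖ₑ ^ 2 * w z ^ (1 / n : ℝ) ≤
      (C1 * (C2 * eS N K h z₀)) * w z ^ (1 / n : ℝ) := by
    intro z hz
    refine mul_le_mul' ((H1 _ _ ξ₀ h (fun _ => hK1') hh hbox hξ₀n z₀ z fun i => ?_).trans
      (mul_le_mul' le_rfl (H2 K hK1 h hh hc z₀))) le_rfl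
    rw [mem_closedBall, dist_eq_norm] at hz
    nlinarith
  refine (setLIntegral_mono' measurableSet_closedBall hpt).trans ?_
  rw [lintegral_const_mul _ (hw.pow_const _)]
  have h4 : ∫⁻ z in closedBall z₀ (K : ℝ), w z ^ (1 / n : ℝ) ≤ C3 * (K : ℝ≥0∞) ^ (n + 1) * avgW K w z₀ :=
    (lintegral_mono_set (closedBall_subset_closedBall (by linarith))).trans (H3 K hK1 w hw z₀)
  calc _ ≤ C1 * (C2 * eS N K h z₀) * (C3 * (K : ℝ≥0∞) ^ (n + 1) * avgW K w z₀) := by gcongr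
    _ = (C1 * C2 * C3) * (K : ℝ≥0∞) ^ (n + 1) * Psi N K h w z₀ := by unfold Psi; ring
    _ ≤ _ := by gcongr

lemma avgW_le_of_subset {n K K' : ℕ} (hK : 1 ≤ K) (hK' : 1 ≤ K') (w : Euc n × ℝ → ℝ≥0∞)
    {z z' : Euc n × ℝ} (hz : dist z' z + 5 * K' ≤ 5 * K) :
    avgW K' w z' ≤ ((K : ℝ≥0∞) ^ (n + 1)) ^ (1 / n : ℝ) * avgW K w z := by
  have hp : (0 : ℝ) ≤ 1 / n := by positivity
  have hX0 : (K : ℝ≥0∞) ^ (n + 1) ≠ 0 := by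
    have : (K : ℝ≥0∞) ≠ 0 := by exact_mod_cast (by omega : K ≠ 0)
    positivity
  have hXt : (K : ℝ≥0∞) ^ (n + 1) ≠ ⊤ := by finiteness
  unfold avgW
  rw [← ENNReal.mul_rpow_of_nonneg _ _ hp, ← mul_assoc, ENNReal.mul_inv_cancel hX0 hXt, one_mul]
  refine ENNReal.rpow_le_rpow ?_ hp
  have h1 : ((K' : ℝ≥0∞) ^ (n + 1))⁻¹ ≤ 1 := by
    rw [ENNReal.inv_le_one]
    exact one_le_pow₀ (by exact_mod_cast hK')
  calc _ ≤ 1 * ∫⁻ z'' in closedBall z' (5 * K'), w z'' := by gcongr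
    _ ≤ _ := by
      rw [one_mul]
      exact lintegral_mono_set (closedBall_subset_closedBall' (by linarith))

/-- Families of pieces of small energy contribute little. -/
lemma small_part {n : ℕ} (N N' : ℕ) (hN : n * N + n + 1 ≤ N') : ∃ C : ℝ≥0∞, C ≠ ⊤ ∧
    ∀ K : ℕ, 1 ≤ K → ∀ h : Euc n → ℂ, Nice h → ∀ S ⊆ caps n K, ∀ (δ : ℝ≥0∞) (z z' : Euc n × ℝ),
      (∀ τ ∈ S, eI N K (cap K τ h) z ≤ δ) → ‖z' - z‖ ≤ n * K →
      ‖evol (part K S h) z'.1 z'.2‖ₑ ^ 2 ≤ C * (caps n K).card ^ 2 * δ ∧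
      ∀ K' : ℕ, 1 ≤ K' → K' ∣ K → eS N' K' (part K S h) z' ≤
        C * (caps n K').card * (caps n K).card ^ 2 * δ := by
  obtain ⟨C1, hC1, H1⟩ := evol_near n (Nat.cast_nonneg n : (0 : ℝ) ≤ n) N
  obtain ⟨C2, hC2, H2⟩ := en_near n (Nat.cast_nonneg n : (0 : ℝ) ≤ n) N N' hN
  refine ⟨C1 + C2, by finiteness, fun K hK h hh S hS δ z z' hδ hz => ?_⟩
  have hK1 : (1 : ℝ) ≤ K := by exact_mod_cast hK
  have hcard : (S.card : ℝ≥0∞) ≤ (caps n K).card := by exact_mod_cast Finset.card_le_card hS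
  constructor
  · unfold part
    rw [evol_sum S fun τ _ => hh.cap K τ]
    refine (sq_enorm_sum_le S _).trans ?_
    have h1 : ∀ τ ∈ S, ‖evol (cap K τ h) z'.1 z'.2‖ₑ ^ 2 ≤ (C1 + C2) * δ := by
      intro τ hτ
      refine (H1 _ _ (cpt K τ) _ (fun _ => hK1) (hh.cap K τ) (inBox_cap hK τ h
        (EuclideanSpace.basisFun (Fin n) ℝ)) (norm_cpt_le hK (hS hτ)) z z' fun _ => hz).trans ?_
      exact mul_le_mul' le_self_add (hδ τ hτ)
    calc _ ≤ (S.card : ℝ≥0∞) * (S.card • ((C1 + C2) * δ)) := by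
          gcongr; exact Finset.sum_le_card_nsmul _ _ _ h1
      _ ≤ _ := by
          rw [nsmul_eq_mul]
          calc _ = (C1 + C2) * (S.card : ℝ≥0∞) ^ 2 * δ := by ring
            _ ≤ _ := by gcongr
  · intro K' hK' hd
    have hKK : (K' : ℝ) ≤ K := by exact_mod_cast Nat.le_of_dvd (by omega) hd
    have h1 : ∀ σ ∈ caps n K', eI N' K' (cap K' σ (part K S h)) z' ≤
        (C1 + C2) * (caps n K).card ^ 2 * δ := by
      intro σ _
      rw [cap_part]
      have h2 : ∀ τ ∈ S, eI N' K' (cap K' σ (cap K τ h)) z' ≤ (C1 + C2) * δ := by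
        intro τ hτ
        rcases cap_cap hK' hK hd σ τ h with h3 | h3
        · rw [h3]
          refine (H2 (EuclideanSpace.basisFun (Fin n) ℝ) (EuclideanSpace.basisFun (Fin n) ℝ)
            (fun _ => K) (fun _ => K') (cpt K τ) _ (fun _ => hK1)
            (fun _ => by exact_mod_cast hK') (fun _ _ => hKK) (hh.cap K τ) (inBox_cap hK τ h _)
            (norm_cpt_le hK (hS hτ)) z z' fun _ => hz).trans ?_
          exact mul_le_mul' le_add_self (hδ τ hτ)
        · rw [h3, eI_zero]; exact bot_le
      refine (en_sum_le _ _ _ S (fun τ _ => (hh.cap K τ).cap K' σ) _ _).trans ?_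
      calc _ ≤ (S.card : ℝ≥0∞) * (S.card • ((C1 + C2) * δ)) := by
            gcongr; exact Finset.sum_le_card_nsmul _ _ _ h2
        _ ≤ _ := by
            rw [nsmul_eq_mul]
            calc _ = (C1 + C2) * (S.card : ℝ≥0∞) ^ 2 * δ := by ring
              _ ≤ _ := by gcongr
    refine (Finset.sum_le_card_nsmul _ _ _ h1).trans_eq ?_
    rw [nsmul_eq_mul]; ring

lemma eS_le_add {n : ℕ} (N K' K : ℕ) {h : Euc n → ℂ} (hh : Nice h) (hc : InCube h)
    {S : Finset (Fin n → ℤ)} (hS : S ⊆ caps n K) (z : Euc n × ℝ) :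
    eS N K' (part K S h) z ≤ 2 * eS N K' h z + 2 * eS N K' (part K (caps n K \ S) h) z := by
  unfold eS
  rw [← mul_add, ← Finset.sum_add_distrib, Finset.mul_sum]
  refine Finset.sum_le_sum fun σ _ => ?_
  have hg : cap K' σ h = fun ξ => cap K' σ (part K S h) ξ + cap K' σ (part K (caps n K \ S) h) ξ := by
    ext ξ
    rw [← cap_add, part_add_part hc hS]
  have h0 := (hh.part K S).cap K' σ
  have h1 := hh.cap K' σ
  have h2 := (hh.part K (caps n K \ S)).cap K' σ
  unfold eI en
  rw [← lintegral_add_left', ← lintegral_const_mul' _ _ (by finiteness)]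
  · refine lintegral_mono fun y => ?_
    rw [← add_mul, ← mul_assoc]
    refine mul_le_mul' ?_ le_rfl
    have h3 := evol_add h0 h2 (z.1 - sc (EuclideanSpace.basisFun (Fin n) ℝ) (fun _ => (K' : ℝ)) y) z.2
    rw [← hg] at h3
    rw [eq_sub_of_add_eq h3.symm, sub_eq_add_neg]
    exact (sq_enorm_add_le _ _).trans_eq (by rw [enorm_neg, mul_add])
  · exact (((measurable_enorm_evol_comp h1 (by fun_prop) (by fun_prop)).pow_const 2).mul
      (measurable_phi N)).aemeasurable

open Classical in
/-- The sum of the geometric means of the energies of transversal families of pieces of `h`. -/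
noncomputable def broadSum {n d : ℕ} (hdn : d ≤ n) (N K : ℕ) (ν : ℝ)
    (b : ONB n) (h : Euc n → ℂ) (z : Euc n × ℝ) : ℝ≥0∞ :=
  ∑ τ ∈ (Fintype.piFinset fun _ : Fin (d + 1) => caps n K) with
    ν ≤ |(vmat fun j i => 2 * ⟪b (Fin.castLE hdn i), cpt K (τ j)⟫_ℝ).det|,
    ∏ j, eI N K (cap K (τ j) h) z ^ (1 / (d + 1 : ℕ) : ℝ)

lemma Psi_part_le {n N N' K K' : ℕ} (hN : N ≤ N') (hK : 1 ≤ K) (hK' : 1 ≤ K') {h : Euc n → ℂ}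
    (hh : Nice h) (hc : InCube h) {S : Finset (Fin n → ℤ)} (hS : S ⊆ caps n K)
    (w : Euc n × ℝ → ℝ≥0∞) {z z' : Euc n × ℝ} (hz : dist z' z + 5 * K' ≤ 5 * K) {δ : ℝ≥0∞}
    (hδ : eS N' K' (part K (caps n K \ S) h) z' ≤ δ) :
    Psi N' K' (part K S h) w z' ≤ 2 * Psi N K' h w z' +
      2 * (((K : ℝ≥0∞) ^ (n + 1)) ^ (1 / n : ℝ) * δ * avgW K w z) := by
  have h1 := avgW_le_of_subset hK hK' w hz
  unfold Psi
  calc _ ≤ avgW K' w z' * (2 * eS N K' h z' + 2 * δ) := by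
        gcongr
        refine (eS_le_add N' K' K hh hc hS z').trans (add_le_add ?_ ?_)
        · exact mul_le_mul' le_rfl (eS_anti hN _ _ _)
        · exact mul_le_mul' le_rfl hδ
    _ = 2 * (avgW K' w z' * eS N K' h z') + 2 * (δ * avgW K' w z') := by ring
    _ ≤ 2 * (avgW K' w z' * eS N K' h z') +
        2 * (δ * (((K : ℝ≥0∞) ^ (n + 1)) ^ (1 / n : ℝ) * avgW K w z)) := by gcongr
    _ = _ := by ring

lemma narrow_step {n : ℕ} (hn : 1 ≤ n) {N N' : ℕ} (hN : n * N + n + 1 ≤ N') (hNN : N ≤ N')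
    (ε : ℝ) (hε : 0 < ε)
    (𝒦 : Finset ℕ) {K₁ K : ℕ} (hK₁ : 1 ≤ K₁) (hK : 3 * K₁ ≤ K) (hd : K₁ ∣ K)
    (h𝒦 : ∀ K' ∈ 𝒦, 1 ≤ K' ∧ K' ∣ K₁) : ∃ D : ℝ≥0∞, D ≠ ⊤ ∧ ∀ (h : Euc n → ℂ), Nice h → InCube h →
    ∀ S ⊆ caps n K, ∀ w : Euc n × ℝ → ℝ≥0∞, Measurable w → ∀ (z : Euc n × ℝ) (δ : ℝ≥0∞),
      (∀ τ ∈ caps n K \ S, eI N K (cap K τ h) z ≤ δ) →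
      ∫⁻ z' in closedBall z K₁, ‖evol (part K S h) z'.1 z'.2‖ₑ ^ 2 * w z' ^ (1 / n : ℝ) ≤
          (∑ K' ∈ 𝒦, (K' : ℝ≥0∞) ^ ε * ∫⁻ z' in closedBall z (3 * K₁), Psi N' K' (part K S h) w z') +
            (K₁ : ℝ≥0∞) ^ ε * (K₁ : ℝ≥0∞) ^ (n + 1) * Psi N' K₁ (part K S h) w z →
      ∫⁻ z' in closedBall z K₁, ‖evol h z'.1 z'.2‖ₑ ^ 2 * w z' ^ (1 / n : ℝ) ≤
        4 * (∑ K' ∈ 𝒦, (K' : ℝ≥0∞) ^ ε * ∫⁻ z' in closedBall z (3 * K₁), Psi N K' h w z') +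
          4 * ((K₁ : ℝ≥0∞) ^ ε * (K₁ : ℝ≥0∞) ^ (n + 1) * Psi N K₁ h w z) + D * δ * avgW K w z := by
  obtain ⟨Cs, hCs, Hs⟩ := small_part (n := n) N N' hN
  obtain ⟨C3, hC3, H3⟩ := setLIntegral_rpow_le_avgW hn
  have hK1 : 1 ≤ K := by omega
  have hn1 : (1 : ℝ) ≤ n := by exact_mod_cast hn
  have hK₁r : (1 : ℝ) ≤ K₁ := by exact_mod_cast hK₁
  have hKr : (3 : ℝ) * K₁ ≤ K := by exact_mod_cast hK
  set κ : ℝ≥0∞ := ((K : ℝ≥0∞) ^ (n + 1)) ^ (1 / n : ℝ) with hκ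
  have hκt : κ ≠ ⊤ := by rw [hκ]; exact ENNReal.rpow_ne_top_of_nonneg (by positivity) (by finiteness)
  set c : ℝ≥0∞ := ((caps n K).card : ℝ≥0∞) with hcdef
  set V : ℝ≥0∞ := volume (closedBall (0 : Euc n × ℝ) (3 * K₁)) with hV
  have hVt : V ≠ ⊤ := measure_closedBall_lt_top.ne
  set D1 : ℝ≥0∞ := ∑ K' ∈ 𝒦, (K' : ℝ≥0∞) ^ ε * (2 * (κ * (Cs * (caps n K').card * c ^ 2)) * V) with hD1
  set D2 : ℝ≥0∞ := (K₁ : ℝ≥0∞) ^ ε * (K₁ : ℝ≥0∞) ^ (n + 1) *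
    (2 * (κ * (Cs * (caps n K₁).card * c ^ 2))) with hD2
  set D3 : ℝ≥0∞ := Cs * c ^ 2 * (C3 * (K : ℝ≥0∞) ^ (n + 1)) with hD3
  have hrp : ∀ k : ℕ, (k : ℝ≥0∞) ^ ε ≠ ⊤ := fun k =>
    ENNReal.rpow_ne_top_of_nonneg hε.le (ENNReal.natCast_ne_top k)
  have hct : c ≠ ⊤ := ENNReal.natCast_ne_top _
  have hD1t : D1 ≠ ⊤ := by
    rw [hD1]
    refine ENNReal.sum_ne_top.2 fun k _ => ENNReal.mul_ne_top (hrp k) ?_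
    finiteness
  have hD2t : D2 ≠ ⊤ := by
    rw [hD2]
    exact ENNReal.mul_ne_top (ENNReal.mul_ne_top (hrp _) (by finiteness)) (by finiteness)
  refine ⟨2 * (D1 + D2 + D3), by finiteness, fun h hh hc S hS w hw z δ hδ hP => ?_⟩
  have hsc : caps n K \ S ⊆ caps n K := Finset.sdiff_subset
  have hnear : ∀ z' ∈ closedBall z (3 * K₁ : ℝ), dist z' z + 5 * K₁ ≤ 5 * K := by
    intro z' hz'
    rw [mem_closedBall] at hz'
    linarith
  have hnK : ∀ z' ∈ closedBall z (3 * K₁ : ℝ), ‖z' - z‖ ≤ n * K := by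
    intro z' hz'
    rw [mem_closedBall, dist_eq_norm] at hz'
    nlinarith
  have hpsi : ∀ K', 1 ≤ K' → K' ∣ K₁ → ∀ z' ∈ closedBall z (3 * K₁ : ℝ),
      Psi N' K' (part K S h) w z' ≤ 2 * Psi N K' h w z' +
        2 * (κ * (Cs * (caps n K').card * c ^ 2 * δ) * avgW K w z) := by
    intro K' hK' hKd z' hz'
    have hle : (K' : ℝ) ≤ K₁ := by exact_mod_cast Nat.le_of_dvd (by omega) hKd
    refine Psi_part_le hNN hK1 hK' hh hc hS w (by linarith [hnear z' hz']) ?_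
    exact (Hs K hK1 h hh _ hsc δ z z' hδ (hnK z' hz')).2 K' hK' (hKd.trans hd)
  have hsub : closedBall z (K₁ : ℝ) ⊆ closedBall z (3 * K₁ : ℝ) :=
    closedBall_subset_closedBall (by linarith)
  have hsmall : ∫⁻ z' in closedBall z (K₁ : ℝ),
      ‖evol (part K (caps n K \ S) h) z'.1 z'.2‖ₑ ^ 2 * w z' ^ (1 / n : ℝ) ≤
        D3 * δ * avgW K w z := by
    have h1 : ∀ z' ∈ closedBall z (K₁ : ℝ),
        ‖evol (part K (caps n K \ S) h) z'.1 z'.2‖ₑ ^ 2 * w z' ^ (1 / n : ℝ) ≤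
        (Cs * c ^ 2 * δ) * w z' ^ (1 / n : ℝ) := fun z' hz' =>
      mul_le_mul' (Hs K hK1 h hh _ hsc δ z z' hδ (hnK z' (hsub hz'))).1 le_rfl
    refine (setLIntegral_mono' measurableSet_closedBall h1).trans ?_
    rw [lintegral_const_mul _ (hw.pow_const _)]
    calc _ ≤ (Cs * c ^ 2 * δ) * (C3 * (K : ℝ≥0∞) ^ (n + 1) * avgW K w z) := by
          refine mul_le_mul' le_rfl ((lintegral_mono_set ?_).trans (H3 K hK1 w hw z))
          exact closedBall_subset_closedBall (by linarith)
      _ = _ := by rw [hD3]; ring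
  have hsplit : ∫⁻ z' in closedBall z (K₁ : ℝ), ‖evol h z'.1 z'.2‖ₑ ^ 2 * w z' ^ (1 / n : ℝ) ≤
      2 * ((∫⁻ z' in closedBall z (K₁ : ℝ), ‖evol (part K S h) z'.1 z'.2‖ₑ ^ 2 * w z' ^ (1 / n : ℝ)) +
      ∫⁻ z' in closedBall z (K₁ : ℝ),
        ‖evol (part K (caps n K \ S) h) z'.1 z'.2‖ₑ ^ 2 * w z' ^ (1 / n : ℝ)) := by
    rw [← lintegral_add_left, ← lintegral_const_mul' _ _ (by finiteness)]
    · refine lintegral_mono fun z' => ?_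
      rw [← add_mul, ← mul_assoc]
      refine mul_le_mul' ?_ le_rfl
      conv_lhs => rw [← part_add_part hc hS]
      rw [evol_add (hh.part K S) (hh.part K _)]
      exact sq_enorm_add_le _ _
    · exact ((measurable_enorm_evol_comp (hh.part K S) (by fun_prop) (by fun_prop)).pow_const 2).mul
        (hw.pow_const _)
  have hsum : (∑ K' ∈ 𝒦, (K' : ℝ≥0∞) ^ ε *
      ∫⁻ z' in closedBall z (3 * K₁), Psi N' K' (part K S h) w z') ≤
      2 * (∑ K' ∈ 𝒦, (K' : ℝ≥0∞) ^ ε * ∫⁻ z' in closedBall z (3 * K₁), Psi N K' h w z') +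
        D1 * δ * avgW K w z := by
    rw [hD1, Finset.sum_mul, Finset.sum_mul, Finset.mul_sum, ← Finset.sum_add_distrib]
    refine Finset.sum_le_sum fun K' hK' => ?_
    have h1 := setLIntegral_mono' (μ := volume) measurableSet_closedBall
      (hpsi K' (h𝒦 K' hK').1 (h𝒦 K' hK').2)
    refine (mul_le_mul' le_rfl h1).trans ?_
    rw [lintegral_add_right _ measurable_const, lintegral_const_mul' _ _ (by finiteness),
      setLIntegral_const]
    have hv : volume (closedBall z (3 * K₁ : ℝ)) = V := by
      rw [hV, Measure.addHaar_closedBall_center]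
    rw [hv]
    exact le_of_eq (by ring)
  have hlast : (K₁ : ℝ≥0∞) ^ ε * (K₁ : ℝ≥0∞) ^ (n + 1) * Psi N' K₁ (part K S h) w z ≤
      2 * ((K₁ : ℝ≥0∞) ^ ε * (K₁ : ℝ≥0∞) ^ (n + 1) * Psi N K₁ h w z) + D2 * δ * avgW K w z := by
    refine (mul_le_mul' le_rfl (hpsi K₁ hK₁ dvd_rfl z (mem_closedBall_self (by positivity)))).trans_eq ?_
    rw [hD2]; ring
  refine hsplit.trans ((mul_le_mul' le_rfl (add_le_add (hP.trans (add_le_add hsum hlast)) hsmall)).trans_eq ?_)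
  ring

/-- One step of the broad-narrow analysis. -/
theorem broad_narrow {n m : ℕ} (hm : m + 1 ≤ n) (hP : Decoupling n m) (N : ℕ) {ε : ℝ}
    (hε : 0 < ε) (L : ℕ) : ∃ (𝒦 : Finset ℕ) (K₁ : ℕ) (ν : ℝ), 0 < ν ∧ 1 ≤ K₁ ∧ L ≤ K₁ ∧
    (∀ K ∈ 𝒦, 1 ≤ K ∧ L ≤ K ∧ K ∣ K₁) ∧ 𝒦.card ≤ 2 * m ∧ ∃ K₀ : ℕ, ∀ K, K₀ ≤ K → K₁ ∣ K →
    ∃ C : ℝ≥0∞, C ≠ ⊤ ∧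
    ∀ (b : ONB n) (β : Fin n → ℝ) (h : Euc n → ℂ),
      Nice h → InCube h →
      (∀ ξ, h ξ ≠ 0 → ∀ i : Fin n, m + 1 ≤ i.val → |⟪b i, ξ⟫_ℝ - β i| ≤ 1 / K) →
      ∀ w : Euc n × ℝ → ℝ≥0∞, Measurable w → ∀ z : Euc n × ℝ,
        ∫⁻ z' in closedBall z K₁, ‖evol h z'.1 z'.2‖ₑ ^ 2 * w z' ^ (1 / n : ℝ) ≤
          4 * (∑ K' ∈ 𝒦, (K' : ℝ≥0∞) ^ ε * ∫⁻ z' in closedBall z (3 * K₁), Psi N K' h w z') +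
          4 * ((K₁ : ℝ≥0∞) ^ ε * (K₁ : ℝ≥0∞) ^ (n + 1) * Psi N K₁ h w z) + Psi N K h w z +
          C * broadSum hm N K ν b h z * avgW K w z := by
  classical
  have hn : 1 ≤ n := by omega
  have hn1 : (1 : ℝ) ≤ n := by exact_mod_cast hn
  set N' : ℕ := n * N + n + 1 with hN'
  have hNN : N ≤ N' := by
    have := Nat.le_mul_of_pos_left N (show 0 < n by omega)
    omega
  obtain ⟨𝒦, K₁, hK₁, hL, h𝒦, hcard, H⟩ := hP N' (by omega) ε hε L
  have hK₁r : (1 : ℝ) ≤ K₁ := by exact_mod_cast hK₁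
  set κ : ℝ := 1 / (2 * (2 * n * n + 2) * K₁) with hκ
  have hκ0 : 0 < κ := by positivity
  have hκ1 : κ ≤ 1 / 2 := by
    rw [hκ]
    apply one_div_le_one_div_of_le (by norm_num)
    nlinarith [mul_nonneg (by linarith : (0 : ℝ) ≤ n) (by linarith : (0 : ℝ) ≤ n)]
  have hκK : (2 * n * n + 2) * κ = 1 / 2 / K₁ := by
    rw [hκ]; field_simp
  set ν : ℝ := κ ^ (m + 1 + 1) / (m + 1 + 1).factorial with hν
  refine ⟨𝒦, K₁, ν, by positivity, hK₁, hL, h𝒦, hcard, 3 * n * K₁, fun K hK hd => ?_⟩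
  have hK3 : 3 * K₁ ≤ K := le_trans (Nat.mul_le_mul_right _ (by omega)) hK
  have hK1 : 1 ≤ K := by omega
  obtain ⟨D, hD, Hnar⟩ := narrow_step hn (N := N) (N' := N') le_rfl hNN ε hε 𝒦 hK₁ hK3 hd
    fun K' hK' => ⟨(h𝒦 K' hK').1, (h𝒦 K' hK').2.2⟩
  obtain ⟨Cs, hCs, Hs⟩ := small_part (n := n) N N' le_rfl
  obtain ⟨C3, hC3, H3⟩ := setLIntegral_rpow_le_avgW hn
  set ς : ℝ≥0∞ := (D + 1)⁻¹ with hς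
  have hςt : ς⁻¹ ≠ ⊤ := by rw [hς, inv_inv]; finiteness
  have hς0 : ς ≠ 0 := by rw [hς]; simp [hD]
  have hDς : D * ς ≤ 1 := by
    rw [hς, ← div_eq_mul_inv]
    exact ENNReal.div_le_of_le_mul (by rw [one_mul]; exact le_self_add)
  refine ⟨Cs * (caps n K).card ^ 2 * ς⁻¹ * (C3 * (K : ℝ≥0∞) ^ (n + 1)), by finiteness,
    fun b β h hh hc hb w hw z => ?_⟩
  have hKr : (3 : ℝ) * n * K₁ ≤ K := by exact_mod_cast hK
  have hK0 : (0 : ℝ) < K := by exact_mod_cast hK1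
  set S : Finset (Fin n → ℤ) := (caps n K).filter fun τ => ς * eS N K h z ≤ eI N K (cap K τ h) z with hS
  have hSc : S ⊆ caps n K := Finset.filter_subset _ _
  rcases narrow_or_broad (d := m + 1) (by omega) hm (by linarith : (0 : ℝ) ≤ n) hκ0 hκ1 b
    ((cpt K) '' (S : Set (Fin n → ℤ))) (by
      rintro _ ⟨τ, hτ, rfl⟩ i
      exact (abs_inner_basis_le b i _).trans (norm_cpt_le hK1 (hSc hτ))) with
    ⟨b', β₁, hb', hβ₁⟩ | ⟨c, hcS, hdet⟩
  · have h1 := Hnar h hh hc S hSc w hw z (ς * eS N K h z) (by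
      intro τ hτ
      rw [Finset.mem_sdiff, hS, Finset.mem_filter] at hτ
      by_contra hcon
      exact hτ.2 ⟨hτ.1, (not_le.1 hcon).le⟩) (by
      refine H b' (fun i => if i.val = m then β₁ else β i) _ (hh.part K S) (hc.part K S) ?_ w hw z
      intro ξ hξ i hi
      obtain ⟨τ, hτ, hξτ⟩ := part_ne_zero hξ
      split_ifs with him
      · have h2 := hβ₁ _ ⟨τ, hτ, rfl⟩
        have h3 : b' ⟨m + 1 - 1, by omega⟩ = b' i := by congr 1; ext; simp [him]
        rw [h3, hκK] at h2
        have h4 := (abs_inner_basis_le b' i (ξ - cpt K τ)).trans (norm_sub_cpt_le hK1 hξτ)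
        rw [inner_sub_right] at h4
        have h5 : (n : ℝ) / K ≤ 1 / 2 / K₁ := by
          rw [div_le_div_iff₀ hK0 (by linarith)]
          nlinarith
        have h6 : (1 : ℝ) / K₁ = 1 / 2 / K₁ + 1 / 2 / K₁ := by ring
        rw [abs_le] at *
        constructor <;> linarith
      · rw [hb' i (by omega)]
        refine (hb ξ (cap_ne_zero hξτ).1 i (by omega)).trans ?_
        apply one_div_le_one_div_of_le (by linarith)
        nlinarith)
    refine (h1.trans (add_le_add le_rfl ?_)).trans le_self_add
    calc D * (ς * eS N K h z) * avgW K w z = (D * ς) * Psi N K h w z := by unfold Psi; ring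
      _ ≤ 1 * Psi N K h w z := by gcongr
      _ = _ := one_mul _
  · refine le_trans ?_ le_add_self
    choose τ hτS hτ using hcS
    have hpt : ∀ z' ∈ closedBall z (K₁ : ℝ), ‖evol h z'.1 z'.2‖ₑ ^ 2 * w z' ^ (1 / n : ℝ) ≤
        (Cs * (caps n K).card ^ 2 * eS N K h z) * w z' ^ (1 / n : ℝ) := by
      intro z' hz'
      refine mul_le_mul' ?_ le_rfl
      have h1 := (Hs K hK1 h hh (caps n K) subset_rfl (eS N K h z) z z' (fun τ hτ =>
        Finset.single_le_sum (f := fun τ => eI N K (cap K τ h) z) (fun _ _ => bot_le) hτ) ?_).1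
      · have h2 : part K (caps n K) h = h := sum_cap hc
        rwa [h2] at h1
      · rw [mem_closedBall, dist_eq_norm] at hz'
        nlinarith
    have hprod : eS N K h z ≤ ς⁻¹ * broadSum hm N K ν b h z := by
      set p : ℝ := 1 / (m + 1 + 1 : ℕ) with hp
      have hp0 : 0 ≤ p := by positivity
      have h1 : ∀ j, eS N K h z ≤ ς⁻¹ * eI N K (cap K (τ j) h) z := by
        intro j
        have := (Finset.mem_filter.1 (hτS j)).2
        calc eS N K h z = ς⁻¹ * (ς * eS N K h z) := by
              rw [← mul_assoc, ENNReal.inv_mul_cancel hς0 (by rw [hς]; simp), one_mul]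
          _ ≤ _ := by gcongr
      have h2 : ∀ x : ℝ≥0∞, (x ^ p) ^ (m + 1 + 1) = x := by
        intro x
        rw [← ENNReal.rpow_natCast, ← ENNReal.rpow_mul, hp, one_div, inv_mul_cancel₀, ENNReal.rpow_one]
        positivity
      calc eS N K h z = ∏ _j : Fin (m + 1 + 1), eS N K h z ^ p := by simp [h2]
        _ ≤ ∏ j : Fin (m + 1 + 1), (ς⁻¹ * eI N K (cap K (τ j) h) z) ^ p := by
            gcongr with j _; exact h1 j
        _ = ς⁻¹ * ∏ j, eI N K (cap K (τ j) h) z ^ p := by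
            rw [prod_mul_rpow _ _ hp0, Fintype.card_fin, h2]
        _ ≤ _ := by
            refine mul_le_mul' le_rfl ?_
            unfold broadSum
            refine Finset.single_le_sum (f := fun τ : Fin (m + 1 + 1) → Fin n → ℤ =>
              ∏ j, eI N K (cap K (τ j) h) z ^ p) (fun _ _ => bot_le) ?_
            rw [Finset.mem_filter, Fintype.mem_piFinset]
            refine ⟨fun j => hSc (hτS j), ?_⟩
            simpa only [hτ] using hdet
    refine (setLIntegral_mono' measurableSet_closedBall hpt).trans ?_
    rw [lintegral_const_mul _ (hw.pow_const _)]
    have h4 : ∫⁻ z' in closedBall z (K₁ : ℝ), w z' ^ (1 / n : ℝ) ≤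
        C3 * (K : ℝ≥0∞) ^ (n + 1) * avgW K w z :=
      (lintegral_mono_set (closedBall_subset_closedBall (by nlinarith))).trans (H3 K hK1 w hw z)
    calc _ ≤ Cs * (caps n K).card ^ 2 * (ς⁻¹ * broadSum hm N K ν b h z) *
          (C3 * (K : ℝ≥0∞) ^ (n + 1) * avgW K w z) := by gcongr
      _ = _ := by ring

lemma lintegral_rpow_mul_rpow_le {α : Type*} [MeasurableSpace α] {μ : Measure α} {f g : α → ℝ≥0∞}
    (hf : Measurable f) (hg : Measurable g) {p q r : ℝ} (hp : 0 ≤ p) (hq : 0 ≤ q) (hr : 0 ≤ r)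
    (h : p + q + r = 1) :
    ∫⁻ a, f a ^ p * g a ^ q ∂μ ≤ (∫⁻ a, f a ∂μ) ^ p * (∫⁻ a, g a ∂μ) ^ q * μ univ ^ r := by
  have := ENNReal.lintegral_prod_norm_pow_le (μ := μ) (Finset.univ : Finset (Fin 3))
    (f := ![f, g, fun _ => 1]) (p := ![p, q, r]) (by
      intro i _; fin_cases i
      · exact hf.aemeasurable
      · exact hg.aemeasurable
      · exact aemeasurable_const) (by simp [Fin.sum_univ_three, h])
    (by intro i _; fin_cases i <;> simpa)
  simpa [Fin.prod_univ_three] using this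

lemma eI_cap_le_eS (n N : ℕ) : ∃ C : ℝ≥0∞, C ≠ ⊤ ∧ ∀ K R : ℕ, 1 ≤ K → 1 ≤ R → K ∣ R →
    ∀ h : Euc n → ℂ, Nice h → InCube h → ∀ τ z, eI N R (cap K τ h) z ≤ C * eS N R h z := by
  obtain ⟨C, hC, H⟩ := eI_le_sum_cap n N
  refine ⟨C, hC, fun K R hK hR hd h hh hc τ z => (H R hR _ (hh.cap K τ) (hc.cap K τ) z).trans ?_⟩
  refine mul_le_mul' le_rfl (Finset.sum_le_sum fun σ _ => ?_)
  rw [cap_comm]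
  rcases cap_cap hK hR hd τ σ h with h1 | h1
  · rw [h1]
  · rw [h1, eI_zero]; exact bot_le

lemma setLIntegral_mass_le {n : ℕ} {w : Euc n × ℝ → ℝ≥0∞} (hw : Measurable w) {K : ℕ} (hK : 1 ≤ K)
    (z₀ : Euc n × ℝ) (r : ℝ) :
    ∫⁻ z in closedBall z₀ r, ((K : ℝ≥0∞) ^ (n + 1))⁻¹ * ∫⁻ z' in closedBall z (5 * K), w z' ≤
      volume (closedBall (0 : Euc n × ℝ) 5) * ∫⁻ z in closedBall z₀ (r + 5 * K), w z := by
  have hK0 : (0 : ℝ) < K := by exact_mod_cast hK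
  have hX0 : (K : ℝ≥0∞) ^ (n + 1) ≠ 0 := by
    have : (K : ℝ≥0∞) ≠ 0 := by exact_mod_cast (by omega : K ≠ 0)
    positivity
  have hXt : (K : ℝ≥0∞) ^ (n + 1) ≠ ⊤ := by finiteness
  rw [lintegral_const_mul' _ _ (by finiteness)]
  have h1 : ∀ z : Euc n × ℝ, ∫⁻ z' in closedBall z (5 * K : ℝ), w z' =
      ∫⁻ y in closedBall (0 : Euc n × ℝ) (5 * K), w (z + y) := by
    intro z
    simp_rw [add_comm z]
    rw [setLIntegral_add_right, zero_add]
  simp_rw [h1]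
  have h2 := setLIntegral_avg_le (μ := (volume : Measure (Euc n × ℝ))) (ν := (volume : Measure (Euc n × ℝ)))
    hw (ι := fun y => y) measurable_id (K := closedBall (0 : Euc n × ℝ) (5 * K)) measurableSet_closedBall
    (r := 5 * K) (fun y hy => by simpa using hy) z₀ r
  calc _ ≤ ((K : ℝ≥0∞) ^ (n + 1))⁻¹ * (volume (closedBall (0 : Euc n × ℝ) (5 * K)) *
        ∫⁻ z in closedBall z₀ (r + 5 * K), w z) := by gcongr
    _ = _ := by
      rw [show (5 : ℝ) * K = K * 5 by ring, volume_closedBall_eq _ hK0, ENNReal.ofReal_natCast, ← mul_assoc,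
        ← mul_assoc, ENNReal.inv_mul_cancel hX0 hXt, one_mul]

lemma broad_term {n d : ℕ} (hd : 1 ≤ d) (hdn : d ≤ n) (hdn' : d + 1 ≤ n) {N Ne : ℕ} (hN : n < N)
    (hNe : n * (n * N) + n + 1 ≤ Ne) {ν : ℝ} (hν : 0 < ν) :
    ∃ C₁ : ℝ≥0∞, C₁ ≠ ⊤ ∧ 1 ≤ C₁ ∧ ∀ K : ℕ, 2 ≤ K → ∃ C : ℝ≥0∞, C ≠ ⊤ ∧ ∀ l : ℕ, 2 ≤ l →
    ∀ (b : ONB n) (β : Fin n → ℝ) (h : Euc n → ℂ),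
      Nice h → InCube h →
      (∀ ξ, h ξ ≠ 0 → ∀ i : Fin n, d ≤ i.val → |⟪b i, ξ⟫_ℝ - β i| ≤ 1 / (K : ℝ) ^ l) →
      ∀ w : Euc n × ℝ → ℝ≥0∞, Measurable w → ∀ z₀ : Euc n × ℝ,
        ∫⁻ z in closedBall z₀ (2 * (K : ℝ) ^ l), broadSum hdn Ne K ν b h z * avgW K w z ≤
          C * C₁ ^ l * ((K ^ l : ℕ) : ℝ≥0∞) ^ (n + 1) * Psi N (K ^ l) h w z₀ := by
  have hn : 1 ≤ n := by omega
  have hn0 : (0 : ℝ) < n := by exact_mod_cast hn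
  have hd0 : (0 : ℝ) < d := by exact_mod_cast hd
  obtain ⟨Cw, hCw, Hw⟩ := broad_window hd hdn hN le_rfl hNe hν
  obtain ⟨C2, hC2, H2⟩ := eI_cap_le_eS n N
  set p : ℝ := d / (d + 1) with hp
  set q : ℝ := 1 / n with hq
  set r : ℝ := 1 - p - q with hr
  have hp0 : 0 ≤ p := by positivity
  have hp1 : p ≤ 1 := by rw [hp, div_le_one (by positivity)]; linarith
  have hq0 : 0 ≤ q := by positivity
  have hr0 : 0 ≤ r := by
    have : (d : ℝ) + 1 ≤ n := by exact_mod_cast hdn'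
    have h1 : q ≤ 1 / (d + 1) := one_div_le_one_div_of_le (by positivity) this
    have h2 : p = 1 - 1 / (d + 1) := by rw [hp]; field_simp; ring
    rw [hr, h2]; linarith
  set V5 := volume (closedBall (0 : Euc n × ℝ) 5) with hV5
  set V2 := volume (closedBall (0 : Euc n × ℝ) 2) with hV2
  have hV5t : V5 ≠ ⊤ := measure_closedBall_lt_top.ne
  have hV2t : V2 ≠ ⊤ := measure_closedBall_lt_top.ne
  refine ⟨Cw + 1, by finiteness, le_add_self, fun K hK => ⟨((Fintype.piFinset fun _ : Fin (d + 1) =>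
    caps n K).card : ℝ≥0∞) * (C2 * V5 ^ q * V2 ^ r), ?_, fun l hl b β h hh hc hb w hw z₀ => ?_⟩⟩
  · have := ENNReal.rpow_ne_top_of_nonneg hq0 hV5t
    have := ENNReal.rpow_ne_top_of_nonneg hr0 hV2t
    finiteness
  have hK1 : 1 ≤ K := by omega
  have hKl1 : 1 ≤ K ^ l := Nat.one_le_pow _ _ (by omega)
  set R : ℕ := K ^ l with hR
  have hRr : (K : ℝ) ^ l = (R : ℝ) := by rw [hR]; push_cast; ring
  have hR0 : (0 : ℝ) < R := by exact_mod_cast hKl1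
  have hKR : 2 * (K : ℝ) ≤ R := by
    have : 2 * K ≤ R := by
      calc 2 * K ≤ K * K := Nat.mul_le_mul_right _ hK
        _ = K ^ 2 := by ring
        _ ≤ R := Nat.pow_le_pow_right (by omega) hl
    exact_mod_cast this
  rw [hRr]
  set E := eS N R h z₀ with hE
  set X : ℝ≥0∞ := (R : ℝ≥0∞) ^ (n + 1) with hX
  have hX0 : X ≠ 0 := by
    have : (R : ℝ≥0∞) ≠ 0 := by exact_mod_cast (by omega : R ≠ 0)
    positivity
  have hXt : X ≠ ⊤ := by finiteness
  have hmain : ∀ τ ∈ (Fintype.piFinset fun _ : Fin (d + 1) => caps n K),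
      ν ≤ |(vmat fun j i => 2 * ⟪b (Fin.castLE hdn i), cpt K (τ j)⟫_ℝ).det| →
      ∫⁻ z in closedBall z₀ (2 * (R : ℝ)),
        (∏ j, eI Ne K (cap K (τ j) h) z ^ (1 / (d + 1 : ℕ) : ℝ)) * avgW K w z ≤
      (C2 * V5 ^ q * V2 ^ r) * (Cw + 1) ^ l * X * Psi N R h w z₀ := by
    intro τ hτ hdet
    rw [Fintype.mem_piFinset] at hτ
    have h1 := Hw K l hK1 (by omega) b β (fun j => cpt K (τ j)) (fun j => cap K (τ j) h)
      (fun j => hh.cap _ _) (fun j => hc.cap _ _) (fun j => norm_cpt_le hK1 (hτ j))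
      (fun j ξ hξ => norm_sub_cpt_le hK1 hξ)
      (fun j ξ hξ => hb ξ (cap_ne_zero hξ).1) hdet z₀
    rw [hRr] at h1
    have h2 : ∏ j, eI N R (cap K (τ j) h) z₀ ^ (1 / d : ℝ) ≤ (C2 * E) ^ ((d + 1) / d : ℝ) := by
      calc _ ≤ ∏ _j : Fin (d + 1), (C2 * E) ^ (1 / d : ℝ) := by
            gcongr with j _
            exact H2 K R hK1 hKl1 (dvd_pow_self K (by omega)) h hh hc _ _
        _ = _ := by
            rw [Finset.prod_const, Finset.card_univ, Fintype.card_fin, ← ENNReal.rpow_natCast,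
              ← ENNReal.rpow_mul]
            congr 1
            push_cast; field_simp
    have h3 : (∫⁻ z in closedBall z₀ (2 * (R : ℝ)), ∏ j, eI Ne K (cap K (τ j) h) z ^ (1 / d : ℝ)) ^ p ≤
        (Cw + 1) ^ l * X ^ p * (C2 * E) := by
      refine (ENNReal.rpow_le_rpow (h1.trans (mul_le_mul' le_rfl h2)) hp0).trans ?_
      rw [ENNReal.mul_rpow_of_nonneg _ _ hp0, ENNReal.mul_rpow_of_nonneg _ _ hp0,
        ← ENNReal.rpow_mul, show ((d : ℝ) + 1) / d * p = 1 by rw [hp]; field_simp, ENNReal.rpow_one,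
        ENNReal.ofReal_pow hR0.le, ENNReal.ofReal_natCast]
      gcongr
      calc (Cw ^ l) ^ p ≤ ((Cw + 1) ^ l) ^ p := by gcongr; exact le_self_add
        _ ≤ ((Cw + 1) ^ l) ^ (1 : ℝ) :=
            ENNReal.rpow_le_rpow_of_exponent_le (one_le_pow₀ le_add_self) hp1
        _ = _ := ENNReal.rpow_one _
    have h4 : (∫⁻ z in closedBall z₀ (2 * (R : ℝ)), ((K : ℝ≥0∞) ^ (n + 1))⁻¹ *
        ∫⁻ z' in closedBall z (5 * K), w z') ^ q ≤ V5 ^ q * (X ^ q * avgW R w z₀) := by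
      refine (ENNReal.rpow_le_rpow (setLIntegral_mass_le hw hK1 z₀ _) hq0).trans ?_
      have hXq : X ^ q * avgW R w z₀ = (∫⁻ z' in closedBall z₀ (5 * R), w z') ^ q := by
        rw [avgW, ← ENNReal.mul_rpow_of_nonneg _ _ hq0, ← mul_assoc,
          ENNReal.mul_inv_cancel hX0 hXt, one_mul]
      rw [hXq, ENNReal.mul_rpow_of_nonneg _ _ hq0]
      refine mul_le_mul' le_rfl (ENNReal.rpow_le_rpow (lintegral_mono_set ?_) hq0)
      exact closedBall_subset_closedBall (by linarith)
    have h5 : volume.restrict (closedBall z₀ (2 * (R : ℝ))) univ ^ r = X ^ r * V2 ^ r := by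
      rw [Measure.restrict_apply MeasurableSet.univ, univ_inter, mul_comm, volume_closedBall_eq _ hR0,
        ENNReal.ofReal_natCast, ENNReal.mul_rpow_of_nonneg _ _ hr0]
    have h6 : ∀ z, (∏ j, eI Ne K (cap K (τ j) h) z ^ (1 / (d + 1 : ℕ) : ℝ)) * avgW K w z =
        (∏ j, eI Ne K (cap K (τ j) h) z ^ (1 / d : ℝ)) ^ p *
        (((K : ℝ≥0∞) ^ (n + 1))⁻¹ * ∫⁻ z' in closedBall z (5 * K), w z') ^ q := by
      intro z
      rw [← ENNReal.prod_rpow_of_nonneg hp0, avgW]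
      congr 2
      ext j
      rw [← ENNReal.rpow_mul]
      congr 1
      rw [hp]; push_cast; field_simp
    simp_rw [h6]
    refine (lintegral_rpow_mul_rpow_le (Finset.measurable_prod _ fun j _ =>
      (measurable_eI Ne K (hh.cap K _)).pow_const _)
      ((measurable_setLIntegral_closedBall hw _).const_mul _) hp0 hq0 hr0 (by rw [hr]; ring)).trans ?_
    rw [h5]
    calc _ ≤ ((Cw + 1) ^ l * X ^ p * (C2 * E)) * (V5 ^ q * (X ^ q * avgW R w z₀)) *
          (X ^ r * V2 ^ r) := by gcongr
      _ = (C2 * V5 ^ q * V2 ^ r) * (Cw + 1) ^ l * (X ^ p * X ^ q * X ^ r) * Psi N R h w z₀ := by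
          unfold Psi; ring
      _ = _ := by
          rw [← ENNReal.rpow_add _ _ hX0 hXt, ← ENNReal.rpow_add _ _ hX0 hXt,
            show p + q + r = 1 by rw [hr]; ring, ENNReal.rpow_one]
  unfold broadSum
  simp_rw [Finset.sum_mul]
  rw [lintegral_finsetSum]
  · refine (Finset.sum_le_card_nsmul _ _ _ fun τ hτ => hmain τ (Finset.mem_filter.1 hτ).1
      (Finset.mem_filter.1 hτ).2).trans ?_
    rw [nsmul_eq_mul]
    calc _ ≤ ((Fintype.piFinset fun _ : Fin (d + 1) => caps n K).card : ℝ≥0∞) *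
          ((C2 * V5 ^ q * V2 ^ r) * (Cw + 1) ^ l * X * Psi N R h w z₀) := by
          gcongr; exact Finset.filter_subset _ _
      _ = _ := by ring
  · intro τ _
    exact (Finset.measurable_prod _ fun _ _ => (measurable_eI Ne K (hh.cap K _)).pow_const _).mul
      (measurable_avgW K hw)

lemma setLIntegral_le_ball_avg {n : ℕ} {F : Euc n × ℝ → ℝ≥0∞} (hF : Measurable F) (z₀ : Euc n × ℝ)
    (R r : ℝ) :
    volume (closedBall (0 : Euc n × ℝ) r) * ∫⁻ z in closedBall z₀ R, F z ≤
      ∫⁻ z in closedBall z₀ (R + r), ∫⁻ z' in closedBall z r, F z' := by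
  refine (setLIntegral_le_avg (ν := (volume : Measure (Euc n × ℝ))) hF measurable_id
    measurableSet_closedBall (fun y hy => by simpa using hy) z₀ R).trans_eq ?_
  congr 1
  ext z
  simp only [id]
  simp_rw [add_comm z]
  rw [setLIntegral_add_right F, zero_add]

lemma setLIntegral_ball_avg_le {n : ℕ} {F : Euc n × ℝ → ℝ≥0∞} (hF : Measurable F) (z₀ : Euc n × ℝ)
    (R r : ℝ) :
    ∫⁻ z in closedBall z₀ R, ∫⁻ z' in closedBall z r, F z' ≤
      volume (closedBall (0 : Euc n × ℝ) r) * ∫⁻ z in closedBall z₀ (R + r), F z := by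
  refine Eq.trans_le ?_ (setLIntegral_avg_le (ν := (volume : Measure (Euc n × ℝ))) hF measurable_id
    measurableSet_closedBall (fun y hy => by simpa using hy) z₀ R)
  congr 1
  ext z
  simp only [id]
  simp_rw [add_comm z]
  rw [setLIntegral_add_right F, zero_add]

lemma tendsto_natCast_rpow_top {ε : ℝ} (hε : 0 < ε) :
    Tendsto (fun K : ℕ => (K : ℝ≥0∞) ^ ε) atTop (𝓝 ⊤) := by
  have := (ENNReal.continuous_rpow_const (y := ε)).tendsto ⊤
  rw [ENNReal.top_rpow_of_pos hε] at this
  exact this.comp ENNReal.tendsto_nat_nhds_top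

lemma exists_forall_le_natCast_rpow {ε : ℝ} (hε : 0 < ε) {A : ℝ≥0∞} (hA : A ≠ ⊤) :
    ∃ L : ℕ, ∀ K, L ≤ K → A ≤ (K : ℝ≥0∞) ^ ε :=
  eventually_atTop.1 (((tendsto_natCast_rpow_top hε).eventually (lt_mem_nhds hA.lt_top)).mono
    fun _ h => h.le)

lemma add_three_le {a b c T : ℝ≥0∞} (ha : 3 * a ≤ T) (hb : 3 * b ≤ T) (hc : 3 * c ≤ T) :
    a + b + c ≤ T := by
  have h : 3 * (a + b + c) ≤ 3 * T := by
    calc 3 * (a + b + c) = 3 * a + 3 * b + 3 * c := by ring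
      _ ≤ T + T + T := by gcongr
      _ = 3 * T := by ring
  exact (ENNReal.mul_le_mul_iff_right (by norm_num) (by norm_num)).1 h

lemma lintegral_four_terms {α ι : Type*} [MeasurableSpace α] {μ : Measure α} (s : Finset ι)
    (c : ι → ℝ≥0∞) {g : ι → α → ℝ≥0∞} (hg : ∀ i, Measurable (g i)) (a : ℝ≥0∞) {p q : α → ℝ≥0∞}
    (hp : Measurable p) (hq : Measurable q) (r : α → ℝ≥0∞) {C : ℝ≥0∞} (hC : C ≠ ⊤) :
    ∫⁻ z, (4 * (∑ i ∈ s, c i * g i z) + 4 * (a * p z) + q z + C * r z) ∂μ =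
      4 * (∑ i ∈ s, c i * ∫⁻ z, g i z ∂μ) + 4 * (a * ∫⁻ z, p z ∂μ) + (∫⁻ z, q z ∂μ) +
        C * ∫⁻ z, r z ∂μ := by
  have h1 : Measurable fun z => 4 * ∑ i ∈ s, c i * g i z :=
    (Finset.measurable_sum _ fun i _ => (hg i).const_mul _).const_mul _
  have h2 : Measurable fun z => 4 * (a * p z) := (hp.const_mul _).const_mul _
  have h12 : Measurable fun z => 4 * (∑ i ∈ s, c i * g i z) + 4 * (a * p z) := h1.add h2
  have h3 : Measurable fun z => 4 * (∑ i ∈ s, c i * g i z) + 4 * (a * p z) + q z := h12.add hq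
  rw [lintegral_add_left h3, lintegral_add_left h12, lintegral_add_left h1,
    lintegral_const_mul _ (Finset.measurable_sum _ fun i _ => (hg i).const_mul _),
    lintegral_finsetSum _ fun i _ => (hg i).const_mul _, lintegral_const_mul _ (hp.const_mul _),
    lintegral_const_mul _ hp, lintegral_const_mul' _ _ hC]
  simp_rw [lintegral_const_mul _ (hg _)]

theorem decoupling_succ {n m : ℕ} (hm : m + 2 ≤ n) (hP : Decoupling n m) : Decoupling n (m + 1) := by
  classical
  intro N hN ε hε L
  have hn : 1 ≤ n := by omega
  set Ne : ℕ := n * (n * N) + n + 1 with hNe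
  have hNNe : N ≤ Ne := by
    have h1 : N ≤ n * N := Nat.le_mul_of_pos_left _ hn
    have h2 : n * N ≤ n * (n * N) := Nat.le_mul_of_pos_left _ hn
    omega
  set V1 := volume (closedBall (0 : Euc n × ℝ) 1) with hV1
  set V3 := volume (closedBall (0 : Euc n × ℝ) 3) with hV3
  have hV1t : V1 ≠ ⊤ := measure_closedBall_lt_top.ne
  have hV3t : V3 ≠ ⊤ := measure_closedBall_lt_top.ne
  have hV10 : V1 ≠ 0 := by
    exact (measure_closedBall_pos _ _ one_pos).ne'
  have hε2 : 0 < ε / 2 := by positivity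
  obtain ⟨LA, hLA⟩ := exists_forall_le_natCast_rpow hε2
    (show V1⁻¹ * (12 * (V3 + 1)) ≠ ⊤ by finiteness)
  obtain ⟨𝒦, K₁, ν, hν, hK₁, hLK₁, h𝒦, hcard, K₀, H⟩ :=
    broad_narrow (by omega : m + 1 ≤ n) hP Ne hε2 (max L LA)
  obtain ⟨C₁, hC₁t, hC₁1, HB⟩ := broad_term (N := N) (Ne := Ne) (by omega : 1 ≤ m + 1)
    (by omega : m + 1 ≤ n) (by omega) hN le_rfl hν
  obtain ⟨LC, hLC⟩ := exists_forall_le_natCast_rpow hε2 hC₁t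
  set K : ℕ := K₁ * (max (max K₀ 2) (max (max L LA) LC)) with hK
  have hKM : max (max K₀ 2) (max (max L LA) LC) ≤ K := Nat.le_mul_of_pos_left _ hK₁
  simp only [max_le_iff] at hKM hLK₁ h𝒦
  obtain ⟨⟨hKK₀, hK2⟩, ⟨hKL, hKLA⟩, hKLC⟩ := hKM
  have hK₁K : K₁ ∣ K := Dvd.intro _ rfl
  obtain ⟨Cn, hCn, Hn⟩ := H K hKK₀ hK₁K
  obtain ⟨Cb, hCb, Hb⟩ := HB K hK2
  obtain ⟨l₀, hl₀⟩ := exists_forall_le_natCast_rpow hε2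
    (show V1⁻¹ * (Cn * Cb) ≠ ⊤ by finiteness)
  set l : ℕ := max l₀ 2 with hl
  have hl2 : 2 ≤ l := le_max_right _ _
  set R : ℕ := K ^ l with hR
  have hKR : 2 * K ≤ R := by
    calc 2 * K ≤ K * K := Nat.mul_le_mul_right _ hK2
      _ = K ^ 2 := by ring
      _ ≤ R := Nat.pow_le_pow_right (by omega) hl2
  have hK₁K' : K₁ ≤ K := Nat.le_of_dvd (by omega) hK₁K
  have hlR : l₀ ≤ R := (le_max_left l₀ 2).trans (Nat.lt_pow_self (by omega)).le
  have hKdR : K ∣ R := dvd_pow_self K (by omega)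
  have hRr : (K : ℝ) ^ l = (R : ℝ) := by rw [hR]; push_cast; ring
  refine ⟨insert K (insert K₁ 𝒦), R, by omega, by omega, ?_, ?_, fun b β h hh hc hb w hw z₀ => ?_⟩
  · intro K' hK'
    simp only [Finset.mem_insert] at hK'
    rcases hK' with rfl | rfl | hK'
    · exact ⟨by omega, hKL, hKdR⟩
    · exact ⟨hK₁, hLK₁.1, hK₁K.trans hKdR⟩
    · obtain ⟨h1, h2, h3⟩ := h𝒦 K' hK'
      exact ⟨h1, h2.1, (h3.trans hK₁K).trans hKdR⟩
  · refine (Finset.card_insert_le _ _).trans ?_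
    have := Finset.card_insert_le K₁ 𝒦
    omega
  have hKRr : 2 * (K : ℝ) ≤ R := by exact_mod_cast hKR
  have hK₁Kr : (K₁ : ℝ) ≤ K := by exact_mod_cast hK₁K'
  have hK₁r : (1 : ℝ) ≤ K₁ := by exact_mod_cast hK₁
  have hK2r : (2 : ℝ) ≤ K := by exact_mod_cast hK2
  have hbK : ∀ ξ, h ξ ≠ 0 → ∀ i : Fin n, m + 1 ≤ i.val → |⟪b i, ξ⟫_ℝ - β i| ≤ 1 / K :=
    fun ξ hξ i hi => (hb ξ hξ i hi).trans
      (one_div_le_one_div_of_le (by linarith) (by linarith))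
  set X : ℝ≥0∞ := (K₁ : ℝ≥0∞) ^ (n + 1) with hX
  have hK₁e : (1 : ℝ≥0∞) ≤ K₁ := by exact_mod_cast hK₁
  have hX1 : 1 ≤ X := one_le_pow₀ hK₁e
  have hXt : X ≠ ⊤ := by finiteness
  have hvol : ∀ c : ℝ, volume (closedBall (0 : Euc n × ℝ) ((K₁ : ℝ) * c)) =
      X * volume (closedBall (0 : Euc n × ℝ) c) := fun c => by
    rw [volume_closedBall_eq _ (by linarith), ENNReal.ofReal_natCast]
  have hvol1 : volume (closedBall (0 : Euc n × ℝ) K₁) = X * V1 := by simpa using hvol 1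
  have hF : Measurable fun z : Euc n × ℝ => ‖evol h z.1 z.2‖ₑ ^ 2 * w z ^ (1 / n : ℝ) :=
    ((measurable_enorm_evol_comp hh measurable_fst measurable_snd).pow_const 2).mul (hw.pow_const _)
  set I : ℕ → ℝ≥0∞ := fun K' => ∫⁻ z in closedBall z₀ (3 * R), Psi N K' h w z with hI
  set S : ℝ≥0∞ := ∑ K' ∈ insert K (insert K₁ 𝒦), (K' : ℝ≥0∞) ^ ε * I K' with hS
  have hA : ∀ K', LA ≤ K' → 1 ≤ K' → 12 * (V3 + 1) * (K' : ℝ≥0∞) ^ (ε / 2) ≤ V1 * (K' : ℝ≥0∞) ^ ε := by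
    intro K' hK' hK'1
    have h0 : (K' : ℝ≥0∞) ≠ 0 := by exact_mod_cast (by omega : K' ≠ 0)
    calc _ = V1 * ((V1⁻¹ * (12 * (V3 + 1))) * (K' : ℝ≥0∞) ^ (ε / 2)) := by
          rw [← mul_assoc, ← mul_assoc V1, ENNReal.mul_inv_cancel hV10 hV1t, one_mul]
      _ ≤ V1 * ((K' : ℝ≥0∞) ^ (ε / 2) * (K' : ℝ≥0∞) ^ (ε / 2)) := by
          gcongr; exact hLA K' hK'
      _ = _ := by
          rw [← ENNReal.rpow_add _ _ h0 (ENNReal.natCast_ne_top _), add_halves]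
  have hmem : ∀ K' ∈ insert K (insert K₁ 𝒦), (K' : ℝ≥0∞) ^ ε * I K' ≤ S := fun K' hK' =>
    Finset.single_le_sum (f := fun K' : ℕ => (K' : ℝ≥0∞) ^ ε * I K') (fun _ _ => bot_le) hK'
  set T1 : ℝ≥0∞ := 4 * ∑ K' ∈ 𝒦, (K' : ℝ≥0∞) ^ (ε / 2) * (X * V3 * I K') with hT1
  set T2 : ℝ≥0∞ := 4 * ((K₁ : ℝ≥0∞) ^ (ε / 2) * X * I K₁) with hT2
  set T4 : ℝ≥0∞ := Cn * (Cb * C₁ ^ l * (R : ℝ≥0∞) ^ (n + 1) * Psi N R h w z₀) with hT4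
  have h1 : 3 * T1 ≤ X * V1 * S := by
    calc 3 * T1 = ∑ K' ∈ 𝒦, X * (12 * V3 * (K' : ℝ≥0∞) ^ (ε / 2)) * I K' := by
          rw [hT1, ← mul_assoc, Finset.mul_sum]
          refine Finset.sum_congr rfl fun K' _ => ?_
          ring
      _ ≤ ∑ K' ∈ 𝒦, X * (V1 * (K' : ℝ≥0∞) ^ ε) * I K' := by
          refine Finset.sum_le_sum fun K' hK' => mul_le_mul' (mul_le_mul' le_rfl ?_) le_rfl
          refine le_trans ?_ (hA K' (h𝒦 K' hK').2.1.2 (h𝒦 K' hK').1)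
          gcongr; exact le_self_add
      _ = X * V1 * ∑ K' ∈ 𝒦, (K' : ℝ≥0∞) ^ ε * I K' := by
          rw [Finset.mul_sum]; refine Finset.sum_congr rfl fun K' _ => ?_
          ring
      _ ≤ _ := by
          refine mul_le_mul' le_rfl (Finset.sum_le_sum_of_subset ?_)
          exact (Finset.subset_insert _ _).trans (Finset.subset_insert _ _)
  have h2 : 3 * T2 ≤ X * V1 * S := by
    calc 3 * T2 = X * (12 * 1 * (K₁ : ℝ≥0∞) ^ (ε / 2)) * I K₁ := by rw [hT2]; ring
      _ ≤ X * (V1 * (K₁ : ℝ≥0∞) ^ ε) * I K₁ := by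
          refine mul_le_mul' (mul_le_mul' le_rfl ?_) le_rfl
          refine le_trans ?_ (hA K₁ hLK₁.2 hK₁)
          gcongr; exact le_add_self
      _ = X * V1 * ((K₁ : ℝ≥0∞) ^ ε * I K₁) := by ring
      _ ≤ _ := mul_le_mul' le_rfl (hmem _ (by simp))
  have h3 : 3 * I K ≤ X * V1 * S := by
    calc 3 * I K ≤ X * (12 * 1 * (K : ℝ≥0∞) ^ (ε / 2)) * I K := by
          refine mul_le_mul' ?_ le_rfl
          have : (1 : ℝ≥0∞) ≤ (K : ℝ≥0∞) ^ (ε / 2) :=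
            ENNReal.one_le_rpow (by exact_mod_cast (by omega : 1 ≤ K)) hε2
          calc (3 : ℝ≥0∞) ≤ 1 * (12 * 1 * 1) := by norm_num
            _ ≤ _ := by gcongr
      _ ≤ X * (V1 * (K : ℝ≥0∞) ^ ε) * I K := by
          refine mul_le_mul' (mul_le_mul' le_rfl ?_) le_rfl
          refine le_trans ?_ (hA K hKLA (by omega))
          gcongr; exact le_add_self
      _ = X * V1 * ((K : ℝ≥0∞) ^ ε * I K) := by ring
      _ ≤ _ := mul_le_mul' le_rfl (hmem _ (by simp))
  have h4 : T4 ≤ X * V1 * ((R : ℝ≥0∞) ^ ε * (R : ℝ≥0∞) ^ (n + 1) * Psi N R h w z₀) := by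
    have hR0 : (R : ℝ≥0∞) ≠ 0 := by exact_mod_cast (by omega : R ≠ 0)
    have hCl : C₁ ^ l ≤ (R : ℝ≥0∞) ^ (ε / 2) := by
      calc C₁ ^ l ≤ ((K : ℝ≥0∞) ^ (ε / 2)) ^ l := pow_le_pow_left' (hLC K hKLC) l
        _ = _ := by
          rw [hR, Nat.cast_pow, ← ENNReal.rpow_natCast, ← ENNReal.rpow_mul, mul_comm (ε / 2),
            ENNReal.rpow_mul, ENNReal.rpow_natCast]
    calc T4 = V1 * ((V1⁻¹ * (Cn * Cb)) * C₁ ^ l) * ((R : ℝ≥0∞) ^ (n + 1) * Psi N R h w z₀) := by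
          rw [← mul_assoc V1, ← mul_assoc V1, ENNReal.mul_inv_cancel hV10 hV1t, one_mul, hT4]; ring
      _ ≤ V1 * ((R : ℝ≥0∞) ^ (ε / 2) * (R : ℝ≥0∞) ^ (ε / 2)) * ((R : ℝ≥0∞) ^ (n + 1) * Psi N R h w z₀) := by
          gcongr; exact hl₀ R hlR
      _ = 1 * (V1 * ((R : ℝ≥0∞) ^ ε * (R : ℝ≥0∞) ^ (n + 1) * Psi N R h w z₀)) := by
          rw [← ENNReal.rpow_add _ _ hR0 (ENNReal.natCast_ne_top _), add_halves]; ring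
      _ ≤ X * (V1 * ((R : ℝ≥0∞) ^ ε * (R : ℝ≥0∞) ^ (n + 1) * Psi N R h w z₀)) := by gcongr
      _ = _ := by ring
  have hXV0 : X * V1 ≠ 0 := mul_ne_zero (by positivity) hV10
  have hXVt : X * V1 ≠ ⊤ := by finiteness
  refine (ENNReal.mul_le_mul_iff_right hXV0 hXVt).1 ?_
  rw [mul_add]
  refine le_trans ?_ (add_le_add (add_three_le h1 h2 h3) h4)
  have hmeasPsi : ∀ N K', Measurable (Psi N K' h w) := fun N K' => measurable_Psi N K' hh hw
  have hmeasB : ∀ N K' r, Measurable fun z => ∫⁻ z' in closedBall z r, Psi N K' h w z' :=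
    fun N K' r => measurable_setLIntegral_closedBall (hmeasPsi N K') r
  have hball : closedBall z₀ (R + K₁ : ℝ) ⊆ closedBall z₀ (3 * R) :=
    closedBall_subset_closedBall (by linarith)
  calc X * V1 * ∫⁻ z in closedBall z₀ R, ‖evol h z.1 z.2‖ₑ ^ 2 * w z ^ (1 / n : ℝ)
      ≤ ∫⁻ z in closedBall z₀ (R + K₁), ∫⁻ z' in closedBall z K₁,
          ‖evol h z'.1 z'.2‖ₑ ^ 2 * w z' ^ (1 / n : ℝ) := by
        rw [← hvol1]; exact setLIntegral_le_ball_avg hF z₀ R K₁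
    _ ≤ ∫⁻ z in closedBall z₀ (R + K₁),
          (4 * (∑ K' ∈ 𝒦, (K' : ℝ≥0∞) ^ (ε / 2) * ∫⁻ z' in closedBall z (3 * K₁), Psi N K' h w z') +
          4 * ((K₁ : ℝ≥0∞) ^ (ε / 2) * X * Psi N K₁ h w z) + Psi N K h w z +
          Cn * (broadSum (by omega : m + 1 ≤ n) Ne K ν b h z * avgW K w z)) := by
        refine lintegral_mono fun z => (Hn b β h hh hc hbK w hw z).trans ?_
        rw [mul_assoc Cn]
        refine add_le_add (add_le_add (add_le_add ?_ ?_) (Psi_anti hNNe _ _ _ _)) le_rfl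
        · refine mul_le_mul' le_rfl (Finset.sum_le_sum fun K' _ => mul_le_mul' le_rfl
            (lintegral_mono fun z' => Psi_anti hNNe _ _ _ _))
        · exact mul_le_mul' le_rfl (mul_le_mul' le_rfl (Psi_anti hNNe _ _ _ _))
    _ = (4 * (∑ K' ∈ 𝒦, (K' : ℝ≥0∞) ^ (ε / 2) * ∫⁻ z in closedBall z₀ (R + K₁),
            ∫⁻ z' in closedBall z (3 * K₁), Psi N K' h w z')) +
          (4 * ((K₁ : ℝ≥0∞) ^ (ε / 2) * X * ∫⁻ z in closedBall z₀ (R + K₁), Psi N K₁ h w z)) +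
          (∫⁻ z in closedBall z₀ (R + K₁), Psi N K h w z) +
          Cn * ∫⁻ z in closedBall z₀ (R + K₁),
            broadSum (by omega : m + 1 ≤ n) Ne K ν b h z * avgW K w z := by
        exact lintegral_four_terms 𝒦 _ (fun K' => hmeasB N K' _) _ (hmeasPsi N K₁) (hmeasPsi N K) _ hCn
    _ ≤ _ := by
        refine add_le_add (add_le_add (add_le_add ?_ ?_) ?_) ?_
        · refine mul_le_mul' le_rfl (Finset.sum_le_sum fun K' _ => mul_le_mul' le_rfl ?_)
          refine (setLIntegral_ball_avg_le (hmeasPsi N K') z₀ _ _).trans ?_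
          rw [mul_comm (3 : ℝ), hvol 3]
          exact mul_le_mul' le_rfl (lintegral_mono_set (closedBall_subset_closedBall (by linarith)))
        · exact mul_le_mul' le_rfl (mul_le_mul' le_rfl (lintegral_mono_set hball))
        · exact lintegral_mono_set hball
        · refine mul_le_mul' le_rfl (le_trans (lintegral_mono_set
            (closedBall_subset_closedBall (by linarith))) (Hb l hl2 b β h hh hc ?_ w hw z₀))
          intro ξ hξ i hi
          rw [hRr]; exact hb ξ hξ i hi

theorem decoupling {n : ℕ} : ∀ m : ℕ, m + 1 ≤ n → Decoupling n m
  | 0, h => decoupling_zero h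
  | m + 1, h => decoupling_succ h (decoupling m (by omega))

section slab
variable {n : ℕ} (i : Fin n) (V : ℝ)

/-- The frequency coordinates adapted to a slab moving in the direction `e_i` with velocity `V`. -/
noncomputable def slabMap (ξ : Euc n) : Euc n :=
  ξ + (V * ξ i - ‖ξ‖ ^ 2 - ξ i) • EuclideanSpace.single i (1 : ℝ)

/-- The discriminant of the quadratic equation inverting `slabMap`. -/
noncomputable def slabDisc (η : Euc n) : ℝ := V ^ 2 / 4 - η i - ‖η‖ ^ 2 + η i ^ 2

/-- The branches of the inverse of `slabMap`. -/
noncomputable def slabInv (σ : ℝ) (η : Euc n) : Euc n :=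
  η + (V / 2 + σ * √(slabDisc i V η) - η i) • EuclideanSpace.single i (1 : ℝ)

lemma norm_add_smul_single_sq (η : Euc n) (c : ℝ) :
    ‖η + c • EuclideanSpace.single i (1 : ℝ)‖ ^ 2 = ‖η‖ ^ 2 + 2 * c * η i + c ^ 2 := by
  rw [norm_add_sq_real, inner_smul_right, norm_smul]
  simp [EuclideanSpace.inner_single_right]
  ring

lemma add_smul_single_apply_self (η : Euc n) (c : ℝ) :
    (η + c • EuclideanSpace.single i (1 : ℝ)) i = η i + c := by simp

variable {i V} {σ θ : ℝ}

lemma slabInv_slabMap (hσ : σ = 1 ∨ σ = -1) {ξ : Euc n} (h : 0 ≤ σ * (2 * ξ i - V)) :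
    slabInv i V σ (slabMap i V ξ) = ξ := by
  have hD : slabDisc i V (slabMap i V ξ) = (ξ i - V / 2) ^ 2 := by
    unfold slabDisc slabMap
    rw [norm_add_smul_single_sq, add_smul_single_apply_self]
    ring
  have hs : σ * √(slabDisc i V (slabMap i V ξ)) = ξ i - V / 2 := by
    rw [hD, Real.sqrt_sq_eq_abs]
    rcases hσ with rfl | rfl
    · rw [abs_of_nonneg (by linarith)]; ring
    · rw [abs_of_nonpos (by linarith)]; ring
  unfold slabInv
  rw [hs]
  unfold slabMap
  rw [add_smul_single_apply_self, add_assoc, ← add_smul]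
  convert add_zero ξ
  rw [smul_eq_zero]
  left
  ring

lemma slabMap_slabInv (hσ : σ = 1 ∨ σ = -1) {η : Euc n} (h : 0 ≤ slabDisc i V η) :
    slabMap i V (slabInv i V σ η) = η := by
  have hσ2 : σ ^ 2 = 1 := by rcases hσ with rfl | rfl <;> norm_num
  have hs := Real.sq_sqrt h
  set s := √(slabDisc i V η) with hs'
  unfold slabMap
  unfold slabInv
  rw [← hs', norm_add_smul_single_sq, add_smul_single_apply_self, add_assoc, ← add_smul]
  convert add_zero η
  rw [smul_eq_zero]
  left
  have : σ ^ 2 * s ^ 2 = V ^ 2 / 4 - η i - ‖η‖ ^ 2 + η i ^ 2 := by rw [hσ2, hs, one_mul, slabDisc]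
  linear_combination -this

lemma slabInv_apply (η : Euc n) : 2 * slabInv i V σ η i - V = 2 * (σ * √(slabDisc i V η)) := by
  unfold slabInv
  rw [add_smul_single_apply_self]
  ring

lemma slabDisc_pos_of (hσ : σ = 1 ∨ σ = -1) (hθ : 0 < θ) {η : Euc n}
    (h : θ ≤ σ * (2 * slabInv i V σ η i - V)) :
    θ ≤ 2 * √(slabDisc i V η) ∧ 0 ≤ slabDisc i V η := by
  have hσ2 : σ ^ 2 = 1 := by rcases hσ with rfl | rfl <;> norm_num
  rw [slabInv_apply] at h
  have h1 : θ ≤ 2 * √(slabDisc i V η) := by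
    calc θ ≤ _ := h
      _ = σ ^ 2 * (2 * √(slabDisc i V η)) := by ring
      _ = _ := by rw [hσ2, one_mul]
  refine ⟨h1, ?_⟩
  by_contra hneg
  rw [Real.sqrt_eq_zero_of_nonpos (by linarith)] at h1
  linarith

/-- The derivative of `slabMap`. -/
noncomputable def slabDeriv (i : Fin n) (V : ℝ) (ξ : Euc n) : Euc n →L[ℝ] Euc n :=
  ContinuousLinearMap.id ℝ _ + (V • EuclideanSpace.proj (𝕜 := ℝ) i - (2 : ℝ) • innerSL ℝ ξ -
    EuclideanSpace.proj (𝕜 := ℝ) i : Euc n →L[ℝ] ℝ).smulRight (EuclideanSpace.single i (1 : ℝ))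

lemma hasFDerivAt_slabMap (ξ : Euc n) : HasFDerivAt (slabMap i V) (slabDeriv i V ξ) ξ := by
  unfold slabMap slabDeriv
  refine (hasFDerivAt_id ξ).add (HasFDerivAt.smul_const ?_ _)
  have h1 : HasFDerivAt (fun ξ : Euc n => ξ i) (EuclideanSpace.proj (𝕜 := ℝ) i : Euc n →L[ℝ] ℝ) ξ :=
    (EuclideanSpace.proj (𝕜 := ℝ) i : Euc n →L[ℝ] ℝ).hasFDerivAt
  have h2 : HasFDerivAt (fun ξ : Euc n => ‖ξ‖ ^ 2) ((2 : ℝ) • innerSL ℝ ξ) ξ := by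
    rw [show (2 : ℝ) = ((2 : ℕ) : ℝ) by norm_num, Nat.cast_smul_eq_nsmul]
    exact (hasStrictFDerivAt_norm_sq ξ).hasFDerivAt
  exact ((h1.const_mul V).sub h2).sub h1

lemma det_slabDeriv (ξ : Euc n) : (slabDeriv i V ξ).det = V - 2 * ξ i := by
  have : ((slabDeriv i V ξ : Euc n →L[ℝ] Euc n) : Euc n →ₗ[ℝ] Euc n) = LinearMap.transvection
      ((V • EuclideanSpace.proj (𝕜 := ℝ) i - (2 : ℝ) • innerSL ℝ ξ -
        EuclideanSpace.proj (𝕜 := ℝ) i : Euc n →L[ℝ] ℝ) : Euc n →ₗ[ℝ] ℝ)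
      (EuclideanSpace.single i (1 : ℝ)) := by
    ext v : 1
    simp [slabDeriv, LinearMap.transvection]
  rw [ContinuousLinearMap.det, this, LinearMap.transvection.det]
  simp [EuclideanSpace.inner_single_right]

lemma inner_slabMap (y ξ : Euc n) :
    ⟪y, slabMap i V ξ⟫_ℝ = ⟪y, ξ⟫_ℝ + (V * ξ i - ‖ξ‖ ^ 2 - ξ i) * y i := by
  unfold slabMap
  rw [inner_add_right, inner_smul_right]
  simp [EuclideanSpace.inner_single_right]

/-- The linear change of variables adapted to a moving slab. -/
noncomputable def slabCoord (i : Fin n) (V : ℝ) : (Euc n × ℝ) →ₗ[ℝ] (Euc n × ℝ) where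
  toFun p := (p.1 + (V * p.1 i + p.2 - p.1 i) • EuclideanSpace.single i (1 : ℝ), p.1 i)
  map_add' p q := by
    refine Prod.ext ?_ (by simp)
    ext j
    by_cases hj : j = i
    · subst hj; simp; ring
    · simp [hj]
  map_smul' c p := by
    refine Prod.ext ?_ (by simp)
    ext j
    by_cases hj : j = i
    · subst hj; simp; ring
    · simp [hj]

lemma abs_det_slabCoord : |LinearMap.det (slabCoord i V)| = 1 := by
  have h0 : slabCoord i 0 ∘ₗ slabCoord i 0 = LinearMap.id := by
    refine LinearMap.ext fun p => Prod.ext ?_ ?_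
    · ext j
      by_cases hj : j = i
      · subst hj; simp [slabCoord]
      · simp [slabCoord, hj]
    · simp [slabCoord]
  have hV : slabCoord i V = slabCoord i 0 ∘ₗ LinearMap.transvection
      (V • ((EuclideanSpace.proj (𝕜 := ℝ) i : Euc n →L[ℝ] ℝ) : Euc n →ₗ[ℝ] ℝ) ∘ₗ
        LinearMap.fst ℝ (Euc n) ℝ) ((0 : Euc n), (1 : ℝ)) := by
    refine LinearMap.ext fun p => Prod.ext ?_ ?_
    · ext j
      by_cases hj : j = i
      · subst hj; simp [slabCoord, LinearMap.transvection]; ring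
      · simp [slabCoord, LinearMap.transvection, hj]
    · simp [slabCoord, LinearMap.transvection]
  have hd0 : |LinearMap.det (slabCoord i 0)| = 1 := by
    have := congrArg LinearMap.det h0
    rw [LinearMap.det_comp, LinearMap.det_id] at this
    have h2 : |LinearMap.det (slabCoord i 0)| ^ 2 = 1 := by rw [sq_abs, sq, this]
    exact (pow_eq_one_iff_of_nonneg (abs_nonneg _) two_ne_zero).1 h2
  rw [hV, LinearMap.det_comp, abs_mul, hd0, LinearMap.transvection.det]
  simp

lemma measurePreserving_slabCoord :
    MeasurePreserving (slabCoord i V) (volume : Measure (Euc n × ℝ)) volume := by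
  have h1 := abs_det_slabCoord (i := i) (V := V)
  refine ⟨(LinearMap.continuous_of_finiteDimensional _).measurable, ?_⟩
  rw [Measure.map_linearMap_addHaar_eq_smul_addHaar _ (by intro h; rw [h] at h1; simp at h1),
    abs_inv, h1]
  simp

end slab

section slab
variable {n : ℕ} {i : Fin n} {V σ θ : ℝ}

/-- The frequency data of the restriction of an evolution to a moving hyperplane. -/
noncomputable def slabData (i : Fin n) (V σ : ℝ) (h : Euc n → ℂ) (η : Euc n) : ℂ :=
  h (slabInv i V σ η) * (((2 * √(slabDisc i V η))⁻¹ : ℝ) : ℂ)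

lemma continuous_slabDisc : Continuous (slabDisc i V) := by
  unfold slabDisc; fun_prop

lemma continuous_slabInv : Continuous (slabInv i V σ) := by
  have := continuous_slabDisc (i := i) (V := V)
  unfold slabInv; fun_prop

lemma slabData_ne_zero (hσ : σ = 1 ∨ σ = -1) (hθ : 0 < θ) {h : Euc n → ℂ}
    (hs : ∀ ξ, h ξ ≠ 0 → θ ≤ σ * (2 * ξ i - V)) {η : Euc n} (hη : slabData i V σ h η ≠ 0) :
    θ ≤ 2 * √(slabDisc i V η) ∧ h (slabInv i V σ η) ≠ 0 ∧
      slabMap i V (slabInv i V σ η) = η := by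
  have h1 := left_ne_zero_of_mul hη
  obtain ⟨h2, h3⟩ := slabDisc_pos_of hσ hθ (hs _ h1)
  exact ⟨h2, h1, slabMap_slabInv hσ h3⟩

lemma Nice.slabData (hσ : σ = 1 ∨ σ = -1) (hθ : 0 < θ) {h : Euc n → ℂ} (hh : Nice h)
    (hs : ∀ ξ, h ξ ≠ 0 → θ ≤ σ * (2 * ξ i - V)) : Nice (slabData i V σ h) := by
  obtain ⟨B, hB⟩ := hh.bdd
  obtain ⟨r, hr⟩ := hh.supp
  have hB0 : 0 ≤ B := (norm_nonneg _).trans (hB 0)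
  refine ⟨?_, ⟨B * θ⁻¹, fun η => ?_⟩, ⟨r + (|V| * r + r ^ 2 + r), fun η hη => ?_⟩⟩
  · have h1 := (continuous_slabInv (i := i) (V := V) (σ := σ)).measurable
    have h2 := (continuous_slabDisc (i := i) (V := V)).measurable
    exact (hh.meas.comp h1).mul (Complex.measurable_ofReal.comp (by fun_prop))
  · by_cases hη : _root_.slabData i V σ h η = 0
    · rw [hη, norm_zero]; positivity
    · obtain ⟨h1, h2, h3⟩ := slabData_ne_zero hσ hθ hs hη
      rw [_root_.slabData, norm_mul, Complex.norm_real, Real.norm_of_nonneg (by positivity)]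
      gcongr
      exact hB _
  · obtain ⟨h1, h2, h3⟩ := slabData_ne_zero hσ hθ hs hη
    have h4 := hr _ h2
    have h5 : |slabInv i V σ η i| ≤ r := (PiLp.norm_apply_le (slabInv i V σ η) i).trans h4
    rw [← h3, slabMap]
    refine (norm_add_le _ _).trans (add_le_add h4 ?_)
    rw [norm_smul, EuclideanSpace.norm_single, norm_one, mul_one, Real.norm_eq_abs]
    refine (abs_sub _ _).trans (add_le_add ((abs_sub _ _).trans (add_le_add ?_ ?_)) h5)
    · rw [abs_mul]; gcongr
    · rw [abs_of_nonneg (by positivity)]; gcongr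

lemma injOn_slabMap (hσ : σ = 1 ∨ σ = -1) (hθ : 0 < θ) :
    InjOn (slabMap i V) {ξ | θ ≤ σ * (2 * ξ i - V)} := fun ξ hξ ξ' hξ' heq => by
  rw [← slabInv_slabMap hσ (hθ.le.trans hξ), heq, slabInv_slabMap hσ (hθ.le.trans hξ')]

lemma slabData_slabMap (hσ : σ = 1 ∨ σ = -1) (hθ : 0 < θ) (h : Euc n → ℂ) {ξ : Euc n}
    (hξ : θ ≤ σ * (2 * ξ i - V)) :
    slabData i V σ h (slabMap i V ξ) = h ξ * ((|(slabDeriv i V ξ).det|⁻¹ : ℝ) : ℂ) ∧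
      θ ≤ |(slabDeriv i V ξ).det| := by
  have hσ1 : |σ| = 1 := by rcases hσ with rfl | rfl <;> simp
  have hd : |(slabDeriv i V ξ).det| = σ * (2 * ξ i - V) := by
    rw [det_slabDeriv, abs_sub_comm, ← one_mul |2 * ξ i - V|, ← hσ1, ← abs_mul,
      abs_of_nonneg (hθ.le.trans hξ)]
  have hD : slabDisc i V (slabMap i V ξ) = (ξ i - V / 2) ^ 2 := by
    unfold slabDisc slabMap
    rw [norm_add_smul_single_sq, add_smul_single_apply_self]
    ring
  have hs : 2 * √(slabDisc i V (slabMap i V ξ)) = |(slabDeriv i V ξ).det| := by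
    rw [hD, Real.sqrt_sq_eq_abs, det_slabDeriv, abs_sub_comm V, show 2 * ξ i - V = 2 * (ξ i - V / 2) by ring,
      abs_mul, abs_two]
  refine ⟨?_, hd ▸ hξ⟩
  rw [slabData, slabInv_slabMap hσ (hθ.le.trans hξ), hs]

lemma slabData_eq_zero_of_notMem_image {h : Euc n → ℂ} (hσ : σ = 1 ∨ σ = -1) (hθ : 0 < θ)
    (hs : ∀ ξ, h ξ ≠ 0 → θ ≤ σ * (2 * ξ i - V)) {η : Euc n}
    (hη : η ∉ slabMap i V '' {ξ | θ ≤ σ * (2 * ξ i - V)}) : slabData i V σ h η = 0 := by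
  by_contra hne
  obtain ⟨_, h2, h3⟩ := slabData_ne_zero hσ hθ hs hne
  exact hη ⟨_, hs _ h2, h3⟩

lemma measurableSet_halfSpace (i : Fin n) (V σ θ : ℝ) :
    MeasurableSet {ξ : Euc n | θ ≤ σ * (2 * ξ i - V)} :=
  measurableSet_le measurable_const (by fun_prop)

lemma evol_slabCoord (hσ : σ = 1 ∨ σ = -1) (hθ : 0 < θ) {h : Euc n → ℂ}
    (hs : ∀ ξ, h ξ ≠ 0 → θ ≤ σ * (2 * ξ i - V)) (y : Euc n) (u : ℝ) :
    evol h (slabCoord i V (y, u)).1 (slabCoord i V (y, u)).2 =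
      fourierInt (slabData i V σ fun ξ => h ξ * osc (u * ξ i)) y := by
  have hs' : ∀ ξ, h ξ * osc (u * ξ i) ≠ 0 → θ ≤ σ * (2 * ξ i - V) :=
    fun ξ hξ => hs ξ (left_ne_zero_of_mul hξ)
  have hR : fourierInt (slabData i V σ fun ξ => h ξ * osc (u * ξ i)) y =
      ∫ η in slabMap i V '' {ξ | θ ≤ σ * (2 * ξ i - V)},
        slabData i V σ (fun ξ => h ξ * osc (u * ξ i)) η * osc ⟪y, η⟫_ℝ :=
    (setIntegral_eq_integral_of_forall_compl_eq_zero fun η hη => by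
      rw [slabData_eq_zero_of_notMem_image hσ hθ hs' hη, zero_mul]).symm
  have hL : evol h (slabCoord i V (y, u)).1 (slabCoord i V (y, u)).2 =
      ∫ ξ in {ξ : Euc n | θ ≤ σ * (2 * ξ i - V)}, h ξ *
        osc (⟪(slabCoord i V (y, u)).1, ξ⟫_ℝ - (slabCoord i V (y, u)).2 * ‖ξ‖ ^ 2) :=
    (setIntegral_eq_integral_of_forall_compl_eq_zero fun ξ hξ => by
      rw [not_imp_comm.1 (hs ξ) hξ, zero_mul]).symm
  rw [hL, hR, integral_image_eq_integral_abs_det_fderiv_smul volume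
    (measurableSet_halfSpace i V σ θ)
    (fun ξ _ => (hasFDerivAt_slabMap ξ).hasFDerivWithinAt) (injOn_slabMap hσ hθ)]
  refine setIntegral_congr_fun (measurableSet_halfSpace i V σ θ) fun ξ hξ => ?_
  obtain ⟨h1, h2⟩ := slabData_slabMap hσ hθ (fun ξ => h ξ * osc (u * ξ i)) hξ
  have h3 : ((|(slabDeriv i V ξ).det| : ℝ) : ℂ) ≠ 0 := by
    exact_mod_cast (hθ.trans_le h2).ne'
  have h4 : ⟪(slabCoord i V (y, u)).1, ξ⟫_ℝ - (slabCoord i V (y, u)).2 * ‖ξ‖ ^ 2 =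
      u * ξ i + ⟪y, slabMap i V ξ⟫_ℝ := by
    rw [inner_slabMap]
    simp only [slabCoord, LinearMap.coe_mk, AddHom.coe_mk, inner_add_left, inner_smul_left]
    simp [EuclideanSpace.inner_single_left]
    ring
  simp only [h1]
  rw [h4, osc_add, Complex.real_smul]
  push_cast
  field_simp

lemma lintegral_slabData_sq_le (hσ : σ = 1 ∨ σ = -1) (hθ : 0 < θ) {h : Euc n → ℂ}
    (hs : ∀ ξ, h ξ ≠ 0 → θ ≤ σ * (2 * ξ i - V)) :
    ∫⁻ η, ‖slabData i V σ h η‖ₑ ^ 2 ≤ ofReal θ⁻¹ * ∫⁻ ξ, ‖h ξ‖ₑ ^ 2 := by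
  have h0 : (fun η => ‖slabData i V σ h η‖ₑ ^ 2).support ⊆
      slabMap i V '' {ξ | θ ≤ σ * (2 * ξ i - V)} := fun η hη => by
    by_contra hne
    exact hη (by simp [slabData_eq_zero_of_notMem_image hσ hθ hs hne])
  rw [← setLIntegral_eq_of_support_subset h0,
    lintegral_image_eq_lintegral_abs_det_fderiv_mul volume (measurableSet_halfSpace i V σ θ)
    (fun ξ _ => (hasFDerivAt_slabMap ξ).hasFDerivWithinAt) (injOn_slabMap hσ hθ),
    ← lintegral_const_mul' _ _ ENNReal.ofReal_ne_top]
  refine (setLIntegral_mono' (measurableSet_halfSpace i V σ θ) fun ξ hξ => ?_).trans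
    (setLIntegral_le_lintegral _ _)
  obtain ⟨h1, h2⟩ := slabData_slabMap hσ hθ h hξ
  have h3 : 0 < |(slabDeriv i V ξ).det| := hθ.trans_le h2
  rw [h1, ← ofReal_norm, ← ofReal_norm, norm_mul, Complex.norm_real,
    Real.norm_of_nonneg (by positivity), ← ENNReal.ofReal_pow (by positivity),
    ← ENNReal.ofReal_pow (by positivity), ← ENNReal.ofReal_mul (by positivity),
    ← ENNReal.ofReal_mul (by positivity)]
  refine ENNReal.ofReal_le_ofReal ?_
  calc _ = |(slabDeriv i V ξ).det|⁻¹ * ‖h ξ‖ ^ 2 := by field_simp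
    _ ≤ _ := by gcongr

lemma local_smoothing_one_sided (hσ : σ = 1 ∨ σ = -1) (hθ : 0 < θ) {h : Euc n → ℂ}
    (hh : Nice h) (hs : ∀ ξ, h ξ ≠ 0 → θ ≤ σ * (2 * ξ i - V)) (a : ℝ) {ρ : ℝ} (hρ : 0 ≤ ρ) :
    ∫⁻ z in {z : Euc n × ℝ | |z.1 i - V * z.2 - a| ≤ θ * ρ}, ‖evol h z.1 z.2‖ₑ ^ 2 ≤
      ofReal (2 * (2 * Real.pi) ^ n) * ofReal ρ * ∫⁻ ξ, ‖h ξ‖ₑ ^ 2 := by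
  set S := {z : Euc n × ℝ | |z.1 i - V * z.2 - a| ≤ θ * ρ} with hS
  have hSm : MeasurableSet S := measurableSet_le (by fun_prop) measurable_const
  have hm : Measurable fun z : Euc n × ℝ => ‖evol h z.1 z.2‖ₑ ^ 2 :=
    (measurable_enorm_evol_comp hh measurable_fst measurable_snd).pow_const 2
  have hpre : slabCoord i V ⁻¹' S = univ ×ˢ Icc (a - θ * ρ) (a + θ * ρ) := by
    ext ⟨y, u⟩
    have : (slabCoord i V (y, u)).1 i - V * (slabCoord i V (y, u)).2 - a = u - a := by
      simp [slabCoord]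
    rw [mem_preimage, hS, mem_ofPred_eq, this, abs_le]
    simp only [mem_prod, mem_univ, true_and, mem_Icc]
    constructor <;> rintro ⟨h1, h2⟩ <;> constructor <;> linarith
  rw [← (measurePreserving_slabCoord (i := i) (V := V)).setLIntegral_comp_preimage hSm hm, hpre,
    Measure.volume_eq_prod, setLIntegral_prod_symm
      (fun z : Euc n × ℝ => ‖evol h (slabCoord i V z).1 (slabCoord i V z).2‖ₑ ^ 2)
      (hm.comp measurePreserving_slabCoord.measurable).aemeasurable]
  have key : ∀ u : ℝ, ∫⁻ y, ‖evol h (slabCoord i V (y, u)).1 (slabCoord i V (y, u)).2‖ₑ ^ 2 ≤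
      ofReal ((2 * Real.pi) ^ n) * (ofReal θ⁻¹ * ∫⁻ ξ, ‖h ξ‖ₑ ^ 2) := fun u => by
    have hs' : ∀ ξ, h ξ * osc (u * ξ i) ≠ 0 → θ ≤ σ * (2 * ξ i - V) :=
      fun ξ hξ => hs ξ (left_ne_zero_of_mul hξ)
    have hN : Nice fun ξ => h ξ * osc (u * ξ i) := hh.mul_osc (by fun_prop)
    have hN' := Nice.slabData hσ hθ hN hs'
    simp_rw [evol_slabCoord hσ hθ hs]
    rw [lintegral_fourierInt_sq hN'.integrable (hN'.memLp 2)]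
    refine mul_le_mul' le_rfl ((lintegral_slabData_sq_le hσ hθ hs').trans_eq ?_)
    simp only [enorm_mul]
    congr 2
    ext ξ
    rw [← ofReal_norm (osc _), norm_osc, ENNReal.ofReal_one, mul_one]
  simp only [Measure.restrict_univ]
  refine (lintegral_mono fun u => key u).trans ?_
  rw [setLIntegral_const, Real.volume_Icc, mul_right_comm]
  rw [show a + θ * ρ - (a - θ * ρ) = 2 * ρ * θ by ring]
  refine le_of_eq ?_
  rw [← mul_assoc, ← ENNReal.ofReal_mul (by positivity),
    ← ENNReal.ofReal_mul (by positivity), ← ENNReal.ofReal_mul (by positivity)]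
  congr 2
  field_simp

/-- Local smoothing across a moving slab transversal to the velocities. -/
theorem local_smoothing (n : ℕ) : ∃ C : ℝ≥0∞, C ≠ ⊤ ∧ ∀ (i : Fin n) (V θ a ρ : ℝ), 0 < θ → 0 ≤ ρ →
    ∀ h : Euc n → ℂ, Nice h → (∀ ξ, h ξ ≠ 0 → θ ≤ |2 * ξ i - V|) →
    ∫⁻ z in {z : Euc n × ℝ | |z.1 i - V * z.2 - a| ≤ θ * ρ}, ‖evol h z.1 z.2‖ₑ ^ 2 ≤
      C * ofReal ρ * ∫⁻ ξ, ‖h ξ‖ₑ ^ 2 := by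
  refine ⟨4 * ofReal (2 * (2 * Real.pi) ^ n), by finiteness,
    fun i V θ a ρ hθ hρ h hh hs => ?_⟩
  set T := {ξ : Euc n | θ ≤ 1 * (2 * ξ i - V)} with hT
  have hTm : MeasurableSet T := measurableSet_halfSpace i V 1 θ
  have h1 := hh.indicator hTm
  have h2 := hh.indicator hTm.compl
  have hs1 : ∀ ξ, T.indicator h ξ ≠ 0 → θ ≤ 1 * (2 * ξ i - V) := fun ξ hξ => by
    have : ξ ∈ T := mem_of_indicator_ne_zero hξ
    exact this
  have hs2 : ∀ ξ, Tᶜ.indicator h ξ ≠ 0 → θ ≤ -1 * (2 * ξ i - V) := fun ξ hξ => by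
    have h3 : ξ ∉ T := mem_of_indicator_ne_zero hξ
    have h4 : h ξ ≠ 0 := fun h5 => hξ (by rw [indicator_apply, h5, ite_self])
    rcases le_abs.1 (hs ξ h4) with h5 | h5
    · exact absurd (by rw [hT, mem_ofPred_eq, one_mul]; exact h5) h3
    · linarith
  have hadd : ∀ x t, evol h x t = evol (T.indicator h) x t + evol (Tᶜ.indicator h) x t := by
    intro x t
    rw [← evol_add h1 h2]
    congr 1
    exact (indicator_self_add_compl T h).symm
  have hle : ∀ U : Set (Euc n), ∫⁻ ξ, ‖U.indicator h ξ‖ₑ ^ 2 ≤ ∫⁻ ξ, ‖h ξ‖ₑ ^ 2 := fun U =>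
    lintegral_mono fun ξ => pow_le_pow_left' (by
      by_cases hξ : ξ ∈ U <;> simp [hξ]) 2
  have hm : Measurable fun z : Euc n × ℝ => ‖evol (T.indicator h) z.1 z.2‖ₑ ^ 2 :=
    (measurable_enorm_evol_comp h1 measurable_fst measurable_snd).pow_const 2
  calc _ ≤ ∫⁻ z in {z : Euc n × ℝ | |z.1 i - V * z.2 - a| ≤ θ * ρ},
        2 * (‖evol (T.indicator h) z.1 z.2‖ₑ ^ 2 + ‖evol (Tᶜ.indicator h) z.1 z.2‖ₑ ^ 2) :=
      lintegral_mono fun z => by rw [hadd]; exact sq_enorm_add_le _ _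
    _ ≤ 2 * (ofReal (2 * (2 * Real.pi) ^ n) * ofReal ρ * (∫⁻ ξ, ‖h ξ‖ₑ ^ 2) +
        ofReal (2 * (2 * Real.pi) ^ n) * ofReal ρ * ∫⁻ ξ, ‖h ξ‖ₑ ^ 2) := by
      rw [lintegral_const_mul' _ _ (by simp), lintegral_add_left hm]
      refine mul_le_mul' le_rfl (add_le_add ?_ ?_)
      · exact (local_smoothing_one_sided (Or.inl rfl) hθ h1 hs1 a hρ).trans
          (mul_le_mul' le_rfl (hle T))
      · exact (local_smoothing_one_sided (Or.inr rfl) hθ h2 hs2 a hρ).trans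
          (mul_le_mul' le_rfl (hle Tᶜ))
    _ = _ := by ring

end slab

lemma lintegral_ball_avg {n : ℕ} {F : Euc n × ℝ → ℝ≥0∞} (hF : Measurable F) (r : ℝ) :
    ∫⁻ z, ∫⁻ z' in closedBall z r, F z' =
      volume (closedBall (0 : Euc n × ℝ) r) * ∫⁻ z, F z := by
  have hm : MeasurableSet {q : (Euc n × ℝ) × (Euc n × ℝ) | dist q.2 q.1 ≤ r} :=
    measurableSet_le (by fun_prop) measurable_const
  have h1 : ∀ z : Euc n × ℝ, ∫⁻ z' in closedBall z r, F z' =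
      ∫⁻ z', {q : (Euc n × ℝ) × (Euc n × ℝ) | dist q.2 q.1 ≤ r}.indicator
        (fun q => F q.2) (z, z') := fun z => by
    rw [← lintegral_indicator measurableSet_closedBall]
    rfl
  simp_rw [h1]
  rw [lintegral_lintegral_swap (f := fun z z' =>
    {q : (Euc n × ℝ) × (Euc n × ℝ) | dist q.2 q.1 ≤ r}.indicator (fun q => F q.2) (z, z')) ((hF.comp measurable_snd).indicator hm).aemeasurable,
    ← lintegral_const_mul _ hF]
  congr 1
  ext z'
  have h2 : ∀ z : Euc n × ℝ, {q : (Euc n × ℝ) × (Euc n × ℝ) | dist q.2 q.1 ≤ r}.indicator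
      (fun q => F q.2) (z, z') = (closedBall z' r).indicator (fun _ => F z') z := fun z => by
    by_cases hz : dist z' z ≤ r
    · rw [indicator_of_mem (show (z, z') ∈ {q : (Euc n × ℝ) × (Euc n × ℝ) | dist q.2 q.1 ≤ r}
        from hz), indicator_of_mem (by rwa [mem_closedBall, dist_comm])]
    · rw [indicator_of_notMem (show (z, z') ∉ {q : (Euc n × ℝ) × (Euc n × ℝ) | dist q.2 q.1 ≤ r}
        from hz), indicator_of_notMem (by rwa [mem_closedBall, dist_comm])]
  simp_rw [h2]
  rw [lintegral_indicator_const measurableSet_closedBall, Measure.addHaar_closedBall_center, mul_comm]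

/-- The global broad-narrow inequality. -/
theorem global_broad_narrow {n : ℕ} (hn : 1 ≤ n) (N : ℕ) (hN : n < N) {ε : ℝ} (hε : 0 < ε) (L : ℕ) :
    ∃ ν : ℝ, 0 < ν ∧ ∀ L' : ℕ, ∃ (𝒦 : Finset ℕ) (K : ℕ), L' ≤ K ∧ (∀ K' ∈ 𝒦, 1 ≤ K' ∧ L ≤ K') ∧
    𝒦.card ≤ 2 * n ∧ ∃ C : ℝ≥0∞, C ≠ ⊤ ∧ ∀ h : Euc n → ℂ, Nice h → InCube h →
      ∀ w : Euc n × ℝ → ℝ≥0∞, Measurable w →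
        ∫⁻ z, ‖evol h z.1 z.2‖ₑ ^ 2 * w z ^ (1 / n : ℝ) ≤
          (∑ K' ∈ 𝒦, (K' : ℝ≥0∞) ^ ε * ∫⁻ z, Psi N K' h w z) +
          C * ∫⁻ z, broadSum le_rfl N K ν (EuclideanSpace.basisFun (Fin n) ℝ) h z * avgW K w z := by
  obtain ⟨m, rfl⟩ : ∃ m, n = m + 1 := ⟨n - 1, by omega⟩
  have hε2 : 0 < ε / 2 := by linarith
  set V1 := volume (closedBall (0 : Euc (m + 1) × ℝ) 1) with hV1
  set V3 := volume (closedBall (0 : Euc (m + 1) × ℝ) 3) with hV3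
  have hV1t : V1 ≠ ⊤ := measure_closedBall_lt_top.ne
  have hV3t : V3 ≠ ⊤ := measure_closedBall_lt_top.ne
  have hV10 : V1 ≠ 0 := (measure_closedBall_pos _ _ one_pos).ne'
  obtain ⟨LA, hLA⟩ := exists_forall_le_natCast_rpow hε2
    (show V1⁻¹ * (12 * (V3 + 1)) ≠ ⊤ by finiteness)
  obtain ⟨𝒦, K₁, ν, hν, hK₁, hLK₁, h𝒦, hcard, K₀, H⟩ :=
    broad_narrow le_rfl (decoupling m le_rfl) N hε2 (max L LA)
  refine ⟨ν, hν, fun L' => ?_⟩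
  set K : ℕ := K₁ * (max (max K₀ 2) (max (max L LA) L')) with hK
  have hKM : max (max K₀ 2) (max (max L LA) L') ≤ K := Nat.le_mul_of_pos_left _ hK₁
  simp only [max_le_iff] at hKM hLK₁ h𝒦
  obtain ⟨⟨hKK₀, hK2⟩, ⟨hKL, hKLA⟩, hKLC⟩ := hKM
  have hK₁K : K₁ ∣ K := Dvd.intro _ rfl
  obtain ⟨Cn, hCn, Hn⟩ := H K hKK₀ hK₁K
  refine ⟨insert K (insert K₁ 𝒦), K, hKLC, ?_, ?_, V1⁻¹ * Cn, by finiteness,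
    fun h hh hc w hw => ?_⟩
  · intro K' hK'
    simp only [Finset.mem_insert] at hK'
    rcases hK' with rfl | rfl | hK'
    · exact ⟨by omega, hKL⟩
    · exact ⟨hK₁, hLK₁.1⟩
    · obtain ⟨h1, h2, h3⟩ := h𝒦 K' hK'
      exact ⟨h1, h2.1⟩
  · refine (Finset.card_insert_le _ _).trans ?_
    have := Finset.card_insert_le K₁ 𝒦
    omega
  set b := EuclideanSpace.basisFun (Fin (m + 1)) ℝ with hb
  have hbK : ∀ ξ, h ξ ≠ 0 → ∀ i : Fin (m + 1), m + 1 ≤ i.val →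
      |⟪b i, ξ⟫_ℝ - (0 : Fin (m + 1) → ℝ) i| ≤ 1 / K := fun ξ hξ i hi => by have := i.2; omega
  set X : ℝ≥0∞ := (K₁ : ℝ≥0∞) ^ (m + 1 + 1) with hX
  have hK₁e : (1 : ℝ≥0∞) ≤ K₁ := by exact_mod_cast hK₁
  have hX1 : 1 ≤ X := one_le_pow₀ hK₁e
  have hXt : X ≠ ⊤ := by finiteness
  have hK₁r : (1 : ℝ) ≤ K₁ := by exact_mod_cast hK₁
  have hvol : ∀ c : ℝ, volume (closedBall (0 : Euc (m + 1) × ℝ) ((K₁ : ℝ) * c)) =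
      X * volume (closedBall (0 : Euc (m + 1) × ℝ) c) := fun c => by
    rw [volume_closedBall_eq _ (by linarith), ENNReal.ofReal_natCast]
  have hvol1 : volume (closedBall (0 : Euc (m + 1) × ℝ) K₁) = X * V1 := by simpa using hvol 1
  have hvol3 : volume (closedBall (0 : Euc (m + 1) × ℝ) (3 * K₁)) = X * V3 := by
    rw [mul_comm (3 : ℝ), hvol 3]
  have hF : Measurable fun z : Euc (m + 1) × ℝ =>
      ‖evol h z.1 z.2‖ₑ ^ 2 * w z ^ (1 / (m + 1 : ℕ) : ℝ) :=
    ((measurable_enorm_evol_comp hh measurable_fst measurable_snd).pow_const 2).mul (hw.pow_const _)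
  set I : ℕ → ℝ≥0∞ := fun K' => ∫⁻ z, Psi N K' h w z with hI
  set S : ℝ≥0∞ := ∑ K' ∈ insert K (insert K₁ 𝒦), (K' : ℝ≥0∞) ^ ε * I K' with hS
  have hA : ∀ K', LA ≤ K' → 1 ≤ K' → 12 * (V3 + 1) * (K' : ℝ≥0∞) ^ (ε / 2) ≤ V1 * (K' : ℝ≥0∞) ^ ε := by
    intro K' hK' hK'1
    have h0 : (K' : ℝ≥0∞) ≠ 0 := by exact_mod_cast (by omega : K' ≠ 0)
    calc _ = V1 * ((V1⁻¹ * (12 * (V3 + 1))) * (K' : ℝ≥0∞) ^ (ε / 2)) := by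
          rw [← mul_assoc, ← mul_assoc V1, ENNReal.mul_inv_cancel hV10 hV1t, one_mul]
      _ ≤ V1 * ((K' : ℝ≥0∞) ^ (ε / 2) * (K' : ℝ≥0∞) ^ (ε / 2)) := by
          gcongr; exact hLA K' hK'
      _ = _ := by
          rw [← ENNReal.rpow_add _ _ h0 (ENNReal.natCast_ne_top _), add_halves]
  have hmem : ∀ K' ∈ insert K (insert K₁ 𝒦), (K' : ℝ≥0∞) ^ ε * I K' ≤ S := fun K' hK' =>
    Finset.single_le_sum (f := fun K' : ℕ => (K' : ℝ≥0∞) ^ ε * I K') (fun _ _ => bot_le) hK'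
  have h1 : 3 * (4 * ∑ K' ∈ 𝒦, (K' : ℝ≥0∞) ^ (ε / 2) * (X * V3 * I K')) ≤ X * V1 * S := by
    calc _ = ∑ K' ∈ 𝒦, X * (12 * V3 * (K' : ℝ≥0∞) ^ (ε / 2)) * I K' := by
          rw [← mul_assoc, Finset.mul_sum]
          refine Finset.sum_congr rfl fun K' _ => ?_
          ring
      _ ≤ ∑ K' ∈ 𝒦, X * (V1 * (K' : ℝ≥0∞) ^ ε) * I K' := by
          refine Finset.sum_le_sum fun K' hK' => mul_le_mul' (mul_le_mul' le_rfl ?_) le_rfl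
          refine le_trans ?_ (hA K' (h𝒦 K' hK').2.1.2 (h𝒦 K' hK').1)
          gcongr; exact le_self_add
      _ = X * V1 * ∑ K' ∈ 𝒦, (K' : ℝ≥0∞) ^ ε * I K' := by
          rw [Finset.mul_sum]; refine Finset.sum_congr rfl fun K' _ => ?_
          ring
      _ ≤ _ := by
          refine mul_le_mul' le_rfl (Finset.sum_le_sum_of_subset ?_)
          exact (Finset.subset_insert _ _).trans (Finset.subset_insert _ _)
  have h2 : ∀ K' ∈ insert K (insert K₁ 𝒦), LA ≤ K' → 1 ≤ K' →
      3 * (4 * ((K' : ℝ≥0∞) ^ (ε / 2) * X * I K')) ≤ X * V1 * S := fun K' hm hL h1 => by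
    calc _ = X * (12 * 1 * (K' : ℝ≥0∞) ^ (ε / 2)) * I K' := by ring
      _ ≤ X * (V1 * (K' : ℝ≥0∞) ^ ε) * I K' := by
          refine mul_le_mul' (mul_le_mul' le_rfl ?_) le_rfl
          refine le_trans ?_ (hA K' hL h1)
          gcongr; exact le_add_self
      _ = X * V1 * ((K' : ℝ≥0∞) ^ ε * I K') := by ring
      _ ≤ _ := mul_le_mul' le_rfl (hmem _ hm)
  have h3 : 3 * I K ≤ X * V1 * S := by
    refine le_trans ?_ (h2 K (by simp) hKLA (by omega))
    have : (1 : ℝ≥0∞) ≤ (K : ℝ≥0∞) ^ (ε / 2) :=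
      ENNReal.one_le_rpow (by exact_mod_cast (by omega : 1 ≤ K)) hε2
    calc 3 * I K = 3 * (1 * (1 * 1 * I K)) := by ring
      _ ≤ _ := by gcongr; norm_num
  have hXV0 : X * V1 ≠ 0 := mul_ne_zero (by positivity) hV10
  have hXVt : X * V1 ≠ ⊤ := by finiteness
  set Bd : ℝ≥0∞ := ∫⁻ z, broadSum le_rfl N K ν b h z * avgW K w z with hBd
  have h4 : Cn * Bd ≤ X * V1 * (V1⁻¹ * Cn * Bd) := by
    calc _ = 1 * ((V1 * V1⁻¹) * Cn * Bd) := by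
          rw [ENNReal.mul_inv_cancel hV10 hV1t, one_mul, one_mul]
      _ ≤ X * ((V1 * V1⁻¹) * Cn * Bd) := by gcongr
      _ = _ := by ring
  refine (ENNReal.mul_le_mul_iff_right hXV0 hXVt).1 ?_
  rw [mul_add]
  refine le_trans ?_ (add_le_add (add_three_le h1 (h2 K₁ (by simp) hLK₁.2 hK₁) h3) h4)
  have hmeasPsi : ∀ K', Measurable (Psi N K' h w) := fun K' => measurable_Psi N K' hh hw
  have hmeasB : ∀ K' r, Measurable fun z => ∫⁻ z' in closedBall z r, Psi N K' h w z' :=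
    fun K' r => measurable_setLIntegral_closedBall (hmeasPsi K') r
  rw [← hvol1, ← lintegral_ball_avg hF K₁]
  calc _ ≤ ∫⁻ z,
          (4 * (∑ K' ∈ 𝒦, (K' : ℝ≥0∞) ^ (ε / 2) * ∫⁻ z' in closedBall z (3 * K₁), Psi N K' h w z') +
          4 * ((K₁ : ℝ≥0∞) ^ (ε / 2) * X * Psi N K₁ h w z) + Psi N K h w z +
          Cn * (broadSum le_rfl N K ν b h z * avgW K w z)) := by
        refine lintegral_mono fun z => (Hn b 0 h hh hc hbK w hw z).trans ?_
        rw [mul_assoc Cn]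
    _ = (4 * (∑ K' ∈ 𝒦, (K' : ℝ≥0∞) ^ (ε / 2) * ∫⁻ z,
            ∫⁻ z' in closedBall z (3 * K₁), Psi N K' h w z')) +
          (4 * ((K₁ : ℝ≥0∞) ^ (ε / 2) * X * ∫⁻ z, Psi N K₁ h w z)) +
          (∫⁻ z, Psi N K h w z) + Cn * Bd := by
        exact lintegral_four_terms 𝒦 _ (fun K' => hmeasB K' _) _ (hmeasPsi K₁) (hmeasPsi K) _ hCn
    _ = _ := by
        congr 4
        refine Finset.sum_congr rfl fun K' _ => ?_
        rw [lintegral_ball_avg (hmeasPsi K'), hvol3]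

/-- Parabolic rescaling composed with a Galilean transformation. -/
noncomputable def rsc {n : ℕ} (K : ℝ) (c : Euc n) (z : Euc n × ℝ) : Euc n × ℝ :=
  (K • z.1 + (2 * (K ^ 2 * z.2)) • c, K ^ 2 * z.2)

lemma continuous_rsc {n : ℕ} (K : ℝ) (c : Euc n) : Continuous (rsc K c) := by
  unfold rsc; fun_prop

lemma lintegral_comp_mul_left_real {G : ℝ → ℝ≥0∞} (hG : Measurable G) {a : ℝ} (ha : 0 < a) :
    ∫⁻ t, G (a * t) = ofReal a⁻¹ * ∫⁻ t, G t := by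
  rw [← lintegral_map hG (measurable_const_mul a), Real.map_volume_mul_left ha.ne',
    lintegral_smul_measure, abs_of_pos (by positivity)]
  rfl

lemma lintegral_comp_rsc {n : ℕ} {F : Euc n × ℝ → ℝ≥0∞} (hF : Measurable F) {K : ℝ} (hK : 0 < K)
    (c : Euc n) :
    ∫⁻ z, F (rsc K c z) = ofReal ((K ^ (n + 2))⁻¹) * ∫⁻ z, F z := by
  rw [Measure.volume_eq_prod, lintegral_prod_symm (fun z => F (rsc K c z))
      (hF.comp (continuous_rsc K c).measurable).aemeasurable,
    lintegral_prod_symm _ hF.aemeasurable]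
  have h1 : ∀ t : ℝ, ∫⁻ x, F (rsc K c (x, t)) =
      ofReal ((K ^ n)⁻¹) * ∫⁻ x, F (x, K ^ 2 * t) := fun t => by
    have := lintegral_comp_smul_euc (fun x : Euc n => F (x + (2 * (K ^ 2 * t)) • c, K ^ 2 * t)) hK.ne'
    rw [abs_of_pos (by positivity), lintegral_add_right_eq_self
      (fun x : Euc n => F (x, K ^ 2 * t))] at this
    exact this
  simp_rw [h1]
  have hG : Measurable fun s : ℝ => ∫⁻ x, F (x, s) := hF.lintegral_prod_left'
  rw [lintegral_const_mul' _ _ ENNReal.ofReal_ne_top,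
    lintegral_comp_mul_left_real hG (by positivity : 0 < K ^ 2), ← mul_assoc,
    ← ENNReal.ofReal_mul (by positivity)]
  congr 2
  rw [pow_add, mul_inv]

lemma lintegral_eq_rsc {n : ℕ} {F : Euc n × ℝ → ℝ≥0∞} (hF : Measurable F) {K : ℝ} (hK : 0 < K)
    (c : Euc n) :
    ∫⁻ z, F z = ofReal (K ^ (n + 2)) * ∫⁻ z, F (rsc K c z) := by
  rw [lintegral_comp_rsc hF hK, ← mul_assoc, ← ENNReal.ofReal_mul (by positivity),
    mul_inv_cancel₀ (by positivity), ENNReal.ofReal_one, one_mul]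

/-- The rescaled frequency data. -/
noncomputable def blow {n : ℕ} (K : ℝ) (c : Euc n) (g : Euc n → ℂ) (ζ : Euc n) : ℂ :=
  g (c + K⁻¹ • ζ)

lemma Nice.blow {n : ℕ} {g : Euc n → ℂ} (hg : Nice g) {K : ℝ} (hK : 0 < K) (c : Euc n) :
    Nice (blow K c g) := by
  obtain ⟨B, hB⟩ := hg.bdd
  obtain ⟨r, hr⟩ := hg.supp
  refine ⟨hg.meas.comp (by fun_prop), ⟨B, fun ξ => hB _⟩, ⟨K * (r + ‖c‖), fun ζ hζ => ?_⟩⟩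
  have h1 := hr _ hζ
  have h2 : ‖K⁻¹ • ζ‖ ≤ r + ‖c‖ := by
    calc ‖K⁻¹ • ζ‖ = ‖(c + K⁻¹ • ζ) - c‖ := by congr 1; abel
      _ ≤ _ := (norm_sub_le _ _).trans (by gcongr)
  rw [norm_smul, norm_inv, Real.norm_of_nonneg hK.le] at h2
  calc ‖ζ‖ = K * (K⁻¹ * ‖ζ‖) := by field_simp
    _ ≤ _ := by gcongr

lemma lintegral_blow {n : ℕ} (g : Euc n → ℂ) {K : ℝ} (hK : 0 < K) (c : Euc n) :
    ∫⁻ ζ, ‖blow K c g ζ‖ₑ ^ 2 = ofReal (K ^ n) * ∫⁻ ξ, ‖g ξ‖ₑ ^ 2 := by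
  have h := lintegral_comp_smul_euc (fun ξ : Euc n => ‖g (c + ξ)‖ₑ ^ 2) (inv_ne_zero hK.ne')
  rw [lintegral_add_left_eq_self (fun ξ => ‖g ξ‖ₑ ^ 2) c, inv_pow, abs_inv, inv_inv,
    abs_of_pos (by positivity)] at h
  exact h

lemma enorm_evol_rsc {n : ℕ} (g : Euc n → ℂ) {K : ℝ} (hK : 0 < K) (c : Euc n) (z : Euc n × ℝ) :
    ‖evol g (rsc K c z).1 (rsc K c z).2‖ₑ =
      ofReal ((K ^ n)⁻¹) * ‖evol (blow K c g) z.1 z.2‖ₑ := by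
  obtain ⟨x, t⟩ := z
  set x' := (rsc K c (x, t)).1 with hx'
  set t' := (rsc K c (x, t)).2 with ht'
  set F : Euc n → ℂ := fun ξ => g ξ * osc (⟪x', ξ⟫_ℝ - t' * ‖ξ‖ ^ 2) with hF
  have h1 : evol g x' t' = ((K ^ n)⁻¹ : ℝ) • ∫ ζ, F (c + K⁻¹ • ζ) := by
    have h2 : ∫ ζ, F (c + K⁻¹ • ζ) = |((K⁻¹) ^ n)⁻¹| • ∫ ξ, F (c + ξ) := by
      have := Measure.integral_comp_smul (volume : Measure (Euc n)) (fun ξ => F (c + ξ)) K⁻¹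
      rwa [finrank_euclideanSpace_fin] at this
    rw [h2, integral_add_left_eq_self F c, smul_smul, inv_pow, inv_inv, abs_of_pos (by positivity),
      inv_mul_cancel₀ (by positivity), one_smul]
    rfl
  have h3 : ∀ ζ, F (c + K⁻¹ • ζ) = osc (⟪x', c⟫_ℝ - t' * ‖c‖ ^ 2) *
      (blow K c g ζ * osc (⟪x, ζ⟫_ℝ - t * ‖ζ‖ ^ 2)) := fun ζ => by
    have h4 : ⟪x', c + K⁻¹ • ζ⟫_ℝ - t' * ‖c + K⁻¹ • ζ‖ ^ 2 =
        (⟪x', c⟫_ℝ - t' * ‖c‖ ^ 2) + (⟪x, ζ⟫_ℝ - t * ‖ζ‖ ^ 2) := by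
      rw [norm_add_sq_real, inner_add_right, norm_smul, norm_inv, Real.norm_of_nonneg hK.le,
        inner_smul_right, inner_smul_right, hx', ht']
      simp only [rsc, inner_add_left, inner_smul_left]
      simp
      field_simp
      ring
    simp only [hF, h4, osc_add, blow]
    ring
  simp_rw [h1, h3]
  rw [integral_const_mul, enorm_smul, enorm_mul, ← ofReal_norm (osc _), norm_osc, ENNReal.ofReal_one,
    one_mul, Real.enorm_of_nonneg (by positivity)]
  rfl

/-- Frequency data transversal to a moving slab. -/
structure Freq {n : ℕ} (B : ℝ) (i : Fin n) (V θ : ℝ) (h : Euc n → ℂ) : Prop where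
  nice : Nice h
  cube : InCube h
  pos : 0 < θ
  dir : ∀ ξ, h ξ ≠ 0 → θ ≤ |2 * ξ i - V|
  speed : |V| + 4 ≤ B * θ

/-- Bounded `α`-dimensional weights supported in a moving slab. -/
structure Wgt {n : ℕ} (α : ℝ) (i : Fin n) (V θ a R : ℝ) (Λ : ℝ≥0∞) (w : Euc n × ℝ → ℝ≥0∞) :
    Prop where
  meas : Measurable w
  supp : ∀ z, w z ≠ 0 → |z.1 i - V * z.2 - a| ≤ θ * R
  le : ∀ z, w z ≤ Λ
  ball : ∀ z r, 1 ≤ r → ∫⁻ z' in closedBall z r, w z' ≤ Λ * ofReal (r ^ α)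

/-- The mass of a weight in a ball of radius `5K`. -/
noncomputable def mass {n : ℕ} (K : ℕ) (w : Euc n × ℝ → ℝ≥0∞) (z : Euc n × ℝ) : ℝ≥0∞ :=
  ((K : ℝ≥0∞) ^ (n + 1))⁻¹ * ∫⁻ z' in closedBall z (5 * K), w z'

lemma measurable_mass {n : ℕ} (K : ℕ) {w : Euc n × ℝ → ℝ≥0∞} (hw : Measurable w) :
    Measurable (mass K w) := (measurable_setLIntegral_closedBall hw _).const_mul _

lemma avgW_eq_mass {n : ℕ} (K : ℕ) (w : Euc n × ℝ → ℝ≥0∞) (z : Euc n × ℝ) :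
    avgW K w z = mass K w z ^ (1 / n : ℝ) := rfl

lemma Freq.mul_osc {n : ℕ} {B : ℝ} {i : Fin n} {V θ : ℝ} {h : Euc n → ℂ} (hf : Freq B i V θ h)
    {g : Euc n → ℝ} (hg : Measurable g) : Freq B i V θ fun ξ => h ξ * osc (g ξ) :=
  ⟨hf.nice.mul_osc hg, fun ξ hξ => hf.cube ξ (left_ne_zero_of_mul hξ), hf.pos,
    fun ξ hξ => hf.dir ξ (left_ne_zero_of_mul hξ), hf.speed⟩

lemma Freq.blow {n : ℕ} {B : ℝ} {i : Fin n} {V θ : ℝ} {h : Euc n → ℂ} (hf : Freq B i V θ h)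
    {K : ℕ} (hK : 2 ≤ K) {τ : Fin n → ℤ} (hτ : τ ∈ caps n K) :
    Freq B i (K * V - 2 * τ i) (K * θ) (blow K (cpt K τ) (cap K τ h)) := by
  have hK0 : (0 : ℝ) < K := by exact_mod_cast (by omega : 0 < K)
  have hK2 : (2 : ℝ) ≤ K := by exact_mod_cast hK
  have hne : ∀ ζ, _root_.blow K (cpt K τ) (cap K τ h) ζ ≠ 0 → h (cpt K τ + (K : ℝ)⁻¹ • ζ) ≠ 0 ∧
      ∀ j, (K : ℝ) * (cpt K τ + (K : ℝ)⁻¹ • ζ) j = τ j + ζ j := fun ζ hζ => by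
    refine ⟨(cap_ne_zero hζ).1, fun j => ?_⟩
    simp [cpt]
    field_simp
  refine ⟨(hf.nice.cap K τ).blow hK0 _, fun ζ hζ j => ?_, by have := hf.pos; positivity,
    fun ζ hζ => ?_, ?_⟩
  · have h1 := (cap_ne_zero hζ).2 j
    rw [(hne ζ hζ).2, Int.floor_eq_iff] at h1
    rw [abs_le]
    constructor <;> linarith
  · have h1 := hf.dir _ (hne ζ hζ).1
    have h2 := (hne ζ hζ).2 i
    rw [show 2 * ζ i - (K * V - 2 * τ i) = K * (2 * (cpt K τ + (K : ℝ)⁻¹ • ζ) i - V) by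
      linear_combination -2 * h2, abs_mul, abs_of_pos hK0]
    gcongr
  · have h1 := Fintype.mem_piFinset.1 hτ i
    rw [Finset.mem_Icc] at h1
    have h2 : |(τ i : ℝ)| ≤ K := by
      rw [abs_le]; exact ⟨by exact_mod_cast h1.1, by exact_mod_cast h1.2⟩
    have h3 : |K * V - 2 * (τ i : ℝ)| ≤ K * |V| + 2 * K := by
      refine (abs_sub _ _).trans (add_le_add ?_ ?_)
      · rw [abs_mul, abs_of_pos hK0]
      · rw [abs_mul, abs_two]; gcongr
    calc _ ≤ K * |V| + 2 * K + 4 := by gcongr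
      _ ≤ K * (|V| + 4) := by linarith
      _ ≤ K * (B * θ) := by gcongr; exact hf.speed
      _ = _ := by ring

lemma setLIntegral_biUnion_finset_le {X ι : Type*} [MeasurableSpace X] {μ : Measure X}
    (s : Finset ι) (P : ι → Set X) (F : X → ℝ≥0∞) :
    ∫⁻ z in ⋃ j ∈ s, P j, F z ∂μ ≤ ∑ j ∈ s, ∫⁻ z in P j, F z ∂μ := by
  classical
  induction s using Finset.induction_on with
  | empty => simp
  | insert a s ha ih =>
    rw [Finset.set_biUnion_insert, Finset.sum_insert ha]
    exact (lintegral_union_le _ _ _).trans (add_le_add le_rfl ih)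

lemma setLIntegral_mass_rsc_le {n : ℕ} {w : Euc n × ℝ → ℝ≥0∞} (hw : Measurable w) {K : ℕ}
    (hK : 1 ≤ K) {c : Euc n} (hc : ‖c‖ ≤ n) (z₀ : Euc n × ℝ) {r : ℝ} (hr : 1 ≤ r) {A : ℝ≥0∞}
    (hA : ∀ q, ∫⁻ z in closedBall q ((6 + 2 * n) * (K * r)), w z ≤ A) :
    ∫⁻ z in closedBall z₀ r, mass K w (rsc K c z) ≤
      3 * volume (closedBall (0 : Euc n × ℝ) 5) * ofReal (((K : ℝ) ^ (n + 1))⁻¹) * A := by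
  have hK0 : (0 : ℝ) < K := by exact_mod_cast hK
  have hK1 : (1 : ℝ) ≤ K := by exact_mod_cast hK
  have hr0 : 0 < r := by linarith
  set V5 := volume (closedBall (0 : Euc n × ℝ) 5)
  set s : ℕ → ℝ := fun j => z₀.2 - r + j * (r / K) with hs
  set P : ℕ → Set (Euc n × ℝ) := fun j =>
    {z | ‖z.1 - z₀.1‖ ≤ r} ∩ {z | |z.2 - s j| ≤ r / K} with hP
  have hPm : ∀ j, MeasurableSet (P j) := fun j =>
    (measurableSet_le (measurable_fst.sub_const _).norm measurable_const).inter
      (measurableSet_le (measurable_norm.comp (measurable_snd.sub_const (s j))) measurable_const)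
  have hcov : closedBall z₀ r ⊆ ⋃ j ∈ Finset.range (2 * K + 1), P j := fun z hz => by
    rw [mem_closedBall, Prod.dist_eq, max_le_iff, dist_eq_norm, Real.dist_eq, abs_le] at hz
    obtain ⟨h1, h2, h3⟩ := hz
    set u : ℝ := (z.2 - z₀.2 + r) * K / r with hu
    have hu0 : 0 ≤ u := by have : 0 ≤ z.2 - z₀.2 + r := by linarith
                           positivity
    have hu1 : u ≤ 2 * K := by rw [hu, div_le_iff₀ hr0]; nlinarith
    have h4 := Nat.floor_le hu0
    have h5 := Nat.lt_floor_add_one u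
    refine mem_biUnion (x := ⌊u⌋₊) ?_ ⟨h1, ?_⟩
    · rw [Finset.coe_range, mem_Iio, Nat.lt_add_one_iff]
      exact_mod_cast h4.trans hu1
    · show |z.2 - s ⌊u⌋₊| ≤ r / K
      have h6 : z.2 - s ⌊u⌋₊ = (u - ⌊u⌋₊) * (r / K) := by
        simp only [hs, hu]; field_simp; ring
      rw [h6, abs_of_nonneg (mul_nonneg (by linarith) (by positivity))]
      calc _ ≤ 1 * (r / K) := by gcongr; linarith
        _ = _ := one_mul _
  set ρ : ℝ := (1 + 2 * n) * (K * r) with hρ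
  have hsub : ∀ j z, z ∈ P j → rsc K c z ∈ closedBall (rsc K c (z₀.1, s j)) ρ := by
    rintro j z ⟨h1, h2⟩
    change ‖z.1 - z₀.1‖ ≤ r at h1
    change |z.2 - s j| ≤ r / K at h2
    have h3 : (K : ℝ) ^ 2 * |z.2 - s j| ≤ K * r := by
      calc _ ≤ (K : ℝ) ^ 2 * (r / K) := by gcongr
        _ = _ := by field_simp
    have hn0 : (0 : ℝ) ≤ n := by positivity
    have hKr : 0 ≤ K * r := by positivity
    rw [mem_closedBall, Prod.dist_eq, max_le_iff, dist_eq_norm, Real.dist_eq]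
    simp only [rsc]
    constructor
    · rw [show (K : ℝ) • z.1 + (2 * ((K : ℝ) ^ 2 * z.2)) • c -
        ((K : ℝ) • z₀.1 + (2 * ((K : ℝ) ^ 2 * s j)) • c) =
        (K : ℝ) • (z.1 - z₀.1) + (2 * ((K : ℝ) ^ 2 * (z.2 - s j))) • c by
          rw [smul_sub, mul_sub, mul_sub, sub_smul]; abel]
      refine (norm_add_le _ _).trans ?_
      rw [norm_smul, norm_smul, Real.norm_of_nonneg hK0.le, Real.norm_eq_abs, abs_mul, abs_two,
        abs_mul, abs_of_nonneg (by positivity : (0 : ℝ) ≤ (K : ℝ) ^ 2), hρ]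
      calc _ ≤ K * r + 2 * (K * r) * n := by gcongr
        _ = _ := by ring
    · rw [← mul_sub, abs_mul, abs_of_nonneg (by positivity : (0 : ℝ) ≤ (K : ℝ) ^ 2)]
      refine h3.trans ?_
      rw [hρ]; nlinarith [mul_nonneg hn0 hKr]
  have hj : ∀ j, ∫⁻ z in P j, mass K w (rsc K c z) ≤
      ofReal (((K : ℝ) ^ (n + 2))⁻¹) * (V5 * A) := fun j => by
    set q := rsc K c (z₀.1, s j)
    have hm : Measurable ((closedBall q ρ).indicator (mass K w)) :=
      (measurable_mass K hw).indicator measurableSet_closedBall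
    calc _ ≤ ∫⁻ z, (closedBall q ρ).indicator (mass K w) (rsc K c z) := by
          rw [← lintegral_indicator (hPm j)]
          refine lintegral_mono fun z => ?_
          by_cases hz : z ∈ P j
          · rw [indicator_of_mem hz, indicator_of_mem (hsub j z hz)]
          · rw [indicator_of_notMem hz]; exact bot_le
      _ = ofReal (((K : ℝ) ^ (n + 2))⁻¹) * ∫⁻ z in closedBall q ρ, mass K w z := by
          rw [lintegral_comp_rsc hm hK0, lintegral_indicator measurableSet_closedBall]
      _ ≤ _ := by
          refine mul_le_mul' le_rfl ((setLIntegral_mass_le hw hK q ρ).trans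
            (mul_le_mul' le_rfl ((lintegral_mono_set (closedBall_subset_closedBall ?_)).trans (hA q))))
          rw [hρ]
          nlinarith
  calc _ ≤ ∫⁻ z in ⋃ j ∈ Finset.range (2 * K + 1), P j, mass K w (rsc K c z) :=
        lintegral_mono_set hcov
    _ ≤ ∑ j ∈ Finset.range (2 * K + 1), ∫⁻ z in P j, mass K w (rsc K c z) :=
        setLIntegral_biUnion_finset_le _ _ _
    _ ≤ ∑ _j ∈ Finset.range (2 * K + 1), ofReal (((K : ℝ) ^ (n + 2))⁻¹) * (V5 * A) :=
        Finset.sum_le_sum fun j _ => hj j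
    _ = ((2 * K + 1 : ℕ) : ℝ≥0∞) * (ofReal (((K : ℝ) ^ (n + 2))⁻¹) * (V5 * A)) := by
        rw [Finset.sum_const, Finset.card_range, nsmul_eq_mul]
    _ ≤ ((3 * K : ℕ) : ℝ≥0∞) * (ofReal (((K : ℝ) ^ (n + 2))⁻¹) * (V5 * A)) := by
        gcongr; omega
    _ = 3 * V5 * (ofReal K * ofReal (((K : ℝ) ^ (n + 2))⁻¹)) * A := by
        rw [ENNReal.ofReal_natCast]; push_cast; ring
    _ = _ := by
        rw [← ENNReal.ofReal_mul (by positivity)]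
        congr 4
        rw [pow_succ]; field_simp

lemma Wgt.rescale (n : ℕ) (α : ℝ) : ∃ C : ℝ≥0∞, C ≠ ⊤ ∧ ∀ {B : ℝ} {i : Fin n}
    {V θ a R : ℝ} {Λ : ℝ≥0∞} {w : Euc n × ℝ → ℝ≥0∞}, Wgt α i V θ a R Λ w → |V| + 4 ≤ B * θ →
    0 < θ → ∀ {K : ℕ}, 2 ≤ K → 5 * K * B ≤ R → ∀ {τ : Fin n → ℤ}, τ ∈ caps n K →
    Wgt α i (K * V - 2 * τ i) (K * θ) (a / K) (2 * R / K ^ 2)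
      (C * ofReal ((K : ℝ) ^ (α - n - 1)) * Λ) (fun z => mass K w (rsc K (cpt K τ) z)) := by
  set V5 := volume (closedBall (0 : Euc n × ℝ) 5) with hV5
  refine ⟨3 * V5 * ofReal ((6 + 2 * n : ℝ) ^ α) + ofReal ((5 : ℝ) ^ α),
    ENNReal.add_ne_top.2 ⟨ENNReal.mul_ne_top (ENNReal.mul_ne_top (by simp)
      (isCompact_closedBall _ _).measure_lt_top.ne) ENNReal.ofReal_ne_top, ENNReal.ofReal_ne_top⟩,
    fun {B i V θ a R Λ w} hw hV hθ {K} hK hR {τ} hτ => ?_⟩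
  have hK0 : (0 : ℝ) < K := by exact_mod_cast (by omega : 0 < K)
  have hK1 : (1 : ℝ) ≤ K := by exact_mod_cast (by omega : 1 ≤ K)
  have hpow : ∀ x : ℝ, 0 ≤ x → ((K : ℝ) ^ (n + 1))⁻¹ * (x * K) ^ α =
      x ^ α * (K : ℝ) ^ (α - n - 1) := fun x hx => by
    rw [Real.mul_rpow hx hK0.le, show α - n - 1 = α - ((n + 1 : ℕ) : ℝ) by push_cast; ring,
      Real.rpow_sub_natCast hK0.ne']
    field_simp
  refine ⟨(measurable_mass K hw.meas).comp (continuous_rsc K _).measurable, fun z hz => ?_,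
    fun z => ?_, fun z r hr => ?_⟩
  · obtain ⟨q, hq, hwq⟩ : ∃ q ∈ closedBall (rsc K (cpt K τ) z) (5 * K), w q ≠ 0 := by
      by_contra! hcon
      refine hz ?_
      rw [mass, setLIntegral_congr_fun measurableSet_closedBall hcon]
      simp
    have h1 := hw.supp q hwq
    rw [mem_closedBall, Prod.dist_eq, max_le_iff, dist_eq_norm, Real.dist_eq] at hq
    have h2 : |q.1 i - (rsc K (cpt K τ) z).1 i| ≤ 5 * K :=
      (PiLp.norm_apply_le (q.1 - (rsc K (cpt K τ) z).1) i).trans hq.1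
    have h3 : |V * (q.2 - (rsc K (cpt K τ) z).2)| ≤ |V| * (5 * K) := by
      rw [abs_mul]; exact mul_le_mul_of_nonneg_left hq.2 (abs_nonneg _)
    have h4 : (rsc K (cpt K τ) z).1 i - V * (rsc K (cpt K τ) z).2 - a =
        K * (z.1 i - (K * V - 2 * τ i) * z.2 - a / K) := by
      simp [rsc, cpt]; field_simp; ring
    have h5 : |K * (z.1 i - (K * V - 2 * τ i) * z.2 - a / K)| ≤ θ * (2 * R) := by
      rw [← h4]
      have h6 : 5 * K * (|V| + 4) ≤ θ * R := by nlinarith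
      rw [abs_le] at *
      constructor <;> nlinarith
    rw [abs_mul, abs_of_pos hK0] at h5
    calc _ = K * |z.1 i - (K * V - 2 * τ i) * z.2 - a / K| / K := by field_simp
      _ ≤ θ * (2 * R) / K := by gcongr
      _ = _ := by field_simp
  · calc _ ≤ ofReal (((K : ℝ) ^ (n + 1))⁻¹) * (Λ * ofReal ((5 * K : ℝ) ^ α)) := by
          rw [ENNReal.ofReal_inv_of_pos (by positivity), ENNReal.ofReal_pow hK0.le,
            ENNReal.ofReal_natCast]
          exact mul_le_mul' le_rfl (hw.ball _ _ (by linarith))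
      _ = ofReal (((K : ℝ) ^ (n + 1))⁻¹ * (5 * K) ^ α) * Λ := by
          rw [ENNReal.ofReal_mul (by positivity)]; ring
      _ = ofReal ((5 : ℝ) ^ α) * ofReal ((K : ℝ) ^ (α - n - 1)) * Λ := by
          rw [hpow _ (by norm_num), ENNReal.ofReal_mul (by positivity)]
      _ ≤ _ := by gcongr; exact le_add_self
  · refine (setLIntegral_mass_rsc_le hw.meas (by omega) (norm_cpt_le (by omega) hτ) z hr
      fun q => hw.ball q _ ?_).trans ?_
    · have : (0 : ℝ) ≤ n := by positivity
      have h1 : 1 ≤ K * r := one_le_mul_of_one_le_of_one_le hK1 hr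
      nlinarith
    · calc _ = 3 * V5 * ofReal (((K : ℝ) ^ (n + 1))⁻¹ * ((6 + 2 * n) * K) ^ α) * Λ *
            ofReal (r ^ α) := by
            rw [show (6 + 2 * n : ℝ) * (K * r) = ((6 + 2 * n) * K) * r by ring,
              Real.mul_rpow (by positivity) (by positivity), ENNReal.ofReal_mul (by positivity),
              ENNReal.ofReal_mul (by positivity)]
            ring
        _ = 3 * V5 * ofReal ((6 + 2 * n : ℝ) ^ α) *
            ofReal ((K : ℝ) ^ (α - n - 1)) * Λ * ofReal (r ^ α) := by
            rw [hpow _ (by positivity), ENNReal.ofReal_mul (by positivity)]; ring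
        _ ≤ _ := by gcongr; exact le_self_add

/-- The weighted estimate at scale `R` with constant `M`. -/
def WBound (n : ℕ) (α B R : ℝ) (M : ℝ≥0∞) : Prop :=
  ∀ (i : Fin n) (V θ a : ℝ) (Λ : ℝ≥0∞) (h : Euc n → ℂ) (w : Euc n × ℝ → ℝ≥0∞),
    Freq B i V θ h → Wgt α i V θ a R Λ w →
    ∫⁻ z, ‖evol h z.1 z.2‖ₑ ^ 2 * w z ^ (1 / n : ℝ) ≤ M * Λ ^ (1 / n : ℝ) * ∫⁻ ξ, ‖h ξ‖ₑ ^ 2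

lemma WBound.cap_le {n : ℕ} (hn : 1 ≤ n) (α : ℝ) : ∃ C : ℝ≥0∞, C ≠ ⊤ ∧
    ∀ {B R : ℝ} {K : ℕ} {M : ℝ≥0∞}, 2 ≤ K → 5 * K * B ≤ R → WBound n α B (2 * R / K ^ 2) M →
    ∀ {i : Fin n} {V θ a : ℝ} {Λ : ℝ≥0∞} {h : Euc n → ℂ} {w : Euc n × ℝ → ℝ≥0∞},
    Freq B i V θ h → Wgt α i V θ a R Λ w → ∀ τ ∈ caps n K,
    ∫⁻ z, ‖evol (cap K τ h) z.1 z.2‖ₑ ^ 2 * mass K w z ^ (1 / n : ℝ) ≤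
      C * ofReal ((K : ℝ) ^ ((n + α - 1) / n)) * M * Λ ^ (1 / n : ℝ) *
        ∫⁻ ξ, ‖cap K τ h ξ‖ₑ ^ 2 := by
  obtain ⟨C, hC, H⟩ := Wgt.rescale n α
  have hn0 : (0 : ℝ) < n := by exact_mod_cast hn
  refine ⟨C ^ (1 / n : ℝ), ENNReal.rpow_ne_top_of_nonneg (by positivity) hC,
    fun {B R K M} hK hR hM {i V θ a Λ h w} hf hw τ hτ => ?_⟩
  have hK0 : (0 : ℝ) < K := by exact_mod_cast (by omega : 0 < K)
  set c := cpt K τ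
  have h1 := hM _ _ _ _ _ _ _ (hf.blow hK hτ) (H hw hf.speed hf.pos hK hR hτ)
  have hev := measurable_enorm_evol_comp (hf.nice.cap K τ) measurable_fst measurable_snd
  have hmeas : Measurable fun z : Euc n × ℝ =>
      ‖evol (cap K τ h) z.1 z.2‖ₑ ^ 2 * mass K w z ^ (1 / n : ℝ) :=
    (hev.pow_const 2).mul ((measurable_mass K hw.meas).pow_const _)
  rw [lintegral_blow _ hK0] at h1
  calc _ = ofReal ((K : ℝ) ^ (n + 2)) * ∫⁻ z, ofReal (((K : ℝ) ^ n)⁻¹) ^ 2 *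
        (‖evol (blow K c (cap K τ h)) z.1 z.2‖ₑ ^ 2 * mass K w (rsc K c z) ^ (1 / n : ℝ)) := by
        rw [lintegral_eq_rsc hmeas hK0 c]
        congr 2 with z
        rw [enorm_evol_rsc _ hK0]; ring
    _ = ofReal ((K : ℝ) ^ (n + 2)) * (ofReal (((K : ℝ) ^ n)⁻¹) ^ 2 *
        ∫⁻ z, ‖evol (blow K c (cap K τ h)) z.1 z.2‖ₑ ^ 2 * mass K w (rsc K c z) ^ (1 / n : ℝ)) := by
        rw [lintegral_const_mul' _ _ (by finiteness)]
    _ ≤ ofReal ((K : ℝ) ^ (n + 2)) * (ofReal (((K : ℝ) ^ n)⁻¹) ^ 2 *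
        (M * (C * ofReal ((K : ℝ) ^ (α - n - 1)) * Λ) ^ (1 / n : ℝ) *
          (ofReal ((K : ℝ) ^ n) * ∫⁻ ξ, ‖cap K τ h ξ‖ₑ ^ 2))) := by gcongr
    _ = C ^ (1 / n : ℝ) * (ofReal ((K : ℝ) ^ (n + 2)) * ofReal (((K : ℝ) ^ n)⁻¹) ^ 2 *
          ofReal ((K : ℝ) ^ (α - n - 1)) ^ (1 / n : ℝ) * ofReal ((K : ℝ) ^ n)) *
          M * Λ ^ (1 / n : ℝ) * ∫⁻ ξ, ‖cap K τ h ξ‖ₑ ^ 2 := by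
        rw [ENNReal.mul_rpow_of_nonneg _ _ (by positivity),
          ENNReal.mul_rpow_of_nonneg _ _ (by positivity)]
        ring
    _ = _ := by
        congr 4
        rw [ENNReal.ofReal_rpow_of_nonneg (by positivity) (by positivity),
          ← ENNReal.ofReal_pow (by positivity), ← ENNReal.ofReal_mul (by positivity),
          ← ENNReal.ofReal_mul (by positivity), ← ENNReal.ofReal_mul (by positivity),
          ← Real.rpow_mul hK0.le]
        congr 1
        rw [show (n + α - 1) / n = (2 : ℕ) + (α - n - 1) * (1 / n) by push_cast; field_simp; ring,
          Real.rpow_add hK0, Real.rpow_natCast]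
        field_simp
        ring

lemma cap_mul {n K : ℕ} (τ : Fin n → ℤ) (h g : Euc n → ℂ) :
    cap K τ (fun ξ => h ξ * g ξ) = fun ξ => cap K τ h ξ * g ξ := by
  ext ξ
  unfold cap
  by_cases hξ : ξ ∈ {ξ : Euc n | ∀ i, ⌊(K : ℝ) * ξ i⌋ = τ i}
  · rw [indicator_of_mem hξ, indicator_of_mem hξ]
  · rw [indicator_of_notMem hξ, indicator_of_notMem hξ, zero_mul]

lemma sum_lintegral_cap_sq {n : ℕ} (K : ℕ) {h : Euc n → ℂ} (hh : Nice h) :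
    ∑ τ ∈ caps n K, ∫⁻ ξ, ‖cap K τ h ξ‖ₑ ^ 2 ≤ ∫⁻ ξ, ‖h ξ‖ₑ ^ 2 := by
  classical
  rw [← lintegral_finsetSum _ fun τ _ => ((hh.cap K τ).meas.enorm.pow_const 2)]
  refine lintegral_mono fun ξ => ?_
  have h1 : ∀ τ : Fin n → ℤ, ‖cap K τ h ξ‖ₑ ^ 2 =
      if (fun i => ⌊(K : ℝ) * ξ i⌋) = τ then ‖h ξ‖ₑ ^ 2 else 0 := fun τ => by
    unfold cap
    by_cases hξ : (fun i => ⌊(K : ℝ) * ξ i⌋) = τ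
    · rw [if_pos hξ, indicator_of_mem (show ξ ∈ {ξ : Euc n | ∀ i, ⌊(K : ℝ) * ξ i⌋ = τ i} from
        fun i => congrFun hξ i)]
    · rw [if_neg hξ, indicator_of_notMem (fun hc : ξ ∈ {ξ : Euc n | ∀ i, ⌊(K : ℝ) * ξ i⌋ = τ i} => hξ (funext hc))]
      simp
  simp_rw [h1]
  rw [Finset.sum_ite_eq]
  split_ifs
  · exact le_rfl
  · exact bot_le

lemma lintegral_mul_eI_le {n N : ℕ} (K : ℝ) {g : Euc n → ℂ} (hg : Nice g) {W : Euc n × ℝ → ℝ≥0∞}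
    (hW : Measurable W) {A : ℝ≥0∞}
    (H : ∀ y, ∫⁻ z : Euc n × ℝ, ‖evol g (z.1 + y) z.2‖ₑ ^ 2 * W z ≤ A) :
    ∫⁻ z, W z * eI N K g z ≤ A * ∫⁻ y : Euc n, phi N y := by
  obtain ⟨S, hS, hSm⟩ : ∃ S : Euc n → Euc n,
      S = (fun y => -sc (EuclideanSpace.basisFun (Fin n) ℝ) (fun _ => K) y) ∧ Measurable S :=
    ⟨_, rfl, by fun_prop⟩
  have heI : ∀ z, eI N K g z = ∫⁻ y, ‖evol g (z.1 + S y) z.2‖ₑ ^ 2 * phi N y := fun z => by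
    rw [hS]; rfl
  have hm0 : Measurable fun p : (Euc n × ℝ) × Euc n => ‖evol g (p.1.1 + S p.2) p.1.2‖ₑ ^ 2 :=
    (measurable_enorm_evol_comp hg (measurable_fst.fst.add (hSm.comp measurable_snd))
      measurable_fst.snd).pow_const 2
  have hm : Measurable fun p : (Euc n × ℝ) × Euc n =>
      ‖evol g (p.1.1 + S p.2) p.1.2‖ₑ ^ 2 * W p.1 := hm0.mul (hW.comp measurable_fst)
  have hm1 : Measurable fun p : (Euc n × ℝ) × Euc n =>
      ‖evol g (p.1.1 + S p.2) p.1.2‖ₑ ^ 2 * W p.1 * phi N p.2 :=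
    hm.mul ((measurable_phi N).comp measurable_snd)
  calc _ = ∫⁻ z : Euc n × ℝ, ∫⁻ y : Euc n, ‖evol g (z.1 + S y) z.2‖ₑ ^ 2 * W z * phi N y := by
        refine lintegral_congr fun z => ?_
        have h2 : Measurable fun y => ‖evol g (z.1 + S y) z.2‖ₑ ^ 2 :=
          (measurable_enorm_evol_comp hg (hSm.const_add z.1) measurable_const).pow_const 2
        have h3 : Measurable fun y => ‖evol g (z.1 + S y) z.2‖ₑ ^ 2 * phi N y :=
          h2.mul (measurable_phi N)
        rw [heI, ← lintegral_const_mul _ h3]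
        exact lintegral_congr fun y => by ring
    _ = ∫⁻ y : Euc n, ∫⁻ z : Euc n × ℝ, ‖evol g (z.1 + S y) z.2‖ₑ ^ 2 * W z * phi N y :=
        lintegral_lintegral_swap
          (f := fun (z : Euc n × ℝ) (y : Euc n) => ‖evol g (z.1 + S y) z.2‖ₑ ^ 2 * W z * phi N y)
          hm1.aemeasurable
    _ ≤ ∫⁻ y : Euc n, A * phi N y := by
        refine lintegral_mono fun y => ?_
        have h2 : Measurable fun z : Euc n × ℝ => ‖evol g (z.1 + S y) z.2‖ₑ ^ 2 * W z :=
          ((measurable_enorm_evol_comp hg (measurable_fst.add_const (S y))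
            measurable_snd).pow_const 2).mul hW
        rw [lintegral_mul_const _ h2]
        exact mul_le_mul' (H _) le_rfl
    _ = _ := lintegral_const_mul _ (measurable_phi N)

lemma WBound.narrow {n : ℕ} (hn : 1 ≤ n) (α : ℝ) {N : ℕ} (hN : n < N) : ∃ C : ℝ≥0∞, C ≠ ⊤ ∧
    ∀ {B R : ℝ} {K : ℕ} {M : ℝ≥0∞}, 2 ≤ K → 5 * K * B ≤ R → WBound n α B (2 * R / K ^ 2) M →
    ∀ {i : Fin n} {V θ a : ℝ} {Λ : ℝ≥0∞} {h : Euc n → ℂ} {w : Euc n × ℝ → ℝ≥0∞},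
    Freq B i V θ h → Wgt α i V θ a R Λ w →
    ∫⁻ z, Psi N K h w z ≤
      C * ofReal ((K : ℝ) ^ ((n + α - 1) / n)) * M * Λ ^ (1 / n : ℝ) *
        ∫⁻ ξ, ‖h ξ‖ₑ ^ 2 := by
  obtain ⟨C, hC, H⟩ := WBound.cap_le hn α
  refine ⟨C * ∫⁻ y : Euc n, phi N y, ENNReal.mul_ne_top hC (lintegral_phi_lt_top hN).ne,
    fun {B R K M} hK hR hM {i V θ a Λ h w} hf hw => ?_⟩
  obtain ⟨A, hA⟩ : ∃ A, A = C * ofReal ((K : ℝ) ^ ((n + α - 1) / n)) * M * Λ ^ (1 / n : ℝ) :=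
    ⟨_, rfl⟩
  have hmass := (measurable_mass K hw.meas).pow_const (1 / n : ℝ)
  have key : ∀ τ ∈ caps n K, ∫⁻ z, mass K w z ^ (1 / n : ℝ) * eI N K (cap K τ h) z ≤
      (A * ∫⁻ ξ, ‖cap K τ h ξ‖ₑ ^ 2) * (∫⁻ y : Euc n, phi N y) := fun τ hτ => by
    refine lintegral_mul_eI_le _ (hf.nice.cap K τ) hmass fun y => ?_
    have h1 := H hK hR hM (hf.mul_osc (g := fun ξ => ⟪y, ξ⟫_ℝ) (by fun_prop)) hw τ hτ
    rw [cap_mul] at h1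
    simp_rw [evol_translate, enorm_mul, enorm_osc, mul_one] at h1
    rw [hA]
    exact h1
  have hPsi : ∀ z, Psi N K h w z =
      ∑ τ ∈ caps n K, mass K w z ^ (1 / n : ℝ) * eI N K (cap K τ h) z := fun z => by
    rw [Psi, avgW_eq_mass, eS, Finset.mul_sum]
  simp_rw [hPsi]
  rw [lintegral_finsetSum (f := fun τ z => mass K w z ^ (1 / n : ℝ) * eI N K (cap K τ h) z) _
    fun τ _ => hmass.mul (measurable_eI N K (hf.nice.cap K τ))]
  calc _ ≤ ∑ τ ∈ caps n K, (A * ∫⁻ ξ, ‖cap K τ h ξ‖ₑ ^ 2) * (∫⁻ y : Euc n, phi N y) :=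
        Finset.sum_le_sum key
    _ = A * (∫⁻ y : Euc n, phi N y) * ∑ τ ∈ caps n K, ∫⁻ ξ, ‖cap K τ h ξ‖ₑ ^ 2 := by
        rw [Finset.mul_sum]
        exact Finset.sum_congr rfl fun _ _ => by ring
    _ ≤ A * (∫⁻ y : Euc n, phi N y) * ∫⁻ ξ, ‖h ξ‖ₑ ^ 2 := by
        gcongr; exact sum_lintegral_cap_sq K hf.nice
    _ = _ := by rw [hA]; ring

lemma Wgt.window {n : ℕ} (hn : 1 ≤ n) {α : ℝ} {K : ℕ} (hK : 1 ≤ K) :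
    ∃ C : ℝ≥0∞, C ≠ ⊤ ∧ ∀ {i : Fin n} {V θ a R : ℝ} {Λ : ℝ≥0∞} {w : Euc n × ℝ → ℝ≥0∞},
    Wgt α i V θ a R Λ w → ∀ r : ℝ, K ≤ r → ∀ z₀,
    (∫⁻ z in closedBall z₀ (2 * r), (mass K w z ^ (1 / n : ℝ)) ^ (n + 1 : ℝ)) ^ (1 / (n + 1) : ℝ) ≤
      C * Λ ^ (1 / n : ℝ) * ofReal (r ^ (α / (n + 1))) := by
  have hn0 : (0 : ℝ) < n := by exact_mod_cast hn
  have hK1 : (1 : ℝ) ≤ K := by exact_mod_cast hK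
  set V5 := volume (closedBall (0 : Euc n × ℝ) 5) with hV5
  have hV5t : V5 ≠ ⊤ := measure_closedBall_lt_top.ne
  set A := ofReal ((5 * K : ℝ) ^ α) with hA
  set D := A ^ (1 / n : ℝ) * V5 * ofReal ((7 : ℝ) ^ α) with hD
  have hDt : D ≠ ⊤ := by
    have := ENNReal.rpow_ne_top_of_nonneg (by positivity : (0 : ℝ) ≤ 1 / n)
      (ENNReal.ofReal_ne_top : A ≠ ⊤)
    finiteness
  have hs0 : (0 : ℝ) ≤ 1 / (n + 1) := by positivity
  refine ⟨D ^ (1 / (n + 1) : ℝ), ENNReal.rpow_ne_top_of_nonneg hs0 hDt,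
    fun {i V θ a R Λ w} hw r hr z₀ => ?_⟩
  have hr0 : 0 < r := by linarith
  have hle : ∀ z, mass K w z ≤ A * Λ := fun z => by
    have h1 : ((K : ℝ≥0∞) ^ (n + 1))⁻¹ ≤ 1 := by
      rw [ENNReal.inv_le_one]
      exact one_le_pow₀ (by exact_mod_cast hK)
    calc _ ≤ 1 * (Λ * A) := mul_le_mul' h1 (hw.ball z _ (by linarith))
      _ = _ := by ring
  have hInt : ∫⁻ z in closedBall z₀ (2 * r), mass K w z ≤
      V5 * (Λ * (ofReal ((7 : ℝ) ^ α) * ofReal (r ^ α))) := by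
    refine (setLIntegral_mass_le hw.meas hK z₀ (2 * r)).trans (mul_le_mul' le_rfl ?_)
    rw [← ENNReal.ofReal_mul (by positivity), ← Real.mul_rpow (by norm_num) hr0.le]
    exact (lintegral_mono_set (closedBall_subset_closedBall (by linarith))).trans
      (hw.ball z₀ (7 * r) (by linarith))
  have hsplit : ∀ z, (mass K w z ^ (1 / n : ℝ)) ^ (n + 1 : ℝ) =
      mass K w z ^ (1 / n : ℝ) * mass K w z := fun z => by
    rw [ENNReal.rpow_add_of_nonneg _ _ hn0.le zero_le_one, ENNReal.rpow_one, ← ENNReal.rpow_mul,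
      one_div_mul_cancel hn0.ne', ENNReal.rpow_one, mul_comm]
  calc _ ≤ (∫⁻ z in closedBall z₀ (2 * r), (A * Λ) ^ (1 / n : ℝ) * mass K w z) ^ (1 / (n + 1) : ℝ) := by
        refine ENNReal.rpow_le_rpow (lintegral_mono fun z => ?_) hs0
        rw [hsplit]
        exact mul_le_mul' (ENNReal.rpow_le_rpow (hle z) (by positivity)) le_rfl
    _ ≤ ((A * Λ) ^ (1 / n : ℝ) *
        (V5 * (Λ * (ofReal ((7 : ℝ) ^ α) * ofReal (r ^ α))))) ^ (1 / (n + 1) : ℝ) := by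
        refine ENNReal.rpow_le_rpow ?_ hs0
        rw [lintegral_const_mul _ (measurable_mass K hw.meas)]
        gcongr
    _ = (D * (Λ ^ (1 / n : ℝ) * Λ) * ofReal (r ^ α)) ^ (1 / (n + 1) : ℝ) := by
        have hAL : (A * Λ) ^ (1 / n : ℝ) = A ^ (1 / n : ℝ) * Λ ^ (1 / n : ℝ) :=
          ENNReal.mul_rpow_of_nonneg _ _ (by positivity)
        rw [hAL, hD]
        congr 1; ring
    _ = _ := by
        have hΛ : (Λ ^ (1 / n : ℝ) * Λ) ^ (1 / (n + 1) : ℝ) = Λ ^ (1 / n : ℝ) := by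
          rw [ENNReal.mul_rpow_of_nonneg _ _ hs0, ← ENNReal.rpow_mul,
            ← ENNReal.rpow_add_of_nonneg _ _ (by positivity) hs0]
          congr 1; field_simp; ring
        have hrr : ofReal (r ^ α) ^ (1 / (n + 1) : ℝ) =
            ofReal (r ^ (α / (n + 1))) := by
          rw [ENNReal.ofReal_rpow_of_nonneg (by positivity) hs0, ← Real.rpow_mul hr0.le]
          congr 2; field_simp
        rw [ENNReal.mul_rpow_of_nonneg _ _ hs0, ENNReal.mul_rpow_of_nonneg (D) _ hs0, hΛ, hrr]

lemma broad_tuple_window {n : ℕ} (hn : 1 ≤ n) {N Ne : ℕ} (hN : n < N)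
    (hNe : n * (n * N) + n + 1 ≤ Ne) {ν : ℝ} (hν : 0 < ν) :
    ∃ C₁ : ℝ≥0∞, C₁ ≠ ⊤ ∧ 1 ≤ C₁ ∧ ∀ {α : ℝ}, 0 ≤ α → ∀ {K : ℕ}, 1 ≤ K →
    ∃ C : ℝ≥0∞, C ≠ ⊤ ∧ ∀ {i : Fin n} {V θ a R : ℝ} {Λ : ℝ≥0∞} {w : Euc n × ℝ → ℝ≥0∞},
    Wgt α i V θ a R Λ w → ∀ {l : ℕ}, 1 ≤ l → ∀ {h : Euc n → ℂ}, Nice h → InCube h →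
    ∀ τ : Fin (n + 1) → Fin n → ℤ, (∀ j, τ j ∈ caps n K) →
    ν ≤ |(vmat fun j i => 2 * ⟪EuclideanSpace.basisFun (Fin n) ℝ (Fin.castLE le_rfl i),
      cpt K (τ j)⟫_ℝ).det| → ∀ z₀,
    ∫⁻ z in closedBall z₀ (2 * (K : ℝ) ^ l),
      (∏ j, eI Ne K (cap K (τ j) h) z ^ (1 / (n + 1 : ℕ) : ℝ)) * avgW K w z ≤
      C * C₁ ^ l * Λ ^ (1 / n : ℝ) * ofReal (((K : ℝ) ^ l) ^ (n + α / (n + 1))) *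
        ∏ j, eI N ((K : ℝ) ^ l) (cap K (τ j) h) z₀ ^ (1 / (n + 1 : ℕ) : ℝ) := by
  obtain ⟨Cw, hCw, Hw⟩ := broad_window hn le_rfl hN le_rfl hNe hν
  have hn0 : (0 : ℝ) < n := by exact_mod_cast hn
  refine ⟨Cw + 1, by finiteness, le_add_self, fun {α} hα {K} hK => ?_⟩
  obtain ⟨C, hC, HC⟩ := Wgt.window (α := α) hn hK
  refine ⟨C, hC, fun {i V θ a R Λ w} hw {l} hl {h} hh hc τ hτ hdet z₀ => ?_⟩
  have hK1 : (1 : ℝ) ≤ K := by exact_mod_cast hK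
  set r : ℝ := (K : ℝ) ^ l with hr
  have hKr : K ≤ r := le_self_pow₀ hK1 (by omega)
  have hr0 : 0 < r := by positivity
  have h1 := Hw K l hK hl (EuclideanSpace.basisFun (Fin n) ℝ) 0 (fun j => cpt K (τ j))
    (fun j => cap K (τ j) h) (fun j => hh.cap _ _) (fun j => hc.cap _ _)
    (fun j => norm_cpt_le hK (hτ j)) (fun j ξ hξ => norm_sub_cpt_le hK hξ)
    (fun j ξ hξ i hi => absurd i.isLt (by omega)) hdet z₀
  have h2 := HC hw r hKr z₀
  have hpq : ((n + 1) / n : ℝ).HolderConjugate (n + 1) := by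
    rw [Real.holderConjugate_iff]
    constructor
    · rw [one_lt_div hn0]; linarith
    · field_simp
  have hp0 : (0 : ℝ) ≤ 1 / ((n + 1) / n) := by positivity
  have hP : Measurable fun z => ∏ j, eI Ne K (cap K (τ j) h) z ^ (1 / (n + 1 : ℕ) : ℝ) :=
    Finset.measurable_fun_prod _ fun j _ => (measurable_eI Ne K (hh.cap K _)).pow_const _
  refine (ENNReal.lintegral_mul_le_Lp_mul_Lq _ hpq hP.aemeasurable
    (measurable_avgW K hw.meas).aemeasurable).trans ?_
  have h3 : ∀ z, (∏ j, eI Ne K (cap K (τ j) h) z ^ (1 / (n + 1 : ℕ) : ℝ)) ^ ((n + 1) / n : ℝ) =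
      ∏ j, eI Ne K (cap K (τ j) h) z ^ (1 / n : ℝ) := fun z => by
    rw [← ENNReal.prod_rpow_of_nonneg (by positivity)]
    refine Finset.prod_congr rfl fun j _ => ?_
    rw [← ENNReal.rpow_mul]
    congr 1; push_cast; field_simp
  simp_rw [h3]
  have h4 : (∫⁻ z in closedBall z₀ (2 * r), ∏ j, eI Ne K (cap K (τ j) h) z ^ (1 / n : ℝ)) ^
      (1 / ((n + 1) / n) : ℝ) ≤ (Cw + 1) ^ l * ofReal (r ^ (n : ℝ)) *
        ∏ j, eI N r (cap K (τ j) h) z₀ ^ (1 / (n + 1 : ℕ) : ℝ) := by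
    refine (ENNReal.rpow_le_rpow h1 hp0).trans ?_
    rw [ENNReal.mul_rpow_of_nonneg _ _ hp0, ENNReal.mul_rpow_of_nonneg _ _ hp0,
      ← ENNReal.prod_rpow_of_nonneg hp0, ENNReal.ofReal_rpow_of_nonneg (by positivity) hp0]
    refine mul_le_mul' (mul_le_mul' ?_ (le_of_eq ?_)) (le_of_eq ?_)
    · calc _ ≤ ((Cw + 1) ^ l) ^ (1 / ((n + 1) / n) : ℝ) := by gcongr; exact le_self_add
        _ ≤ ((Cw + 1) ^ l) ^ (1 : ℝ) := by
            refine ENNReal.rpow_le_rpow_of_exponent_le (one_le_pow₀ le_add_self) ?_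
            rw [one_div_div, div_le_one (by positivity)]; linarith
        _ = _ := ENNReal.rpow_one _
    · rw [← Real.rpow_natCast, ← Real.rpow_mul hr0.le]
      congr 2; push_cast; field_simp
    · refine Finset.prod_congr rfl fun j _ => ?_
      rw [← ENNReal.rpow_mul]
      congr 1; push_cast; field_simp
  refine (mul_le_mul' h4 h2).trans (le_of_eq ?_)
  rw [Real.rpow_add hr0, ENNReal.ofReal_mul (by positivity)]
  ring

lemma prod_rpow_le_sum {n : ℕ} (x : Fin (n + 1) → ℝ≥0∞) :
    ∏ j, x j ^ (1 / (n + 1 : ℕ) : ℝ) ≤ ∑ j, x j := by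
  calc _ ≤ ∏ _j : Fin (n + 1), (∑ j, x j) ^ (1 / (n + 1 : ℕ) : ℝ) :=
        Finset.prod_le_prod' fun j hj => ENNReal.rpow_le_rpow
          (Finset.single_le_sum (fun _ _ => bot_le) hj) (by positivity)
    _ = _ := by
        rw [Finset.prod_const, Finset.card_univ, Fintype.card_fin, ← ENNReal.rpow_natCast,
          ← ENNReal.rpow_mul, one_div_mul_cancel (by positivity), ENNReal.rpow_one]

lemma local_smoothing_eI {n N : ℕ} (hN : n < N) : ∃ C : ℝ≥0∞, C ≠ ⊤ ∧
    ∀ (i : Fin n) (V θ a ρ r : ℝ), 0 < θ → 0 ≤ ρ → ∀ h : Euc n → ℂ, Nice h →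
    (∀ ξ, h ξ ≠ 0 → θ ≤ |2 * ξ i - V|) →
    ∫⁻ z in {z : Euc n × ℝ | |z.1 i - V * z.2 - a| ≤ θ * ρ}, eI N r h z ≤
      C * ofReal ρ * ∫⁻ ξ, ‖h ξ‖ₑ ^ 2 := by
  obtain ⟨C, hC, H⟩ := local_smoothing n
  refine ⟨C * ∫⁻ y : Euc n, phi N y, ENNReal.mul_ne_top hC (lintegral_phi_lt_top hN).ne,
    fun i V θ a ρ r hθ hρ h hh hd => ?_⟩
  set S := {z : Euc n × ℝ | |z.1 i - V * z.2 - a| ≤ θ * ρ} with hS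
  have hSm : MeasurableSet S := by
    refine (isClosed_le ?_ continuous_const).measurableSet
    fun_prop
  have h1 := lintegral_mul_eI_le (N := N) r hh (W := S.indicator 1)
    (measurable_one.indicator hSm) (A := C * ofReal ρ * ∫⁻ ξ, ‖h ξ‖ₑ ^ 2) fun y => by
    have h2 := H i V θ a ρ hθ hρ _ (hh.mul_osc (g := fun ξ => ⟪y, ξ⟫_ℝ) (by fun_prop))
      fun ξ hξ => hd ξ (left_ne_zero_of_mul hξ)
    simp_rw [evol_translate, enorm_mul, enorm_osc, mul_one] at h2
    rw [← lintegral_indicator hSm] at h2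
    refine (lintegral_mono fun z => ?_).trans h2
    by_cases hz : z ∈ S
    · simp [hz, add_comm]
    · simp [hz]
  rw [← lintegral_indicator hSm]
  refine (lintegral_mono fun z => ?_).trans (h1.trans (le_of_eq (by ring)))
  by_cases hz : z ∈ S <;> simp [hz]

lemma Wgt.slab_of_avgW_ne_zero {n : ℕ} (hn : 1 ≤ n) {α : ℝ} {i : Fin n} {V θ a R : ℝ} {Λ : ℝ≥0∞}
    {w : Euc n × ℝ → ℝ≥0∞} (hw : Wgt α i V θ a R Λ w) {B r : ℝ} (hV : |V| + 4 ≤ B * θ)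
    (hθ : 0 < θ) {K : ℕ} (hR : 5 * K * B ≤ R) (hr : R ≤ r) (hr0 : 0 ≤ r) {z z₀ : Euc n × ℝ}
    (hz : z ∈ closedBall z₀ (2 * r)) (hne : avgW K w z ≠ 0) :
    |z₀.1 i - V * z₀.2 - a| ≤ θ * ((2 + 2 * B) * r) := by
  obtain ⟨q, hq, hwq⟩ : ∃ q ∈ closedBall z (5 * K), w q ≠ 0 := by
    by_contra! hcon
    refine hne ?_
    rw [avgW, setLIntegral_congr_fun measurableSet_closedBall hcon]
    simp
    omega
  have h1 := hw.supp q hwq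
  have h0 : dist q z₀ ≤ 5 * K + 2 * r :=
    (dist_triangle q z z₀).trans (add_le_add hq hz)
  rw [Prod.dist_eq, max_le_iff, dist_eq_norm, Real.dist_eq] at h0
  have h2 : |q.1 i - z₀.1 i| ≤ 5 * K + 2 * r := (PiLp.norm_apply_le (q.1 - z₀.1) i).trans h0.1
  have h3 : |V * (q.2 - z₀.2)| ≤ |V| * (5 * K + 2 * r) := by
    rw [abs_mul]; exact mul_le_mul_of_nonneg_left h0.2 (abs_nonneg _)
  have hK0 : (0 : ℝ) ≤ K := by positivity
  have h6 : (5 * K + 2 * r) * (|V| + 1) ≤ (5 * K + 2 * r) * (B * θ) :=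
    mul_le_mul_of_nonneg_left (by linarith) (by positivity)
  have h7 : 5 * K * B * θ ≤ r * θ := mul_le_mul_of_nonneg_right (hR.trans hr) hθ.le
  have h8 : θ * R ≤ θ * r := mul_le_mul_of_nonneg_left hr hθ.le
  rw [abs_le] at *
  constructor <;> nlinarith

lemma broad_tuple_bound {n : ℕ} (hn : 1 ≤ n) {Ne : ℕ} (hNe : n * (n * (n + 1)) + n + 1 ≤ Ne)
    {ν : ℝ} (hν : 0 < ν) : ∃ C₁ : ℝ≥0∞, C₁ ≠ ⊤ ∧ 1 ≤ C₁ ∧ ∀ {α : ℝ}, 0 ≤ α → ∀ B : ℝ,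
    ∀ {K : ℕ}, 1 ≤ K →
    ∃ C : ℝ≥0∞, C ≠ ⊤ ∧ ∀ {i : Fin n} {V θ a R : ℝ} {Λ : ℝ≥0∞} {h : Euc n → ℂ}
    {w : Euc n × ℝ → ℝ≥0∞}, Freq B i V θ h → Wgt α i V θ a R Λ w → ∀ {l : ℕ}, 1 ≤ l →
    5 * K * B ≤ R → R ≤ (K : ℝ) ^ l → ∀ τ : Fin (n + 1) → Fin n → ℤ, (∀ j, τ j ∈ caps n K) →
    ν ≤ |(vmat fun j i => 2 * ⟪EuclideanSpace.basisFun (Fin n) ℝ (Fin.castLE le_rfl i),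
      cpt K (τ j)⟫_ℝ).det| →
    ∫⁻ z, (∏ j, eI Ne K (cap K (τ j) h) z ^ (1 / (n + 1 : ℕ) : ℝ)) * avgW K w z ≤
      C * (C₁ ^ l * ofReal (((K : ℝ) ^ l) ^ (α / (n + 1))) * Λ ^ (1 / n : ℝ) *
        ∫⁻ ξ, ‖h ξ‖ₑ ^ 2) := by
  obtain ⟨C₁, hC₁, h1C₁, H⟩ := broad_tuple_window hn (Nat.lt_succ_self n) hNe hν
  obtain ⟨Cs, hCs, Hs⟩ := local_smoothing_eI (Nat.lt_succ_self n)
  refine ⟨C₁, hC₁, h1C₁, fun {α} hα B {K} hK => ?_⟩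
  obtain ⟨C, hC, HC⟩ := H hα hK
  set V2 := volume (closedBall (0 : Euc n × ℝ) 2) with hV2
  have hV2t : V2 ≠ ⊤ := measure_closedBall_lt_top.ne
  have hV20 : V2 ≠ 0 := (measure_closedBall_pos _ _ (by norm_num)).ne'
  refine ⟨V2⁻¹ * C * ((n + 1 : ℕ) * Cs * ofReal (2 + 2 * B)), by finiteness,
    fun {i V θ a R Λ h w} hf hw l hl hKB hR τ hτ hdet => ?_⟩
  have hB : 0 ≤ B := by
    by_contra! hB
    nlinarith [hf.speed, hf.pos, abs_nonneg V]
  have hK1 : (1 : ℝ) ≤ K := by exact_mod_cast hK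
  set r : ℝ := (K : ℝ) ^ l with hr
  have hr0 : 0 < r := by positivity
  set S := {z : Euc n × ℝ | |z.1 i - V * z.2 - a| ≤ θ * ((2 + 2 * B) * r)} with hS
  have hSm : MeasurableSet S := by
    refine (isClosed_le ?_ continuous_const).measurableSet
    fun_prop
  obtain ⟨X, hX⟩ : ∃ X, X = C * C₁ ^ l * Λ ^ (1 / n : ℝ) *
    ofReal (r ^ (n + α / (n + 1))) := ⟨_, rfl⟩
  obtain ⟨Y, hY⟩ : ∃ Y, Y = V2⁻¹ * C * ((n + 1 : ℕ) * Cs * ofReal (2 + 2 * B)) * (C₁ ^ l *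
    ofReal (r ^ (α / (n + 1))) * Λ ^ (1 / n : ℝ) * ∫⁻ ξ, ‖h ξ‖ₑ ^ 2) := ⟨_, rfl⟩
  have hP : Measurable fun z => ∏ j, eI Ne K (cap K (τ j) h) z ^ (1 / (n + 1 : ℕ) : ℝ) :=
    Finset.measurable_fun_prod _ fun j _ => (measurable_eI Ne K (hf.nice.cap K _)).pow_const _
  rw [← hY]
  have hFm : Measurable fun z =>
      (∏ j, eI Ne K (cap K (τ j) h) z ^ (1 / (n + 1 : ℕ) : ℝ)) * avgW K w z :=
    hP.mul (measurable_avgW K hw.meas)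
  have h1 : ∀ z₀, ∫⁻ z in closedBall z₀ (2 * r),
      (∏ j, eI Ne K (cap K (τ j) h) z ^ (1 / (n + 1 : ℕ) : ℝ)) * avgW K w z ≤
      S.indicator (fun z₀ => X * ∑ j, eI (n + 1) r (cap K (τ j) h) z₀) z₀ := fun z₀ => by
    by_cases hz₀ : z₀ ∈ S
    · rw [indicator_of_mem hz₀]
      refine (HC hw hl hf.nice hf.cube τ hτ hdet z₀).trans ?_
      rw [hX]
      exact mul_le_mul' le_rfl (prod_rpow_le_sum _)
    · rw [indicator_of_notMem hz₀, setLIntegral_congr_fun (g := fun _ => 0)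
        measurableSet_closedBall fun z hz => ?_]
      · simp
      · by_contra hne
        exact hz₀ (hw.slab_of_avgW_ne_zero hn hf.speed hf.pos hKB hR hr0.le hz
          (right_ne_zero_of_mul hne))
  have h2 : ∫⁻ z in S, ∑ j, eI (n + 1) r (cap K (τ j) h) z ≤
      (n + 1 : ℕ) * (Cs * ofReal ((2 + 2 * B) * r) * ∫⁻ ξ, ‖h ξ‖ₑ ^ 2) := by
    rw [lintegral_finsetSum (f := fun j z => eI (n + 1) r (cap K (τ j) h) z) _
      fun j _ => measurable_eI _ r (hf.nice.cap K _)]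
    refine (Finset.sum_le_card_nsmul _ _ _ fun j _ => ?_).trans
      (le_of_eq (by rw [Finset.card_univ, Fintype.card_fin, nsmul_eq_mul]))
    refine (Hs i V θ a _ r hf.pos (by positivity) _ (hf.nice.cap K _) fun ξ hξ =>
      hf.dir ξ fun h0 => hξ ?_).trans (mul_le_mul' le_rfl (lintegral_mono fun ξ => ?_))
    · rw [cap, indicator_apply, h0, ite_self]
    · exact pow_le_pow_left' (by rw [cap]; exact enorm_indicator_le_enorm_self _ _) 2
  have h3 := (lintegral_mono (μ := volume) h1).trans_eq (lintegral_indicator hSm _)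
  rw [lintegral_ball_avg hFm, mul_comm 2 r, volume_closedBall_eq _ hr0, ← hV2, lintegral_const_mul _
    (Finset.measurable_fun_sum _ fun j _ => measurable_eI _ r (hf.nice.cap K _))] at h3
  have h4 := h3.trans (mul_le_mul' le_rfl h2)
  have hr' : ofReal r ^ (n + 1) ≠ 0 := by
    simpa using hr0
  have hrt : ofReal r ^ (n + 1) ≠ ⊤ := by finiteness
  have h5 : (ofReal r ^ (n + 1) * V2) * Y =
      X * ((n + 1 : ℕ) * (Cs * ofReal ((2 + 2 * B) * r) * ∫⁻ ξ, ‖h ξ‖ₑ ^ 2)) := by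
    have h6 : ofReal (r ^ (n + α / (n + 1))) * ofReal r =
        ofReal r ^ (n + 1) * ofReal (r ^ (α / (n + 1))) := by
      rw [Real.rpow_add hr0, ENNReal.ofReal_mul (by positivity), Real.rpow_natCast,
        ENNReal.ofReal_pow hr0.le]
      ring
    calc _ = (V2 * V2⁻¹) * C * ((n + 1 : ℕ) * Cs * ofReal (2 + 2 * B)) * C₁ ^ l *
          (ofReal r ^ (n + 1) * ofReal (r ^ (α / (n + 1)))) *
            Λ ^ (1 / n : ℝ) * ∫⁻ ξ, ‖h ξ‖ₑ ^ 2 := by rw [hY]; ring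
      _ = _ := by
          rw [ENNReal.mul_inv_cancel hV20 hV2t, ← h6, hX, ENNReal.ofReal_mul (by positivity)]
          ring
  rw [← h5] at h4
  exact (ENNReal.mul_le_mul_iff_right (mul_ne_zero hr' hV20)
    (ENNReal.mul_ne_top hrt hV2t)).1 h4

lemma broad_bound {n : ℕ} (hn : 1 ≤ n) {Ne : ℕ} (hNe : n * (n * (n + 1)) + n + 1 ≤ Ne) {ν : ℝ}
    (hν : 0 < ν) : ∃ C₁ : ℝ≥0∞, C₁ ≠ ⊤ ∧ 1 ≤ C₁ ∧ ∀ {α : ℝ}, 0 ≤ α → ∀ B : ℝ, ∀ {K : ℕ}, 1 ≤ K →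
    ∃ C : ℝ≥0∞, C ≠ ⊤ ∧ ∀ {i : Fin n} {V θ a R : ℝ} {Λ : ℝ≥0∞} {h : Euc n → ℂ}
    {w : Euc n × ℝ → ℝ≥0∞}, Freq B i V θ h → Wgt α i V θ a R Λ w → ∀ {l : ℕ}, 1 ≤ l →
    5 * K * B ≤ R → R ≤ (K : ℝ) ^ l →
    ∫⁻ z, broadSum le_rfl Ne K ν (EuclideanSpace.basisFun (Fin n) ℝ) h z * avgW K w z ≤
      C * (C₁ ^ l * ofReal (((K : ℝ) ^ l) ^ (α / (n + 1))) * Λ ^ (1 / n : ℝ) *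
        ∫⁻ ξ, ‖h ξ‖ₑ ^ 2) := by
  obtain ⟨C₁, hC₁, h1C₁, H⟩ := broad_tuple_bound hn hNe hν
  refine ⟨C₁, hC₁, h1C₁, fun {α} hα B {K} hK => ?_⟩
  obtain ⟨C, hC, HC⟩ := H hα B hK
  obtain ⟨T, hT⟩ : ∃ T : Finset (Fin (n + 1) → Fin n → ℤ),
    T = {τ ∈ Fintype.piFinset fun _ : Fin (n + 1) => caps n K |
    ν ≤ |(vmat fun j i => 2 * ⟪EuclideanSpace.basisFun (Fin n) ℝ (Fin.castLE le_rfl i),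
      cpt K (τ j)⟫_ℝ).det|} := ⟨_, rfl⟩
  refine ⟨T.card * C, ENNReal.mul_ne_top (ENNReal.natCast_ne_top _) hC,
    fun {i V θ a R Λ h w} hf hw l hl hKB hR => ?_⟩
  have hsum : ∀ z, broadSum le_rfl Ne K ν (EuclideanSpace.basisFun (Fin n) ℝ) h z * avgW K w z =
      ∑ τ ∈ T, (∏ j, eI Ne K (cap K (τ j) h) z ^ (1 / (n + 1 : ℕ) : ℝ)) * avgW K w z := fun z => by
    rw [broadSum, hT, Finset.sum_mul]
  have hm : ∀ τ : Fin (n + 1) → Fin n → ℤ, Measurable fun z =>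
      (∏ j, eI Ne K (cap K (τ j) h) z ^ (1 / (n + 1 : ℕ) : ℝ)) * avgW K w z := fun τ =>
    (Finset.measurable_fun_prod _ fun j _ =>
      (measurable_eI Ne K (hf.nice.cap K _)).pow_const _).mul (measurable_avgW K hw.meas)
  obtain ⟨X, hX⟩ : ∃ X, X = C₁ ^ l * ofReal (((K : ℝ) ^ l) ^ (α / (n + 1))) *
    Λ ^ (1 / n : ℝ) * ∫⁻ ξ, ‖h ξ‖ₑ ^ 2 := ⟨_, rfl⟩
  have key : ∀ τ ∈ T, ∫⁻ z, (∏ j, eI Ne K (cap K (τ j) h) z ^ (1 / (n + 1 : ℕ) : ℝ)) *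
      avgW K w z ≤ C * X := fun τ hτ => by
    rw [hT, Finset.mem_filter, Fintype.mem_piFinset] at hτ
    rw [hX]
    exact HC hf hw hl hKB hR τ hτ.1 hτ.2
  rw [lintegral_congr hsum, lintegral_finsetSum _ fun τ _ => hm τ, ← hX, mul_assoc,
    ← nsmul_eq_mul]
  exact Finset.sum_le_card_nsmul _ _ _ key

lemma WBound.of_local_smoothing {n : ℕ} (hn : 1 ≤ n) (α B : ℝ) : ∃ C : ℝ≥0∞, C ≠ ⊤ ∧ ∀ R, 0 ≤ R →
    WBound n α B R (C * ofReal R) := by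
  obtain ⟨C, hC, H⟩ := local_smoothing n
  refine ⟨C, hC, fun R hR i V θ a Λ h w hf hw => ?_⟩
  have hn0 : (0 : ℝ) < n := by exact_mod_cast hn
  have hs : (0 : ℝ) < 1 / n := by positivity
  have h1 := H i V θ a R hf.pos hR h hf.nice hf.dir
  set S := {z : Euc n × ℝ | |z.1 i - V * z.2 - a| ≤ θ * R} with hS
  have hSm : MeasurableSet S := by
    refine (isClosed_le ?_ continuous_const).measurableSet
    fun_prop
  calc _ ≤ ∫⁻ z, Λ ^ (1 / n : ℝ) * S.indicator (fun z => ‖evol h z.1 z.2‖ₑ ^ 2) z := by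
        refine lintegral_mono fun z => ?_
        by_cases hz : w z = 0
        · rw [hz, ENNReal.zero_rpow_of_pos hs, mul_zero]; exact bot_le
        · rw [indicator_of_mem (show z ∈ S from hw.supp z hz), mul_comm]
          exact mul_le_mul' (ENNReal.rpow_le_rpow (hw.le z) hs.le) le_rfl
    _ = Λ ^ (1 / n : ℝ) * ∫⁻ z in S, ‖evol h z.1 z.2‖ₑ ^ 2 := by
        rw [lintegral_const_mul, lintegral_indicator hSm]
        exact ((measurable_enorm_evol hf.nice).pow_const 2).indicator hSm
    _ ≤ _ := (mul_le_mul' le_rfl h1).trans (le_of_eq (by ring))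

lemma WBound.mono {n : ℕ} {α B R : ℝ} {M M' : ℝ≥0∞} (h : WBound n α B R M) (hM : M ≤ M') :
    WBound n α B R M' := fun i V θ a Λ g w hf hw => (h i V θ a Λ g w hf hw).trans (by gcongr)

lemma narrow_factor {β ε R : ℝ} (hR : 0 ≤ R) {K : ℕ} (hK : 1 ≤ K)
    {A C : ℝ≥0∞}
    (hA : A * C * ofReal (2 ^ (β + ε)) ≤ (K : ℝ≥0∞) ^ ε) :
    A * ((K : ℝ≥0∞) ^ ε * (C * ofReal ((K : ℝ) ^ (2 * β)) *
      ofReal ((2 * R / K ^ 2) ^ (β + ε)))) ≤ ofReal (R ^ (β + ε)) := by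
  have hK0 : (0 : ℝ) < K := by exact_mod_cast hK
  have hKE : (K : ℝ≥0∞) ^ ε = ofReal ((K : ℝ) ^ ε) := by
    rw [← ENNReal.ofReal_natCast, ENNReal.ofReal_rpow_of_pos hK0]
  rw [hKE] at hA ⊢
  have h1 : (K : ℝ) ^ ε * (K : ℝ) ^ (2 * β) * (2 * R / K ^ 2) ^ (β + ε) * (K : ℝ) ^ ε =
      2 ^ (β + ε) * R ^ (β + ε) := by
    rw [Real.div_rpow (by positivity) (by positivity), Real.mul_rpow (by norm_num) hR,
      ← Real.rpow_natCast, ← Real.rpow_mul hK0.le]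
    have h2 : (K : ℝ) ^ (((2 : ℕ) : ℝ) * (β + ε)) = (K : ℝ) ^ ε * (K : ℝ) ^ (2 * β) * (K : ℝ) ^ ε := by
      rw [← Real.rpow_add hK0, ← Real.rpow_add hK0]; congr 1; push_cast; ring
    rw [h2]
    field_simp
  have h3 : ofReal ((K : ℝ) ^ ε) ≠ 0 := by
    simpa using Real.rpow_pos_of_pos hK0 ε
  rw [← ENNReal.mul_le_mul_iff_left h3 ENNReal.ofReal_ne_top]
  calc _ = A * C * ofReal ((K : ℝ) ^ ε * (K : ℝ) ^ (2 * β) * (2 * R / K ^ 2) ^ (β + ε) *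
        (K : ℝ) ^ ε) := by
        rw [ENNReal.ofReal_mul (by positivity), ENNReal.ofReal_mul (by positivity),
          ENNReal.ofReal_mul (by positivity)]
        ring
    _ = A * C * ofReal (2 ^ (β + ε)) * ofReal (R ^ (β + ε)) := by
        rw [h1, ENNReal.ofReal_mul (by positivity)]; ring
    _ ≤ _ := by rw [mul_comm (ofReal (R ^ (β + ε)))]; gcongr

lemma WBound.step {n : ℕ} (hn : 1 ≤ n) {α : ℝ} (hα : 0 < α) (hαn : α ≤ n) {ε : ℝ} (hε : 0 < ε)
    (B : ℝ) : ∃ R₀ : ℝ, 1 ≤ R₀ ∧ ∃ D : ℝ≥0∞, D ≠ ⊤ ∧ ∀ R, R₀ ≤ R → ∀ A : ℝ≥0∞,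
    (∀ R', 1 ≤ R' → R' ≤ R / 2 →
      WBound n α B R' (A * ofReal (R' ^ ((n + α - 1) / (2 * n) + ε)))) →
    WBound n α B R ((A / 2 + D) * ofReal (R ^ ((n + α - 1) / (2 * n) + ε))) := by
  have hn0 : (0 : ℝ) < n := by exact_mod_cast hn
  have hn1 : (1 : ℝ) ≤ n := by exact_mod_cast hn
  obtain ⟨β, hβ⟩ : ∃ β : ℝ, β = (n + α - 1) / (2 * n) := ⟨_, rfl⟩
  have hβ0 : 0 ≤ β := by rw [hβ]; exact div_nonneg (by linarith) (by positivity)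
  have hβ2 : ((n : ℝ) + α - 1) / n = 2 * β := by rw [hβ]; field_simp
  have hβα : α / (n + 1) ≤ β := by
    rw [hβ, div_le_div_iff₀ (by positivity) (by positivity)]
    nlinarith [mul_nonneg (sub_nonneg.2 hn1) (sub_nonneg.2 hαn)]
  rw [← hβ]
  set Ne := n * (n * (n + 1)) + n + 1 with hNe
  have hnNe : n < Ne := by rw [hNe]; nlinarith [Nat.zero_le (n * (n * (n + 1)))]
  obtain ⟨Cn, hCn, Hn⟩ := WBound.narrow hn α hnNe
  obtain ⟨L, hL⟩ := exists_forall_le_natCast_rpow hε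
    (A := (4 * n : ℕ) * Cn * ofReal (2 ^ (β + ε))) (by finiteness)
  obtain ⟨ν, hν, Hν⟩ := global_broad_narrow hn Ne hnNe hε (max L 2)
  obtain ⟨C₁, hC₁, h1C₁, Hb⟩ := broad_bound hn le_rfl hν
  obtain ⟨L₁, hL₁⟩ := exists_forall_le_natCast_rpow hε hC₁
  obtain ⟨𝒦, K, hK, h𝒦, hcard, Cg, hCg, Hg⟩ := Hν (max L₁ 2)
  have hK2 : 2 ≤ K := (le_max_right _ _).trans hK
  have hKr : (1 : ℝ) < K := by exact_mod_cast hK2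
  have hK0 : (0 : ℝ) < K := by linarith
  obtain ⟨Cb, hCb, Hb⟩ := Hb hα.le B (by omega : 1 ≤ K)
  refine ⟨1 + ∑ K' ∈ insert K 𝒦, (5 * K' * |B| + (K' : ℝ) ^ 2), ?_,
    Cg * (Cb * ofReal ((K : ℝ) ^ (β + ε))), by finiteness, fun R hR A hA => ?_⟩
  · have : 0 ≤ ∑ K' ∈ insert K 𝒦, (5 * K' * |B| + (K' : ℝ) ^ 2) := by positivity
    linarith
  have hRK : ∀ K' ∈ insert K 𝒦, 1 + (5 * K' * |B| + (K' : ℝ) ^ 2) ≤ R := fun K' hK' => by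
    have := Finset.single_le_sum (f := fun K' : ℕ => (5 * K' * |B| + (K' : ℝ) ^ 2))
      (fun _ _ => by positivity) hK'
    linarith
  have hRB : ∀ K' ∈ insert K 𝒦, 5 * K' * B ≤ R := fun K' hK' => by
    have h1 := hRK K' hK'
    have h2 : 5 * (K' : ℝ) * B ≤ 5 * K' * |B| := by gcongr; exact le_abs_self B
    nlinarith [sq_nonneg (K' : ℝ)]
  have hR1 : 1 ≤ R := by
    have h1 := hRK K (Finset.mem_insert_self _ _)
    have : 0 ≤ 5 * K * |B| + (K : ℝ) ^ 2 := by positivity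
    linarith
  intro i V θ a Λ h w hf hw
  obtain ⟨m, hm1, hm2⟩ := exists_nat_pow_near hR1 hKr
  have hb := Hb hf hw (l := m + 1) (by omega) (hRB K (Finset.mem_insert_self _ _)) hm2.le
  have hb2 : C₁ ^ (m + 1) * ofReal (((K : ℝ) ^ (m + 1)) ^ (α / (n + 1))) ≤
      ofReal ((K : ℝ) ^ (β + ε)) * ofReal (R ^ (β + ε)) := by
    have h1 : C₁ ≤ ofReal ((K : ℝ) ^ ε) := by
      rw [← ENNReal.ofReal_rpow_of_pos hK0, ENNReal.ofReal_natCast]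
      exact hL₁ K ((le_max_left _ _).trans hK)
    have h2 : 1 ≤ (K : ℝ) ^ (m + 1) := one_le_pow₀ hKr.le
    calc _ ≤ ofReal ((K : ℝ) ^ ε) ^ (m + 1) *
          ofReal (((K : ℝ) ^ (m + 1)) ^ β) := by
          refine mul_le_mul' (pow_le_pow_left' h1 _) (ENNReal.ofReal_le_ofReal ?_)
          exact Real.rpow_le_rpow_of_exponent_le h2 hβα
      _ = ofReal (((K : ℝ) ^ (m + 1)) ^ (β + ε)) := by
          rw [← ENNReal.ofReal_pow (by positivity), ← ENNReal.ofReal_mul (by positivity),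
            Real.rpow_add (by positivity)]
          congr 1
          rw [← Real.rpow_natCast, ← Real.rpow_mul hK0.le, ← Real.rpow_natCast (K : ℝ) (m + 1),
            ← Real.rpow_mul hK0.le, ← Real.rpow_mul hK0.le, mul_comm ε, mul_comm]
      _ ≤ ofReal ((K * R) ^ (β + ε)) := by
          refine ENNReal.ofReal_le_ofReal (Real.rpow_le_rpow (by positivity) ?_ (by positivity))
          rw [pow_succ']; gcongr
      _ = _ := by
          rw [Real.mul_rpow hK0.le (by linarith), ENNReal.ofReal_mul (by positivity)]
  obtain ⟨X, hX⟩ : ∃ X, X = Λ ^ (1 / n : ℝ) * ∫⁻ ξ, ‖h ξ‖ₑ ^ 2 := ⟨_, rfl⟩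
  have hnar : ∀ K' ∈ 𝒦, (K' : ℝ≥0∞) ^ ε * ∫⁻ z, Psi Ne K' h w z ≤
      ((4 * n : ℕ) : ℝ≥0∞)⁻¹ * A * ofReal (R ^ (β + ε)) * X := fun K' hK' => by
    have hK'2 : 2 ≤ K' := (le_max_right _ _).trans (h𝒦 K' hK').2
    have hK'r : (2 : ℝ) ≤ K' := by exact_mod_cast hK'2
    have h1 := hRK K' (Finset.mem_insert_of_mem hK')
    have h2 : 0 ≤ 5 * K' * |B| := by positivity
    have h3 := Hn hK'2 (hRB K' (Finset.mem_insert_of_mem hK')) (hA (2 * R / K' ^ 2)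
      (by rw [one_le_div (by positivity)]; linarith)
      (by rw [div_le_div_iff₀ (by positivity) (by norm_num)]; nlinarith [mul_le_mul hK'r hK'r (by norm_num) (by linarith)])) hf hw
    rw [hβ2] at h3
    have h4 := narrow_factor (by linarith : 0 ≤ R) (by omega : 1 ≤ K')
      (hL K' ((le_max_left _ _).trans (h𝒦 K' hK').2))
    have h5 : ((4 * n : ℕ) : ℝ≥0∞) ≠ 0 := by simp; omega
    calc _ ≤ ((K' : ℝ≥0∞) ^ ε * (Cn * ofReal ((K' : ℝ) ^ (2 * β)) *
          ofReal ((2 * R / K' ^ 2) ^ (β + ε)))) * A * X := by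
          refine (mul_le_mul' le_rfl h3).trans (le_of_eq ?_)
          rw [hX]; ring
      _ ≤ ((4 * n : ℕ) : ℝ≥0∞)⁻¹ * ofReal (R ^ (β + ε)) * A * X := by
          refine mul_le_mul' (mul_le_mul' ?_ le_rfl) le_rfl
          rwa [mul_comm (_⁻¹), ← div_eq_mul_inv, ENNReal.le_div_iff_mul_le (Or.inl h5)
            (Or.inl (ENNReal.natCast_ne_top _)), mul_comm]
      _ = _ := by ring
  refine (Hg h hf.nice hf.cube w hw.meas).trans ?_
  calc _ ≤ (2 * n : ℕ) * (((4 * n : ℕ) : ℝ≥0∞)⁻¹ * A * ofReal (R ^ (β + ε)) * X) +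
        Cg * (Cb * (ofReal ((K : ℝ) ^ (β + ε)) * ofReal (R ^ (β + ε))) * X) := by
        refine add_le_add ((Finset.sum_le_card_nsmul _ _ _ hnar).trans ?_) (mul_le_mul' le_rfl ?_)
        · rw [nsmul_eq_mul]
          exact mul_le_mul' (by exact_mod_cast hcard) le_rfl
        · refine hb.trans ?_
          calc _ = Cb * (C₁ ^ (m + 1) * ofReal (((K : ℝ) ^ (m + 1)) ^ (α / (n + 1)))) * X := by
                rw [hX]; ring
            _ ≤ _ := by gcongr
    _ = _ := by
        have h6 : ((2 * n : ℕ) : ℝ≥0∞) * ((4 * n : ℕ) : ℝ≥0∞)⁻¹ = 2⁻¹ := by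
          have h7 : ((2 * n : ℕ) : ℝ≥0∞) ≠ 0 := by simp; omega
          rw [show 4 * n = 2 * (2 * n) by ring, Nat.cast_mul 2 (2 * n),
            ENNReal.mul_inv (Or.inl (by simp)) (Or.inl (by simp)), mul_left_comm,
            ENNReal.mul_inv_cancel h7 (ENNReal.natCast_ne_top _), mul_one, Nat.cast_ofNat]
        rw [← mul_assoc, ← mul_assoc, ← mul_assoc, h6, hX, ENNReal.div_eq_inv_mul]
        ring

/-- The weighted space-time estimate. -/
theorem wBound_rpow {n : ℕ} (hn : 1 ≤ n) {α : ℝ} (hα : 0 < α) (hαn : α ≤ n) {ε : ℝ} (hε : 0 < ε)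
    (B : ℝ) : ∃ C : ℝ≥0∞, C ≠ ⊤ ∧ ∀ R, 1 ≤ R →
    WBound n α B R (C * ofReal (R ^ ((n + α - 1) / (2 * n) + ε))) := by
  obtain ⟨R₀, hR₀, D, hD, H⟩ := WBound.step hn hα hαn hε B
  obtain ⟨Cs, hCs, Hs⟩ := WBound.of_local_smoothing hn α B
  have hn1 : (1 : ℝ) ≤ n := by exact_mod_cast hn
  have hγ : 0 ≤ ((n : ℝ) + α - 1) / (2 * n) + ε :=
    add_nonneg (div_nonneg (by linarith) (by positivity)) hε.le
  have key : ∀ j : ℕ, ∀ R, 1 ≤ R → R ≤ 2 ^ j → WBound n α B R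
      ((Cs * ofReal R₀ + 2 * D) * ofReal (R ^ ((n + α - 1) / (2 * n) + ε))) := by
    intro j
    induction j with
    | zero =>
      intro R hR1 hR
      refine (Hs R (by linarith)).mono ?_
      rw [pow_zero] at hR
      have h1 : 1 ≤ ofReal (R ^ (((n : ℝ) + α - 1) / (2 * n) + ε)) := by
        rw [ENNReal.one_le_ofReal]; exact Real.one_le_rpow hR1 hγ
      calc _ ≤ (Cs * ofReal R₀) * 1 := by rw [mul_one]; gcongr; linarith
        _ ≤ _ := mul_le_mul' le_self_add h1
    | succ j ih =>
      intro R hR1 hR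
      by_cases hRR : R ≤ R₀
      · refine (Hs R (by linarith)).mono ?_
        have h1 : 1 ≤ ofReal (R ^ (((n : ℝ) + α - 1) / (2 * n) + ε)) := by
          rw [ENNReal.one_le_ofReal]; exact Real.one_le_rpow hR1 hγ
        calc _ ≤ (Cs * ofReal R₀) * 1 := by rw [mul_one]; gcongr
          _ ≤ _ := mul_le_mul' le_self_add h1
      · push Not at hRR
        refine (H R hRR.le _ fun R' h1 h2 => ih R' h1 ?_).mono ?_
        · rw [pow_succ] at hR; linarith
        · refine mul_le_mul' ?_ le_rfl
          rw [ENNReal.add_div, mul_div_assoc, mul_comm 2 D, ENNReal.mul_div_cancel_right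
            two_ne_zero ENNReal.ofNat_ne_top, add_assoc, ← two_mul, mul_comm D 2]
          gcongr
          exact ENNReal.div_le_of_le_mul (le_mul_of_one_le_right bot_le one_le_two)
  refine ⟨Cs * ofReal R₀ + 2 * D, by finiteness, fun R hR => ?_⟩
  obtain ⟨j, hj⟩ := pow_unbounded_of_one_lt R one_lt_two
  exact key j R hR hj.le

lemma measure_closedBall_le_cAlpha {n : ℕ} (α : ℝ) (μ : Measure (Euc n)) (y : Euc n) {r : ℝ}
    (hr : 0 < r) : μ (closedBall y r) ≤ cAlpha n α μ * ofReal ((2 * r) ^ α) := by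
  have h0 : 0 < (2 * r) ^ α := by positivity
  refine (measure_mono (closedBall_subset_ball (by linarith : r < 2 * r))).trans ?_
  rw [← ENNReal.div_le_iff (by simpa using h0) ENNReal.ofReal_ne_top]
  exact le_iSup₂_of_le y (2 * r) (le_iSup_of_le (by positivity) le_rfl)

lemma IsAlphaDimensional.measure_univ_le {n : ℕ} {α : ℝ} {μ : Measure (Euc n)}
    (hμ : IsAlphaDimensional n α μ) : μ univ ≤ cAlpha n α μ * ofReal (2 ^ α) := by
  rw [← measure_add_measure_compl (measurableSet_closedBall (x := (0 : Euc n)) (ε := 1)), hμ.1,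
    add_zero]
  simpa using measure_closedBall_le_cAlpha α μ 0 one_pos

lemma exists_measurable_argmax {X : Type*} [MeasurableSpace X] {U : X → ℕ → ℝ≥0∞}
    (hU : ∀ l, Measurable fun x => U x l) (m : ℕ) :
    ∃ J : X → ℕ, Measurable J ∧ ∀ x, ∀ l ≤ m, U x l ≤ U x (J x) := by
  classical
  have hex : ∀ x, ∃ k, ∀ l ∈ Finset.range (m + 1), U x l ≤ U x k := fun x => by
    obtain ⟨k, -, hk⟩ := Finset.exists_max_image (Finset.range (m + 1)) (U x) ⟨0, by simp⟩
    exact ⟨k, hk⟩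
  refine ⟨fun x => Nat.find (hex x), measurable_find hex fun k => ?_, fun x l hl =>
    Nat.find_spec (hex x) l (by simp; omega)⟩
  have : {x | ∀ l ∈ Finset.range (m + 1), U x l ≤ U x k} =
      ⋂ l ∈ Finset.range (m + 1), {x | U x l ≤ U x k} := by ext; simp
  rw [this]
  exact Finset.measurableSet_biInter _ fun l _ => measurableSet_le (hU l) (hU k)

lemma enorm_evol_sq_le_eI (n N : ℕ) : ∃ C : ℝ≥0∞, C ≠ ⊤ ∧ ∀ h : Euc n → ℂ, Nice h → InCube h →
    ∀ z z' : Euc n × ℝ, ‖z' - z‖ ≤ 1 → ‖evol h z'.1 z'.2‖ₑ ^ 2 ≤ C * eI N 1 h z := by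
  obtain ⟨C, hC, H⟩ := evol_near n zero_le_one N
  refine ⟨C, hC, fun h hh hc z z' hz => H (EuclideanSpace.basisFun (Fin n) ℝ) (fun _ => 1) 0 h
    (fun _ => le_rfl) hh (fun ξ hξ i => ?_) (by simp) z z' fun _ => by simpa using hz⟩
  rw [sub_zero, one_mul, EuclideanSpace.basisFun_apply, EuclideanSpace.inner_single_left]
  simpa using hc ξ hξ i

/-- The points `(z, x)` such that `z` is at unit distance from `(N x, J x)`. -/
def nearSet {n : ℕ} (N : ℝ) (J : Euc n → ℕ) : Set ((Euc n × ℝ) × Euc n) :=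
  {p | ⌊p.1.2⌋ = (J p.2 : ℤ) ∧ ‖N • p.2 - p.1.1‖ ≤ 1 ∧ ‖p.2‖ ≤ 1}

lemma measurableSet_nearSet {n : ℕ} (N : ℝ) {J : Euc n → ℕ} (hJ : Measurable J) :
    MeasurableSet (nearSet N J) := by
  have hJ' : Measurable fun p : (Euc n × ℝ) × Euc n => (J p.2 : ℤ) :=
    (measurable_from_nat (f := fun k : ℕ => (k : ℤ))).comp (hJ.comp measurable_snd)
  refine (measurableSet_eq_fun (Int.measurable_floor.comp measurable_fst.snd) hJ').inter
    ((isClosed_le (f := fun p : (Euc n × ℝ) × Euc n => ‖N • p.2 - p.1.1‖) (by fun_prop)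
      continuous_const).inter (isClosed_le (f := fun p : (Euc n × ℝ) × Euc n => ‖p.2‖)
      (by fun_prop) continuous_const)).measurableSet

lemma volume_nearSet_le {n : ℕ} (N : ℝ) (J : Euc n → ℕ) (x : Euc n) :
    volume {z : Euc n × ℝ | (z, x) ∈ nearSet N J} ≤ volume (closedBall (0 : Euc n) 1) := by
  have : {z : Euc n × ℝ | (z, x) ∈ nearSet N J} ⊆
      closedBall (N • x) 1 ×ˢ Ico (J x : ℝ) (J x + 1) := by
    rintro z ⟨h1, h2, -⟩
    rw [Int.floor_eq_iff] at h1
    refine ⟨?_, by simpa using h1⟩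
    rw [mem_closedBall, dist_comm, dist_eq_norm]
    exact h2
  refine (measure_mono this).trans ?_
  rw [Measure.volume_eq_prod, Measure.prod_prod, Real.volume_Ico, add_sub_cancel_left,
    ENNReal.ofReal_one, mul_one, Measure.addHaar_closedBall_center]

lemma measure_nearSet_le {n : ℕ} (α : ℝ) (μ : Measure (Euc n)) {N : ℝ} (hN : 0 < N)
    (y : Euc n) {r : ℝ} (hr : 0 < r) :
    μ {x | ‖N • x - y‖ ≤ r} ≤ cAlpha n α μ * ofReal ((2 * r / N) ^ α) := by
  refine (measure_mono fun x hx => ?_).trans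
    ((measure_closedBall_le_cAlpha α μ (N⁻¹ • y) (r := r / N) (by positivity)).trans_eq
      (by rw [mul_div_assoc]))
  rw [mem_closedBall, dist_eq_norm, le_div_iff₀ hN, mul_comm]
  have : N • x - y = N • (x - N⁻¹ • y) := by rw [smul_sub, smul_inv_smul₀ hN.ne']
  change ‖N • x - y‖ ≤ r at hx
  rwa [this, norm_smul, Real.norm_of_nonneg hN.le] at hx

/-- The weight associated with the linearised maximal function. -/
lemma wgt_nearSet {n : ℕ} (hn : 1 ≤ n) {α : ℝ} (hα : 0 < α) : ∃ D : ℝ≥0∞, D ≠ ⊤ ∧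
    ∀ (μ : Measure (Euc n)) [IsFiniteMeasure μ] (N : ℝ), 1 ≤ N → ∀ J : Euc n → ℕ, Measurable J →
    ∀ i : Fin n, Wgt α i 0 (1 / n) 0 (2 * n * N)
      (D * (cAlpha n α μ * ofReal ((4 / N) ^ α)) ^ n)
      fun z => μ {x | (z, x) ∈ nearSet N J} ^ n := by
  refine ⟨1 + volume (closedBall (0 : Euc n) 1),
    ENNReal.add_ne_top.2 ⟨ENNReal.one_ne_top, measure_closedBall_lt_top.ne⟩, ?_⟩
  intro μ _ N hN J hJ i
  have hS := measurableSet_nearSet N hJ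
  have hn0 : (0 : ℝ) < n := by exact_mod_cast hn
  have hN0 : 0 < N := by linarith
  have hm : Measurable fun z => μ {x | (z, x) ∈ nearSet N J} := measurable_measure_prodMk_left hS
  obtain ⟨L, hL⟩ : ∃ L, L = cAlpha n α μ * ofReal ((4 / N) ^ α) := ⟨_, rfl⟩
  have hball : ∀ (y : Euc n) (r : ℝ), 1 ≤ r →
      μ {x | ‖N • x - y‖ ≤ r + 1} ≤ L * ofReal (r ^ α) := fun y r hr => by
    refine (measure_nearSet_le α μ hN0 y (by linarith)).trans ?_
    rw [hL, mul_assoc, ← ENNReal.ofReal_mul (by positivity),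
      ← Real.mul_rpow (by positivity) (by positivity)]
    refine mul_le_mul' le_rfl (ENNReal.ofReal_le_ofReal (Real.rpow_le_rpow (by positivity) ?_ hα.le))
    rw [div_mul_eq_mul_div]
    exact div_le_div_of_nonneg_right (by linarith) hN0.le
  have hle : ∀ z : Euc n × ℝ, μ {x | (z, x) ∈ nearSet N J} ≤ L := fun z => by
    have := hball z.1 1 le_rfl
    rw [Real.one_rpow, ENNReal.ofReal_one, mul_one] at this
    exact (measure_mono fun x hx => le_trans hx.2.1 (by norm_num)).trans this
  rw [← hL]
  refine ⟨hm.pow_const n, fun z hz => ?_, fun z => ?_, fun z r hr => ?_⟩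
  · have h1 : μ {x | (z, x) ∈ nearSet N J} ≠ 0 := fun h => hz (by
      show μ {x | (z, x) ∈ nearSet N J} ^ n = 0
      rw [h, zero_pow (by omega)])
    obtain ⟨x, -, h2, h3⟩ := nonempty_of_measure_ne_zero h1
    have h4 : ‖z.1‖ ≤ 2 * N := by
      have := norm_sub_norm_le z.1 (N • x)
      rw [norm_smul, Real.norm_of_nonneg hN0.le, norm_sub_rev] at this
      have h2' : ‖N • x - z.1‖ ≤ 1 := h2
      have h3' : ‖x‖ ≤ 1 := h3
      nlinarith
    have h5 := (PiLp.norm_apply_le z.1 i).trans h4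
    rw [Real.norm_eq_abs] at h5
    rw [zero_mul, sub_zero, sub_zero]
    refine h5.trans (le_of_eq ?_)
    field_simp
  · calc _ ≤ L ^ n := pow_le_pow_left' (hle z) n
      _ ≤ _ := le_mul_of_one_le_left bot_le le_self_add
  · have h1 : ∀ z', μ {x | (z', x) ∈ nearSet N J} ^ n ≤
        L ^ (n - 1) * μ {x | (z', x) ∈ nearSet N J} := fun z' => by
      obtain ⟨k, rfl⟩ : ∃ k, n = k + 1 := ⟨n - 1, by omega⟩
      rw [pow_succ]
      exact mul_le_mul' (pow_le_pow_left' (hle z') _) le_rfl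
    have h2 : ∫⁻ z' in closedBall z r, μ {x | (z', x) ∈ nearSet N J} ≤
        volume (closedBall (0 : Euc n) 1) * (L * ofReal (r ^ α)) := by
      have e1 : ∫⁻ z' in closedBall z r, μ {x | (z', x) ∈ nearSet N J} =
          ((volume.restrict (closedBall z r)).prod μ) (nearSet N J) := (Measure.prod_apply hS).symm
      rw [e1, Measure.prod_apply_symm hS]
      calc _ ≤ ∫⁻ x, {x | ‖N • x - z.1‖ ≤ r + 1}.indicator
            (fun _ => volume (closedBall (0 : Euc n) 1)) x ∂μ := by
            refine lintegral_mono fun x => ?_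
            by_cases hx : ‖N • x - z.1‖ ≤ r + 1
            · rw [indicator_of_mem (show x ∈ {x | ‖N • x - z.1‖ ≤ r + 1} from hx)]
              exact (Measure.restrict_apply_le _ _).trans (volume_nearSet_le N J x)
            · rw [indicator_of_notMem (show x ∉ {x | ‖N • x - z.1‖ ≤ r + 1} from hx), nonpos_iff_eq_zero, Measure.restrict_apply₀']
              · convert measure_empty (μ := (volume : Measure (Euc n × ℝ)))
                refine eq_empty_of_forall_notMem fun z' ⟨h3, h4⟩ => hx ?_
                have h5 : ‖N • x - z'.1‖ ≤ 1 := h3.2.1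
                have h6 : ‖z'.1 - z.1‖ ≤ r := by
                  rw [← dist_eq_norm]; exact (le_max_left _ _).trans h4
                have := norm_sub_le_norm_sub_add_norm_sub (N • x) z'.1 z.1
                linarith
              · exact measurableSet_closedBall.nullMeasurableSet
        _ ≤ _ := by
            rw [lintegral_indicator_const]
            · exact mul_le_mul' le_rfl (hball z.1 r hr)
            · exact (isClosed_le (by fun_prop) continuous_const).measurableSet
    calc _ ≤ ∫⁻ z' in closedBall z r, L ^ (n - 1) * μ {x | (z', x) ∈ nearSet N J} :=
          lintegral_mono h1
      _ = L ^ (n - 1) * ∫⁻ z' in closedBall z r, μ {x | (z', x) ∈ nearSet N J} :=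
          lintegral_const_mul _ hm
      _ ≤ L ^ (n - 1) * (volume (closedBall (0 : Euc n) 1) * (L * ofReal (r ^ α))) :=
          mul_le_mul' le_rfl h2
      _ = volume (closedBall (0 : Euc n) 1) * (L ^ (n - 1) * L) * ofReal (r ^ α) := by ring
      _ ≤ _ := by
          rw [← pow_succ, Nat.sub_add_cancel hn]
          gcongr
          exact le_add_self

lemma volume_nearSet_const {n : ℕ} (N : ℝ) (l : ℕ) {x : Euc n} (hx : ‖x‖ ≤ 1) :
    volume {z : Euc n × ℝ | (z, x) ∈ nearSet N fun _ => l} = volume (closedBall (0 : Euc n) 1) := by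
  refine le_antisymm (volume_nearSet_le N _ x) ?_
  have : closedBall (N • x) 1 ×ˢ Ico (l : ℝ) (l + 1) ⊆
      {z : Euc n × ℝ | (z, x) ∈ nearSet N fun _ => l} := by
    rintro z ⟨h1, h2⟩
    refine ⟨Int.floor_eq_iff.2 (by simpa using h2), ?_, hx⟩
    rw [mem_closedBall, dist_comm, dist_eq_norm] at h1
    exact h1
  refine le_trans ?_ (measure_mono this)
  rw [Measure.volume_eq_prod, Measure.prod_prod, Real.volume_Ico, add_sub_cancel_left,
    ENNReal.ofReal_one, mul_one, Measure.addHaar_closedBall_center _ (N • x)]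

/-- The maximal estimate at unit frequency. -/
theorem maximal_unit {n : ℕ} (hn : 1 ≤ n) {α : ℝ} (hα : 0 < α) (hαn : α ≤ n) {ε : ℝ}
    (hε : 0 < ε) : ∃ C : ℝ≥0∞, C ≠ ⊤ ∧ ∀ (i : Fin n) (G : Euc n → ℂ), Freq (4 * n) i 0 (1 / n) G →
    ∀ μ : Measure (Euc n), IsAlphaDimensional n α μ → ∀ N : ℝ, 1 ≤ N →
    ∫⁻ x, ⨆ (t : ℝ) (_ : t ∈ Ioo (0 : ℝ) 1), ‖evol G (N • x) (N ^ 2 * t)‖ₑ ^ 2 ∂μ ≤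
      C * (cAlpha n α μ * ofReal (N ^ ((n + α - 1) / (2 * n) + ε - α))) *
        ∫⁻ ξ, ‖G ξ‖ₑ ^ 2 := by
  obtain ⟨Cn, hCn, Hn⟩ := enorm_evol_sq_le_eI n (n + 1)
  obtain ⟨D, hD, HD⟩ := wgt_nearSet hn hα
  obtain ⟨C, hC, HC⟩ := wBound_rpow hn hα hαn hε (4 * n)
  have hn1 : (1 : ℝ) ≤ n := by exact_mod_cast hn
  obtain ⟨γ, hγ⟩ : ∃ γ, γ = ((n : ℝ) + α - 1) / (2 * n) + ε := ⟨_, rfl⟩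
  rw [← hγ] at HC ⊢
  obtain ⟨V, hV⟩ : ∃ V, V = volume (closedBall (0 : Euc n) 1) := ⟨_, rfl⟩
  have hV0 : V ≠ 0 := by rw [hV]; exact (measure_closedBall_pos _ _ one_pos).ne'
  have hVt : V ≠ ⊤ := by rw [hV]; exact measure_closedBall_lt_top.ne
  have hphi : (∫⁻ y : Euc n, phi (n + 1) y) ≠ ⊤ := (lintegral_phi_lt_top (Nat.lt_succ_self n)).ne
  refine ⟨V⁻¹ * Cn * (C * ofReal ((2 * n) ^ γ) * D ^ (1 / n : ℝ) *
    ofReal (4 ^ α) * ∫⁻ y : Euc n, phi (n + 1) y), ?_, fun i G hG μ hμ N hN => ?_⟩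
  · have h1 := ENNReal.rpow_ne_top_of_nonneg (by positivity : (0 : ℝ) ≤ 1 / n) hD
    have h2 := ENNReal.inv_ne_top.2 hV0
    finiteness
  have hN0 : 0 < N := by linarith
  have : IsFiniteMeasure μ :=
    ⟨hμ.measure_univ_le.trans_lt (ENNReal.mul_lt_top hμ.2.lt_top ENNReal.ofReal_lt_top)⟩
  have hE : Measurable (eI (n + 1) 1 G) := measurable_eI _ _ hG.nice
  have hF : ∀ J : Euc n → ℕ, Measurable J →
      Measurable ((nearSet N J).indicator fun p => eI (n + 1) 1 G p.1) := fun J hJ =>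
    (hE.comp measurable_fst).indicator (measurableSet_nearSet N hJ)
  obtain ⟨U, hU⟩ : ∃ U : Euc n → ℕ → ℝ≥0∞, U = fun x l =>
    ∫⁻ z, (nearSet N fun _ => l).indicator (fun p => eI (n + 1) 1 G p.1) (z, x) := ⟨_, rfl⟩
  obtain ⟨J, hJ, hJU⟩ := exists_measurable_argmax (U := U)
    (fun l => by rw [hU]; exact (hF _ measurable_const).lintegral_prod_left') ⌊N ^ 2⌋₊
  have hpt : ∀ᵐ x ∂μ, (⨆ (t : ℝ) (_ : t ∈ Ioo (0 : ℝ) 1), ‖evol G (N • x) (N ^ 2 * t)‖ₑ ^ 2) ≤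
      V⁻¹ * Cn * U x (J x) := by
    have h0 : ∀ᵐ x ∂μ, x ∈ closedBall (0 : Euc n) 1 := hμ.1
    filter_upwards [h0] with x hx
    rw [mem_closedBall_zero_iff] at hx
    refine iSup₂_le fun t ht => ?_
    have hl : ⌊N ^ 2 * t⌋₊ ≤ ⌊N ^ 2⌋₊ := Nat.floor_mono (by nlinarith [ht.1, ht.2, sq_nonneg N])
    refine le_trans ?_ (mul_le_mul' le_rfl (hJU x _ hl))
    have hm : MeasurableSet {z : Euc n × ℝ | (z, x) ∈ nearSet N fun _ => ⌊N ^ 2 * t⌋₊} :=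
      measurable_prodMk_right (measurableSet_nearSet N measurable_const)
    have h1 : V * ‖evol G (N • x) (N ^ 2 * t)‖ₑ ^ 2 ≤ Cn * U x ⌊N ^ 2 * t⌋₊ := by
      calc _ = ∫⁻ z in {z : Euc n × ℝ | (z, x) ∈ nearSet N fun _ => ⌊N ^ 2 * t⌋₊},
            ‖evol G (N • x) (N ^ 2 * t)‖ₑ ^ 2 := by
            rw [setLIntegral_const, volume_nearSet_const N _ hx, hV, mul_comm]
        _ ≤ ∫⁻ z in {z : Euc n × ℝ | (z, x) ∈ nearSet N fun _ => ⌊N ^ 2 * t⌋₊},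
            Cn * eI (n + 1) 1 G z := by
            refine setLIntegral_mono (hE.const_mul _) fun z hz => ?_
            refine Hn G hG.nice hG.cube z (N • x, N ^ 2 * t) ?_
            have h2 : ⌊z.2⌋ = ((⌊N ^ 2 * t⌋₊ : ℕ) : ℤ) := hz.1
            have h3 : ‖N • x - z.1‖ ≤ 1 := hz.2.1
            rw [Int.floor_eq_iff] at h2
            push_cast at h2
            have h4 := Nat.floor_le (mul_nonneg (sq_nonneg N) ht.1.le)
            have h5 := Nat.lt_floor_add_one (N ^ 2 * t)
            refine max_le h3 ?_
            rw [Real.norm_eq_abs, abs_le]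
            constructor <;> simp only [Prod.snd_sub] <;> linarith [h2.1, h2.2]
        _ = _ := by
            rw [lintegral_const_mul _ hE, ← lintegral_indicator hm, hU]
            rfl
    rw [mul_assoc, ← ENNReal.div_eq_inv_mul, ENNReal.le_div_iff_mul_le (Or.inl hV0) (Or.inl hVt),
      mul_comm]
    exact h1
  obtain ⟨X, hX⟩ : ∃ X, X = ∫⁻ ξ, ‖G ξ‖ₑ ^ 2 := ⟨_, rfl⟩
  obtain ⟨L, hL⟩ : ∃ L, L = cAlpha n α μ * ofReal ((4 / N) ^ α) := ⟨_, rfl⟩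
  have hw := HD μ N hN J hJ i
  rw [← hL] at hw
  have hroot : ∀ a : ℝ≥0∞, (a ^ n) ^ (1 / n : ℝ) = a := fun a => by
    rw [one_div]; exact ENNReal.pow_rpow_inv_natCast (by omega) a
  have hR : 1 ≤ 2 * n * N := by nlinarith
  have hmain : ∫⁻ z, μ {x | (z, x) ∈ nearSet N J} * eI (n + 1) 1 G z ≤
      (C * ofReal ((2 * n * N) ^ γ) * (D ^ (1 / n : ℝ) * L) * X) *
        ∫⁻ y : Euc n, phi (n + 1) y := by
    refine lintegral_mul_eI_le 1 hG.nice
      (measurable_measure_prodMk_left (measurableSet_nearSet N hJ)) fun y => ?_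
    have h2 := HC _ hR i 0 (1 / n) 0 _ _ _ (hG.mul_osc (g := fun ξ => ⟪y, ξ⟫_ℝ) (by fun_prop)) hw
    simp_rw [evol_translate, enorm_mul, enorm_osc, mul_one] at h2
    rw [ENNReal.mul_rpow_of_nonneg _ _ (by positivity), hroot] at h2
    simp_rw [hroot] at h2
    rw [hX]
    exact h2
  calc _ ≤ ∫⁻ x, V⁻¹ * Cn * U x (J x) ∂μ := lintegral_mono_ae hpt
    _ = V⁻¹ * Cn * ∫⁻ x, U x (J x) ∂μ :=
        lintegral_const_mul' _ _ (ENNReal.mul_ne_top (ENNReal.inv_ne_top.2 hV0) hCn)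
    _ = V⁻¹ * Cn * ∫⁻ z, μ {x | (z, x) ∈ nearSet N J} * eI (n + 1) 1 G z := by
        congr 1
        have h1 : ∀ x, U x (J x) =
            ∫⁻ z, (nearSet N J).indicator (fun p => eI (n + 1) 1 G p.1) (z, x) := fun x => by
          rw [hU]; rfl
        simp_rw [h1]
        rw [← lintegral_lintegral_swap (f := fun z x =>
          (nearSet N J).indicator (fun p => eI (n + 1) 1 G p.1) (z, x)) (hF J hJ).aemeasurable]
        refine lintegral_congr fun z => ?_
        have h2 : ∀ x, (nearSet N J).indicator (fun p => eI (n + 1) 1 G p.1) (z, x) =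
          {x | (z, x) ∈ nearSet N J}.indicator (fun _ => eI (n + 1) 1 G z) x := fun x => rfl
        simp_rw [h2]
        have h4 : MeasurableSet {x | (z, x) ∈ nearSet N J} :=
          measurable_prodMk_left (measurableSet_nearSet N hJ)
        rw [lintegral_indicator_const h4, mul_comm]
    _ ≤ V⁻¹ * Cn * ((C * ofReal ((2 * n * N) ^ γ) * (D ^ (1 / n : ℝ) * L) * X) *
        ∫⁻ y : Euc n, phi (n + 1) y) := mul_le_mul' le_rfl hmain
    _ = _ := by
        have h3 : ofReal ((2 * n * N) ^ γ) * ofReal ((4 / N) ^ α) =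
            ofReal ((2 * n) ^ γ) * ofReal (4 ^ α) *
              ofReal (N ^ (γ - α)) := by
          rw [← ENNReal.ofReal_mul (by positivity), ← ENNReal.ofReal_mul (by positivity),
            ← ENNReal.ofReal_mul (by positivity), Real.mul_rpow (by positivity) hN0.le,
            Real.div_rpow (by norm_num) hN0.le, Real.rpow_sub hN0]
          congr 1
          ring
        rw [← hX, hL]
        calc _ = V⁻¹ * Cn * C * D ^ (1 / n : ℝ) * (ofReal ((2 * n * N) ^ γ) *
              ofReal ((4 / N) ^ α)) * cAlpha n α μ * X * ∫⁻ y : Euc n, phi (n + 1) y := by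
              ring
          _ = _ := by rw [h3]; ring

/-- The local maximal function. -/
noncomputable def maxEvol {n : ℕ} (h : Euc n → ℂ) (x : Euc n) : ℝ≥0∞ :=
  ⨆ (t : ℝ) (_ : t ∈ Ioo (0 : ℝ) 1), ‖evol h x t‖ₑ ^ 2

lemma measurable_maxEvol {n : ℕ} {h : Euc n → ℂ} (hh : Nice h) : Measurable (maxEvol h) := by
  refine LowerSemicontinuous.measurable (lowerSemicontinuous_biSup fun t _ => ?_)
  have h1 : Continuous fun x : Euc n => ‖evol h x t‖ₑ ^ 2 :=
    (ENNReal.continuous_pow 2).comp ((continuous_evol hh).comp (f := fun x : Euc n => (x, t))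
      (by fun_prop)).enorm
  exact h1.lowerSemicontinuous

lemma enorm_evol_rescale {n : ℕ} (g : Euc n → ℂ) {N : ℝ} (hN : 0 < N) (x : Euc n) (t : ℝ) :
    ‖evol g x t‖ₑ ^ 2 = ofReal (N ^ n) ^ 2 *
      ‖evol (fun ξ => g (N • ξ)) (N • x) (N ^ 2 * t)‖ₑ ^ 2 := by
  have h1 : evol (fun ξ => g (N • ξ)) (N • x) (N ^ 2 * t) = ((N ^ n)⁻¹ : ℝ) • evol g x t := by
    have := Measure.integral_comp_smul_of_nonneg (volume : Measure (Euc n))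
      (fun ξ => g ξ * osc (⟪x, ξ⟫_ℝ - t * ‖ξ‖ ^ 2)) N (hR := hN.le)
    rw [finrank_euclideanSpace_fin] at this
    unfold evol
    rw [← this]
    refine integral_congr_ae (.of_forall fun ξ => ?_)
    simp only
    congr 2
    rw [norm_smul, real_inner_smul_left, real_inner_smul_right, Real.norm_of_nonneg hN.le]
    ring
  rw [h1, enorm_smul, ← mul_pow, ← mul_assoc, Real.enorm_of_nonneg (by positivity),
    ← ENNReal.ofReal_mul (by positivity), mul_inv_cancel₀ (by positivity), ENNReal.ofReal_one,
    one_mul]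

lemma Nice.comp_smul {n : ℕ} {g : Euc n → ℂ} (hg : Nice g) {N : ℝ} (hN : 0 < N) :
    Nice fun ξ => g (N • ξ) := by
  obtain ⟨B, hB⟩ := hg.bdd
  obtain ⟨r, hr⟩ := hg.supp
  refine ⟨hg.meas.comp (measurable_const_smul N), ⟨B, fun ξ => hB _⟩, r / N, fun ξ hξ => ?_⟩
  have := hr _ hξ
  rw [norm_smul, Real.norm_of_nonneg hN.le] at this
  rw [le_div_iff₀ hN]
  linarith

lemma exists_dominant_coord (n : ℕ) : ∃ J : Euc n → ℕ, Measurable J ∧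
    ∀ ξ : Euc n, ξ ≠ 0 → ∃ i : Fin n, J ξ = i ∧ ‖ξ‖ ≤ n * |ξ i| := by
  obtain ⟨J, hJ, hJU⟩ := exists_measurable_argmax
    (U := fun (ξ : Euc n) l => if h : l < n then ‖ξ ⟨l, h⟩‖ₑ else 0) (fun l => by
      by_cases h : l < n
      · simp only [h, dite_true]; fun_prop
      · simp only [h, dite_false]; fun_prop) n
  refine ⟨J, hJ, fun ξ hξ => ?_⟩
  have h1 : J ξ < n := by
    by_contra! hcon
    refine hξ (PiLp.ext fun i => ?_)
    have := hJU ξ i i.2.le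
    simpa [hcon.not_gt] using this
  refine ⟨⟨J ξ, h1⟩, rfl, ?_⟩
  have h2 := norm_le_sum_coord (v := ξ) (a := |ξ ⟨J ξ, h1⟩|) fun i => by
    have := hJU ξ i i.2.le
    simp only [h1, i.2, dite_true, enorm_eq_nnnorm, ENNReal.coe_le_coe] at this
    exact this
  exact h2

/-- The maximal estimate for a dyadic frequency annulus. -/
theorem maximal_annulus {n : ℕ} (hn : 1 ≤ n) {α : ℝ} (hα : 0 < α) (hαn : α ≤ n) {ε : ℝ}
    (hε : 0 < ε) : ∃ C : ℝ≥0∞, C ≠ ⊤ ∧ ∀ g : Euc n → ℂ, Nice g → ∀ N : ℝ, 1 ≤ N →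
    (∀ ξ, g ξ ≠ 0 → N / 2 < ‖ξ‖ ∧ ‖ξ‖ ≤ N) → ∀ μ : Measure (Euc n), IsAlphaDimensional n α μ →
    ∫⁻ x, maxEvol g x ∂μ ≤
      C * (cAlpha n α μ * ofReal (N ^ (n + ((n + α - 1) / (2 * n) + ε - α)))) *
        ∫⁻ ξ, ‖g ξ‖ₑ ^ 2 := by
  obtain ⟨C, hC, H⟩ := maximal_unit hn hα hαn hε
  obtain ⟨J, hJ, hJc⟩ := exists_dominant_coord n
  refine ⟨n * (n * C), by finiteness, fun g hg N hN hsupp μ hμ => ?_⟩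
  have hN0 : 0 < N := by linarith
  have hn1 : (1 : ℝ) ≤ n := by exact_mod_cast hn
  obtain ⟨γ, hγ⟩ : ∃ γ, γ = ((n : ℝ) + α - 1) / (2 * n) + ε - α := ⟨_, rfl⟩
  rw [← hγ] at H ⊢
  obtain ⟨p, hp⟩ : ∃ p : Fin n → Euc n → ℂ, p = fun i : Fin n => {ξ | J ξ = (i : ℕ)}.indicator g := ⟨_, rfl⟩
  have hpn : ∀ i, Nice (p i) := fun i => by
    rw [hp]; exact hg.indicator (hJ (measurableSet_singleton _))
  have hple : ∀ i ξ, ‖p i ξ‖ₑ ≤ ‖g ξ‖ₑ := fun i ξ => by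
    rw [hp]; exact enorm_indicator_le_enorm_self _ _
  have hsum : g = fun ξ => ∑ i, p i ξ := by
    funext ξ
    by_cases h0 : g ξ = 0
    · rw [hp]; simp [indicator_apply, h0]
    · obtain ⟨i, hi, -⟩ := hJc ξ (norm_pos_iff.1 (by linarith [(hsupp ξ h0).1]))
      rw [hp, Finset.sum_eq_single i]
      · simp [hi]
      · intro j _ hj
        refine indicator_of_notMem (fun h => hj ?_) _
        exact Fin.ext ((show J ξ = j from h).symm.trans hi)
      · simp
  have hpiece : ∀ i, ∫⁻ x, maxEvol (p i) x ∂μ ≤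
      C * (cAlpha n α μ * ofReal (N ^ (n + γ))) * ∫⁻ ξ, ‖g ξ‖ₑ ^ 2 := fun i => by
    have hF : Freq (4 * n) i 0 (1 / n) fun ξ => p i (N • ξ) := by
      have hb : ∀ ξ, p i (N • ξ) ≠ 0 → 1 / 2 < ‖ξ‖ ∧ ‖ξ‖ ≤ 1 ∧ ‖ξ‖ ≤ n * |ξ i| := fun ξ hξ => by
        rw [hp] at hξ
        change {ξ | J ξ = (i : ℕ)}.indicator g (N • ξ) ≠ 0 at hξ
        have h1 : J (N • ξ) = i :=
          (mem_of_indicator_ne_zero hξ : N • ξ ∈ {ξ | J ξ = (i : ℕ)})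
        have h2 : g (N • ξ) ≠ 0 := fun h => hξ (by simp [indicator_apply, h])
        have h3 := hsupp _ h2
        obtain ⟨j, hj, hj2⟩ := hJc (N • ξ) (norm_pos_iff.1 (by linarith [h3.1]))
        obtain rfl : i = j := Fin.ext (h1.symm.trans hj)
        rw [norm_smul, Real.norm_of_nonneg hN0.le] at h3 hj2
        rw [PiLp.smul_apply, smul_eq_mul, abs_mul, abs_of_pos hN0] at hj2
        refine ⟨by nlinarith [h3.1], by nlinarith [h3.2], ?_⟩
        nlinarith
      refine ⟨(hpn i).comp_smul hN0, fun ξ hξ j => (PiLp.norm_apply_le ξ j).trans (hb ξ hξ).2.1,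
        by positivity, fun ξ hξ => ?_, ?_⟩
      · obtain ⟨h1, -, h2⟩ := hb ξ hξ
        rw [sub_zero, abs_mul, abs_two, div_le_iff₀ (by positivity)]
        linarith
      · rw [abs_zero]
        field_simp
        norm_num
    have h1 := H i _ hF μ hμ N hN
    have h2 : ∀ x, maxEvol (p i) x = ofReal (N ^ n) ^ 2 * ⨆ (t : ℝ) (_ : t ∈ Ioo (0 : ℝ) 1),
        ‖evol (fun ξ => p i (N • ξ)) (N • x) (N ^ 2 * t)‖ₑ ^ 2 := fun x => by
      unfold maxEvol
      simp_rw [ENNReal.mul_iSup, ← enorm_evol_rescale (p i) hN0]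
    simp_rw [h2]
    rw [lintegral_const_mul' _ _ (by finiteness)]
    refine (mul_le_mul' le_rfl h1).trans ?_
    rw [lintegral_comp_smul_euc (fun ξ => ‖p i ξ‖ₑ ^ 2) hN0.ne', abs_of_pos (by positivity)]
    have h3 : ∫⁻ ξ, ‖p i ξ‖ₑ ^ 2 ≤ ∫⁻ ξ, ‖g ξ‖ₑ ^ 2 :=
      lintegral_mono fun ξ => pow_le_pow_left' (hple i ξ) 2
    have h4 : ofReal (N ^ n) ^ 2 * ofReal (N ^ γ) * ofReal (N ^ n)⁻¹ =
        ofReal (N ^ (n + γ)) := by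
      rw [← ENNReal.ofReal_pow (by positivity), ← ENNReal.ofReal_mul (by positivity),
        ← ENNReal.ofReal_mul (by positivity), Real.rpow_add hN0, Real.rpow_natCast]
      congr 1
      field_simp
    rw [← h4]
    calc _ = C * (cAlpha n α μ * (ofReal (N ^ n) ^ 2 * ofReal (N ^ γ) *
          ofReal (N ^ n)⁻¹)) * ∫⁻ ξ, ‖p i ξ‖ₑ ^ 2 := by ring
      _ ≤ _ := mul_le_mul' le_rfl h3
  have hmax : ∀ x, maxEvol g x ≤ n * ∑ i, maxEvol (p i) x := fun x => by
    refine iSup₂_le fun t ht => ?_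
    rw [hsum, evol_sum _ fun i _ => hpn i]
    refine (sq_enorm_sum_le _ _).trans ?_
    rw [Finset.card_univ, Fintype.card_fin]
    refine mul_le_mul' le_rfl (Finset.sum_le_sum fun i _ => ?_)
    exact le_iSup₂_of_le t ht le_rfl
  calc _ ≤ ∫⁻ x, n * ∑ i, maxEvol (p i) x ∂μ := lintegral_mono hmax
    _ = n * ∑ i, ∫⁻ x, maxEvol (p i) x ∂μ := by
        rw [lintegral_const_mul' _ _ (ENNReal.natCast_ne_top n),
          lintegral_finsetSum _ fun i _ => measurable_maxEvol (hpn i)]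
    _ ≤ n * (n * (C * (cAlpha n α μ * ofReal (N ^ (n + γ))) * ∫⁻ ξ, ‖g ξ‖ₑ ^ 2)) := by
        refine mul_le_mul' le_rfl ((Finset.sum_le_card_nsmul _ _ _ fun i _ => hpiece i).trans ?_)
        rw [nsmul_eq_mul, Finset.card_univ, Fintype.card_fin]
    _ = _ := by ring

/-- The dyadic frequency scale. -/
noncomputable def dyad {n : ℕ} (ξ : Euc n) : ℕ := Nat.clog 2 ⌈‖ξ‖⌉₊

lemma measurable_dyad {n : ℕ} : Measurable (dyad : Euc n → ℕ) :=
  (measurable_from_nat (f := Nat.clog 2)).comp (Nat.measurable_ceil.comp measurable_norm)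

lemma norm_le_two_pow_dyad {n : ℕ} (ξ : Euc n) : ‖ξ‖ ≤ 2 ^ dyad ξ :=
  (Nat.le_ceil _).trans (by exact_mod_cast Nat.le_pow_clog one_lt_two ⌈‖ξ‖⌉₊)

lemma two_pow_dyad_lt {n : ℕ} {ξ : Euc n} (h : dyad ξ ≠ 0) : (2 : ℝ) ^ dyad ξ / 2 < ‖ξ‖ := by
  have h1 : 1 < ⌈‖ξ‖⌉₊ := by
    by_contra! hcon
    exact h (Nat.clog_of_right_le_one hcon 2)
  have h2 := Nat.lt_ceil.1 (Nat.pow_pred_clog_lt_self one_lt_two h1)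
  push_cast at h2
  obtain ⟨k, hk⟩ := Nat.exists_eq_succ_of_ne_zero h
  change (2 : ℝ) ^ (dyad ξ).pred < ‖ξ‖ at h2
  rw [hk] at h2 ⊢
  rw [pow_succ, mul_div_cancel_right₀ _ two_ne_zero]
  exact h2

lemma two_pow_dyad_sq_le {n : ℕ} (ξ : Euc n) : ((2 : ℝ) ^ dyad ξ) ^ 2 ≤ 4 * (1 + ‖ξ‖ ^ 2) := by
  by_cases h : dyad ξ = 0
  · rw [h]; nlinarith [sq_nonneg ‖ξ‖]
  · nlinarith [two_pow_dyad_lt h, pow_pos (two_pos (α := ℝ)) (dyad ξ)]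

/-- The dyadic frequency pieces. -/
noncomputable def dpiece {n : ℕ} (k : ℕ) (F : Euc n → ℂ) : Euc n → ℂ := {ξ | dyad ξ = k}.indicator F

lemma measurableSet_dyad {n : ℕ} (k : ℕ) : MeasurableSet {ξ : Euc n | dyad ξ = k} :=
  measurable_dyad (measurableSet_singleton k)

lemma nice_dpiece {n : ℕ} {F : Euc n → ℂ} (hF : Measurable F) {B : ℝ} (hB : ∀ ξ, ‖F ξ‖ ≤ B) (k : ℕ) :
    Nice (dpiece k F) := by
  refine ⟨hF.indicator (measurableSet_dyad k), ⟨B, fun ξ => ?_⟩, 2 ^ k, fun ξ hξ => ?_⟩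
  · exact (norm_indicator_le_norm_self _ _).trans (hB ξ)
  · have h1 : dyad ξ = k := (mem_of_indicator_ne_zero hξ : ξ ∈ {ξ | dyad ξ = k})
    rw [← h1]
    exact norm_le_two_pow_dyad ξ

lemma enorm_evol_le_tsum {n : ℕ} {F : Euc n → ℂ} (hF : Integrable F) (x : Euc n) (t : ℝ) :
    ‖evol F x t‖ₑ ≤ ∑' k, ‖evol (dpiece k F) x t‖ₑ := by
  have hU : ⋃ k, {ξ : Euc n | dyad ξ = k} = univ := by ext; simp
  have h1 := hasSum_integral_iUnion (μ := volume) (s := fun k : ℕ => {ξ : Euc n | dyad ξ = k})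
    (f := fun ξ => F ξ * osc (⟪x, ξ⟫_ℝ - t * ‖ξ‖ ^ 2)) measurableSet_dyad
    (fun i j hij => disjoint_left.2 fun ξ (h : dyad ξ = i) (h' : dyad ξ = j) => hij (h ▸ h'))
    (by rw [hU, integrableOn_univ]; exact integrable_evol hF (by fun_prop))
  rw [hU, setIntegral_univ] at h1
  have h2 : ∀ k, ∫ ξ in {ξ : Euc n | dyad ξ = k}, F ξ * osc (⟪x, ξ⟫_ℝ - t * ‖ξ‖ ^ 2) =
      evol (dpiece k F) x t := fun k => by
    rw [← integral_indicator (measurableSet_dyad k)]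
    refine integral_congr_ae (.of_forall fun ξ => ?_)
    simp only [dpiece, indicator_mul_left]
  simp_rw [h2] at h1
  unfold evol at h1 ⊢
  rw [← h1.tsum_eq]
  exact enorm_tsum_le_tsum_enorm

lemma maximal_low {n : ℕ} {α : ℝ} {g : Euc n → ℂ} (hg : Nice g) (hsupp : ∀ ξ, g ξ ≠ 0 → ‖ξ‖ ≤ 1)
    {μ : Measure (Euc n)} (hμ : IsAlphaDimensional n α μ) :
    ∫⁻ x, maxEvol g x ∂μ ≤ volume (closedBall (0 : Euc n) 1) * ofReal (2 ^ α) *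
      cAlpha n α μ * ∫⁻ ξ, ‖g ξ‖ₑ ^ 2 := by
  have h1 : ∀ x, maxEvol g x ≤ volume (closedBall (0 : Euc n) 1) * ∫⁻ ξ, ‖g ξ‖ₑ ^ 2 := fun x => by
    refine iSup₂_le fun t _ => ?_
    have h2 : ‖evol g x t‖ₑ ≤ ∫⁻ ξ, (closedBall (0 : Euc n) 1).indicator 1 ξ * ‖g ξ‖ₑ := by
      refine (enorm_integral_le_lintegral_enorm _).trans (lintegral_mono fun ξ => ?_)
      rw [enorm_mul, enorm_osc, mul_one]
      by_cases h0 : g ξ = 0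
      · simp [h0]
      · rw [indicator_of_mem (by simpa using hsupp ξ h0), Pi.one_apply, one_mul]
    refine (pow_le_pow_left' h2 2).trans ((lintegral_mul_sq_le ?_ ?_).trans ?_)
    · exact (measurable_one.indicator measurableSet_closedBall).aemeasurable
    · exact hg.meas.enorm.aemeasurable
    · rw [lintegral_indicator_one measurableSet_closedBall]
      refine mul_le_mul' le_rfl (lintegral_mono fun ξ => ?_)
      by_cases h : ξ ∈ closedBall (0 : Euc n) 1 <;> simp [h]
  refine (lintegral_mono h1).trans ?_
  rw [lintegral_const]
  calc _ ≤ (volume (closedBall (0 : Euc n) 1) * ∫⁻ ξ, ‖g ξ‖ₑ ^ 2) *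
        (cAlpha n α μ * ofReal (2 ^ α)) := mul_le_mul' le_rfl hμ.measure_univ_le
    _ = _ := by ring

lemma sq_le_tsum_of_geometric {q : ℝ≥0∞} (hq0 : q ≠ 0) (hq1 : q ≠ ⊤) (a : ℕ → ℝ≥0∞) :
    (∑' k, a k) ^ 2 ≤ ((1 - q)⁻¹) ^ 2 * ∑' k, ((q ^ k)⁻¹) ^ 2 * a k ^ 2 := by
  obtain ⟨T, hT⟩ : ∃ T, T = ∑' k, ((q ^ k)⁻¹) ^ 2 * a k ^ 2 := ⟨_, rfl⟩
  have h1 : ∀ k, a k ≤ q ^ k * T ^ (1 / 2 : ℝ) := fun k => by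
    have h2 : ((q ^ k)⁻¹ * a k) ^ 2 ≤ T := by
      rw [hT, mul_pow]
      exact ENNReal.le_tsum k
    have h3 : (q ^ k)⁻¹ * a k ≤ T ^ (1 / 2 : ℝ) := by
      rw [one_div, ENNReal.le_rpow_inv_iff two_pos]
      exact_mod_cast h2
    rw [← ENNReal.div_eq_inv_mul] at h3
    rw [mul_comm]
    exact (ENNReal.div_le_iff (pow_ne_zero _ hq0) (ENNReal.pow_ne_top hq1)).1 h3
  have h4 : ∑' k, a k ≤ (1 - q)⁻¹ * T ^ (1 / 2 : ℝ) := by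
    rw [← ENNReal.tsum_geometric, ← ENNReal.tsum_mul_right]
    exact ENNReal.tsum_le_tsum h1
  rw [← hT]
  refine (pow_le_pow_left' h4 2).trans (le_of_eq ?_)
  rw [mul_pow, ← ENNReal.rpow_natCast (T ^ (1 / 2 : ℝ)), ← ENNReal.rpow_mul]
  norm_num

/-- The maximal estimate on the Fourier side. -/
theorem maximal_sobolev {n : ℕ} (hn : 1 ≤ n) {α : ℝ} (hα : 0 < α) (hαn : α ≤ n) {s : ℝ}
    (hs : n - α + (n + α - 1) / (2 * n) < 2 * s) : ∃ C : ℝ≥0∞, C ≠ ⊤ ∧ ∀ F : Euc n → ℂ,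
    Measurable F → Integrable F → ∀ B : ℝ, (∀ ξ, ‖F ξ‖ ≤ B) → ∀ μ : Measure (Euc n),
    IsAlphaDimensional n α μ → ∫⁻ x, maxEvol F x ∂μ ≤
      C * cAlpha n α μ * ∫⁻ ξ, ofReal ((1 + ‖ξ‖ ^ 2) ^ s) * ‖F ξ‖ₑ ^ 2 := by
  obtain ⟨ε, hε⟩ : ∃ ε, ε = (2 * s - (n - α + (n + α - 1) / (2 * n))) / 3 := ⟨_, rfl⟩
  have hε0 : 0 < ε := by rw [hε]; linarith
  have hn1 : (1 : ℝ) ≤ n := by exact_mod_cast hn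
  have hs0 : 0 ≤ s := by
    have : 0 ≤ ((n : ℝ) + α - 1) / (2 * n) := div_nonneg (by linarith) (by linarith)
    linarith
  obtain ⟨C, hC, H⟩ := maximal_annulus hn hα hαn hε0
  obtain ⟨q, hq⟩ : ∃ q, q = ofReal (2 ^ (-ε)) := ⟨_, rfl⟩
  have hq0 : q ≠ 0 := by rw [hq, ne_eq, ENNReal.ofReal_eq_zero, not_le]; positivity
  have hqt : q ≠ ⊤ := by rw [hq]; exact ENNReal.ofReal_ne_top
  have hq1 : q < 1 := by
    rw [hq, ENNReal.ofReal_lt_one]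
    exact Real.rpow_lt_one_of_one_lt_of_neg one_lt_two (by linarith)
  have hV : volume (closedBall (0 : Euc n) 1) ≠ ⊤ := measure_closedBall_lt_top.ne
  obtain ⟨D, hD⟩ : ∃ D, D = C + volume (closedBall (0 : Euc n) 1) * ofReal (2 ^ α) :=
    ⟨_, rfl⟩
  have hDt : D ≠ ⊤ := by rw [hD]; finiteness
  have hqq : ((1 - q)⁻¹) ^ 2 ≠ ⊤ :=
    ENNReal.pow_ne_top (ENNReal.inv_ne_top.2 (tsub_pos_of_lt hq1).ne')
  refine ⟨((1 - q)⁻¹) ^ 2 * D * ofReal (4 ^ s), by finiteness,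
    fun F hF hFi B hB μ hμ => ?_⟩
  have hN := nice_dpiece hF hB
  have hmem : ∀ k ξ, dpiece k F ξ ≠ 0 → dyad ξ = k := fun k ξ hξ =>
    (mem_of_indicator_ne_zero hξ : ξ ∈ {ξ | dyad ξ = k})
  have hmax : ∀ x, maxEvol F x ≤ ((1 - q)⁻¹) ^ 2 * ∑' k, ((q ^ k)⁻¹) ^ 2 * maxEvol (dpiece k F) x :=
    fun x => iSup₂_le fun t ht => by
      refine (pow_le_pow_left' (enorm_evol_le_tsum hFi x t) 2).trans
        ((sq_le_tsum_of_geometric hq0 hqt _).trans (mul_le_mul' le_rfl ?_))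
      refine ENNReal.tsum_le_tsum fun k => mul_le_mul' le_rfl ?_
      exact le_iSup₂_of_le (f := fun t (_ : t ∈ Ioo (0 : ℝ) 1) => ‖evol (dpiece k F) x t‖ₑ ^ 2) t ht
        le_rfl
  have hpiece : ∀ k, ((q ^ k)⁻¹) ^ 2 * ∫⁻ x, maxEvol (dpiece k F) x ∂μ ≤ D * cAlpha n α μ *
      (ofReal (((2 : ℝ) ^ k) ^ (2 * s)) * ∫⁻ ξ, ‖dpiece k F ξ‖ₑ ^ 2) := fun k => by
    rcases Nat.eq_zero_or_pos k with rfl | hk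
    · have h1 := maximal_low (hN 0) (fun ξ hξ => by
        simpa [hmem 0 ξ hξ] using norm_le_two_pow_dyad ξ) hμ
      simp only [pow_zero, inv_one, one_pow, one_mul, Real.one_rpow, ENNReal.ofReal_one]
      refine h1.trans ?_
      rw [hD]
      gcongr
      exact le_add_self
    · have h1 := H _ (hN k) (2 ^ k) (one_le_pow₀ one_le_two) (fun ξ hξ => by
        have h2 := hmem k ξ hξ
        have h3 := two_pow_dyad_lt (ξ := ξ) (by omega)
        rw [h2] at h3
        exact ⟨h3, h2 ▸ norm_le_two_pow_dyad ξ⟩) μ hμ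
      have h4 : ((q ^ k)⁻¹) ^ 2 * ofReal
          (((2 : ℝ) ^ k) ^ (n + ((n + α - 1) / (2 * n) + ε - α))) =
          ofReal (((2 : ℝ) ^ k) ^ (2 * s)) := by
        rw [hq, ← ENNReal.ofReal_pow (by positivity), ← ENNReal.ofReal_inv_of_pos (by positivity),
          ← ENNReal.ofReal_pow (by positivity), ← ENNReal.ofReal_mul (by positivity)]
        congr 1
        rw [← Real.rpow_natCast 2 k, ← Real.rpow_natCast _ k, ← Real.rpow_mul (by norm_num),
          ← Real.rpow_mul (by norm_num), ← Real.rpow_mul (by norm_num),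
          ← Real.rpow_neg (by norm_num), ← Real.rpow_natCast _ 2, ← Real.rpow_mul (by norm_num),
          ← Real.rpow_add two_pos]
        congr 1
        rw [show 2 * s = 3 * ε + (n - α + (n + α - 1) / (2 * n)) by rw [hε]; ring]
        push_cast
        ring
      calc _ ≤ _ := mul_le_mul' le_rfl h1
        _ = C * cAlpha n α μ * ((((q ^ k)⁻¹) ^ 2 * ofReal
          (((2 : ℝ) ^ k) ^ (n + ((n + α - 1) / (2 * n) + ε - α)))) * ∫⁻ ξ, ‖dpiece k F ξ‖ₑ ^ 2) := by
            ring
        _ ≤ _ := by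
          rw [h4, hD]
          gcongr
          exact le_self_add
  have hm : ∀ k, Measurable fun ξ => ‖dpiece k F ξ‖ₑ ^ 2 := fun k => (hN k).meas.enorm.pow_const 2
  have hsum : ∑' k, ofReal (((2 : ℝ) ^ k) ^ (2 * s)) * ∫⁻ ξ, ‖dpiece k F ξ‖ₑ ^ 2 ≤
      ofReal (4 ^ s) * ∫⁻ ξ, ofReal ((1 + ‖ξ‖ ^ 2) ^ s) * ‖F ξ‖ₑ ^ 2 := by
    simp_rw [← fun k => lintegral_const_mul (μ := volume) (ofReal (((2 : ℝ) ^ k) ^ (2 * s)))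
      (hm k)]
    rw [← lintegral_tsum fun k => ((hm k).const_mul _).aemeasurable,
      ← lintegral_const_mul' _ _ ENNReal.ofReal_ne_top]
    refine lintegral_mono fun ξ => ?_
    rw [tsum_eq_single (dyad ξ) fun k hk => ?_]
    · rw [← mul_assoc, ← ENNReal.ofReal_mul (by positivity),
        ← Real.mul_rpow (by positivity) (by positivity)]
      refine mul_le_mul' (ENNReal.ofReal_le_ofReal ?_)
        (pow_le_pow_left' (enorm_indicator_le_enorm_self _ _) 2)
      rw [Real.rpow_mul (by positivity), Real.rpow_two]
      exact Real.rpow_le_rpow (by positivity) (two_pow_dyad_sq_le ξ) hs0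
    · by_cases h0 : dpiece k F ξ = 0
      · simp [h0]
      · exact absurd (hmem k ξ h0).symm hk
  calc _ ≤ ∫⁻ x, ((1 - q)⁻¹) ^ 2 * ∑' k, ((q ^ k)⁻¹) ^ 2 * maxEvol (dpiece k F) x ∂μ :=
        lintegral_mono hmax
    _ = ((1 - q)⁻¹) ^ 2 * ∑' k, ((q ^ k)⁻¹) ^ 2 * ∫⁻ x, maxEvol (dpiece k F) x ∂μ := by
        rw [lintegral_const_mul' _ _ hqq, lintegral_tsum fun k =>
          ((measurable_maxEvol (hN k)).const_mul _).aemeasurable]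
        simp_rw [fun k => lintegral_const_mul (μ := μ) (((q ^ k)⁻¹) ^ 2)
          (measurable_maxEvol (hN k))]
    _ ≤ ((1 - q)⁻¹) ^ 2 * ∑' k, D * cAlpha n α μ *
        (ofReal (((2 : ℝ) ^ k) ^ (2 * s)) * ∫⁻ ξ, ‖dpiece k F ξ‖ₑ ^ 2) :=
        mul_le_mul' le_rfl (ENNReal.tsum_le_tsum hpiece)
    _ ≤ ((1 - q)⁻¹) ^ 2 * (D * cAlpha n α μ * (ofReal (4 ^ s) *
        ∫⁻ ξ, ofReal ((1 + ‖ξ‖ ^ 2) ^ s) * ‖F ξ‖ₑ ^ 2)) := by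
        rw [ENNReal.tsum_mul_left]
        exact mul_le_mul' le_rfl (mul_le_mul' le_rfl hsum)
    _ = _ := by ring

open scoped FourierTransform in
lemma hatFn_eq_schwartz {n : ℕ} (f : SchwartzMap (Euc n) ℂ) :
    ∃ G : SchwartzMap (Euc n) ℂ, hatFn n f = G := by
  have hpi : (2 * Real.pi)⁻¹ ≠ 0 := by positivity
  refine ⟨(((2 * Real.pi) ^ (-(n : ℝ) / 2) : ℝ) : ℂ) • SchwartzMap.compCLMOfContinuousLinearEquiv ℂ
    (ContinuousLinearEquiv.smulLeft (Units.mk0 _ hpi)) (𝓕 f), ?_⟩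
  funext ξ
  rw [smul_apply, smul_eq_mul, hatFn]
  congr 1
  change _ = (𝓕 f : SchwartzMap (Euc n) ℂ) ((2 * Real.pi)⁻¹ • ξ)
  rw [SchwartzMap.fourier_coe, Real.fourier_eq']
  refine integral_congr_ae (.of_forall fun x => ?_)
  simp only [smul_eq_mul]
  congr 2
  rw [real_inner_smul_right]
  push_cast
  field_simp

lemma integrable_sobolev {n : ℕ} (s : ℝ) (G : SchwartzMap (Euc n) ℂ) :
    Integrable fun ξ => (1 + ‖ξ‖ ^ 2) ^ s * ‖G ξ‖ ^ 2 := by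
  obtain ⟨m, hm⟩ := exists_nat_ge s
  obtain ⟨B, hB⟩ : ∃ B, ∀ ξ, ‖G ξ‖ ≤ B :=
    ⟨_, fun ξ => (G.toBoundedContinuousFunction).norm_coe_le_norm ξ⟩
  have h1 : Integrable fun ξ => (2 : ℝ) ^ m * ((‖ξ‖ ^ 0 * ‖G ξ‖ + ‖ξ‖ ^ (2 * m) * ‖G ξ‖) * B) :=
    (((G.integrable_pow_mul volume 0).add (G.integrable_pow_mul volume (2 * m))).mul_const
      B).const_mul _
  refine h1.mono' ?_ (.of_forall fun ξ => ?_)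
  · refine Continuous.aestronglyMeasurable ?_
    refine Continuous.mul (Continuous.rpow_const (by fun_prop) fun ξ => Or.inl (by positivity)) ?_
    exact G.continuous.norm.pow 2
  · rw [Real.norm_of_nonneg (by positivity), sq ‖G ξ‖]
    have h2 : (1 + ‖ξ‖ ^ 2) ^ s ≤ 2 ^ m * (1 + ‖ξ‖ ^ (2 * m)) := by
      calc _ ≤ (1 + ‖ξ‖ ^ 2) ^ (m : ℝ) :=
            Real.rpow_le_rpow_of_exponent_le (by nlinarith [sq_nonneg ‖ξ‖]) hm
        _ ≤ 2 ^ m * (1 ^ m + (‖ξ‖ ^ 2) ^ m) := by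
            rw [Real.rpow_natCast]
            refine (add_pow_le zero_le_one (sq_nonneg _) m).trans ?_
            gcongr
            · norm_num
            · omega
        _ = _ := by rw [one_pow, pow_mul]
    calc _ ≤ (2 ^ m * (1 + ‖ξ‖ ^ (2 * m))) * (‖G ξ‖ * B) :=
          mul_le_mul h2 (mul_le_mul_of_nonneg_left (hB ξ) (norm_nonneg _)) (by positivity)
            (by positivity)
      _ = _ := by ring

lemma schroEvol_eq {n : ℕ} (f : SchwartzMap (Euc n) ℂ) (t : ℝ) (x : Euc n) :
    schroEvol n f t x =
      (((2 * Real.pi) ^ (-(n : ℝ) / 2) : ℝ) : ℂ) * evol (hatFn n f) x t := by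
  unfold schroEvol evol osc
  congr 1
  refine integral_congr_ae (.of_forall fun ξ => ?_)
  simp only
  congr 2
  push_cast
  ring

lemma exponent_lt {n : ℕ} (hn : 1 ≤ n) {α s : ℝ}
    (hs1 : α ≤ (n : ℝ) - 1 + 2 / (n + 1) → ((n : ℝ) - α) / 2 + n / (2 * (n + 1)) < s)
    (hs2 : (n : ℝ) - 1 + 2 / (n + 1) ≤ α → ((n : ℝ) - α + 1) * (1 / 2 - 1 / (4 * n)) < s) :
    n - α + (n + α - 1) / (2 * n) < 2 * s := by
  have hn0 : (0 : ℝ) < n := by exact_mod_cast hn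
  rcases le_total α ((n : ℝ) - 1 + 2 / (n + 1)) with h | h
  · have h1 := hs1 h
    have h2 : ((n : ℝ) + α - 1) / (2 * n) ≤ (n + ((n : ℝ) - 1 + 2 / (n + 1)) - 1) / (2 * n) := by
      gcongr
    have h3 : ((n : ℝ) + ((n : ℝ) - 1 + 2 / (n + 1)) - 1) / (2 * n) = 2 * (n / (2 * (n + 1))) := by
      field_simp
      ring
    linarith
  · have h1 := hs2 h
    have h2 : (n : ℝ) - α + (n + α - 1) / (2 * n) =
        2 * (((n : ℝ) - α + 1) * (1 / 2 - 1 / (4 * n))) := by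
      field_simp
      ring
    linarith

theorem stmt13 (n : ℕ) (hn : 1 ≤ n) (α s : ℝ) (hα0 : 0 < α) (hαn : α ≤ n)
    (hs1 : α ≤ (n : ℝ) - 1 + 2 / (n + 1) →
      ((n : ℝ) - α) / 2 + n / (2 * (n + 1)) < s)
    (hs2 : (n : ℝ) - 1 + 2 / (n + 1) ≤ α →
      ((n : ℝ) - α + 1) * (1 / 2 - 1 / (4 * n)) < s) :
    ∃ C : ℝ, 0 < C ∧
      ∀ f : SchwartzMap (EuclideanSpace ℝ (Fin n)) ℂ,
      ∀ μ : Measure (EuclideanSpace ℝ (Fin n)), IsAlphaDimensional n α μ →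
        ∫⁻ x, (⨆ (t : ℝ) (_ : t ∈ Ioo (0 : ℝ) 1),
            ENNReal.ofReal (‖schroEvol n f t x‖ ^ 2)) ∂μ
          ≤ ENNReal.ofReal
              ((C * Real.sqrt ((cAlpha n α μ).toReal) * hsNorm n s f) ^ 2) := by
  obtain ⟨C, hC, H⟩ := maximal_sobolev hn hα0 hαn (exponent_lt hn hs1 hs2)
  obtain ⟨c, hc⟩ : ∃ c : ℝ, c = (2 * Real.pi) ^ (-(n : ℝ) / 2) := ⟨_, rfl⟩
  have hc0 : 0 < c := by rw [hc]; positivity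
  refine ⟨c * Real.sqrt (C.toReal + 1), by positivity, fun f μ hμ => ?_⟩
  obtain ⟨G, hG⟩ := hatFn_eq_schwartz f
  obtain ⟨I, hI⟩ : ∃ I, I = ∫ ξ, (1 + ‖ξ‖ ^ 2) ^ s * ‖G ξ‖ ^ 2 := ⟨_, rfl⟩
  have hI0 : 0 ≤ I := by rw [hI]; exact integral_nonneg fun ξ => by positivity
  have hsup : ∀ x, (⨆ (t : ℝ) (_ : t ∈ Ioo (0 : ℝ) 1), ofReal (‖schroEvol n f t x‖ ^ 2)) =
      ofReal (c ^ 2) * maxEvol G x := fun x => by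
    unfold maxEvol
    simp_rw [ENNReal.mul_iSup, schroEvol_eq, hG, ← hc, norm_mul, mul_pow,
      Complex.norm_of_nonneg hc0.le, ENNReal.ofReal_mul (sq_nonneg c),
      ENNReal.ofReal_pow (norm_nonneg _), ofReal_norm]
  have hL : ∫⁻ ξ, ofReal ((1 + ‖ξ‖ ^ 2) ^ s) * ‖G ξ‖ₑ ^ 2 = ofReal I := by
    rw [hI, ofReal_integral_eq_lintegral_ofReal (integrable_sobolev s G)
      (.of_forall fun ξ => by positivity)]
    refine lintegral_congr fun ξ => ?_
    rw [ENNReal.ofReal_mul (by positivity), ENNReal.ofReal_pow (norm_nonneg _), ofReal_norm]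
  have hH : hsNorm n s f ^ 2 = I := by
    unfold hsNorm
    rw [hG, ← hI, ← Real.sqrt_eq_rpow, Real.sq_sqrt hI0]
  have hmain := H G G.continuous.measurable G.integrable _
    (fun ξ => (G.toBoundedContinuousFunction).norm_coe_le_norm ξ) μ hμ
  rw [hL] at hmain
  simp_rw [hsup]
  rw [lintegral_const_mul' _ _ ENNReal.ofReal_ne_top, mul_pow, mul_pow, mul_pow, hH,
    Real.sq_sqrt (by positivity), Real.sq_sqrt ENNReal.toReal_nonneg, mul_assoc, mul_assoc,
    ENNReal.ofReal_mul (sq_nonneg c), ENNReal.ofReal_mul (by positivity),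
    ENNReal.ofReal_mul ENNReal.toReal_nonneg, ENNReal.ofReal_toReal hμ.2, ← mul_assoc _ (cAlpha n α μ)]
  refine mul_le_mul' le_rfl (hmain.trans (mul_le_mul' (mul_le_mul' ?_ le_rfl) le_rfl))
  rw [ENNReal.le_ofReal_iff_toReal_le hC (by positivity)]
  linarith
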